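/- Let Γ ⊂ ℂ be a bounded quasicircle with interior Ω and exterior Ω*, let f : 𝔻 → Ω and g : Δ → Ω* be conformal bijections with g(z) → ∞ as z → ∞, and let h = g⁻¹ ∘ f : S¹ → S¹ be the welding homeomorphism. Then ∬_𝔻 |f''(z)/f'(z)|² dA(z) < ∞ (i.e., Γ is a Weil–Petersson quasicircle) if and only if h is absolutely continuous with h'(θ) > 0 for almost every θ and E(log h') < ∞, i.e., log h' belongs to the homogeneous Sobolev space Ḣ^{1/2}(S¹) (Shen). -/

import Mathlib

/-!
STATEMENT 4 (Shen): for a bounded quasicircle `Γ` with interior Riemann map `f` and exterior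
Riemann map `g` (fixing `∞`), the curve is Weil–Petersson (`∬_𝔻 |f''/f'|² dA < ∞`) if and
only if the welding homeomorphism `h = g⁻¹ ∘ f` is absolutely continuous with `h' > 0` a.e.
and `log h'` has finite `Ḣ^{1/2}(S¹)` seminorm (Douglas energy).
-/

open MeasureTheory Metric Real

/-- Douglas energy of a `2π`-periodic function of the angle: the `Ḣ^{1/2}(S¹)` seminorm
`∬ |u(θ)−u(σ)|²/|e^{iθ}−e^{iσ}|² dθ dσ` over one period in each variable. -/
noncomputable def douglasEnergyP (u : ℝ → ℂ) : ENNReal :=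
  ∫⁻ θ in Set.Ioc 0 (2 * π), ∫⁻ σ in Set.Ioc 0 (2 * π),
    ENNReal.ofReal
      (‖u θ - u σ‖ ^ 2 / ‖Complex.exp (θ * Complex.I) - Complex.exp (σ * Complex.I)‖ ^ 2)

namespace WP

open Filter Topology

/-- The unimodular exponential `θ ↦ e^{inθ}`. -/
noncomputable def ee (n : ℤ) (θ : ℝ) : ℂ := Complex.exp (n * θ * Complex.I)

/-- Lebesgue measure on one period. -/
noncomputable def per : Measure ℝ := volume.restrict (Set.Ioc 0 (2 * π))

/-- Fourier coefficients of a function on `(0, 2π]`. -/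
noncomputable def fc (u : ℝ → ℂ) (n : ℤ) : ℂ :=
  (1 / (2 * π) : ℝ) * ∫ θ in (0 : ℝ)..(2 * π), ee (-n) θ * u θ

instance : IsFiniteMeasure per := by unfold per; infer_instance

lemma per_univ : per Set.univ = ENNReal.ofReal (2 * π) := by simp [per]

lemma ee_add (m n : ℤ) (θ : ℝ) : ee (m + n) θ = ee m θ * ee n θ := by
  simp only [ee, ← Complex.exp_add]; push_cast; ring_nf

lemma ee_zero (θ : ℝ) : ee 0 θ = 1 := by simp [ee]

lemma ee_arg_add (n : ℤ) (s t : ℝ) : ee n (s + t) = ee n s * ee n t := by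
  simp only [ee, ← Complex.exp_add]; push_cast; ring_nf

lemma ee_ne_zero (n : ℤ) (θ : ℝ) : ee n θ ≠ 0 := Complex.exp_ne_zero _

lemma norm_ee (n : ℤ) (θ : ℝ) : ‖ee n θ‖ = 1 := by
  have : (n * θ * Complex.I : ℂ) = ((n * θ : ℝ) : ℂ) * Complex.I := by push_cast; ring
  rw [ee, this, Complex.norm_exp_ofReal_mul_I]

lemma ee_neg (n : ℤ) (θ : ℝ) : ee (-n) θ = (ee n θ)⁻¹ := by
  simp only [ee, ← Complex.exp_neg]; push_cast; ring_nf

lemma conj_ee (n : ℤ) (θ : ℝ) : (starRingEnd ℂ) (ee n θ) = ee (-n) θ := by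
  simp only [ee, ← Complex.exp_conj]; simp

lemma ee_pow (n : ℤ) (k : ℕ) (θ : ℝ) : ee n θ ^ k = ee (n * k) θ := by
  simp only [ee, ← Complex.exp_nat_mul]; push_cast; ring_nf

lemma ee_period (n : ℤ) (θ : ℝ) : ee n (θ + 2 * π) = ee n θ := by
  rw [ee, ee, Complex.exp_eq_exp_iff_exists_int]
  exact ⟨n, by push_cast; ring⟩

@[fun_prop]
lemma continuous_ee (n : ℤ) : Continuous (ee n) := by unfold ee; fun_prop

lemma hasDerivAt_ee (n : ℤ) (θ : ℝ) : HasDerivAt (ee n) (n * Complex.I * ee n θ) θ := by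
  have h1 : HasDerivAt (fun θ : ℝ => (n * θ * Complex.I : ℂ)) (n * Complex.I) θ := by
    have := ((Complex.ofRealCLM.hasDerivAt (x := θ)).const_mul (n : ℂ)).mul_const Complex.I
    simpa using this
  have := h1.cexp
  rw [mul_comm] at this
  exact this

lemma fourier_eq_ee (n : ℤ) (θ : ℝ) : fourier n (θ : AddCircle (2 * π)) = ee n θ := by
  rw [fourier_coe_apply, ee]
  congr 1
  have : (π : ℂ) ≠ 0 := by exact_mod_cast Real.pi_ne_zero
  push_cast
  field_simp

instance factTwoPi : Fact (0 < 2 * π) := ⟨Real.two_pi_pos⟩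

lemma fc_eq_fourierCoeffOn (u : ℝ → ℂ) (n : ℤ) :
    fc u n = fourierCoeffOn Real.two_pi_pos u n := by
  rw [fourierCoeffOn_eq_integral, fc, Complex.real_smul]
  congr 1
  · simp
  · apply intervalIntegral.integral_congr
    intro θ _
    have hp : (π : ℂ) ≠ 0 := by exact_mod_cast Real.pi_ne_zero
    simp only [smul_eq_mul, fourier_coe_apply, ee]
    congr 2
    push_cast
    field_simp
    ring

lemma parseval {u : ℝ → ℂ} (hu : MemLp u 2 per) :
    HasSum (fun n => ‖fc u n‖ ^ 2) ((1 / (2 * π)) * ∫ θ in (0 : ℝ)..(2 * π), ‖u θ‖ ^ 2) := by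
  have := hasSum_sq_fourierCoeffOn Real.two_pi_pos hu
  simp only [fc_eq_fourierCoeffOn]
  simpa using this

lemma fc_congr {u v : ℝ → ℂ} (h : u =ᵐ[per] v) (n : ℤ) : fc u n = fc v n := by
  unfold fc
  congr 1
  rw [intervalIntegral.integral_of_le Real.two_pi_pos.le,
    intervalIntegral.integral_of_le Real.two_pi_pos.le]
  apply integral_congr_ae
  filter_upwards [h] with θ hθ
  rw [hθ]

lemma integrable_ee_mul {u : ℝ → ℂ} (hu : Integrable u per) (n : ℤ) :
    Integrable (fun θ => ee n θ * u θ) per := by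
  refine hu.bdd_mul (c := 1) (continuous_ee n).aestronglyMeasurable ?_
  exact Eventually.of_forall fun θ => (norm_ee n θ).le

lemma fc_eq_setIntegral (u : ℝ → ℂ) (n : ℤ) :
    fc u n = (1 / (2 * π) : ℝ) * ∫ θ, ee (-n) θ * u θ ∂per := by
  rw [fc, intervalIntegral.integral_of_le Real.two_pi_pos.le]; rfl

lemma fc_add {u v : ℝ → ℂ} (hu : Integrable u per) (hv : Integrable v per) (n : ℤ) :
    fc (fun θ => u θ + v θ) n = fc u n + fc v n := by
  simp only [fc_eq_setIntegral, mul_add]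
  rw [integral_add (integrable_ee_mul hu _) (integrable_ee_mul hv _), mul_add]

lemma fc_sub {u v : ℝ → ℂ} (hu : Integrable u per) (hv : Integrable v per) (n : ℤ) :
    fc (fun θ => u θ - v θ) n = fc u n - fc v n := by
  simp only [fc_eq_setIntegral, mul_sub]
  rw [integral_sub (integrable_ee_mul hu _) (integrable_ee_mul hv _), mul_sub]

lemma fc_const_mul (c : ℂ) (u : ℝ → ℂ) (n : ℤ) :
    fc (fun θ => c * u θ) n = c * fc u n := by
  simp only [fc_eq_setIntegral]
  rw [mul_left_comm, ← integral_const_mul c]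
  congr 2
  funext θ
  ring

lemma fc_sum {ι : Type*} (s : Finset ι) (u : ι → ℝ → ℂ) (hu : ∀ i ∈ s, Integrable (u i) per)
    (n : ℤ) : fc (fun θ => ∑ i ∈ s, u i θ) n = ∑ i ∈ s, fc (u i) n := by
  simp only [fc_eq_setIntegral, Finset.mul_sum]
  rw [integral_finsetSum _ fun i hi => integrable_ee_mul (hu i hi) _, Finset.mul_sum]

lemma integral_ee (n : ℤ) : ∫ θ in (0 : ℝ)..(2 * π), ee n θ = if n = 0 then (2 * π : ℂ) else 0 := by
  split_ifs with h
  · subst h; simp [ee_zero]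
  · have h' : (n * Complex.I : ℂ) ≠ 0 := by simp [h]
    have hd : ∀ θ ∈ Set.uIcc (0 : ℝ) (2 * π),
        HasDerivAt (fun θ => ee n θ / (n * Complex.I)) (ee n θ) θ := by
      intro θ _
      have := (hasDerivAt_ee n θ).div_const (n * Complex.I)
      rwa [mul_div_cancel_left₀ _ h'] at this
    rw [intervalIntegral.integral_eq_sub_of_hasDerivAt hd
      ((continuous_ee n).intervalIntegrable _ _)]
    have := ee_period n 0
    rw [zero_add] at this
    rw [this, sub_self]

lemma fc_ee (m n : ℤ) : fc (ee m) n = if n = m then 1 else 0 := by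
  unfold fc
  simp_rw [← ee_add]
  rw [integral_ee]
  have hp : (π : ℂ) ≠ 0 := by exact_mod_cast Real.pi_ne_zero
  by_cases h : n = m
  · subst h; simp; field_simp
  · have : ¬ (-n + m = 0) := by omega
    simp [h, this]

lemma integrable_of_continuous {u : ℝ → ℂ} (hu : Continuous u) : Integrable u per :=
  (hu.integrableOn_Icc (a := 0) (b := 2 * π)).mono_set Set.Ioc_subset_Icc_self

lemma memLp_of_continuous {u : ℝ → ℂ} (hu : Continuous u) (p : ENNReal) : MemLp u p per := by
  obtain ⟨C, hC⟩ := (isCompact_Icc (a := 0) (b := 2 * π)).exists_bound_of_continuousOn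
    hu.continuousOn
  refine MemLp.of_bound hu.aestronglyMeasurable C ?_
  unfold per
  filter_upwards [ae_restrict_mem measurableSet_Ioc] with θ hθ
  exact hC θ (Set.Ioc_subset_Icc_self hθ)

lemma integrable_of_memLp_two {u : ℝ → ℂ} (hu : MemLp u 2 per) : Integrable u per :=
  hu.integrable (by norm_num)

lemma integral_norm_sq_eq {u : ℝ → ℂ} (hu : MemLp u 2 per) :
    ∫ θ, ‖u θ‖ ^ 2 ∂per = 2 * π * ∑' n, ‖fc u n‖ ^ 2 := by
  rw [(parseval hu).tsum_eq, intervalIntegral.integral_of_le Real.two_pi_pos.le]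
  have := Real.pi_pos
  rw [← mul_assoc, mul_one_div_cancel (by positivity), one_mul]; rfl

lemma lintegral_norm_sq_eq {u : ℝ → ℂ} (hu : MemLp u 2 per) :
    ∫⁻ θ, ENNReal.ofReal (‖u θ‖ ^ 2) ∂per
      = ENNReal.ofReal (2 * π) * ∑' n, ENNReal.ofReal (‖fc u n‖ ^ 2) := by
  rw [← ofReal_integral_eq_lintegral_ofReal hu.norm.integrable_sq
    (Eventually.of_forall fun _ => by positivity), integral_norm_sq_eq hu,
    ENNReal.ofReal_mul (by positivity), ENNReal.ofReal_tsum_of_nonneg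
      (fun _ => by positivity) (parseval hu).summable]

lemma ae_eq_of_fc_eq {u v : ℝ → ℂ} (hu : MemLp u 2 per) (hv : MemLp v 2 per)
    (h : ∀ n, fc u n = fc v n) : u =ᵐ[per] v := by
  have hd := hu.sub hv
  have h0 : ∀ n, fc (u - v) n = 0 := fun n => by
    have := fc_sub (integrable_of_memLp_two hu) (integrable_of_memLp_two hv) n
    rw [h n, sub_self] at this
    exact this
  have h1 := integral_norm_sq_eq hd
  simp only [h0] at h1
  simp only [norm_zero, ne_eq, OfNat.ofNat_ne_zero, not_false_eq_true, zero_pow, tsum_zero,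
    mul_zero] at h1
  rw [integral_eq_zero_iff_of_nonneg (fun _ => by positivity) hd.norm.integrable_sq] at h1
  filter_upwards [h1] with θ hθ
  simpa [sub_eq_zero] using hθ

lemma fc_aecover_coe (f : AddCircle (2 * π) → ℂ) (n : ℤ) :
    fc (fun θ => f θ) n = fourierCoeff f n := by
  rw [fc, fourierCoeff_eq_intervalIntegral f n 0, Complex.real_smul, zero_add]
  congr 1
  apply intervalIntegral.integral_congr
  intro θ _
  simp only [smul_eq_mul, fourier_eq_ee]

lemma exists_fc_eq {x : ℤ → ℂ} (hx : Summable fun n => ‖x n‖ ^ 2) :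
    ∃ u : ℝ → ℂ, Measurable u ∧ (∀ θ, u (θ + 2 * π) = u θ) ∧ MemLp u 2 per ∧
      ∀ n, fc u n = x n := by
  have hx' : Memℓp x 2 := by
    apply memℓp_gen
    simpa using hx
  let f : Lp ℂ 2 (AddCircle.haarAddCircle (T := 2 * π)) := fourierBasis.repr.symm ⟨x, hx'⟩
  have hf : MemLp f 2 (AddCircle.haarAddCircle (T := 2 * π)) := Lp.memLp f
  refine ⟨fun θ => f (θ : AddCircle (2 * π)), ?_, fun θ => by simp, ?_, fun n => ?_⟩
  · exact (Lp.stronglyMeasurable f).measurable.comp AddCircle.measurable_mk'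
  · have h2 := memLp_haarAddCircle_iff.1 hf
    have := h2.comp_measurePreserving (AddCircle.measurePreserving_mk (2 * π) 0)
    rw [zero_add] at this
    exact this
  · have h1 := fc_aecover_coe f n
    rw [h1, ← fourierBasis_repr]
    simp [f]

lemma lintegral_per_shift {g : ℝ → ENNReal} (hg : ∀ θ, g (θ + 2 * π) = g θ) (s : ℝ) :
    ∫⁻ θ, g (θ + s) ∂per = ∫⁻ θ, g θ ∂per := by
  have hper : Function.Periodic g (2 * π) := hg
  have h1 := AddCircle.lintegral_preimage (2 * π) 0 hper.lift
  have h2 := AddCircle.lintegral_preimage (2 * π) s hper.lift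
  rw [zero_add] at h1
  simp only [hper.lift_coe] at h1 h2
  rw [per, h1, ← h2]
  have hmp := (measurePreserving_add_right volume s).setLIntegral_comp_preimage_emb
    (MeasurableEquiv.addRight s).measurableEmbedding g (Set.Ioc s (s + 2 * π))
  rw [← hmp]
  congr 2
  ext x
  simp

lemma fc_shift {u : ℝ → ℂ} (hu : ∀ θ, u (θ + 2 * π) = u θ) (s : ℝ) (n : ℤ) :
    fc (fun θ => u (θ + s)) n = ee n s * fc u n := by
  unfold fc
  have h1 : ∀ θ, ee (-n) θ * u (θ + s) = ee n s * (ee (-n) (θ + s) * u (θ + s)) := by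
    intro θ
    rw [ee_arg_add, ee_neg n s]
    field_simp [ee_ne_zero]
  simp_rw [h1]
  rw [intervalIntegral.integral_const_mul,
    intervalIntegral.integral_comp_add_right (fun θ => ee (-n) θ * u θ) s]
  have hp : Function.Periodic (fun θ => ee (-n) θ * u θ) (2 * π) := by
    intro θ; simp only [ee_period, hu]
  have := hp.intervalIntegral_add_eq s 0
  rw [zero_add] at this
  rw [zero_add, add_comm (2 * π) s, this]
  ring

lemma ee_one_eq_one_iff {s : ℝ} : ee 1 s = 1 ↔ ∃ m : ℤ, s = m * (2 * π) := by
  rw [ee, Complex.exp_eq_one_iff]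
  refine exists_congr fun m => ⟨fun hm => ?_, fun hm => ?_⟩
  · have h3 : (s * Complex.I : ℂ) = (m * (2 * π) : ℝ) * Complex.I := by
      push_cast; push_cast at hm; linear_combination hm
    exact_mod_cast mul_right_cancel₀ Complex.I_ne_zero h3
  · rw [hm]; push_cast; ring

lemma ee_one_eq_iff {s t : ℝ} : ee 1 s = ee 1 t ↔ ∃ m : ℤ, s = t + m * (2 * π) := by
  have h : ee 1 s = ee 1 t * ee 1 (s - t) := by rw [← ee_arg_add]; ring_nf
  rw [h, mul_eq_left₀ (ee_ne_zero _ _), ee_one_eq_one_iff]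
  exact exists_congr fun m => by constructor <;> intro h <;> linarith

lemma eq_of_ee_one_eq {s t : ℝ} (h : ee 1 s = ee 1 t) (hst : |s - t| < 2 * π) : s = t := by
  obtain ⟨m, hm⟩ := ee_one_eq_iff.1 h
  rw [hm, add_sub_cancel_left, abs_mul, abs_of_pos Real.two_pi_pos] at hst
  have h1 : |(m : ℝ)| < 1 := by
    by_contra! hc
    nlinarith [Real.two_pi_pos]
  have h2 : m = 0 := by
    have : |m| < 1 := by exact_mod_cast h1
    simpa using this
  simpa [h2] using hm

lemma ae_ee_one_ne : ∀ᵐ s ∂per, ee 1 s ≠ 1 := by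
  have h : ∀ᵐ s : ℝ, s ≠ 2 * π := by
    simp [ae_iff, measure_singleton]
  have hm : ∀ᵐ s ∂per, s ∈ Set.Ioc 0 (2 * π) := ae_restrict_mem measurableSet_Ioc
  filter_upwards [hm, ae_restrict_of_ae h] with s hs hne heq
  refine hne (eq_of_ee_one_eq (heq.trans ?_) ?_)
  · have := ee_period 1 0
    rw [zero_add] at this
    rw [this, ee]; simp
  · rw [abs_lt]; constructor <;> linarith [hs.1, hs.2, Real.pi_pos]

lemma lintegral_dirichlet_nat (n : ℕ) :
    ∫⁻ s, ENNReal.ofReal (‖ee n s - 1‖ ^ 2 / ‖ee 1 s - 1‖ ^ 2) ∂per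
      = ENNReal.ofReal (2 * π * n) := by
  let D : ℝ → ℂ := fun s => ∑ k ∈ Finset.range n, ee k s
  have hDc : Continuous D := by fun_prop
  have h1 : ∀ᵐ s ∂per, ENNReal.ofReal (‖ee n s - 1‖ ^ 2 / ‖ee 1 s - 1‖ ^ 2)
      = ENNReal.ofReal (‖D s‖ ^ 2) := by
    filter_upwards [ae_ee_one_ne] with s hs
    have hg := geom_sum_mul (ee 1 s) n
    simp only [ee_pow, one_mul] at hg
    rw [← hg, norm_mul, mul_pow, mul_div_assoc, div_self, mul_one]
    exact pow_ne_zero _ (norm_ne_zero_iff.2 (sub_ne_zero.2 hs))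
  rw [lintegral_congr_ae h1, lintegral_norm_sq_eq (memLp_of_continuous hDc 2)]
  have hfc : ∀ m, fc D m = ∑ k ∈ Finset.range n, if m = (k : ℤ) then 1 else 0 := by
    intro m
    have := fc_sum (Finset.range n) (fun k => ee (k : ℤ))
      (fun k _ => integrable_of_continuous (continuous_ee _)) m
    simp only [fc_ee] at this
    exact this
  have hs : ∑' m, ENNReal.ofReal (‖fc D m‖ ^ 2) = n := by
    rw [tsum_eq_sum (s := (Finset.range n).map Nat.castEmbedding)]
    · rw [Finset.sum_map]
      trans ∑ k ∈ Finset.range n, (1 : ENNReal)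
      · refine Finset.sum_congr rfl fun k hk => ?_
        rw [hfc]
        simp only [Nat.castEmbedding_apply, Nat.cast_inj]
        rw [Finset.sum_ite_eq]
        simp [hk]
      · simp
    · intro m hm
      rw [hfc, Finset.sum_eq_zero]
      · simp
      · intro k hk
        rw [if_neg]
        rintro rfl
        exact hm (Finset.mem_map_of_mem Nat.castEmbedding hk)
  rw [hs, ENNReal.ofReal_mul (p := 2 * π) (by positivity), ENNReal.ofReal_natCast]

lemma lintegral_dirichlet (n : ℤ) :
    ∫⁻ s, ENNReal.ofReal (‖ee n s - 1‖ ^ 2 / ‖ee 1 s - 1‖ ^ 2) ∂per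
      = ENNReal.ofReal (2 * π * |(n : ℝ)|) := by
  rcases n.natAbs_eq with h | h
  · rw [h, lintegral_dirichlet_nat]; simp
  · rw [h, ← Int.cast_abs, abs_neg]
    have : ∀ s, ‖ee (-(n.natAbs : ℤ)) s - 1‖ = ‖ee (n.natAbs : ℤ) s - 1‖ := by
      intro s
      rw [← conj_ee, ← Complex.norm_conj]
      simp
    simp only [this]
    rw [lintegral_dirichlet_nat]; simp

lemma energy_congr {u v : ℝ → ℂ} (h : u =ᵐ[per] v) : douglasEnergyP u = douglasEnergyP v := by
  unfold douglasEnergyP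
  have h' : ∀ᵐ θ ∂(volume.restrict (Set.Ioc 0 (2 * π))), u θ = v θ := h
  refine lintegral_congr_ae ?_
  filter_upwards [h'] with θ hθ
  refine lintegral_congr_ae ?_
  filter_upwards [h'] with σ hσ
  rw [hθ, hσ]

lemma norm_ee_sub_ee (θ σ : ℝ) : ‖ee 1 θ - ee 1 σ‖ = ‖ee 1 (σ - θ) - 1‖ := by
  have : ee 1 σ = ee 1 θ * ee 1 (σ - θ) := by rw [← ee_arg_add]; ring_nf
  rw [this, ← mul_one_sub, norm_mul, norm_ee, one_mul, norm_sub_rev]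

lemma energy_eq_of_periodic {u : ℝ → ℂ} (hm : Measurable u) (hp : ∀ θ, u (θ + 2 * π) = u θ)
    (hu : MemLp u 2 per) :
    douglasEnergyP u = ENNReal.ofReal (4 * π ^ 2) *
      ∑' n : ℤ, ENNReal.ofReal (|(n : ℝ)| * ‖fc u n‖ ^ 2) := by
  have h1 : douglasEnergyP u = ∫⁻ θ, ∫⁻ s,
      ENNReal.ofReal (‖u (θ + s) - u θ‖ ^ 2 / ‖ee 1 s - 1‖ ^ 2) ∂per ∂per := by
    unfold douglasEnergyP
    refine lintegral_congr fun θ => ?_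
    have := lintegral_per_shift
      (g := fun σ => ENNReal.ofReal (‖u σ - u θ‖ ^ 2 / ‖ee 1 (σ - θ) - 1‖ ^ 2)) (fun σ => by
        simp only [hp]
        rw [show σ + 2 * π - θ = (σ - θ) + 2 * π by ring, ee_period]) θ
    simp only [add_sub_cancel_right] at this
    simp only [add_comm θ]
    rw [this]
    refine lintegral_congr fun σ => ?_
    rw [← norm_ee_sub_ee, norm_sub_rev]
    simp [ee]
  rw [h1, lintegral_lintegral_swap]
  swap
  · apply Measurable.aemeasurable
    have := (continuous_ee 1).measurable
    unfold Function.uncurry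
    fun_prop
  have h2 : ∀ s, ∫⁻ θ, ENNReal.ofReal (‖u (θ + s) - u θ‖ ^ 2 / ‖ee 1 s - 1‖ ^ 2) ∂per
      = ENNReal.ofReal (2 * π) * ∑' n : ℤ, ENNReal.ofReal (‖fc u n‖ ^ 2) *
        ENNReal.ofReal (‖ee n s - 1‖ ^ 2 / ‖ee 1 s - 1‖ ^ 2) := by
    intro s
    have hus : MemLp (fun θ => u (θ + s)) 2 per := by
      refine ⟨(hm.comp (measurable_add_const s)).aestronglyMeasurable, ?_⟩
      have h3 := hu.2
      rw [eLpNorm_lt_top_iff_lintegral_rpow_enorm_lt_top (by norm_num) (by norm_num)] at h3 ⊢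
      rwa [lintegral_per_shift (g := fun θ => ‖u θ‖ₑ ^ (ENNReal.toReal 2)) (fun θ => by
        simp only [hp])]
    have h4 := lintegral_norm_sq_eq (hus.sub hu)
    have h5 : ∀ n, fc ((fun θ => u (θ + s)) - u) n = (ee n s - 1) * fc u n := by
      intro n
      have := fc_sub (integrable_of_memLp_two hus) (integrable_of_memLp_two hu) n
      rw [fc_shift hp] at this
      rw [sub_mul, one_mul]
      exact this
    simp only [h5] at h4
    have h6 : ∀ θ, ENNReal.ofReal (‖u (θ + s) - u θ‖ ^ 2 / ‖ee 1 s - 1‖ ^ 2)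
        = ENNReal.ofReal (1 / ‖ee 1 s - 1‖ ^ 2) * ENNReal.ofReal (‖u (θ + s) - u θ‖ ^ 2) := by
      intro θ
      rw [← ENNReal.ofReal_mul (by positivity)]
      congr 1; ring
    simp only [h6]
    rw [lintegral_const_mul' _ _ ENNReal.ofReal_ne_top]
    simp only [Pi.sub_apply] at h4
    rw [h4, mul_left_comm, ← ENNReal.tsum_mul_left]
    congr 1
    refine tsum_congr fun n => ?_
    rw [← ENNReal.ofReal_mul (by positivity), ← ENNReal.ofReal_mul (by positivity), norm_mul]
    congr 1; ring
  simp only [h2]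
  rw [lintegral_const_mul' _ _ ENNReal.ofReal_ne_top, lintegral_tsum]
  swap
  · intro n
    apply Measurable.aemeasurable
    have := (continuous_ee 1).measurable
    have := (continuous_ee n).measurable
    fun_prop
  have h7 : ∀ n : ℤ, ∫⁻ s, ENNReal.ofReal (‖fc u n‖ ^ 2) *
        ENNReal.ofReal (‖ee n s - 1‖ ^ 2 / ‖ee 1 s - 1‖ ^ 2) ∂per
      = ENNReal.ofReal (2 * π) * ENNReal.ofReal (|(n : ℝ)| * ‖fc u n‖ ^ 2) := by
    intro n
    rw [lintegral_const_mul' _ _ ENNReal.ofReal_ne_top, lintegral_dirichlet,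
      ← ENNReal.ofReal_mul (by positivity), ← ENNReal.ofReal_mul (by positivity)]
    congr 1; ring
  simp only [h7]
  rw [ENNReal.tsum_mul_left, ← mul_assoc, ← ENNReal.ofReal_mul (by positivity)]
  congr 2; ring

lemma exists_periodic_modification {u : ℝ → ℂ} (hu : AEStronglyMeasurable u per) :
    ∃ v : ℝ → ℂ, Measurable v ∧ (∀ θ, v (θ + 2 * π) = v θ) ∧ u =ᵐ[per] v := by
  obtain ⟨w, hw, huw⟩ := hu
  have hpi := Real.pi_pos
  refine ⟨fun θ => w (Int.fract (θ / (2 * π)) * (2 * π)), ?_, ?_, ?_⟩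
  · have := hw.measurable
    exact this.comp (by fun_prop)
  · intro θ
    simp only [add_div, div_self Real.two_pi_pos.ne']
    rw [Int.fract_add_one]
  · have h : ∀ᵐ s : ℝ, s ≠ 2 * π := by simp [ae_iff, measure_singleton]
    have hm : ∀ᵐ s ∂per, s ∈ Set.Ioc 0 (2 * π) := ae_restrict_mem measurableSet_Ioc
    filter_upwards [huw, hm, ae_restrict_of_ae h] with θ h1 h2 h3
    rw [h1, Int.fract_eq_self.2, div_mul_cancel₀ _ Real.two_pi_pos.ne']
    constructor
    · exact div_nonneg h2.1.le Real.two_pi_pos.le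
    · rw [div_lt_one Real.two_pi_pos]; exact lt_of_le_of_ne h2.2 h3

/-- The Douglas formula for the energy in terms of Fourier coefficients. -/
theorem energy_eq {u : ℝ → ℂ} (hu : MemLp u 2 per) :
    douglasEnergyP u = ENNReal.ofReal (4 * π ^ 2) *
      ∑' n : ℤ, ENNReal.ofReal (|(n : ℝ)| * ‖fc u n‖ ^ 2) := by
  obtain ⟨v, hv, hp, huv⟩ := exists_periodic_modification hu.1
  rw [energy_congr huv, energy_eq_of_periodic hv hp ((memLp_congr_ae huv).1 hu)]
  simp only [fc_congr huv]

lemma memLp_of_energy_lt_top {u : ℝ → ℂ} (hu : AEStronglyMeasurable u per)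
    (h : douglasEnergyP u < ⊤) : MemLp u 2 per := by
  obtain ⟨v, hv, hp, huv⟩ := exists_periodic_modification hu
  rw [energy_congr huv] at h
  rw [memLp_congr_ae huv]
  have hmeas : Measurable fun θ => ∫⁻ σ in Set.Ioc 0 (2 * π), ENNReal.ofReal (‖v θ - v σ‖ ^ 2 /
      ‖Complex.exp (θ * Complex.I) - Complex.exp (σ * Complex.I)‖ ^ 2) := by
    apply Measurable.lintegral_prod_right'
      (f := fun p : ℝ × ℝ => ENNReal.ofReal (‖v p.1 - v p.2‖ ^ 2 /
        ‖Complex.exp (p.1 * Complex.I) - Complex.exp (p.2 * Complex.I)‖ ^ 2))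
    fun_prop
  have h1 : ∀ᵐ θ ∂per, ∫⁻ σ in Set.Ioc 0 (2 * π), ENNReal.ofReal (‖v θ - v σ‖ ^ 2 /
      ‖Complex.exp (θ * Complex.I) - Complex.exp (σ * Complex.I)‖ ^ 2) < ⊤ :=
    ae_lt_top hmeas h.ne
  have hm : ∀ᵐ s ∂per, s ∈ Set.Ioc 0 (2 * π) := ae_restrict_mem measurableSet_Ioc
  have hne : NeBot (ae per) := by
    rw [ae_neBot]
    intro h0
    have := per_univ
    rw [h0] at this
    simp at this
    linarith [Real.pi_pos]
  obtain ⟨θ, h2, hθ⟩ := (Filter.Eventually.and h1 hm).exists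
  have h3 : MemLp (fun σ => v θ - v σ) 2 per := by
    refine ⟨(measurable_const.sub hv).aestronglyMeasurable, ?_⟩
    rw [eLpNorm_lt_top_iff_lintegral_rpow_enorm_lt_top (by norm_num) (by norm_num)]
    calc ∫⁻ σ, ‖v θ - v σ‖ₑ ^ (ENNReal.toReal 2) ∂per
        ≤ ∫⁻ σ, 4 * ENNReal.ofReal (‖v θ - v σ‖ ^ 2 /
          ‖Complex.exp (θ * Complex.I) - Complex.exp (σ * Complex.I)‖ ^ 2) ∂per := by
          refine lintegral_mono_ae ?_
          filter_upwards [hm] with σ hσ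
          by_cases hee : ee 1 θ = ee 1 σ
          · have := eq_of_ee_one_eq hee (by
              rw [abs_lt]; constructor <;> linarith [hσ.1, hσ.2, hθ.1, hθ.2])
            simp [this]
          · have h5 : ‖Complex.exp (θ * Complex.I) - Complex.exp (σ * Complex.I)‖
                = ‖ee 1 θ - ee 1 σ‖ := by simp [ee]
            have h6 : 0 < ‖ee 1 θ - ee 1 σ‖ := norm_pos_iff.2 (sub_ne_zero.2 hee)
            have h7 : ‖ee 1 θ - ee 1 σ‖ ≤ 2 := (norm_sub_le _ _).trans (by simp [norm_ee]; norm_num)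
            have h8 : ‖v θ - v σ‖ₑ ^ (ENNReal.toReal 2) = ENNReal.ofReal (‖v θ - v σ‖ ^ 2) := by
              rw [← ofReal_norm, ENNReal.toReal_ofNat, ENNReal.ofReal_rpow_of_nonneg
                (norm_nonneg _) (by norm_num)]
              norm_cast
            rw [h8, h5, show (4 : ENNReal) = ENNReal.ofReal 4 by simp,
              ← ENNReal.ofReal_mul (by norm_num)]
            apply ENNReal.ofReal_le_ofReal
            rw [mul_div_assoc', le_div_iff₀ (by positivity), mul_comm (4 : ℝ)]
            gcongr
            nlinarith
      _ < ⊤ := by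
          rw [lintegral_const_mul' _ _ (by norm_num)]
          exact ENNReal.mul_lt_top (by norm_num) h2
  have h4 := (memLp_const (v θ)).sub h3
  convert h4 using 1
  funext σ
  simp

lemma fc_deriv {u u' : ℝ → ℂ} (hu : ∀ θ, u (θ + 2 * π) = u θ) (hd : ∀ θ, HasDerivAt u (u' θ) θ)
    (hi : Integrable u' per) (n : ℤ) : fc u' n = n * Complex.I * fc u n := by
  have h1 : IntervalIntegrable u' volume 0 (2 * π) := by
    rwa [intervalIntegrable_iff, Set.uIoc_of_le Real.two_pi_pos.le]
  have h2 := intervalIntegral.integral_mul_deriv_eq_deriv_mul (a := 0) (b := 2 * π)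
    (fun θ _ => hasDerivAt_ee (-n) θ) (fun θ _ => hd θ)
    (Continuous.intervalIntegrable (by fun_prop) _ _) h1
  have h3 := ee_period (-n) 0
  have h4 := hu 0
  rw [zero_add] at h3 h4
  rw [h3, h4, sub_self, zero_sub] at h2
  unfold fc
  rw [h2]
  have : ∀ θ, ((-n : ℤ) : ℂ) * Complex.I * ee (-n) θ * u θ
      = (-(n * Complex.I)) * (ee (-n) θ * u θ) := by intro θ; push_cast; ring
  simp_rw [this]
  rw [intervalIntegral.integral_const_mul]
  ring

lemma halfline_bound {w w' : ℝ → ℂ} {N : ℝ} (hN : 1 ≤ N)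
    (hd : ∀ y, 0 < y → HasDerivAt w (w' y) y) {y₀ : ℝ} (hy₀ : 0 < y₀) :
    ENNReal.ofReal (N * ‖w y₀‖ ^ 2)
      ≤ ∫⁻ y in Set.Ioi 0, ENNReal.ofReal (‖w' y‖ ^ 2 + N ^ 2 * ‖w y‖ ^ 2) := by
  set D : ℝ → ℝ := fun y => ‖w' y‖ ^ 2 + N ^ 2 * ‖w y‖ ^ 2 with hD
  have hD0 : ∀ y, 0 ≤ D y := fun y => by simp only [hD]; positivity
  by_cases htop : ∫⁻ y in Set.Ioi 0, ENNReal.ofReal (D y) = ⊤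
  · rw [htop]; exact le_top
  have hmeas : AEStronglyMeasurable D (volume.restrict (Set.Ioi 0)) := by
    have h1 : AEStronglyMeasurable w (volume.restrict (Set.Ioi 0)) :=
      ContinuousOn.aestronglyMeasurable
        (fun y hy => (hd y hy).continuousAt.continuousWithinAt) measurableSet_Ioi
    have h2 : AEStronglyMeasurable w' (volume.restrict (Set.Ioi 0)) := by
      refine (stronglyMeasurable_deriv w).aestronglyMeasurable.congr ?_
      filter_upwards [ae_restrict_mem measurableSet_Ioi] with y hy
      exact (hd y hy).deriv
    exact (h2.norm.pow 2).add ((h1.norm.pow 2).const_mul _)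
  have hintble : IntegrableOn D (Set.Ioi 0) := by
    refine ⟨hmeas, ?_⟩
    rw [hasFiniteIntegral_iff_ofReal (Eventually.of_forall hD0)]
    exact lt_top_iff_ne_top.2 htop
  rw [← ofReal_integral_eq_lintegral_ofReal hintble (Eventually.of_forall hD0)]
  apply ENNReal.ofReal_le_ofReal
  refine le_of_forall_pos_le_add fun ε hε => ?_
  obtain ⟨Y, hY, hYε⟩ : ∃ Y, y₀ < Y ∧ D Y < ε := by
    by_contra! hcon
    apply htop
    rw [eq_top_iff]
    calc (⊤ : ENNReal) = ∫⁻ y in Set.Ioi y₀, ENNReal.ofReal ε := by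
          rw [setLIntegral_const, Real.volume_Ioi, ENNReal.mul_top]
          simpa using hε
      _ ≤ ∫⁻ y in Set.Ioi y₀, ENNReal.ofReal (D y) :=
          setLIntegral_mono' measurableSet_Ioi fun y hy => ENNReal.ofReal_le_ofReal (hcon y hy)
      _ ≤ _ := lintegral_mono_set (Set.Ioi_subset_Ioi hy₀.le)
  have hderiv : ∀ y, 0 < y → HasDerivAt (fun y => -(N * ‖w y‖ ^ 2))
      (-(N * (2 * inner ℝ (w y) (w' y)))) y := fun y hy => ((hd y hy).norm_sq.const_mul N).neg
  have hsub : Set.Icc y₀ Y ⊆ Set.Ioi 0 := fun y hy => hy₀.trans_le hy.1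
  have h3 := intervalIntegral.sub_le_integral_of_hasDeriv_right_of_le
    (g := fun y => -(N * ‖w y‖ ^ 2)) (φ := D) hY.le
    (fun y hy => (hderiv y (hsub hy)).continuousAt.continuousWithinAt)
    (fun y hy => (hderiv y (hy₀.trans hy.1)).hasDerivWithinAt)
    (hintble.mono_set hsub) (fun y hy => by
      have h4 := abs_real_inner_le_norm (w y) (w' y)
      have h5 := neg_abs_le (inner ℝ (w y) (w' y))
      simp only [hD]
      nlinarith [sq_nonneg (‖w' y‖ - N * ‖w y‖), norm_nonneg (w y), norm_nonneg (w' y)])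
  have h6 : ∫ y in y₀..Y, D y ≤ ∫ y in Set.Ioi 0, D y := by
    rw [intervalIntegral.integral_of_le hY.le]
    exact setIntegral_mono_set hintble (Eventually.of_forall hD0)
      (LE.le.eventuallyLE (Set.Ioc_subset_Icc_self.trans hsub))
  have h7 : N * ‖w Y‖ ^ 2 ≤ D Y := by
    simp only [hD]
    nlinarith [sq_nonneg ‖w' Y‖, mul_nonneg (mul_nonneg (by linarith : 0 ≤ N)
      (sub_nonneg.2 hN)) (sq_nonneg ‖w Y‖)]
  linarith

/-- Dirichlet principle on the half strip: the boundary energy is bounded by the Dirichlet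
integral of any extension. -/
theorem dirichlet_principle {W : ℂ → ℂ} (hW : ContDiffOn ℝ 1 W {z | 0 < z.im})
    (hc : ContinuousOn W {z | 0 ≤ z.im}) (hp : ∀ z : ℂ, 0 ≤ z.im → W (z + 2 * π) = W z) :
    ∑' n : ℤ, ENNReal.ofReal (|(n : ℝ)| * ‖fc (fun x : ℝ => W x) n‖ ^ 2)
      ≤ ENNReal.ofReal (1 / π) * ∫⁻ z in {z : ℂ | z.re ∈ Set.Ioc 0 (2 * π) ∧ 0 < z.im},
        ENNReal.ofReal (‖fderiv ℝ W z‖ ^ 2) := by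
  have hopen : IsOpen {z : ℂ | 0 < z.im} := isOpen_lt continuous_const Complex.continuous_im
  have hfd : ContinuousOn (fderiv ℝ W) {z | 0 < z.im} :=
    hW.continuousOn_fderiv_of_isOpen hopen le_rfl
  have hdiff : ∀ z : ℂ, 0 < z.im → HasFDerivAt W (fderiv ℝ W z) z := fun z hz =>
    ((hW.differentiableOn one_ne_zero).differentiableAt (hopen.mem_nhds hz)).hasFDerivAt
  let q : ℝ → ℝ → ℂ := fun x y => x + y * Complex.I
  have hqim : ∀ x y, (q x y).im = y := fun x y => by simp [q]
  have hqre : ∀ x y, (q x y).re = x := fun x y => by simp [q]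
  have hqc : Continuous fun p : ℝ × ℝ => q p.1 p.2 := by fun_prop
  -- horizontal and vertical derivatives
  have hdx : ∀ x y, 0 < y → HasDerivAt (fun x => W (q x y)) (fderiv ℝ W (q x y) 1) x := by
    intro x y hy
    have h1 : HasDerivAt (fun x : ℝ => q x y) 1 x := by
      have := (Complex.ofRealCLM.hasDerivAt (x := x)).add_const (y * Complex.I)
      rw [Complex.ofRealCLM_apply, Complex.ofReal_one] at this
      exact this
    exact (hdiff _ (by rwa [hqim])).comp_hasDerivAt x h1
  have hdy : ∀ x y, 0 < y → HasDerivAt (fun y => W (q x y)) (fderiv ℝ W (q x y) Complex.I) y := by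
    intro x y hy
    have h1 : HasDerivAt (fun y : ℝ => q x y) Complex.I y := by
      have := ((Complex.ofRealCLM.hasDerivAt (x := y)).mul_const Complex.I).const_add (x : ℂ)
      rw [Complex.ofRealCLM_apply, Complex.ofReal_one, one_mul] at this
      exact this
    exact (hdiff _ (by rwa [hqim])).comp_hasDerivAt y h1
  have hcx : ∀ y, 0 < y → ∀ v : ℂ, Continuous fun x => fderiv ℝ W (q x y) v := by
    intro y hy v
    have : Continuous fun x => fderiv ℝ W (q x y) :=
      hfd.comp_continuous (by fun_prop) (fun x => by simpa [hqim] using hy)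
    fun_prop
  have hWc : ∀ y, 0 ≤ y → Continuous fun x => W (q x y) := fun y hy =>
    hc.comp_continuous (by fun_prop) (fun x => by simpa [hqim] using hy)
  have hqp : ∀ x y, 0 ≤ y → W (q (x + 2 * π) y) = W (q x y) := by
    intro x y hy
    have := hp (q x y) (by rwa [hqim])
    rw [← this]
    congr 1
    simp only [q]; push_cast; ring
  let w : ℤ → ℝ → ℂ := fun n y => fc (fun x => W (q x y)) n
  let w' : ℤ → ℝ → ℂ := fun n y => fc (fun x => fderiv ℝ W (q x y) Complex.I) n
  have hwd : ∀ n y, 0 < y → HasDerivAt (w n) (w' n y) y := by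
    intro n y hy
    let K : Set ℂ := (fun p : ℝ × ℝ => q p.1 p.2) '' (Set.Icc 0 (2 * π) ×ˢ Set.Icc (y / 2) (2 * y))
    have hK : IsCompact K := (isCompact_Icc.prod isCompact_Icc).image hqc
    have hKs : K ⊆ {z | 0 < z.im} := by
      rintro _ ⟨p, hp, rfl⟩
      simp only [Set.mem_ofPred_eq, hqim]
      linarith [hp.2.1]
    obtain ⟨C, hC⟩ := hK.exists_bound_of_continuousOn (hfd.mono hKs)
    have := (intervalIntegral.hasDerivAt_integral_of_dominated_loc_of_deriv_le
      (μ := volume) (a := 0) (b := 2 * π) (x₀ := y) (bound := fun _ => C)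
      (F := fun y x => ee (-n) x * W (q x y))
      (F' := fun y x => ee (-n) x * fderiv ℝ W (q x y) Complex.I)
      (s := Set.Icc (y / 2) (2 * y)) (Icc_mem_nhds (by linarith) (by linarith))
      ?_ ?_ ?_ ?_ ?_ ?_).2
    · exact this.const_mul _
    · filter_upwards [lt_mem_nhds hy] with t ht
      exact ((continuous_ee _).mul (hWc t ht.le)).aestronglyMeasurable
    · exact ((continuous_ee _).mul (hWc y hy.le)).intervalIntegrable _ _
    · exact ((continuous_ee _).mul (hcx y hy _)).aestronglyMeasurable
    · refine Eventually.of_forall fun x hx t ht => ?_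
      rw [Set.uIoc_of_le Real.two_pi_pos.le] at hx
      rw [norm_mul, norm_ee, one_mul]
      refine (ContinuousLinearMap.le_opNorm _ _).trans ?_
      rw [Complex.norm_I, mul_one]
      exact hC _ ⟨(x, t), ⟨Set.Ioc_subset_Icc_self hx, ht⟩, rfl⟩
    · exact intervalIntegrable_const
    · refine Eventually.of_forall fun x hx t ht => ?_
      exact (hdy x t (by linarith [ht.1])).const_mul _
  have hwx : ∀ n y, 0 < y → fc (fun x => fderiv ℝ W (q x y) 1) n = n * Complex.I * w n y := by
    intro n y hy
    exact fc_deriv (fun x => hqp x y hy.le) (fun x => hdx x y hy)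
      (integrable_of_continuous (hcx y hy 1)) n
  set M : ENNReal := ENNReal.ofReal (1 / π) *
    ∫⁻ z in {z : ℂ | z.re ∈ Set.Ioc 0 (2 * π) ∧ 0 < z.im}, ENNReal.ofReal (‖fderiv ℝ W z‖ ^ 2)
    with hM
  -- the slice estimate
  have hslice : ∀ y, 0 < y → ∑' n : ℤ, ENNReal.ofReal (‖w' n y‖ ^ 2 + |(n : ℝ)| ^ 2 * ‖w n y‖ ^ 2)
      ≤ ENNReal.ofReal (1 / π) * ∫⁻ x, ENNReal.ofReal (‖fderiv ℝ W (q x y)‖ ^ 2) ∂per := by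
    intro y hy
    have h1 := lintegral_norm_sq_eq (memLp_of_continuous (hcx y hy 1) 2)
    have h2 := lintegral_norm_sq_eq (memLp_of_continuous (hcx y hy Complex.I) 2)
    simp only [hwx _ y hy] at h1
    have h3 : ∀ n : ℤ, ENNReal.ofReal (‖w' n y‖ ^ 2 + |(n : ℝ)| ^ 2 * ‖w n y‖ ^ 2)
        = ENNReal.ofReal (‖w' n y‖ ^ 2) + ENNReal.ofReal (‖n * Complex.I * w n y‖ ^ 2) := by
      intro n
      rw [← ENNReal.ofReal_add (by positivity) (by positivity)]
      congr 2
      rw [norm_mul, norm_mul, Complex.norm_I, mul_one, mul_pow]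
      simp
    have h4 : ∀ v : ℂ, ‖v‖ = 1 → ∫⁻ x, ENNReal.ofReal (‖fderiv ℝ W (q x y) v‖ ^ 2) ∂per
        ≤ ∫⁻ x, ENNReal.ofReal (‖fderiv ℝ W (q x y)‖ ^ 2) ∂per := by
      intro v hv
      refine lintegral_mono fun x => ENNReal.ofReal_le_ofReal ?_
      have := (fderiv ℝ W (q x y)).le_opNorm v
      rw [hv, mul_one] at this
      gcongr
    have h5 := h4 1 (by simp)
    have h6 := h4 Complex.I (by simp)
    rw [h1] at h5
    rw [h2] at h6
    simp only [h3]
    rw [ENNReal.tsum_add]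
    have h7 := add_le_add h6 h5
    rw [← mul_add, ← two_mul] at h7
    have h8 : ENNReal.ofReal (1 / (2 * π)) * ENNReal.ofReal (2 * π) = 1 := by
      rw [← ENNReal.ofReal_mul (by positivity), one_div_mul_cancel Real.two_pi_pos.ne']; simp
    have h9 : ENNReal.ofReal (1 / (2 * π)) * 2 = ENNReal.ofReal (1 / π) := by
      rw [show (2 : ENNReal) = ENNReal.ofReal 2 by simp, ← ENNReal.ofReal_mul (by positivity)]
      congr 1
      field_simp
    have h10 := mul_le_mul_right h7 (ENNReal.ofReal (1 / (2 * π)))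
    rw [← mul_assoc, h8, one_mul, ← mul_assoc, h9] at h10
    exact h10
  -- Tonelli
  have hton : ∫⁻ y in Set.Ioi (0 : ℝ), ∫⁻ x, ENNReal.ofReal (‖fderiv ℝ W (q x y)‖ ^ 2) ∂per
      = ∫⁻ z in {z : ℂ | z.re ∈ Set.Ioc 0 (2 * π) ∧ 0 < z.im},
        ENNReal.ofReal (‖fderiv ℝ W z‖ ^ 2) := by
    have hmp := Complex.volume_preserving_equiv_real_prod.symm
    rw [← hmp.setLIntegral_comp_preimage_emb
      Complex.measurableEquivRealProd.symm.measurableEmbedding]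
    have hpre : (Complex.measurableEquivRealProd.symm ⁻¹'
        {z : ℂ | z.re ∈ Set.Ioc 0 (2 * π) ∧ 0 < z.im}) = Set.Ioc 0 (2 * π) ×ˢ Set.Ioi 0 := by
      ext p
      simp [Complex.measurableEquivRealProd_symm_apply]
    have hq : ∀ p, Complex.measurableEquivRealProd.symm p = q p.1 p.2 := by
      intro p
      simp only [q, Complex.measurableEquivRealProd_symm_apply]
      apply Complex.ext <;> simp
    rw [hpre]
    simp only [hq]
    have hmeas : AEMeasurable (fun p : ℝ × ℝ => ENNReal.ofReal (‖fderiv ℝ W (q p.1 p.2)‖ ^ 2))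
        ((volume.restrict (Set.Ioc 0 (2 * π))).prod (volume.restrict (Set.Ioi 0))) := by
      have hqm := hqc.measurable
      have hfm : Measurable (fun p : ℝ × ℝ => fderiv ℝ W (q p.1 p.2)) :=
        (measurable_fderiv ℝ W).comp hqm
      exact (hfm.norm.pow_const 2).ennreal_ofReal.aemeasurable
    rw [Measure.volume_eq_prod, ← Measure.prod_restrict, lintegral_prod_symm _ hmeas]
    rfl
  have hfin : ∀ y, 0 < y → ∀ s : Finset ℤ,
      ∑ n ∈ s, ENNReal.ofReal (|(n : ℝ)| * ‖w n y‖ ^ 2) ≤ M := by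
    intro y hy s
    have hm : ∀ n,
        AEMeasurable (fun y => ENNReal.ofReal (‖w' n y‖ ^ 2 + |(n : ℝ)| ^ 2 * ‖w n y‖ ^ 2))
        (volume.restrict (Set.Ioi 0)) := by
      intro n
      have h1 : AEStronglyMeasurable (w n) (volume.restrict (Set.Ioi 0)) :=
        ContinuousOn.aestronglyMeasurable
          (fun y hy => (hwd n y hy).continuousAt.continuousWithinAt) measurableSet_Ioi
      have h2 : AEStronglyMeasurable (w' n) (volume.restrict (Set.Ioi 0)) := by
        refine (stronglyMeasurable_deriv (w n)).aestronglyMeasurable.congr ?_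
        filter_upwards [ae_restrict_mem measurableSet_Ioi] with y hy
        exact (hwd n y hy).deriv
      exact ((h2.norm.pow 2).add ((h1.norm.pow 2).const_mul _)).aemeasurable.ennreal_ofReal
    calc ∑ n ∈ s, ENNReal.ofReal (|(n : ℝ)| * ‖w n y‖ ^ 2)
        ≤ ∑ n ∈ s, ∫⁻ y in Set.Ioi 0,
            ENNReal.ofReal (‖w' n y‖ ^ 2 + |(n : ℝ)| ^ 2 * ‖w n y‖ ^ 2) := by
          refine Finset.sum_le_sum fun n _ => ?_
          by_cases hn : n = 0
          · simp [hn]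
          · refine halfline_bound ?_ (hwd n) hy
            exact_mod_cast Int.one_le_abs hn
      _ = ∫⁻ y in Set.Ioi 0, ∑ n ∈ s,
            ENNReal.ofReal (‖w' n y‖ ^ 2 + |(n : ℝ)| ^ 2 * ‖w n y‖ ^ 2) :=
          (lintegral_finsetSum' _ fun n _ => hm n).symm
      _ ≤ ∫⁻ y in Set.Ioi 0, ENNReal.ofReal (1 / π) *
            ∫⁻ x, ENNReal.ofReal (‖fderiv ℝ W (q x y)‖ ^ 2) ∂per := by
          refine setLIntegral_mono' measurableSet_Ioi fun y hy => ?_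
          exact (ENNReal.sum_le_tsum s).trans (hslice y hy)
      _ = M := by
          rw [lintegral_const_mul' _ _ ENNReal.ofReal_ne_top, hton]
  have hlim : ∀ n, Tendsto (fun y => w n y) (𝓝[>] 0) (𝓝 (w n 0)) := by
    intro n
    have h1 : Continuous (fun p : ℝ × ℝ => ee (-n) p.2 * W (q p.2 (max p.1 0))) := by
      refine Continuous.mul (by fun_prop) ?_
      exact hc.comp_continuous (by fun_prop) fun p => by simp [hqim]
    have h2 := intervalIntegral.continuous_parametric_intervalIntegral_of_continuous' (μ := volume)
      (f := fun y x => ee (-n) x * W (q x (max y 0))) h1 0 (2 * π)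
    have h3 := ((h2.tendsto 0).const_mul ((1 / (2 * π) : ℝ) : ℂ)).mono_left
      (nhdsWithin_le_nhds (s := Set.Ioi 0))
    simp only [max_self] at h3
    refine h3.congr' ?_
    filter_upwards [self_mem_nhdsWithin] with y hy
    simp only [w, fc, max_eq_left (le_of_lt (Set.mem_Ioi.1 hy))]
  have hw0 : ∀ n, fc (fun x : ℝ => W x) n = w n 0 := by
    intro n; simp [w, q]
  simp only [hw0]
  refine ENNReal.summable.tsum_le_of_sum_le fun s => ?_
  have ht : Tendsto (fun y => ∑ n ∈ s, ENNReal.ofReal (|(n : ℝ)| * ‖w n y‖ ^ 2)) (𝓝[>] 0)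
      (𝓝 (∑ n ∈ s, ENNReal.ofReal (|(n : ℝ)| * ‖w n 0‖ ^ 2))) :=
    tendsto_finsetSum _ fun n _ =>
      ENNReal.tendsto_ofReal (((hlim n).norm.pow 2).const_mul _)
  refine le_of_tendsto ht ?_
  filter_upwards [self_mem_nhdsWithin] with y hy
  exact hfin y hy s

/-- One period of the upper half plane. -/
def strip : Set ℂ := {z : ℂ | z.re ∈ Set.Ioc 0 (2 * π) ∧ 0 < z.im}

lemma measurableSet_strip : MeasurableSet strip :=
  (measurableSet_Ioc.preimage Complex.measurable_re).inter
    (measurableSet_Ioi.preimage Complex.measurable_im)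

/-- The energy of boundary values of `φ ∘ T` for a quasiregular injective `T`. -/
theorem energy_le_of_comp {W T φ : ℂ → ℂ} {K : ℝ} (hT : ContDiffOn ℝ 1 T {z | 0 < z.im})
    (hinj : Set.InjOn T strip)
    (hK : ∀ z ∈ strip, ‖fderiv ℝ T z‖ ^ 2 ≤ K * |(fderiv ℝ T z).det|)
    (hφ : ContDiff ℝ 1 φ) (hWT : ∀ z : ℂ, 0 < z.im → W z = φ (T z))
    (hc : ContinuousOn W {z | 0 ≤ z.im}) (hp : ∀ z : ℂ, 0 ≤ z.im → W (z + 2 * π) = W z) :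
    douglasEnergyP (fun x : ℝ => W x)
      ≤ ENNReal.ofReal (4 * π * K) * ∫⁻ w in T '' strip, ENNReal.ofReal (‖fderiv ℝ φ w‖ ^ 2) := by
  have hopen : IsOpen {z : ℂ | 0 < z.im} := isOpen_lt continuous_const Complex.continuous_im
  have hW : ContDiffOn ℝ 1 W {z | 0 < z.im} := (hφ.comp_contDiffOn hT).congr fun z hz => hWT z hz
  have hTd : ∀ z : ℂ, 0 < z.im → HasFDerivAt T (fderiv ℝ T z) z := fun z hz =>
    ((hT.differentiableOn one_ne_zero).differentiableAt (hopen.mem_nhds hz)).hasFDerivAt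
  have hcr : Continuous fun x : ℝ => W x :=
    hc.comp_continuous Complex.continuous_ofReal (fun x => by simp)
  rw [energy_eq (memLp_of_continuous hcr 2)]
  have h1 := dirichlet_principle hW hc hp
  have h2 : ∫⁻ z in strip, ENNReal.ofReal (‖fderiv ℝ W z‖ ^ 2)
      ≤ ENNReal.ofReal K * ∫⁻ w in T '' strip, ENNReal.ofReal (‖fderiv ℝ φ w‖ ^ 2) := by
    rw [lintegral_image_eq_lintegral_abs_det_fderiv_mul volume measurableSet_strip
      (fun z hz => (hTd z hz.2).hasFDerivWithinAt) hinj, ← lintegral_const_mul' _ _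
      ENNReal.ofReal_ne_top]
    refine setLIntegral_mono' measurableSet_strip fun z hz => ?_
    by_cases hK0 : 0 ≤ K
    · rw [← ENNReal.ofReal_mul (by positivity), ← ENNReal.ofReal_mul hK0]
      apply ENNReal.ofReal_le_ofReal
      have h3 : fderiv ℝ W z = (fderiv ℝ φ (T z)).comp (fderiv ℝ T z) := by
        have h4 : W =ᶠ[𝓝 z] φ ∘ T := by
          filter_upwards [hopen.mem_nhds hz.2] with y hy
          exact hWT y hy
        rw [h4.fderiv_eq]
        exact ((hφ.differentiable one_ne_zero (T z)).hasFDerivAt.comp z (hTd z hz.2)).fderiv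
      have h5 := ContinuousLinearMap.opNorm_comp_le (fderiv ℝ φ (T z)) (fderiv ℝ T z)
      rw [← h3] at h5
      calc ‖fderiv ℝ W z‖ ^ 2 ≤ (‖fderiv ℝ φ (T z)‖ * ‖fderiv ℝ T z‖) ^ 2 := by gcongr
        _ = ‖fderiv ℝ T z‖ ^ 2 * ‖fderiv ℝ φ (T z)‖ ^ 2 := by ring
        _ ≤ (K * |(fderiv ℝ T z).det|) * ‖fderiv ℝ φ (T z)‖ ^ 2 := by
            gcongr; exact hK z hz
        _ = _ := by ring
    · have h3 : fderiv ℝ T z = 0 := by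
        have h4 := hK z hz
        have h5 : K * |(fderiv ℝ T z).det| ≤ 0 :=
          mul_nonpos_of_nonpos_of_nonneg (by linarith) (abs_nonneg _)
        have h6 : ‖fderiv ℝ T z‖ ^ 2 = 0 := le_antisymm (h4.trans h5) (sq_nonneg _)
        simpa using h6
      have h3' : fderiv ℝ W z = 0 := by
        have h4 : W =ᶠ[𝓝 z] φ ∘ T := by
          filter_upwards [hopen.mem_nhds hz.2] with y hy
          exact hWT y hy
        rw [h4.fderiv_eq, ((hφ.differentiable one_ne_zero (T z)).hasFDerivAt.comp z
          (hTd z hz.2)).fderiv, h3]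
        simp
      rw [h3']
      simp
  calc _ ≤ ENNReal.ofReal (4 * π ^ 2) * (ENNReal.ofReal (1 / π) * (ENNReal.ofReal K *
        ∫⁻ w in T '' strip, ENNReal.ofReal (‖fderiv ℝ φ w‖ ^ 2))) := by
        gcongr
        exact h1.trans (by gcongr; exact h2)
    _ = _ := by
        rw [← mul_assoc, ← mul_assoc, ← ENNReal.ofReal_mul (by positivity),
          ← ENNReal.ofReal_mul (by positivity)]
        congr 2
        have := Real.pi_ne_zero
        field_simp

lemma norm_fderiv_sq_eq_det {T : ℂ → ℂ} {z : ℂ} (hT : DifferentiableAt ℂ T z) :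
    ‖fderiv ℝ T z‖ ^ 2 = |(fderiv ℝ T z).det| := by
  have h1 := hT.hasDerivAt.complexToReal_fderiv
  rw [h1.fderiv]
  have h2 : (deriv T z • (1 : ℂ →L[ℝ] ℂ)).det = ‖deriv T z‖ ^ 2 := by
    rw [ContinuousLinearMap.det]
    have := Complex.det_conjAe
    rw [← LinearMap.det_toMatrix Complex.basisOneI, Matrix.det_fin_two]
    simp [LinearMap.toMatrix_apply, Complex.sq_norm, Complex.normSq_apply]
  rw [h2, norm_smul, abs_of_nonneg (by positivity)]
  simp

lemma exp_I_injOn_strip : Set.InjOn (fun z : ℂ => Complex.exp (Complex.I * z)) strip := by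
  intro z hz w hw h
  obtain ⟨m, hm⟩ := Complex.exp_eq_exp_iff_exists_int.1 h
  have h1 : z = w + m * (2 * π) := by
    have : Complex.I * z = Complex.I * (w + m * (2 * π)) := by rw [hm]; ring
    exact mul_left_cancel₀ Complex.I_ne_zero this
  have h2 : z.re = w.re + m * (2 * π) := by
    rw [h1]; simp
  have h3 : |(m : ℝ)| < 1 := by
    by_contra! hc
    have h4 : |z.re - w.re| < 2 * π := by
      rw [abs_lt]; constructor <;> linarith [hz.1.1, hz.1.2, hw.1.1, hw.1.2]
    rw [h2, add_sub_cancel_left, abs_mul, abs_of_pos Real.two_pi_pos] at h4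
    nlinarith [Real.two_pi_pos]
  have h5 : m = 0 := by
    have : |m| < 1 := by exact_mod_cast h3
    simpa using this
  rw [h1, h5]; simp

lemma norm_exp_I_mul (z : ℂ) : ‖Complex.exp (Complex.I * z)‖ = Real.exp (-z.im) := by
  rw [Complex.norm_exp]; simp

lemma exp_I_mul_add_period (z : ℂ) :
    Complex.exp (Complex.I * (z + 2 * π)) = Complex.exp (Complex.I * z) := by
  rw [Complex.exp_eq_exp_iff_exists_int]
  exact ⟨1, by push_cast; ring⟩

/-- Capacity estimate from the interior conformal map. -/
theorem energy_comp_le_interior {F φ : ℂ → ℂ} (hF : DifferentiableOn ℂ F (ball (0 : ℂ) 1))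
    (hFi : Set.InjOn F (ball (0 : ℂ) 1)) (hFc : ContinuousOn F (closedBall (0 : ℂ) 1))
    (hφ : ContDiff ℝ 1 φ) :
    douglasEnergyP (fun θ => φ (F (ee 1 θ)))
      ≤ ENNReal.ofReal (4 * π) * ∫⁻ w, ENNReal.ofReal (‖fderiv ℝ φ w‖ ^ 2) := by
  have hopen : IsOpen {z : ℂ | 0 < z.im} := isOpen_lt continuous_const Complex.continuous_im
  have hmaps : ∀ z : ℂ, 0 < z.im → Complex.exp (Complex.I * z) ∈ ball (0 : ℂ) 1 := by
    intro z hz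
    rw [mem_ball_zero_iff, norm_exp_I_mul]
    simpa using hz
  have hmaps' : ∀ z : ℂ, 0 ≤ z.im → Complex.exp (Complex.I * z) ∈ closedBall (0 : ℂ) 1 := by
    intro z hz
    rw [mem_closedBall_zero_iff, norm_exp_I_mul]
    simpa using hz
  have hTd : DifferentiableOn ℂ (fun z => F (Complex.exp (Complex.I * z))) {z | 0 < z.im} :=
    hF.comp (by fun_prop) fun z hz => hmaps z hz
  have h := energy_le_of_comp (W := fun z => φ (F (Complex.exp (Complex.I * z))))
    (T := fun z => F (Complex.exp (Complex.I * z))) (φ := φ) (K := 1)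
    ((hTd.contDiffOn hopen).restrict_scalars ℝ)
    (fun z hz w hw h => exp_I_injOn_strip hz hw (hFi (hmaps z hz.2) (hmaps w hw.2) h))
    (fun z hz => by
      rw [one_mul]
      exact (norm_fderiv_sq_eq_det (hTd.differentiableAt (hopen.mem_nhds hz.2))).le)
    hφ (fun z _ => rfl)
    (hφ.continuous.comp_continuousOn (hFc.comp (by fun_prop) fun z hz => hmaps' z hz))
    (fun z _ => by simp only [exp_I_mul_add_period])
  rw [mul_one] at h
  have h2 : (fun x : ℝ => φ (F (Complex.exp (Complex.I * x)))) = fun θ => φ (F (ee 1 θ)) := by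
    funext x
    simp [ee, mul_comm]
  rw [h2] at h
  exact h.trans (by gcongr; exact Measure.restrict_le_self)

lemma fc_comp_neg {u : ℝ → ℂ} (hu : ∀ θ, u (θ + 2 * π) = u θ) (n : ℤ) :
    fc (fun θ => u (-θ)) n = fc u (-n) := by
  unfold fc
  congr 1
  have h1 : ∀ θ, ee (-n) θ * u (-θ) = (fun t => ee n t * u t) (-θ) := by
    intro θ
    simp [ee]
  simp_rw [h1]
  rw [intervalIntegral.integral_comp_neg (fun t => ee n t * u t), neg_neg]
  have hp : Function.Periodic (fun θ => ee n θ * u θ) (2 * π) := by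
    intro θ; simp only [ee_period, hu]
  have := hp.intervalIntegral_add_eq (-(2 * π)) 0
  simpa using this

lemma energy_comp_neg {u : ℝ → ℂ} (hc : Continuous u) (hu : ∀ θ, u (θ + 2 * π) = u θ) :
    douglasEnergyP (fun θ => u (-θ)) = douglasEnergyP u := by
  rw [energy_eq (memLp_of_continuous hc 2),
    energy_eq (u := fun θ => u (-θ)) (memLp_of_continuous (hc.comp continuous_neg) 2)]
  congr 1
  simp only [fc_comp_neg hu]
  rw [← (Equiv.neg ℤ).tsum_eq]
  simp

/-- Capacity estimate from the exterior conformal map. -/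
theorem energy_comp_le_exterior {G φ : ℂ → ℂ} (hG : DifferentiableOn ℂ G {z : ℂ | 1 < ‖z‖})
    (hGi : Set.InjOn G {z : ℂ | 1 < ‖z‖}) (hGc : ContinuousOn G {z : ℂ | 1 ≤ ‖z‖})
    (hφ : ContDiff ℝ 1 φ) :
    douglasEnergyP (fun θ => φ (G (ee 1 θ)))
      ≤ ENNReal.ofReal (4 * π) * ∫⁻ w, ENNReal.ofReal (‖fderiv ℝ φ w‖ ^ 2) := by
  have hopen : IsOpen {z : ℂ | 0 < z.im} := isOpen_lt continuous_const Complex.continuous_im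
  have hnorm : ∀ z : ℂ, ‖(Complex.exp (Complex.I * z))⁻¹‖ = Real.exp z.im := by
    intro z
    rw [norm_inv, norm_exp_I_mul, Real.exp_neg, inv_inv]
  have hmaps : ∀ z : ℂ, 0 < z.im → 1 < ‖(Complex.exp (Complex.I * z))⁻¹‖ := by
    intro z hz
    rw [hnorm]
    simpa using hz
  have hmaps' : ∀ z : ℂ, 0 ≤ z.im → 1 ≤ ‖(Complex.exp (Complex.I * z))⁻¹‖ := by
    intro z hz
    rw [hnorm]
    simpa using hz
  have hd : Differentiable ℂ fun z => (Complex.exp (Complex.I * z))⁻¹ := by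
    intro z
    exact DifferentiableAt.inv (by fun_prop) (Complex.exp_ne_zero _)
  have hTd : DifferentiableOn ℂ (fun z => G (Complex.exp (Complex.I * z))⁻¹) {z | 0 < z.im} :=
    hG.comp hd.differentiableOn fun z hz => hmaps z hz
  have h := energy_le_of_comp (W := fun z => φ (G (Complex.exp (Complex.I * z))⁻¹))
    (T := fun z => G (Complex.exp (Complex.I * z))⁻¹) (φ := φ) (K := 1)
    ((hTd.contDiffOn hopen).restrict_scalars ℝ)
    (fun z hz w hw h => exp_I_injOn_strip hz hw
      (inv_injective (hGi (hmaps z hz.2) (hmaps w hw.2) h)))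
    (fun z hz => by
      rw [one_mul]
      exact (norm_fderiv_sq_eq_det (hTd.differentiableAt (hopen.mem_nhds hz.2))).le)
    hφ (fun z _ => rfl)
    (hφ.continuous.comp_continuousOn
      (hGc.comp hd.continuous.continuousOn fun z hz => hmaps' z hz))
    (fun z _ => by simp only [exp_I_mul_add_period])
  rw [mul_one] at h
  have h2 : (fun x : ℝ => φ (G (Complex.exp (Complex.I * x))⁻¹))
      = fun θ => φ (G (ee 1 (-θ))) := by
    funext x
    rw [← Complex.exp_neg]
    simp [ee, mul_comm]
  have hcont : Continuous fun θ => φ (G (ee 1 θ)) :=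
    hφ.continuous.comp (hGc.comp_continuous (continuous_ee 1) fun x => by simp [norm_ee])
  rw [h2, energy_comp_neg hcont (fun θ => by simp only [ee_period])] at h
  exact h.trans (by gcongr; exact Measure.restrict_le_self)

/-- Average of `H` over the segment from `s` to `t`. -/
noncomputable def av (H : ℝ → ℝ) (s t : ℝ) : ℝ := ∫ u in (0 : ℝ)..1, H ((1 - u) * s + u * t)

/-- The Beurling–Ahlfors extension. -/
noncomputable def ba (H : ℝ → ℝ) (z : ℂ) : ℂ :=
  ((av H z.re (z.re + z.im) + av H (z.re - z.im) z.re) / 2 : ℝ)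
    + ((av H z.re (z.re + z.im) - av H (z.re - z.im) z.re) / 2 : ℝ) * Complex.I

lemma av_lt {H : ℝ → ℝ} (hc : Continuous H) (hm : StrictMono H) {s t s' t' : ℝ} (hs : s ≤ s')
    (ht : t ≤ t') (h : s < s' ∨ t < t') :
    av H s t < av H s' t' := by
  unfold av
  refine intervalIntegral.integral_lt_integral_of_continuousOn_of_le_of_exists_lt one_pos
    (by fun_prop) (by fun_prop) (fun u hu => hm.monotone ?_) ⟨1 / 2, ⟨by norm_num, by norm_num⟩,
      hm ?_⟩
  · have := hu.1.le; have := sub_nonneg.2 hu.2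
    gcongr
  · rcases h with h | h <;> linarith

lemma continuous_av {H : ℝ → ℝ} (hc : Continuous H) : Continuous fun p : ℝ × ℝ => av H p.1 p.2 := by
  unfold av
  apply intervalIntegral.continuous_parametric_intervalIntegral_of_continuous'
  unfold Function.uncurry
  fun_prop

lemma av_eq_primitive {H : ℝ → ℝ} (hc : Continuous H) {s t : ℝ} (hst : s ≠ t) :
    av H s t = ((∫ x in (0 : ℝ)..t, H x) - ∫ x in (0 : ℝ)..s, H x) / (t - s) := by
  rw [intervalIntegral.integral_interval_sub_left (hc.intervalIntegrable _ _)
    (hc.intervalIntegrable _ _)]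
  have h : t - s ≠ 0 := sub_ne_zero.2 hst.symm
  unfold av
  have h1 : ∀ u, H ((1 - u) * s + u * t) = H (s + (t - s) * u) := by intro u; ring_nf
  simp_rw [h1]
  rw [intervalIntegral.integral_comp_add_mul _ h]
  simp only [mul_zero, add_zero, mul_one, add_sub_cancel, smul_eq_mul]
  rw [inv_mul_eq_div]

lemma av_le {H : ℝ → ℝ} (hc : Continuous H) (hm : Monotone H) {s t : ℝ} (hst : s ≤ t) :
    av H s t ≤ H t := by
  have : av H s t ≤ ∫ u in (0 : ℝ)..1, H t := by
    refine intervalIntegral.integral_mono_on zero_le_one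
      (Continuous.intervalIntegrable (by fun_prop) _ _)
      (Continuous.intervalIntegrable (by fun_prop) _ _) fun u hu => hm ?_
    nlinarith [hu.1, hu.2]
  simpa using this

lemma le_av {H : ℝ → ℝ} (hc : Continuous H) (hm : Monotone H) {s t : ℝ} (hst : s ≤ t) :
    H s ≤ av H s t := by
  have : ∫ u in (0 : ℝ)..1, H s ≤ av H s t := by
    refine intervalIntegral.integral_mono_on zero_le_one
      (Continuous.intervalIntegrable (by fun_prop) _ _)
      (Continuous.intervalIntegrable (by fun_prop) _ _) fun u hu => hm ?_
    nlinarith [hu.1, hu.2]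
  simpa using this

lemma av_split {H : ℝ → ℝ} (hc : Continuous H) (s t : ℝ) :
    av H s t = (av H s ((s + t) / 2) + av H ((s + t) / 2) t) / 2 := by
  unfold av
  have hi : ∀ a b, IntervalIntegrable (fun u => H ((1 - u) * s + u * t)) volume a b := fun a b =>
    Continuous.intervalIntegrable (by fun_prop) _ _
  rw [← intervalIntegral.integral_add_adjacent_intervals (hi 0 (1 / 2)) (hi (1 / 2) 1)]
  have h1 : ∀ u, H ((1 - u) * s + u * ((s + t) / 2))
      = (fun v => H ((1 - v) * s + v * t)) (u * (1 / 2)) := by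
    intro u; simp only; ring_nf
  have h2 : ∀ u, H ((1 - u) * ((s + t) / 2) + u * t)
      = (fun v => H ((1 - v) * s + v * t)) (u * (1 / 2) + 1 / 2) := by
    intro u; simp only; ring_nf
  have e1 : ∫ u in (0 : ℝ)..1, H ((1 - u) * s + u * ((s + t) / 2))
      = 2 * ∫ v in (0 : ℝ)..(1 / 2), H ((1 - v) * s + v * t) := by
    rw [intervalIntegral.integral_congr (fun u _ => h1 u),
      intervalIntegral.integral_comp_mul_right (fun v => H ((1 - v) * s + v * t)) (by norm_num)]
    norm_num
  have e2 : ∫ u in (0 : ℝ)..1, H ((1 - u) * ((s + t) / 2) + u * t)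
      = 2 * ∫ v in (1 / 2 : ℝ)..1, H ((1 - v) * s + v * t) := by
    rw [intervalIntegral.integral_congr (fun u _ => h2 u)]
    rw [intervalIntegral.integral_congr (g := fun u => (fun v => H ((1 - v) * s + v * t))
      ((1 / 2) * u + 1 / 2)) (fun u _ => by simp only; ring_nf),
      intervalIntegral.integral_comp_mul_add (fun v => H ((1 - v) * s + v * t)) (by norm_num)]
    norm_num
  rw [e1, e2]
  ring

lemma av_add_period {H : ℝ → ℝ} (hc : Continuous H)
    (hp : ∀ θ, H (θ + 2 * π) = H θ + 2 * π) (s t : ℝ) :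
    av H (s + 2 * π) (t + 2 * π) = av H s t + 2 * π := by
  unfold av
  have h1 : ∀ u, H ((1 - u) * (s + 2 * π) + u * (t + 2 * π)) = H ((1 - u) * s + u * t) + 2 * π := by
    intro u; rw [← hp]; ring_nf
  simp_rw [h1]
  rw [intervalIntegral.integral_add (Continuous.intervalIntegrable (by fun_prop) _ _)
    (Continuous.intervalIntegrable (by fun_prop) _ _)]
  simp

lemma continuous_ba {H : ℝ → ℝ} (hc : Continuous H) : Continuous (ba H) := by
  have h := continuous_av hc
  have h1 : Continuous fun z : ℂ => av H z.re (z.re + z.im) :=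
    h.comp (f := fun z : ℂ => (z.re, z.re + z.im)) (by fun_prop)
  have h2 : Continuous fun z : ℂ => av H (z.re - z.im) z.re :=
    h.comp (f := fun z : ℂ => (z.re - z.im, z.re)) (by fun_prop)
  unfold ba
  fun_prop

lemma ba_add_period {H : ℝ → ℝ} (hc : Continuous H)
    (hp : ∀ θ, H (θ + 2 * π) = H θ + 2 * π) (z : ℂ) :
    ba H (z + 2 * π) = ba H z + 2 * π := by
  have h1 := av_add_period hc hp z.re (z.re + z.im)
  have h2 := av_add_period hc hp (z.re - z.im) z.re
  have hre : (z + 2 * π : ℂ).re = z.re + 2 * π := by simp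
  have him : (z + 2 * π : ℂ).im = z.im := by simp
  unfold ba
  rw [hre, him, show z.re + 2 * π + z.im = z.re + z.im + 2 * π by ring,
    show z.re + 2 * π - z.im = z.re - z.im + 2 * π by ring, h1, h2]
  push_cast
  ring

lemma ba_ofReal {H : ℝ → ℝ} (x : ℝ) : ba H x = H x := by
  have : ∀ u : ℝ, (1 - u) * x + u * x = x := by intro u; ring
  simp [ba, av, this]

lemma ba_im_pos {H : ℝ → ℝ} (hc : Continuous H) (hm : StrictMono H) {z : ℂ} (hz : 0 < z.im) :
    0 < (ba H z).im := by
  have := av_lt hc hm (s := z.re - z.im) (t := z.re) (s' := z.re) (t' := z.re + z.im)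
    (by linarith) (by linarith) (Or.inl (by linarith))
  simp [ba]
  linarith

lemma ba_injOn {H : ℝ → ℝ} (hc : Continuous H) (hm : StrictMono H) :
    Set.InjOn (ba H) {z | 0 < z.im} := by
  have key : ∀ z w : ℂ, 0 < z.im → 0 < w.im → ba H z = ba H w → z.re ≤ w.re → z = w := by
    intro z w hz hw h hle
    have hre := congrArg Complex.re h
    have him := congrArg Complex.im h
    simp [ba] at hre him
    have h1 : av H z.re (z.re + z.im) = av H w.re (w.re + w.im) := by linarith
    have h2 : av H (z.re - z.im) z.re = av H (w.re - w.im) w.re := by linarith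
    rcases hle.eq_or_lt with heq | hlt
    · have h3 : z.im = w.im := by
        rw [heq] at h1
        rcases lt_trichotomy z.im w.im with h4 | h4 | h4
        · exact absurd h1 (av_lt hc hm le_rfl (by linarith) (Or.inr (by linarith))).ne
        · exact h4
        · exact absurd h1.symm (av_lt hc hm le_rfl (by linarith) (Or.inr (by linarith))).ne
      exact Complex.ext heq h3
    · exfalso
      have h3 : w.re + w.im < z.re + z.im := by
        by_contra! hcon
        exact absurd h1 (av_lt hc hm hlt.le hcon (Or.inl hlt)).ne
      exact absurd h2 (av_lt hc hm (by linarith) hlt.le (Or.inr hlt)).ne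
  intro z hz w hw h
  rcases le_total z.re w.re with h1 | h1
  · exact key z w hz hw h h1
  · exact (key w z hw hz h.symm h1).symm

lemma hasDerivAt_primitive {H : ℝ → ℝ} (hc : Continuous H) (x : ℝ) :
    HasDerivAt (fun t => ∫ x in (0 : ℝ)..t, H x) (H x) x :=
  intervalIntegral.integral_hasDerivAt_right (hc.intervalIntegrable _ _)
    (hc.stronglyMeasurableAtFilter _ _) hc.continuousAt

lemma contDiff_primitive {H : ℝ → ℝ} (hc : Continuous H) :
    ContDiff ℝ 1 (fun t => ∫ x in (0 : ℝ)..t, H x) := by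
  rw [contDiff_one_iff_deriv]
  refine ⟨fun x => (hasDerivAt_primitive hc x).differentiableAt, ?_⟩
  rw [show deriv (fun t => ∫ x in (0 : ℝ)..t, H x) = H from
    funext fun x => (hasDerivAt_primitive hc x).deriv]
  exact hc

lemma contDiffOn_ba {H : ℝ → ℝ} (hc : Continuous H) : ContDiffOn ℝ 1 (ba H) {z | 0 < z.im} := by
  have hP := contDiff_primitive hc
  set P : ℝ → ℝ := fun t => ∫ x in (0 : ℝ)..t, H x with hPdef
  have hre : ContDiff ℝ 1 Complex.re := Complex.reCLM.contDiff
  have him : ContDiff ℝ 1 Complex.im := Complex.imCLM.contDiff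
  have hof : ContDiff ℝ 1 Complex.ofReal := Complex.ofRealCLM.contDiff
  have h1 : ContDiffOn ℝ 1 (fun z : ℂ => (P (z.re + z.im) - P z.re) / z.im) {z | 0 < z.im} :=
    ((hP.comp (hre.add him)).sub (hP.comp hre)).contDiffOn.div him.contDiffOn
      fun z hz => ne_of_gt hz
  have h2 : ContDiffOn ℝ 1 (fun z : ℂ => (P z.re - P (z.re - z.im)) / z.im) {z | 0 < z.im} :=
    ((hP.comp hre).sub (hP.comp (hre.sub him))).contDiffOn.div him.contDiffOn
      fun z hz => ne_of_gt hz
  have h3 : ContDiffOn ℝ 1 (fun z : ℂ =>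
      (((P (z.re + z.im) - P z.re) / z.im + (P z.re - P (z.re - z.im)) / z.im) / 2 : ℝ)
      + ((((P (z.re + z.im) - P z.re) / z.im - (P z.re - P (z.re - z.im)) / z.im) / 2 : ℝ) : ℂ)
        * Complex.I) {z | 0 < z.im} :=
    (hof.comp_contDiffOn ((h1.add h2).div_const 2)).add
      ((hof.comp_contDiffOn ((h1.sub h2).div_const 2)).mul contDiffOn_const)
  refine h3.congr fun z hz => ?_
  have hz' : 0 < z.im := hz
  unfold ba
  rw [av_eq_primitive hc (by linarith), av_eq_primitive hc (by linarith)]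
  simp only [hPdef, add_sub_cancel_left, sub_sub_cancel]

lemma hasDerivAt_av_add_left {H : ℝ → ℝ} (hc : Continuous H) {x y : ℝ} (hy : 0 < y) :
    HasDerivAt (fun x => av H x (x + y)) ((H (x + y) - H x) / y) x := by
  have h1 : HasDerivAt (fun x => ((∫ t in (0 : ℝ)..(x + y), H t) - ∫ t in (0 : ℝ)..x, H t) / y)
      ((H (x + y) - H x) / y) x :=
    (((hasDerivAt_primitive hc (x + y)).comp_add_const x y).sub
      (hasDerivAt_primitive hc x)).div_const y
  refine h1.congr_of_eventuallyEq (Eventually.of_forall fun x => ?_)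
  simp only
  rw [av_eq_primitive hc (by linarith), add_sub_cancel_left]

lemma hasDerivAt_av_sub_left {H : ℝ → ℝ} (hc : Continuous H) {x y : ℝ} (hy : 0 < y) :
    HasDerivAt (fun x => av H (x - y) x) ((H x - H (x - y)) / y) x := by
  have h1 : HasDerivAt (fun x => ((∫ t in (0 : ℝ)..x, H t) - ∫ t in (0 : ℝ)..(x - y), H t) / y)
      ((H x - H (x - y)) / y) x :=
    ((hasDerivAt_primitive hc x).sub
      ((hasDerivAt_primitive hc (x - y)).comp_sub_const x y)).div_const y
  refine h1.congr_of_eventuallyEq (Eventually.of_forall fun x => ?_)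
  simp only
  rw [av_eq_primitive hc (by linarith), sub_sub_cancel]

lemma hasDerivAt_av_add_right {H : ℝ → ℝ} (hc : Continuous H) {x y : ℝ} (hy : 0 < y) :
    HasDerivAt (fun y => av H x (x + y)) ((H (x + y) - av H x (x + y)) / y) y := by
  have h1 : HasDerivAt (fun y => ((∫ t in (0 : ℝ)..(x + y), H t) - ∫ t in (0 : ℝ)..x, H t) / y)
      ((H (x + y) * y - ((∫ t in (0 : ℝ)..(x + y), H t) - ∫ t in (0 : ℝ)..x, H t) * 1) / y ^ 2) y :=
    (((hasDerivAt_primitive hc (x + y)).comp_const_add x y).sub_const _).div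
      (hasDerivAt_id y) hy.ne'
  have h2 : (H (x + y) - av H x (x + y)) / y
      = (H (x + y) * y - ((∫ t in (0 : ℝ)..(x + y), H t) - ∫ t in (0 : ℝ)..x,
          H t) * 1) / y ^ 2 := by
    rw [av_eq_primitive hc (by linarith), add_sub_cancel_left]
    field_simp
  rw [h2]
  refine h1.congr_of_eventuallyEq ?_
  filter_upwards [lt_mem_nhds hy] with y hy
  rw [av_eq_primitive hc (by linarith), add_sub_cancel_left]

lemma hasDerivAt_av_sub_right {H : ℝ → ℝ} (hc : Continuous H) {x y : ℝ} (hy : 0 < y) :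
    HasDerivAt (fun y => av H (x - y) x) ((H (x - y) - av H (x - y) x) / y) y := by
  have h0 : HasDerivAt (fun y => ∫ t in (0 : ℝ)..(x - y), H t) (-H (x - y)) y :=
    (hasDerivAt_primitive hc (x - y)).comp_const_sub x y
  have h1 : HasDerivAt (fun y => ((∫ t in (0 : ℝ)..x, H t) - ∫ t in (0 : ℝ)..(x - y), H t) / y)
      ((- -H (x - y) * y - ((∫ t in (0 : ℝ)..x, H t) - ∫ t in (0 : ℝ)..(x - y),
          H t) * 1) / y ^ 2) y :=
    (h0.const_sub _).div (hasDerivAt_id y) hy.ne'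
  have h2 : (H (x - y) - av H (x - y) x) / y
      = (- -H (x - y) * y - ((∫ t in (0 : ℝ)..x, H t) - ∫ t in (0 : ℝ)..(x - y),
          H t) * 1) / y ^ 2 := by
    rw [av_eq_primitive hc (by linarith), sub_sub_cancel]
    field_simp
  rw [h2]
  refine h1.congr_of_eventuallyEq ?_
  filter_upwards [lt_mem_nhds hy] with y hy
  rw [av_eq_primitive hc (by linarith), sub_sub_cancel]

lemma det_eq_of_clm (L : ℂ →L[ℝ] ℂ) :
    L.det = (L 1).re * (L Complex.I).im - (L 1).im * (L Complex.I).re := by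
  rw [ContinuousLinearMap.det, ← LinearMap.det_toMatrix Complex.basisOneI, Matrix.det_fin_two]
  simp [LinearMap.toMatrix_apply]
  ring

lemma opNorm_le_of_clm (L : ℂ →L[ℝ] ℂ) : ‖L‖ ≤ ‖L 1‖ + ‖L Complex.I‖ := by
  refine L.opNorm_le_bound (by positivity) fun z => ?_
  have h : z = z.re • (1 : ℂ) + z.im • Complex.I := by
    simp only [Complex.real_smul, mul_one]; exact (Complex.re_add_im z).symm
  have h2 : L z = z.re • L 1 + z.im • L Complex.I := by
    conv_lhs => rw [h]
    rw [map_add, map_smul, map_smul]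
  rw [h2]
  refine (norm_add_le _ _).trans ?_
  rw [norm_smul, norm_smul, add_mul, mul_comm ‖L 1‖, mul_comm ‖L Complex.I‖]
  gcongr
  · exact Complex.abs_re_le_norm z
  · exact Complex.abs_im_le_norm z

lemma ba_algebra {r l p q M : ℝ} (hr : 0 < r) (hl : 0 < l) (hp : 0 < p) (hq : 0 < q) (hM : 0 < M)
    (hrl : r ≤ M * l) (hlr : l ≤ M * r) (hpr : p ≤ r) (hql : q ≤ l)
    (hpl : r ≤ 2 * (M + 1) * p) (hqr : l ≤ 2 * (M + 1) * q) :
    2 * (r ^ 2 + l ^ 2 + (p ^ 2 + q ^ 2)) ≤ 8 * M * (M + 1) * (r * q + l * p) := by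
  have a1 : p ^ 2 ≤ r ^ 2 := pow_le_pow_left₀ hp.le hpr 2
  have a2 : q ^ 2 ≤ l ^ 2 := pow_le_pow_left₀ hq.le hql 2
  have a3 : r * r ≤ r * (M * l) := mul_le_mul_of_nonneg_left hrl hr.le
  have a4 : l * l ≤ l * (M * r) := mul_le_mul_of_nonneg_left hlr hl.le
  have a5 : r * l ≤ r * (2 * (M + 1) * q) := mul_le_mul_of_nonneg_left hqr hr.le
  have a6 : l * r ≤ l * (2 * (M + 1) * p) := mul_le_mul_of_nonneg_left hpl hl.le
  have a7 := mul_le_mul_of_nonneg_left a5 hM.le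
  have a8 := mul_le_mul_of_nonneg_left a6 hM.le
  linarith

/-- Quasiconformality of the Beurling–Ahlfors extension of a doubling homeomorphism. -/
lemma ba_quasiconformal {H : ℝ → ℝ} (hc : Continuous H) (hm : StrictMono H) {M : ℝ}
    (h1 : ∀ x t, 0 < t → H (x + t) - H x ≤ M * (H x - H (x - t)))
    (h2 : ∀ x t, 0 < t → H x - H (x - t) ≤ M * (H (x + t) - H x)) {z : ℂ} (hz : 0 < z.im) :
    ‖fderiv ℝ (ba H) z‖ ^ 2 ≤ 8 * M * (M + 1) * |(fderiv ℝ (ba H) z).det| := by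
  obtain ⟨x, y, rfl⟩ : ∃ x y : ℝ, z = x + y * Complex.I := ⟨z.re, z.im, (Complex.re_add_im z).symm⟩
  have hy : 0 < y := by simpa using hz
  have hopen : IsOpen {z : ℂ | 0 < z.im} := isOpen_lt continuous_const Complex.continuous_im
  have hd : HasFDerivAt (ba H) (fderiv ℝ (ba H) (x + y * Complex.I)) (x + y * Complex.I) :=
    (((contDiffOn_ba hc).differentiableOn one_ne_zero).differentiableAt
      (hopen.mem_nhds hz)).hasFDerivAt
  set L := fderiv ℝ (ba H) (x + y * Complex.I) with hL
  set r := H (x + y) - H x with hr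
  set l := H x - H (x - y) with hl
  have hba : ∀ x y : ℝ, ba H (x + y * Complex.I) = ((av H x (x + y) + av H (x - y) x) / 2 : ℝ)
      + ((av H x (x + y) - av H (x - y) x) / 2 : ℝ) * Complex.I := by
    intro x y; simp [ba]
  have hLx : L 1 = ((r / y + l / y) / 2 : ℝ) + ((r / y - l / y) / 2 : ℝ) * Complex.I := by
    have e1 : HasDerivAt (fun x : ℝ => (x + y * Complex.I : ℂ)) 1 x := by
      have := (Complex.ofRealCLM.hasDerivAt (x := x)).add_const (y * Complex.I)
      rw [Complex.ofRealCLM_apply, Complex.ofReal_one] at this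
      exact this
    have e2 := hd.comp_hasDerivAt x e1
    have e3 := hasDerivAt_av_add_left hc (x := x) hy
    have e4 := hasDerivAt_av_sub_left hc (x := x) hy
    have e5 := (((e3.add e4).div_const 2).ofReal_comp).add
      ((((e3.sub e4).div_const 2).ofReal_comp).mul_const Complex.I)
    refine e2.unique (e5.congr_of_eventuallyEq (Eventually.of_forall fun x => ?_))
    simp [hba]
  set p := (H (x + y) - av H x (x + y)) with hp
  set q := av H (x - y) x - H (x - y) with hq
  have hLy : L Complex.I = ((p / y - q / y) / 2 : ℝ) + ((p / y + q / y) / 2 : ℝ) * Complex.I := by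
    have e1 : HasDerivAt (fun y : ℝ => (x + y * Complex.I : ℂ)) Complex.I y := by
      have := ((Complex.ofRealCLM.hasDerivAt (x := y)).mul_const Complex.I).const_add (x : ℂ)
      rw [Complex.ofRealCLM_apply, Complex.ofReal_one, one_mul] at this
      exact this
    have e2 := hd.comp_hasDerivAt y e1
    have e3 := hasDerivAt_av_add_right hc (x := x) hy
    have e4 := hasDerivAt_av_sub_right hc (x := x) hy
    have e5 := (((e3.add e4).div_const 2).ofReal_comp).add
      ((((e3.sub e4).div_const 2).ofReal_comp).mul_const Complex.I)
    have e6 := e2.unique (e5.congr_of_eventuallyEq (Eventually.of_forall fun x => by simp [hba]))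
    rw [e6, hp, hq]
    push_cast
    ring
  have hr0 : 0 < r := sub_pos.2 (hm (by linarith))
  have hl0 : 0 < l := sub_pos.2 (hm (by linarith))
  have hrl : r ≤ M * l := h1 x y hy
  have hlr : l ≤ M * r := h2 x y hy
  have hM : 0 < M := by
    by_contra! hcon
    nlinarith
  have hpr : p ≤ r := by
    have := le_av hc hm.monotone (s := x) (t := x + y) (by linarith)
    simp only [hp, hr]; linarith
  have hql : q ≤ l := by
    have := av_le hc hm.monotone (s := x - y) (t := x) (by linarith)
    simp only [hq, hl]; linarith
  have hpl : r ≤ 2 * (M + 1) * p := by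
    have e1 := av_split hc x (x + y)
    have e2 := av_le hc hm.monotone (s := x) (t := (x + (x + y)) / 2) (by linarith)
    have e3 := av_le hc hm.monotone (s := (x + (x + y)) / 2) (t := x + y) (by linarith)
    have e4 := h2 (x + y / 2) (y / 2) (by linarith)
    rw [show (x + (x + y)) / 2 = x + y / 2 by ring] at e1 e2 e3
    rw [show x + y / 2 + y / 2 = x + y by ring, show x + y / 2 - y / 2 = x by ring] at e4
    have e5 : H (x + y) - H (x + y / 2) ≤ 2 * p := by simp only [hp]; linarith
    have e6 : r ≤ (M + 1) * (H (x + y) - H (x + y / 2)) := by simp only [hr]; linarith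
    nlinarith
  have hqr : l ≤ 2 * (M + 1) * q := by
    have e1 := av_split hc (x - y) x
    have e2 := le_av hc hm.monotone (s := x - y) (t := (x - y + x) / 2) (by linarith)
    have e3 := le_av hc hm.monotone (s := (x - y + x) / 2) (t := x) (by linarith)
    have e4 := h1 (x - y / 2) (y / 2) (by linarith)
    rw [show (x - y + x) / 2 = x - y / 2 by ring] at e1 e2 e3
    rw [show x - y / 2 + y / 2 = x by ring, show x - y / 2 - y / 2 = x - y by ring] at e4
    have e5 : H (x - y / 2) - H (x - y) ≤ 2 * q := by simp only [hq]; linarith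
    have e6 : l ≤ (M + 1) * (H (x - y / 2) - H (x - y)) := by simp only [hl]; linarith
    nlinarith
  have hp0 : 0 < p := by
    by_contra! hcon
    nlinarith
  have hq0 : 0 < q := by
    by_contra! hcon
    nlinarith
  have hdet : L.det = (r * q + l * p) / (2 * y ^ 2) := by
    rw [det_eq_of_clm, hLx, hLy]
    simp
    field_simp
    ring
  have hn1 : ‖L 1‖ ^ 2 = (r ^ 2 + l ^ 2) / (2 * y ^ 2) := by
    rw [hLx, Complex.sq_norm, Complex.normSq_apply]
    simp
    field_simp
    ring
  have hn2 : ‖L Complex.I‖ ^ 2 = (p ^ 2 + q ^ 2) / (2 * y ^ 2) := by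
    rw [hLy, Complex.sq_norm, Complex.normSq_apply]
    simp
    field_simp
    ring
  have hnorm : ‖L‖ ^ 2 ≤ 2 * (‖L 1‖ ^ 2 + ‖L Complex.I‖ ^ 2) := by
    have := opNorm_le_of_clm L
    nlinarith [norm_nonneg L, norm_nonneg (L 1), norm_nonneg (L Complex.I),
      sq_nonneg (‖L 1‖ - ‖L Complex.I‖)]
  refine hnorm.trans ?_
  rw [hn1, hn2, hdet, abs_of_pos (by positivity)]
  rw [← add_div, mul_div_assoc', mul_div_assoc']
  exact div_le_div_of_nonneg_right
    (ba_algebra hr0 hl0 hp0 hq0 hM hrl hlr hpr hql hpl hqr) (by positivity)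

lemma fc_of_hasSum {ι : Type*} [Countable ι] {d : ι → ℂ} (hd : Summable fun i => ‖d i‖) (k : ι → ℤ)
    {u : ℝ → ℂ} (hu : ∀ θ, HasSum (fun i => d i * ee (k i) θ) (u θ)) (n : ℤ) :
    HasSum (fun i => if n = k i then d i else 0) (fc u n) := by
  have h := intervalIntegral.hasSum_integral_of_dominated_convergence (a := 0) (b := 2 * π)
    (μ := volume) (F := fun i θ => ee (-n) θ * (d i * ee (k i) θ)) (f := fun θ => ee (-n) θ * u θ)
    (fun i _ => ‖d i‖) (fun i => (((continuous_ee _).mul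
      (continuous_const.mul (continuous_ee _))).aestronglyMeasurable))
    (fun i => Eventually.of_forall fun θ _ => by simp [norm_ee])
    (Eventually.of_forall fun _ _ => hd) (by simp)
    (Eventually.of_forall fun θ _ => (hu θ).mul_left _)
  have h2 := h.mul_left ((1 / (2 * π) : ℝ) : ℂ)
  have e : (fun i => ((1 / (2 * π) : ℝ) : ℂ) * ∫ θ in (0 : ℝ)..(2 * π),
      ee (-n) θ * (d i * ee (k i) θ))
      = fun i => if n = k i then d i else 0 := by
    funext i
    have := fc_const_mul (d i) (ee (k i)) n
    rw [fc_ee] at this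
    unfold fc at this
    rw [this]
    split_ifs <;> simp
  rw [e] at h2
  exact h2

/-- Taylor coefficients at the origin. -/
noncomputable def tc (g : ℂ → ℂ) (n : ℕ) : ℂ := ((n.factorial : ℂ))⁻¹ * iteratedDeriv n g 0

lemma hasSum_tc {g : ℂ → ℂ} (hg : DifferentiableOn ℂ g (ball 0 1))
    {z : ℂ} (hz : z ∈ ball (0 : ℂ) 1) :
    HasSum (fun n => tc g n * z ^ n) (g z) := by
  have := Complex.hasSum_taylorSeries_on_ball hg hz
  have e : (fun n => tc g n * z ^ n)
      = fun n => ((n.factorial : ℂ))⁻¹ • (z - 0) ^ n • iteratedDeriv n g 0 := by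
    funext n
    simp only [tc, smul_eq_mul, sub_zero]; ring
  rw [e]
  exact this

lemma circle_mem_ball {r : ℝ} (h0 : 0 ≤ r) (h1 : r < 1) (θ : ℝ) :
    (r : ℂ) * ee 1 θ ∈ ball (0 : ℂ) 1 := by
  simp [norm_ee, abs_of_nonneg h0, h1]

lemma summable_tc {g : ℂ → ℂ} (hg : DifferentiableOn ℂ g (ball 0 1)) {r : ℝ} (h0 : 0 ≤ r)
    (h1 : r < 1) :
    Summable fun n : ℕ => ‖tc g n * (r : ℂ) ^ n‖ := by
  have : (r : ℂ) ∈ ball (0 : ℂ) 1 := by simp [abs_of_nonneg h0, h1]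
  exact (hasSum_tc hg this).summable.norm

lemma hasSum_circle {g : ℂ → ℂ} (hg : DifferentiableOn ℂ g (ball 0 1)) {r : ℝ} (h0 : 0 ≤ r)
    (h1 : r < 1)
    (θ : ℝ) : HasSum (fun n : ℕ => tc g n * (r : ℂ) ^ n * ee (n : ℤ) θ) (g (r * ee 1 θ)) := by
  have := hasSum_tc hg (circle_mem_ball h0 h1 θ)
  convert this using 2 with n
  rw [mul_pow, ee_pow]; simp [mul_assoc]

lemma fc_circle {g : ℂ → ℂ} (hg : DifferentiableOn ℂ g (ball 0 1)) {r : ℝ} (h0 : 0 ≤ r) (h1 : r < 1)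
    (n : ℕ) : fc (fun θ => g (r * ee 1 θ)) n = tc g n * (r : ℂ) ^ n := by
  have h := fc_of_hasSum (summable_tc hg h0 h1) (fun n : ℕ => (n : ℤ)) (hasSum_circle hg h0 h1) n
  refine h.unique ?_
  have e : (fun i : ℕ => if (n : ℤ) = (i : ℤ) then tc g i * (r : ℂ) ^ i else 0)
      = fun i => if i = n then tc g n * (r : ℂ) ^ n else 0 := by
    funext i; by_cases hi : i = n
    · simp [hi]
    · rw [if_neg hi, if_neg]; exact_mod_cast Ne.symm hi
  rw [e]
  exact hasSum_ite_eq n _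

lemma fc_circle_neg {g : ℂ → ℂ} (hg : DifferentiableOn ℂ g (ball 0 1)) {r : ℝ} (h0 : 0 ≤ r)
    (h1 : r < 1)
    {n : ℤ} (hn : n < 0) : fc (fun θ => g (r * ee 1 θ)) n = 0 := by
  have h := fc_of_hasSum (summable_tc hg h0 h1) (fun n : ℕ => (n : ℤ)) (hasSum_circle hg h0 h1) n
  have e : (fun i : ℕ => if n = (i : ℤ) then tc g i * (r : ℂ) ^ i else 0) = fun _ => 0 := by
    funext i; rw [if_neg]; omega
  rw [e] at h
  exact h.unique hasSum_zero

lemma tsum_int_of_nat {a : ℤ → ENNReal} (h : ∀ n < 0, a n = 0) : ∑' n, a n = ∑' n : ℕ, a n := by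
  refine (Function.Injective.tsum_eq (f := a)
      (g := fun n : ℕ => (n : ℤ)) Nat.cast_injective ?_).symm
  intro n hn
  by_contra hcon
  refine hn (h n ?_)
  by_contra! h0
  exact hcon ⟨n.toNat, by simp [h0]⟩

lemma lintegral_circle {g : ℂ → ℂ} (hg : DifferentiableOn ℂ g (ball 0 1)) {r : ℝ} (h0 : 0 ≤ r)
    (h1 : r < 1) :
    ∫⁻ θ, ENNReal.ofReal (‖g (r * ee 1 θ)‖ ^ 2) ∂per
      = ENNReal.ofReal (2 * π) * ∑' n : ℕ, ENNReal.ofReal (‖tc g n‖ ^ 2 * r ^ (2 * n)) := by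
  have hc : Continuous fun θ => g (r * ee 1 θ) :=
    hg.continuousOn.comp_continuous (continuous_const.mul (continuous_ee 1)) (circle_mem_ball h0 h1)
  rw [lintegral_norm_sq_eq (memLp_of_continuous hc 2), tsum_int_of_nat]
  · congr 2; funext n
    rw [fc_circle hg h0 h1, norm_mul, norm_pow, mul_pow, ← pow_mul, mul_comm n 2]
    simp [abs_of_nonneg h0]
  · intro n hn; simp [fc_circle_neg hg h0 h1 hn]

lemma lintegral_pow_radius (n : ℕ) :
    ∫⁻ r in Set.Ioo (0 : ℝ) 1, ENNReal.ofReal (r * r ^ (2 * n))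
        = ENNReal.ofReal (1 / (2 * (n + 1))) := by
  rw [← ofReal_integral_eq_lintegral_ofReal, ← integral_Ioc_eq_integral_Ioo,
    ← intervalIntegral.integral_of_le zero_le_one]
  · congr 1
    simp_rw [← pow_succ']
    rw [integral_pow]
    push_cast
    simp only [one_pow, ne_eq, Nat.add_eq_zero_iff, one_ne_zero, and_false, not_false_eq_true,
      zero_pow, sub_zero]
    congr 1
    ring
  · exact (Continuous.integrableOn_Icc (by fun_prop)).mono_set Set.Ioo_subset_Icc_self
  · filter_upwards [ae_restrict_mem measurableSet_Ioo] with r hr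
    have := hr.1
    positivity

/-- The area formula for the `L²` norm of a holomorphic function on the disk. -/
theorem lintegral_disk {g : ℂ → ℂ} (hg : DifferentiableOn ℂ g (ball 0 1)) :
    ∫⁻ z in ball (0 : ℂ) 1, ENNReal.ofReal (‖g z‖ ^ 2)
      = ENNReal.ofReal π * ∑' n : ℕ, ENNReal.ofReal (‖tc g n‖ ^ 2 / (n + 1)) := by
  set f : ℂ → ENNReal := (ball (0 : ℂ) 1).indicator fun z => ENNReal.ofReal (‖g z‖ ^ 2) with hf
  have hfm : Measurable f := by
    classical
    have hg2 : ContinuousOn (fun z => ENNReal.ofReal (‖g z‖ ^ 2)) (ball (0 : ℂ) 1) :=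
      ENNReal.continuous_ofReal.comp_continuousOn (hg.continuousOn.norm.pow 2)
    rw [hf, ← Set.piecewise_eq_indicator]
    exact hg2.measurable_piecewise continuousOn_const measurableSet_ball
  rw [← lintegral_indicator measurableSet_ball, ← hf, ← Complex.lintegral_comp_polarCoord_symm,
    polarCoord_target, Measure.volume_eq_prod, ← Measure.prod_restrict, lintegral_prod]
  · have key : ∀ r ∈ Set.Ioi (0 : ℝ), ∫⁻ θ in Set.Ioo (-π) π,
        ENNReal.ofReal r • f (Complex.polarCoord.symm (r, θ))
        = (Set.Ioo (0 : ℝ) 1).indicator (fun r => ENNReal.ofReal (2 * π) *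
          ∑' n : ℕ, ENNReal.ofReal (‖tc g n‖ ^ 2) * ENNReal.ofReal (r * r ^ (2 * n))) r := by
      intro r hr
      have hr0 : 0 < r := hr
      have e : ∀ θ : ℝ, Complex.polarCoord.symm (r, θ) = (r : ℂ) * ee 1 θ := by
        intro θ
        simp [Complex.polarCoord_symm_apply, ee, Complex.exp_mul_I]
      simp_rw [e]
      by_cases h1 : r < 1
      · rw [Set.indicator_of_mem (Set.mem_Ioo.2 ⟨hr0, h1⟩)]
        have e2 : ∀ θ : ℝ, f ((r : ℂ) * ee 1 θ) = ENNReal.ofReal (‖g (r * ee 1 θ)‖ ^ 2) := fun θ =>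
          Set.indicator_of_mem (circle_mem_ball hr0.le h1 θ) _
        simp_rw [e2, smul_eq_mul]
        have hc : Continuous fun θ => g (r * ee 1 θ) :=
          hg.continuousOn.comp_continuous (continuous_const.mul (continuous_ee 1))
            (circle_mem_ball hr0.le h1)
        rw [lintegral_const_mul _ (show Measurable fun θ =>
            ENNReal.ofReal (‖g (r * ee 1 θ)‖ ^ 2) from
          (hc.norm.pow 2).measurable.ennreal_ofReal)]
        have e3 : ∫⁻ θ in Set.Ioo (-π) π, ENNReal.ofReal (‖g (r * ee 1 θ)‖ ^ 2)
            = ∫⁻ θ, ENNReal.ofReal (‖g (r * ee 1 θ)‖ ^ 2) ∂per := by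
          have hper : ∀ θ, (fun θ => ENNReal.ofReal (‖g (r * ee 1 θ)‖ ^ 2)) (θ + 2 * π)
              = (fun θ => ENNReal.ofReal (‖g (r * ee 1 θ)‖ ^ 2)) θ := by
            intro θ; simp only [ee_period]
          rw [← lintegral_per_shift hper (-π), per]
          rw [Measure.restrict_congr_set Ioo_ae_eq_Ioc]
          have := (measurePreserving_add_right (volume : Measure ℝ)
              (-π)).setLIntegral_comp_preimage_emb
            (measurableEmbedding_addRight (-π)) (fun θ => ENNReal.ofReal (‖g (r * ee 1 θ)‖ ^ 2))
            (Set.Ioc (-π) π)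
          rw [← this]
          congr 2
          ext x; simp; intro _; constructor <;> intro h <;> linarith
        rw [e3, lintegral_circle hg hr0.le h1, mul_left_comm, ← ENNReal.tsum_mul_left]
        congr 2; funext n
        rw [ENNReal.ofReal_mul (by positivity), ENNReal.ofReal_mul hr0.le]
        ring
      · rw [Set.indicator_of_notMem (by simp; intro _; linarith)]
        have e2 : ∀ θ : ℝ, f ((r : ℂ) * ee 1 θ) = 0 := fun θ =>
          Set.indicator_of_notMem (by simp [norm_ee, abs_of_pos hr0]; linarith) _
        simp [e2]
    rw [setLIntegral_congr_fun measurableSet_Ioi key, lintegral_indicator measurableSet_Ioo,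
      Measure.restrict_restrict measurableSet_Ioo,
      Set.inter_eq_left.2 (Set.Ioo_subset_Ioi_self : Set.Ioo (0 : ℝ) 1 ⊆ Set.Ioi 0),
      lintegral_const_mul _ (by fun_prop), lintegral_tsum (fun n => by fun_prop)]
    have e4 : ∀ n : ℕ, ∫⁻ r in Set.Ioo (0 : ℝ) 1, ENNReal.ofReal (‖tc g n‖ ^ 2) *
        ENNReal.ofReal (r * r ^ (2 * n))
        = ENNReal.ofReal (1 / 2) * ENNReal.ofReal (‖tc g n‖ ^ 2 / (n + 1)) := by
      intro n
      rw [lintegral_const_mul _ (by fun_prop), lintegral_pow_radius,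
        ← ENNReal.ofReal_mul (by positivity), ← ENNReal.ofReal_mul (by positivity)]
      congr 1
      field_simp
    simp_rw [e4]
    rw [ENNReal.tsum_mul_left, ← mul_assoc, ← ENNReal.ofReal_mul (by positivity)]
    congr 2; ring
  · have hpc : Measurable fun p : ℝ × ℝ => Complex.polarCoord.symm p := by
      simp_rw [Complex.polarCoord_symm_apply]
      fun_prop
    exact ((ENNReal.measurable_ofReal.comp measurable_fst).mul (hfm.comp hpc)).aemeasurable

/-- Fourier coefficients of the boundary values of a function of the disk algebra. -/
lemma tendsto_fc_circle {g : ℂ → ℂ} (hc : ContinuousOn g (closedBall 0 1)) (n : ℤ) :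
    Tendsto (fun r : ℝ => fc (fun θ => g (r * ee 1 θ)) n) (𝓝[<] 1)
        (𝓝 (fc (fun θ => g (ee 1 θ)) n)) := by
  obtain ⟨B, hB⟩ := (isCompact_closedBall (0 : ℂ) 1).exists_bound_of_continuousOn hc
  unfold fc
  refine Tendsto.const_mul _ ?_
  have hev : ∀ᶠ r : ℝ in 𝓝[<] 1, 0 < r ∧ r < 1 :=
    Filter.Eventually.and (mem_nhdsWithin_of_mem_nhds (lt_mem_nhds zero_lt_one)) self_mem_nhdsWithin
  have hmem : ∀ {r : ℝ}, 0 < r → r < 1 → ∀ θ, (r : ℂ) * ee 1 θ ∈ closedBall (0 : ℂ) 1 :=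
    fun h0 h1 θ => ball_subset_closedBall (circle_mem_ball h0.le h1 θ)
  refine intervalIntegral.tendsto_integral_filter_of_dominated_convergence (fun _ =>
      B) ?_ ?_ (by simp) ?_
  · filter_upwards [hev] with r hr
    exact ((continuous_ee _).mul (hc.comp_continuous (continuous_const.mul (continuous_ee 1))
      (hmem hr.1 hr.2))).aestronglyMeasurable
  · filter_upwards [hev] with r hr
    refine Eventually.of_forall fun θ _ => ?_
    rw [norm_mul, norm_ee, one_mul]
    exact hB _ (hmem hr.1 hr.2 θ)
  · refine Eventually.of_forall fun θ _ => Tendsto.const_mul _ ?_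
    have h1 : ContinuousWithinAt g (closedBall 0 1) (ee 1 θ) := hc _ (by simp [norm_ee])
    refine h1.tendsto.comp (tendsto_nhdsWithin_iff.2 ⟨?_, ?_⟩)
    · have : Tendsto (fun r : ℝ => (r : ℂ) * ee 1 θ) (𝓝 1) (𝓝 (((1 : ℝ) : ℂ) * ee 1 θ)) :=
        Continuous.tendsto (by fun_prop) 1
      rw [Complex.ofReal_one, one_mul] at this
      exact this.mono_left nhdsWithin_le_nhds
    · filter_upwards [hev] with r hr using hmem hr.1 hr.2 θ

lemma fc_boundary {g : ℂ → ℂ} (hg : DifferentiableOn ℂ g (ball 0 1))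
    (hc : ContinuousOn g (closedBall 0 1))
    (n : ℕ) : fc (fun θ => g (ee 1 θ)) n = tc g n := by
  refine tendsto_nhds_unique (tendsto_fc_circle hc n) ?_
  have : Tendsto (fun r : ℝ => tc g n * (r : ℂ) ^ n) (𝓝[<] 1) (𝓝 (tc g n * ((1 : ℝ) : ℂ) ^ n)) :=
    (Continuous.tendsto (by fun_prop) 1).mono_left nhdsWithin_le_nhds
  rw [Complex.ofReal_one, one_pow, mul_one] at this
  refine this.congr' ?_
  filter_upwards [mem_nhdsWithin_of_mem_nhds (lt_mem_nhds zero_lt_one),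
      self_mem_nhdsWithin] with r h0 h1
  exact (fc_circle hg (le_of_lt h0) h1 n).symm

lemma fc_boundary_neg {g : ℂ → ℂ} (hg : DifferentiableOn ℂ g (ball 0 1))
    (hc : ContinuousOn g (closedBall 0 1)) {n : ℤ} (hn : n < 0) :
        fc (fun θ => g (ee 1 θ)) n = 0 := by
  refine tendsto_nhds_unique (tendsto_fc_circle hc n) ?_
  refine tendsto_const_nhds.congr' ?_
  filter_upwards [mem_nhdsWithin_of_mem_nhds (lt_mem_nhds zero_lt_one),
      self_mem_nhdsWithin] with r h0 h1
  exact (fc_circle_neg hg (le_of_lt h0) h1 hn).symm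

lemma sum_Icc_neg {A : Type*} [AddCommMonoid A] (g : ℤ → A) (N : ℕ) :
    ∑ n ∈ Finset.Icc (-(N : ℤ)) N, g n
      = g 0 + ∑ k ∈ Finset.range N, (g (k + 1) + g (-(k + 1))) := by
  induction N with
  | zero => simp
  | succ N ih =>
    rw [Finset.sum_range_succ, ← add_assoc, ← ih]
    have e : Finset.Icc (-((N + 1 : ℕ) : ℤ)) (N + 1 : ℕ)
        = insert ((N : ℤ) + 1) (insert (-((N : ℤ) + 1)) (Finset.Icc (-(N : ℤ)) N)) := by
      ext n; simp only [Finset.mem_insert, Finset.mem_Icc]; push_cast; omega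
    rw [e, Finset.sum_insert (by simp; omega), Finset.sum_insert (by simp)]
    abel

lemma lintegral_disk_deriv_poly (N : ℕ) (a : ℕ → ℂ) :
    ∫⁻ z in ball (0 : ℂ) 1, ENNReal.ofReal (‖∑ k ∈ Finset.range N, (k + 1) * a k * z ^ k‖ ^ 2)
      = ENNReal.ofReal π * ∑ k ∈ Finset.range N, ENNReal.ofReal ((k + 1) * ‖a k‖ ^ 2) := by
  have hd : Differentiable ℂ fun z : ℂ => ∑ k ∈ Finset.range N, (k + 1) * a k * z ^ k := by fun_prop
  rw [lintegral_disk hd.differentiableOn]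
  have htc : ∀ n : ℕ, tc (fun z : ℂ => ∑ k ∈ Finset.range N, (k + 1) * a k * z ^ k) n
      = if n ∈ Finset.range N then (n + 1) * a n else 0 := by
    intro n
    rw [← fc_boundary hd.differentiableOn hd.continuous.continuousOn]
    have e : (fun θ => ∑ k ∈ Finset.range N, ((k : ℂ) + 1) * a k * ee 1 θ ^ k)
        = fun θ => ∑ k ∈ Finset.range N, (fun θ => (((k : ℂ) + 1) * a k) * ee k θ) θ := by
      funext θ; simp [ee_pow]
    rw [e]
    refine (fc_sum (Finset.range N) (fun k θ => (((k : ℂ) + 1) * a k) * ee k θ)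
      (fun k _ => integrable_of_continuous (continuous_const.mul (continuous_ee _))) n).trans ?_
    simp_rw [fc_const_mul, fc_ee]
    simp
  rw [tsum_eq_sum (s := Finset.range N)]
  · congr 1
    refine Finset.sum_congr rfl fun k hk => ?_
    rw [htc, if_pos hk, norm_mul]
    congr 1
    have : ‖((k : ℂ) + 1)‖ = (k : ℝ) + 1 := by
      rw [show ((k : ℂ) + 1)
          = ((k + 1 : ℕ) : ℂ) by push_cast; rfl, Complex.norm_natCast]; push_cast; rfl
    rw [this]
    field_simp
  · intro n hn
    rw [htc, if_neg hn]; simp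

/-- The holomorphic polynomial `∑ a_k z^{k+1}`. -/
noncomputable def hp (N : ℕ) (a : ℕ → ℂ) (z : ℂ) : ℂ := ∑ k ∈ Finset.range N, a k * z ^ (k + 1)

lemma hasDerivAt_hp (N : ℕ) (a : ℕ → ℂ) (z : ℂ) :
    HasDerivAt (hp N a) (∑ k ∈ Finset.range N, (k + 1) * a k * z ^ k) z := by
  unfold hp
  refine HasDerivAt.fun_sum fun k _ => ?_
  have := (hasDerivAt_pow (k + 1) z).const_mul (a k)
  have e : ((k : ℂ) + 1) * a k * z ^ k = a k * (((k + 1 : ℕ) : ℂ) * z ^ (k + 1 - 1)) := by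
    rw [Nat.add_sub_cancel]; push_cast; ring
  rw [e]
  exact this

/-- The harmonic polynomial with coefficients `a` (holomorphic), `b` (antiholomorphic). -/
noncomputable def harm (N : ℕ) (c : ℂ) (a b : ℕ → ℂ) (z : ℂ) : ℂ :=
  c + (hp N a z + hp N b ((starRingEnd ℂ) z))

lemma contDiff_harm (N : ℕ) (c : ℂ) (a b : ℕ → ℂ) : ContDiff ℝ 1 (harm N c a b) := by
  have h : ∀ a, ContDiff ℝ 1 (hp N a) := fun a => by unfold hp; fun_prop
  have hs : ContDiff ℝ 1 (fun z : ℂ => (starRingEnd ℂ) z) := Complex.conjCLE.contDiff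
  exact contDiff_const.add ((h a).add ((h b).comp hs))

lemma norm_fderiv_real_eq {T : ℂ → ℂ} {z T' : ℂ} (h : HasDerivAt T T' z) :
    ‖fderiv ℝ T z‖ = ‖T'‖ := by
  have h1 : HasFDerivAt T ((ContinuousLinearMap.toSpanSingleton ℂ T').restrictScalars ℝ) z :=
    h.hasFDerivAt.restrictScalars ℝ
  rw [h1.fderiv, ContinuousLinearMap.norm_restrictScalars]
  simp

lemma norm_fderiv_harm_sq_le (N : ℕ) (c : ℂ) (a b : ℕ → ℂ) (z : ℂ) :
    ‖fderiv ℝ (harm N c a b) z‖ ^ 2 ≤ 2 * ‖∑ k ∈ Finset.range N, (k + 1) * a k * z ^ k‖ ^ 2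
      + 2 * ‖∑ k ∈ Finset.range N, (k + 1) * b k * ((starRingEnd ℂ) z) ^ k‖ ^ 2 := by
  have h1 : DifferentiableAt ℝ (hp N a) z :=
    ((hasDerivAt_hp N a z).differentiableAt).restrictScalars ℝ
  have h2 : DifferentiableAt ℝ (hp N b) ((starRingEnd ℂ) z) :=
    ((hasDerivAt_hp N b _).differentiableAt).restrictScalars ℝ
  have hs : HasFDerivAt (fun z : ℂ => (starRingEnd ℂ) z) (Complex.conjCLE : ℂ →L[ℝ] ℂ) z :=
    Complex.conjCLE.hasFDerivAt
  have h3 := (h1.hasFDerivAt.add (h2.hasFDerivAt.comp z hs)).const_add c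
  have h4 : fderiv ℝ (harm N c a b) z = _ := h3.fderiv
  rw [h4]
  have e1 := norm_fderiv_real_eq (hasDerivAt_hp N a z)
  have e2 := norm_fderiv_real_eq (hasDerivAt_hp N b ((starRingEnd ℂ) z))
  rw [← e1, ← e2]
  have e3 : ‖(fderiv ℝ (hp N b) ((starRingEnd ℂ) z)).comp (Complex.conjCLE : ℂ →L[ℝ] ℂ)‖
      ≤ ‖fderiv ℝ (hp N b) ((starRingEnd ℂ) z)‖ := by
    refine (ContinuousLinearMap.opNorm_comp_le _ _).trans ?_
    rw [Complex.conjCLE_norm, mul_one]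
  have e4 := norm_add_le (fderiv ℝ (hp N a) z)
    ((fderiv ℝ (hp N b) ((starRingEnd ℂ) z)).comp (Complex.conjCLE : ℂ →L[ℝ] ℂ))
  have e5 := e4.trans (add_le_add_right e3 _)
  refine (pow_le_pow_left₀ (norm_nonneg _) e5 2).trans ?_
  nlinarith [sq_nonneg (‖fderiv ℝ (hp N a) z‖ - ‖fderiv ℝ (hp N b) ((starRingEnd ℂ) z)‖)]

lemma lintegral_disk_conj {f : ℂ → ENNReal} :
    ∫⁻ z in ball (0 : ℂ) 1, f ((starRingEnd ℂ) z) = ∫⁻ z in ball (0 : ℂ) 1, f z := by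
  have hmp : MeasurePreserving (Complex.conjLIE) (volume : Measure ℂ) volume :=
    Complex.conjLIE.measurePreserving
  have := hmp.setLIntegral_comp_preimage_emb Complex.conjLIE.toMeasurableEquiv.measurableEmbedding
    f (ball 0 1)
  rw [← this]
  have e : Complex.conjLIE ⁻¹' ball (0 : ℂ) 1 = ball (0 : ℂ) 1 := by ext z; simp
  rw [e]
  rfl

lemma lintegral_fderiv_harm_le (N : ℕ) (c : ℂ) (a b : ℕ → ℂ) :
    ∫⁻ z in ball (0 : ℂ) 1, ENNReal.ofReal (‖fderiv ℝ (harm N c a b) z‖ ^ 2)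
      ≤ ENNReal.ofReal (2 * π) * ∑ k ∈ Finset.range N,
        (ENNReal.ofReal ((k + 1) * ‖a k‖ ^ 2) + ENNReal.ofReal ((k + 1) * ‖b k‖ ^ 2)) := by
  calc _ ≤ ∫⁻ z in ball (0 : ℂ) 1,
        (ENNReal.ofReal 2 * ENNReal.ofReal (‖∑ k ∈ Finset.range N, (k + 1) * a k * z ^ k‖ ^ 2)
        + ENNReal.ofReal 2 * ENNReal.ofReal
          (‖∑ k ∈ Finset.range N, (k + 1) * b k * ((starRingEnd ℂ) z) ^ k‖ ^ 2)) := by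
        refine lintegral_mono fun z => ?_
        rw [← ENNReal.ofReal_mul (by norm_num), ← ENNReal.ofReal_mul (by norm_num),
          ← ENNReal.ofReal_add (by positivity) (by positivity)]
        exact ENNReal.ofReal_le_ofReal (norm_fderiv_harm_sq_le N c a b z)
    _ = _ := by
        rw [lintegral_add_left (by fun_prop), lintegral_const_mul _ (by fun_prop),
          lintegral_const_mul' _ _ (by simp), lintegral_disk_deriv_poly,
          lintegral_disk_conj (f := fun z => ENNReal.ofReal
          (‖∑ k ∈ Finset.range N, (k + 1) * b k * z ^ k‖ ^ 2)), lintegral_disk_deriv_poly,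
          Finset.sum_add_distrib, ENNReal.ofReal_mul (by norm_num)]
        ring

lemma lift_add_int {H : ℝ → ℝ} (hp : ∀ θ, H (θ + 2 * π) = H θ + 2 * π)
    (θ : ℝ) (m : ℤ) : H (θ + m * (2 * π)) = H θ + m * (2 * π) := by
  induction m using Int.induction_on with
  | zero => simp
  | succ m ih =>
    push_cast at ih ⊢
    rw [show θ + ((m : ℝ) + 1) * (2 * π) = θ + m * (2 * π) + 2 * π by ring, hp, ih]; ring
  | pred m ih =>
    push_cast at ih ⊢
    have := hp (θ + (-(m : ℝ) - 1) * (2 * π))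
    rw [show θ + (-(m : ℝ) - 1) * (2 * π) + 2 * π = θ + -(m : ℝ) * (2 * π) by ring, ih] at this
    linarith

lemma ba_add_int {H : ℝ → ℝ} (hc : Continuous H) (hp : ∀ θ, H (θ + 2 * π) = H θ + 2 * π)
    (z : ℂ) (m : ℤ) : ba H (z + m * (2 * π)) = ba H z + m * (2 * π) := by
  induction m using Int.induction_on with
  | zero => simp
  | succ m ih =>
    push_cast at ih ⊢
    rw [show z + ((m : ℂ) + 1) * (2 * π) = z + m * (2 * π) + 2 * π by ring, ba_add_period hc hp, ih]
    ring
  | pred m ih =>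
    push_cast at ih ⊢
    have := ba_add_period hc hp (z + (-(m : ℂ) - 1) * (2 * π))
    rw [show z + (-(m : ℂ) - 1) * (2 * π) + 2 * π = z + -(m : ℂ) * (2 * π) by ring, ih] at this
    linear_combination -this

lemma ba_exp_injOn {H : ℝ → ℝ} (hc : Continuous H) (hm : StrictMono H)
    (hp : ∀ θ, H (θ + 2 * π) = H θ + 2 * π) :
    Set.InjOn (fun z => Complex.exp (Complex.I * ba H z)) strip := by
  intro z hz w hw h
  obtain ⟨n, hn⟩ := Complex.exp_eq_exp_iff_exists_int.1 h
  have h1 : ba H z = ba H (w + n * (2 * π)) := by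
    rw [ba_add_int hc hp]
    have : Complex.I * (ba H z - (ba H w + n * (2 * π))) = 0 := by linear_combination hn
    rcases mul_eq_zero.1 this with h | h
    · exact absurd h Complex.I_ne_zero
    · exact sub_eq_zero.1 h
  have h2 : z = w + n * (2 * π) := by
    refine ba_injOn hc hm hz.2 ?_ h1
    have e : (w + n * (2 * π) : ℂ).im = w.im := by simp
    show 0 < (w + n * (2 * π) : ℂ).im
    rw [e]; exact hw.2
  have h3 : z.re = w.re + n * (2 * π) := by rw [h2]; simp
  have hz1 := hz.1.1
  have hz2 := hz.1.2
  have hw1 := hw.1.1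
  have hw2 := hw.1.2
  have hn0 : n = 0 := by
    have a1 : (n : ℝ) < 1 := by nlinarith [Real.pi_pos]
    have a2 : (-1 : ℝ) < n := by nlinarith [Real.pi_pos]
    have a1' : n < 1 := by exact_mod_cast a1
    have a2' : -1 < n := by exact_mod_cast a2
    omega
  rw [h2, hn0]; simp

/-- Composition with a quasisymmetric homeomorphism is bounded for the Douglas energy
(on trigonometric polynomials). -/
theorem energy_comp_harm_le {H : ℝ → ℝ} (hc : Continuous H) (hm : StrictMono H)
    (hp : ∀ θ, H (θ + 2 * π) = H θ + 2 * π) {M : ℝ}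
    (h1 : ∀ x t, 0 < t → H (x + t) - H x ≤ M * (H x - H (x - t)))
    (h2 : ∀ x t, 0 < t → H x - H (x - t) ≤ M * (H (x + t) - H x))
    (N : ℕ) (c : ℂ) (a b : ℕ → ℂ) :
    douglasEnergyP (fun θ => harm N c a b (ee 1 (H θ)))
      ≤ ENNReal.ofReal (4 * π * (8 * M * (M + 1))) * (ENNReal.ofReal (2 * π) *
        ∑ k ∈ Finset.range N,
        (ENNReal.ofReal ((k + 1) * ‖a k‖ ^ 2) + ENNReal.ofReal ((k + 1) * ‖b k‖ ^ 2))) := by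
  have hopen : IsOpen {z : ℂ | 0 < z.im} := isOpen_lt continuous_const Complex.continuous_im
  set T : ℂ → ℂ := fun z => Complex.exp (Complex.I * ba H z) with hT
  have hTc : Continuous T := by have := continuous_ba hc; fun_prop
  have hexp : ContDiff ℝ 1 (fun z : ℂ => Complex.exp (Complex.I * z)) := by fun_prop
  have key := energy_le_of_comp (W := fun z => harm N c a b (T z)) (T := T) (φ := harm N c a b)
    (K := 8 * M * (M + 1))
    (hexp.comp_contDiffOn (contDiffOn_ba hc)) (ba_exp_injOn hc hm hp) ?_ (contDiff_harm N c a b)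
    (fun _ _ => rfl) ((contDiff_harm N c a b).continuous.comp hTc).continuousOn ?_
  · have e : (fun x : ℝ => harm N c a b (T x)) = fun θ => harm N c a b (ee 1 (H θ)) := by
      funext x
      simp only [hT, ba_ofReal, ee]
      congr 2; push_cast; ring
    rw [e] at key
    refine key.trans (mul_le_mul_right ?_ _)
    refine (lintegral_mono_set ?_).trans (lintegral_fderiv_harm_le N c a b)
    rintro _ ⟨z, hz, rfl⟩
    rw [mem_ball_zero_iff, hT, norm_exp_I_mul]
    rw [← Real.exp_zero]
    exact Real.exp_lt_exp.2 (by have := ba_im_pos hc hm hz.2; linarith)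
  · intro z hz
    have hd1 : DifferentiableAt ℝ (ba H) z :=
      ((contDiffOn_ba hc).differentiableOn one_ne_zero).differentiableAt (hopen.mem_nhds hz.2)
    have hd2 : DifferentiableAt ℂ (fun z : ℂ => Complex.exp (Complex.I * z)) (ba H z) := by fun_prop
    have hcomp : fderiv ℝ T z = (fderiv ℝ (fun z : ℂ => Complex.exp (Complex.I * z)) (ba H z)).comp
        (fderiv ℝ (ba H) z) := fderiv_comp z (hd2.restrictScalars ℝ) hd1
    rw [hcomp]
    have hdet : ((fderiv ℝ (fun z : ℂ => Complex.exp (Complex.I * z)) (ba H z)).comp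
        (fderiv ℝ (ba H) z)).det
            = (fderiv ℝ (fun z : ℂ => Complex.exp (Complex.I * z)) (ba H z)).det
        * (fderiv ℝ (ba H) z).det := LinearMap.det_comp _ _
    rw [hdet, abs_mul, ← norm_fderiv_sq_eq_det hd2]
    have q := ba_quasiconformal hc hm h1 h2 hz.2
    calc _ ≤ (‖fderiv ℝ (fun z : ℂ => Complex.exp (Complex.I * z)) (ba H z)‖
          * ‖fderiv ℝ (ba H) z‖) ^ 2 :=
          pow_le_pow_left₀ (norm_nonneg _) (ContinuousLinearMap.opNorm_comp_le _ _) 2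
      _ = ‖fderiv ℝ (fun z : ℂ => Complex.exp (Complex.I * z)) (ba H z)‖ ^ 2
          * ‖fderiv ℝ (ba H) z‖ ^ 2 := by ring
      _ ≤ ‖fderiv ℝ (fun z : ℂ => Complex.exp (Complex.I * z)) (ba H z)‖ ^ 2
          * (8 * M * (M + 1) * |(fderiv ℝ (ba H) z).det|) :=
          mul_le_mul_of_nonneg_left q (by positivity)
      _ = _ := by ring
  · intro z _
    simp only [hT, ba_add_period hc hp, exp_I_mul_add_period]

/-- The bound for composition in terms of Fourier coefficients. -/
theorem energy_comp_trig_le {H : ℝ → ℝ} (hc : Continuous H) (hm : StrictMono H)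
    (hp : ∀ θ, H (θ + 2 * π) = H θ + 2 * π) {M : ℝ}
    (h1 : ∀ x t, 0 < t → H (x + t) - H x ≤ M * (H x - H (x - t)))
    (h2 : ∀ x t, 0 < t → H x - H (x - t) ≤ M * (H (x + t) - H x)) (N : ℕ) (x : ℤ → ℂ) :
    douglasEnergyP (fun θ => ∑ n ∈ Finset.Icc (-(N : ℤ)) N, x n * ee n (H θ))
      ≤ ENNReal.ofReal (4 * π * (8 * M * (M + 1)) * (2 * π)) *
        ∑ n ∈ Finset.Icc (-(N : ℤ)) N, ENNReal.ofReal (|(n : ℝ)| * ‖x n‖ ^ 2) := by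
  have key :=
      energy_comp_harm_le hc hm hp h1 h2 N (x 0) (fun k => x (k + 1)) (fun k => x (-(k + 1)))
  have e : (fun θ => ∑ n ∈ Finset.Icc (-(N : ℤ)) N, x n * ee n (H θ)) = fun θ =>
      harm N (x 0) (fun k => x (k + 1)) (fun k => x (-(k + 1))) (ee 1 (H θ)) := by
    funext θ
    rw [sum_Icc_neg, ee_zero, mul_one, harm, WP.hp, WP.hp, ← Finset.sum_add_distrib, conj_ee]
    congr 1
    refine Finset.sum_congr rfl fun k _ => ?_
    rw [ee_pow, ee_pow]
    push_cast
    simp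
  rw [e]
  refine key.trans (le_of_eq ?_)
  have hpos : 0 ≤ M * (M + 1) := by
    have a1 := h1 0 1 one_pos
    have a2 : H 0 < H (0 + 1) := hm (by norm_num)
    have a3 : H (0 - 1) < H 0 := hm (by norm_num)
    have : 0 ≤ M := by by_contra! hcon; nlinarith
    positivity
  rw [sum_Icc_neg, ← mul_assoc, ← ENNReal.ofReal_mul (by nlinarith [Real.pi_pos])]
  congr 1
  simp only [Int.cast_zero, abs_zero, zero_mul, ENNReal.ofReal_zero, zero_add]
  refine Finset.sum_congr rfl fun k _ => ?_
  have : |((((k : ℤ) + 1 : ℤ)) : ℝ)| = (k : ℝ) + 1 := by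
    push_cast; exact abs_of_nonneg (by positivity)
  rw [Int.cast_neg, abs_neg, this]

theorem deriv_ne_zero_of_injOn {f : ℂ → ℂ} {U : Set ℂ} {z₀ : ℂ} (hf : AnalyticAt ℂ f z₀)
    (hU : U ∈ 𝓝 z₀) (hi : Set.InjOn f U) : deriv f z₀ ≠ 0 := by
  intro hd
  have hg : AnalyticAt ℂ (fun z => f z - f z₀) z₀ := hf.sub analyticAt_const
  have hne : ¬ ∀ᶠ z in 𝓝 z₀, f z - f z₀ = 0 := by
    intro h
    have h2 : ∀ᶠ z in 𝓝[≠] z₀, f z - f z₀ = 0 ∧ z ∈ U :=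
      (h.and hU).filter_mono nhdsWithin_le_nhds
    obtain ⟨z, ⟨hz, hzU⟩, hzn⟩ := (h2.and self_mem_nhdsWithin).exists
    exact hzn (hi hzU (mem_of_mem_nhds hU) (sub_eq_zero.1 hz))
  obtain ⟨n, k, hk, hk0, hgk⟩ := hg.exists_eventuallyEq_pow_smul_nonzero_iff.2 hne
  have hn0 : n ≠ 0 := by
    rintro rfl
    have := hgk.self_of_nhds
    simp at this
    exact hk0 this.symm
  have hn1 : n ≠ 1 := by
    rintro rfl
    have e1 : HasDerivAt (fun z => (z - z₀) ^ 1 • k z) (k z₀) z₀ := by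
      have := ((hasDerivAt_id z₀).sub_const z₀).mul hk.differentiableAt.hasDerivAt
      rw [show (fun z => (z - z₀) ^ 1 • k z) = (fun x => id x - z₀) * k by funext z; simp]
      simpa using this
    have e2 := (e1.congr_of_eventuallyEq hgk).deriv
    rw [deriv_sub_const, hd] at e2
    exact hk0 e2.symm
  obtain ⟨c, hc⟩ := IsAlgClosed.exists_pow_nat_eq (k z₀) (Nat.pos_of_ne_zero hn0)
  have hc0 : c ≠ 0 := by
    rintro rfl
    rw [zero_pow hn0] at hc
    exact hk0 hc.symm
  have hka : AnalyticAt ℂ (fun z => k z / k z₀) z₀ := hk.div analyticAt_const hk0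
  have hlog : AnalyticAt ℂ (fun z => Complex.log (k z / k z₀)) z₀ :=
    hka.clog (by simp [div_self hk0])
  have hκ : AnalyticAt ℂ (fun z => c * Complex.exp (Complex.log (k z / k z₀) / n)) z₀ :=
    analyticAt_const.mul (hlog.div analyticAt_const (by exact_mod_cast hn0)).cexp
  have hψ : AnalyticAt ℂ (fun z =>
      (z - z₀) * (c * Complex.exp (Complex.log (k z / k z₀) / n))) z₀ :=
    (analyticAt_id.sub analyticAt_const).mul hκ
  set ψ := fun z => (z - z₀) * (c * Complex.exp (Complex.log (k z / k z₀) / n)) with hψd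
  have hψ' : deriv ψ z₀ ≠ 0 := by
    have := ((hasDerivAt_id z₀).sub_const z₀).mul hκ.differentiableAt.hasDerivAt
    have e : HasDerivAt ψ c z₀ := by
      have e : (fun x => id x - z₀) * (fun z => c * Complex.exp (Complex.log (k z / k z₀) / n))
          = ψ := rfl
      rw [e] at this
      simpa [hk0] using this
    rw [e.deriv]; exact hc0
  have hmap : map ψ (𝓝 z₀) = 𝓝 (ψ z₀) := hψ.hasStrictDerivAt.map_nhds_eq hψ'
  have hψ0 : ψ z₀ = 0 := by simp [hψd]
  have hkne : ∀ᶠ z in 𝓝 z₀, k z ≠ 0 := hk.continuousAt.eventually_ne hk0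
  have hV : {z | z ∈ U ∧ f z - f z₀ = ψ z ^ n} ∈ 𝓝 z₀ := by
    filter_upwards [hU, hgk, hkne] with z h1 h2 h3
    refine ⟨h1, ?_⟩
    rw [h2, hψd]
    simp only [smul_eq_mul, mul_pow, ← Complex.exp_nat_mul]
    rw [mul_div_cancel₀ _ (by exact_mod_cast hn0), Complex.exp_log (div_ne_zero h3 hk0), hc,
      mul_div_cancel₀ _ hk0]
  have hI := image_mem_map (m := ψ) hV
  rw [hmap, hψ0] at hI
  obtain ⟨r, hr, hb⟩ := Metric.mem_nhds_iff.1 hI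
  have hω := Complex.isPrimitiveRoot_exp n hn0
  set ω := Complex.exp (2 * π * Complex.I / n)
  have hωn : ‖ω‖ = 1 := hω.norm'_eq_one hn0
  obtain ⟨z1, ⟨h1U, h1⟩, h1e⟩ := hb (show ((r / 2 : ℝ) : ℂ) ∈ ball 0 r by
    rw [mem_ball_zero_iff, Complex.norm_real, Real.norm_eq_abs, abs_of_pos (by positivity)]
    linarith)
  obtain ⟨z2, ⟨h2U, h2⟩, h2e⟩ := hb (show ω * ((r / 2 : ℝ) : ℂ) ∈ ball 0 r by
    rw [mem_ball_zero_iff, norm_mul, hωn, Complex.norm_real, Real.norm_eq_abs,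
      abs_of_pos (by positivity)]; linarith)
  have : z1 = z2 := hi h1U h2U (by
    rw [h1e] at h1
    rw [h2e, mul_pow, hω.pow_eq_one, one_mul] at h2
    linear_combination h1 - h2)
  rw [this, h2e] at h1e
  have h3 : ω = 1 := by
    have : ((r / 2 : ℝ) : ℂ) ≠ 0 := by exact_mod_cast (by positivity : r / 2 ≠ 0)
    exact mul_right_cancel₀ this (by rw [h1e, one_mul])
  have := hω.ne_one (by omega)
  exact this h3

theorem exists_log_closedBall {f : ℂ → ℂ} (hf : ContinuousOn f (closedBall 0 1))
    (h0 : ∀ z ∈ closedBall (0:ℂ) 1, f z ≠ 0) :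
    ∃ l : ℂ → ℂ, ContinuousOn l (closedBall 0 1) ∧
      ∀ z ∈ closedBall (0:ℂ) 1, Complex.exp (l z) = f z := by
  have hr : Continuous fun z : ℂ => ((max 1 ‖z‖ : ℝ) : ℂ)⁻¹ * z := by
    refine Continuous.mul (Continuous.inv₀ (by fun_prop) fun z => ?_) continuous_id
    have : 0 < max 1 ‖z‖ := lt_max_of_lt_left one_pos
    exact_mod_cast this.ne'
  have hm : ∀ z : ℂ, ((max 1 ‖z‖ : ℝ) : ℂ)⁻¹ * z ∈ closedBall (0:ℂ) 1 := by
    intro z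
    have : 0 < max 1 ‖z‖ := lt_max_of_lt_left one_pos
    rw [mem_closedBall_zero_iff, norm_mul, norm_inv, Complex.norm_real, Real.norm_eq_abs,
      abs_of_pos this, inv_mul_le_iff₀ this]
    simp
  have hU : IsSimplyConnected (Set.univ : Set ℂ) := by
    have := convex_univ.contractibleSpace (s := (Set.univ : Set ℂ)) Set.univ_nonempty
    exact SimplyConnectedSpace.ofContractible _
  obtain ⟨l, hl, hle⟩ :=
      Complex.exists_continuousOn_eqOn_exp_comp (g := fun z => f (((max 1 ‖z‖ : ℝ) : ℂ)⁻¹ * z))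
    hU isOpen_univ (hf.comp_continuous hr hm).continuousOn (by
      rintro ⟨z, -, hz⟩
      exact h0 _ (hm z) hz)
  refine ⟨l, hl.mono (Set.subset_univ _), fun z hz => ?_⟩
  have := hle (Set.mem_univ z)
  rw [mem_closedBall_zero_iff] at hz
  simpa [max_eq_left hz] using this

theorem exists_log_ratio {S K : Set ℂ} (hS : IsPreconnected S) (hK : IsCompact K)
    (hd : Disjoint S K) {w₁ w₂ : ℂ} (h1 : w₁ ∈ S) (h2 : w₂ ∈ S) :
    ∃ l : ℂ → ℂ, ContinuousOn l K ∧ ∀ x ∈ K, Complex.exp (l x) = (x - w₁) / (x - w₂) := by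
  have hne : ∀ w ∈ S, ∀ x ∈ K, x - w ≠ 0 := by
    intro w hw x hx h
    rw [sub_eq_zero] at h
    exact Set.disjoint_left.1 hd hw (h ▸ hx)
  refine hS.induction₂ (fun w₁ w₂ => ∃ l : ℂ → ℂ, ContinuousOn l K ∧
    ∀ x ∈ K, Complex.exp (l x) = (x - w₁) / (x - w₂)) ?_ ?_ ?_ h1 h2
  · intro w hw
    rcases K.eq_empty_or_nonempty with rfl | hKn
    · exact Filter.Eventually.of_forall fun y => ⟨fun _ => 0, by simp, by simp⟩
    have hpos : 0 < infDist w K := (hK.isClosed.notMem_iff_infDist_pos hKn).1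
      (Set.disjoint_left.1 hd hw)
    filter_upwards [inter_mem_nhdsWithin S (Metric.ball_mem_nhds w hpos)] with y ⟨hyS, hy⟩
    refine ⟨fun x => - Complex.log ((x - y) / (x - w)), ?_, fun x hx => ?_⟩
    · refine ContinuousOn.neg (ContinuousOn.clog ?_ fun x hx => ?_)
      · exact ContinuousOn.div (by fun_prop) (by fun_prop) (hne w hw)
      · have e : (x - y) / (x - w) = 1 + (w - y) / (x - w) := by
          field_simp [hne w hw x hx]; ring
        rw [e]
        apply Complex.mem_slitPlane_of_norm_lt_one
        rw [norm_div, div_lt_one (norm_pos_iff.2 (hne w hw x hx))]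
        have := infDist_le_dist_of_mem (x := w) hx
        rw [dist_comm, dist_eq_norm] at this
        rw [mem_ball, dist_comm, dist_eq_norm] at hy
        linarith
    · rw [Complex.exp_neg, Complex.exp_log (div_ne_zero (hne y hyS x hx) (hne w hw x hx)), inv_div]
  · rintro x y z hx hy hz ⟨l, hl, hle⟩ ⟨m, hm, hme⟩
    refine ⟨fun t => l t + m t, hl.add hm, fun t ht => ?_⟩
    rw [Complex.exp_add, hle t ht, hme t ht, div_mul_div_cancel₀ (hne y hy t ht)]
  · rintro x y hx hy ⟨l, hl, hle⟩
    refine ⟨fun t => - l t, hl.neg, fun t ht => ?_⟩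
    rw [Complex.exp_neg, hle t ht, inv_div]

theorem log_sub_const {S : Set ℂ} (hS : IsPreconnected S) {l m : ℂ → ℂ} (hl : ContinuousOn l S)
    (hm : ContinuousOn m S) (h : ∀ x ∈ S, Complex.exp (l x) = Complex.exp (m x)) {x y : ℂ}
    (hx : x ∈ S) (hy : y ∈ S) : l y - l x = m y - m x := by
  have hT : IsDiscrete (Set.range fun n : ℤ => (n : ℝ)) := by
    rw [isDiscrete_iff_discreteTopology]
    exact Int.isClosedEmbedding_coe_real.isEmbedding.toHomeomorph.symm.isEmbedding.discreteTopology
  have := hS.constant_of_mapsTo hT (f := fun x => ((l x - m x) / (2 * π * Complex.I)).re)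
    (Complex.continuous_re.comp_continuousOn ((hl.sub hm).div_const _)) (by
      intro z hz
      obtain ⟨n, hn⟩ := Complex.exp_eq_exp_iff_exists_int.1 (h z hz)
      refine ⟨n, ?_⟩
      show (n : ℝ) = ((l z - m z) / (2 * π * Complex.I)).re
      rw [show l z - m z = n * (2 * π * Complex.I) by rw [hn]; ring,
        mul_div_cancel_right₀ _ (by simp [Real.pi_ne_zero])]
      simp) hx hy
  obtain ⟨n, hn⟩ := Complex.exp_eq_exp_iff_exists_int.1 (h x hx)
  obtain ⟨k, hk⟩ := Complex.exp_eq_exp_iff_exists_int.1 (h y hy)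
  rw [show l x - m x = n * (2 * π * Complex.I) by rw [hn]; ring,
    show l y - m y = k * (2 * π * Complex.I) by rw [hk]; ring,
        mul_div_cancel_right₀ _ (by simp [Real.pi_ne_zero]),
        mul_div_cancel_right₀ _ (by simp [Real.pi_ne_zero])] at this
  have e : n = k := by exact_mod_cast this
  rw [hn, hk, e]; ring

theorem preconnected_image_union {F : ℂ → ℂ} (hFc : ContinuousOn F (closedBall 0 1))
    {D T : Set ℂ} (hD : IsPreconnected D) (hDb : D ⊆ closedBall 0 1) (hT : IsPreconnected T)
    {z : ℂ} (hz : z ∈ closure D) (hzT : F z ∈ T) : IsPreconnected (F '' D ∪ T) := by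
  have hzb : z ∈ closedBall (0:ℂ) 1 := closure_minimal hDb isClosed_closedBall hz
  have h1 : F z ∈ closure (F '' D) := ((hFc z hzb).mono hDb).mem_closure_image hz
  have h2 : IsPreconnected (F '' D ∪ {F z}) :=
    (hD.image F (hFc.mono hDb)).subset_closure Set.subset_union_left
      (Set.union_subset subset_closure (Set.singleton_subset_iff.2 h1))
  have := h2.union (F z) (Or.inr rfl) hzT hT
  rwa [Set.union_assoc, Set.singleton_union, Set.insert_eq_of_mem hzT] at this

theorem mem_closure_of_sphere {D : Set ℂ} {z : ℂ}
    (h : ∀ᶠ t : ℝ in 𝓝[<] 1, (t : ℂ) * z ∈ D) : z ∈ closure D := by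
  have h1 : Tendsto (fun t : ℝ => (t : ℂ) * z) (𝓝[<] 1) (𝓝 (((1:ℝ):ℂ) * z)) :=
    ((Complex.continuous_ofReal.mul continuous_const).tendsto 1).mono_left nhdsWithin_le_nhds
  rw [Complex.ofReal_one, one_mul] at h1
  exact mem_closure_of_tendsto h1 h

theorem boundary_fiber_false {F : ℂ → ℂ} {Γ Ω : Set ℂ} (hF : DifferentiableOn ℂ F (ball 0 1))
    (hFi : Set.InjOn F (ball 0 1)) (hFc : ContinuousOn F (closedBall 0 1))
    (hFΩ : Set.MapsTo F (ball 0 1) Ω) (hΩ : IsPreconnected Ω) (hΓ : IsCompact Γ)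
    (hd : Disjoint Ω Γ) (hFΓ : Set.MapsTo F (sphere 0 1) Γ) {p : ℂ} (hp : p ∈ Γ)
    (hΓp : IsPreconnected (Γ \ {p})) {δ : ℝ} (hδ0 : 0 < δ) (hδ : δ < π)
    (hA : F (ee 1 (-δ)) = p) (hB : F (ee 1 δ) = p) {z₁ z₂ : ℂ} (h1s : z₁ ∈ sphere (0:ℂ) 1)
    (h2s : z₂ ∈ sphere (0:ℂ) 1) (h1 : cos δ < z₁.re) (h2 : z₂.re < cos δ) (h1p : F z₁ ≠ p)
    (h2p : F z₂ ≠ p) : False := by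
  have hsin : 0 < sin δ := sin_pos_of_pos_of_lt_pi hδ0 hδ
  set m := cos δ with hm
  have hm1 : |m| < 1 := by
    rw [abs_lt]; constructor <;> nlinarith [sin_sq_add_cos_sq δ]
  obtain ⟨hmA, hmB⟩ := abs_lt.1 hm1
  set ε := (1 - |m|) / 2 with hε
  have hε0 : 0 < ε := by rw [hε]; linarith
  have hζ : ∀ x : ℝ, |x| = ε → ((m + x : ℝ) : ℂ) ∈ ball (0:ℂ) 1 := by
    intro x hx
    rw [mem_ball_zero_iff, Complex.norm_real, Real.norm_eq_abs]
    have := abs_add_le m x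
    rw [hx] at this; linarith
  have hζ1 := hζ ε (abs_of_pos hε0)
  have hζ2 := hζ (-ε) (by rw [abs_neg, abs_of_pos hε0])
  set ζ₁ : ℂ := ((m + ε : ℝ) : ℂ) with hζ₁
  set ζ₂ : ℂ := ((m + -ε : ℝ) : ℂ) with hζ₂
  have hΩΓ : ∀ {x y}, x ∈ Ω → y ∈ Γ → x ≠ y := fun hx hy h => Set.disjoint_left.1 hd hx (h ▸ hy)
  -- logarithms of the difference quotients
  have hR : ∀ ζ ∈ ball (0:ℂ) 1, ∃ l : ℂ → ℂ, ContinuousOn l (closedBall 0 1) ∧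
      ∀ z ∈ closedBall (0:ℂ) 1, (z - ζ) * Complex.exp (l z) = F z - F ζ := by
    intro ζ hζ
    have hda : DifferentiableAt ℂ F ζ := hF.differentiableAt (isOpen_ball.mem_nhds hζ)
    obtain ⟨l, hl, hle⟩ := exists_log_closedBall (f := dslope F ζ)
      ((continuousOn_dslope (mem_of_superset (isOpen_ball.mem_nhds hζ) ball_subset_closedBall)).2
        ⟨hFc, hda⟩) (by
        intro z hz
        by_cases hzζ : z = ζ
        · rw [hzζ, dslope_same]
          exact deriv_ne_zero_of_injOn (hF.analyticAt (isOpen_ball.mem_nhds hζ))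
            (isOpen_ball.mem_nhds hζ) hFi
        · rw [dslope_of_ne _ hzζ, slope_def_field]
          refine div_ne_zero (sub_ne_zero.2 fun h => ?_) (sub_ne_zero.2 hzζ)
          rw [← ball_union_sphere] at hz
          rcases hz with hz | hz
          · exact hzζ (hFi hz hζ h)
          · exact hΩΓ (hFΩ hζ) (hFΓ hz) h.symm)
    exact ⟨l, hl, fun z hz => by rw [hle z hz, ← smul_eq_mul, sub_smul_dslope]⟩
  obtain ⟨ρ₁, hρ₁, hρe₁⟩ := hR ζ₁ hζ1
  obtain ⟨ρ₂, hρ₂, hρe₂⟩ := hR ζ₂ hζ2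
  -- the chord
  set Ch : Set ℂ := closedBall 0 1 ∩ {z | z.re = m} with hCh
  have hChc : IsCompact Ch := (isCompact_closedBall 0 1).inter_right
    (isClosed_eq Complex.continuous_re continuous_const)
  have hChconv : Convex ℝ Ch := (convex_closedBall 0 1).inter
    (convex_hyperplane (𝕜 := ℝ) (f := Complex.reLm) Complex.reLm.isLinear m)
  have hee : ∀ x : ℝ, ee 1 x = ⟨cos x, sin x⟩ := by
    intro x
    rw [ee]
    apply Complex.ext <;> simp [Complex.exp_re, Complex.exp_im]
  have hChp : ∀ z ∈ Ch, z ∈ sphere (0:ℂ) 1 → F z = p := by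
    rintro z ⟨-, hz⟩ hzs
    have hzr : z.re = m := hz
    have h3 : z.re ^ 2 + z.im ^ 2 = 1 := by
      rw [mem_sphere_zero_iff_norm] at hzs
      have := Complex.sq_norm z
      rw [hzs, Complex.normSq_apply] at this
      nlinarith
    have h4 : (z.im - sin δ) * (z.im + sin δ) = 0 := by
      rw [hzr] at h3; nlinarith [sin_sq_add_cos_sq δ]
    rcases mul_eq_zero.1 h4 with h5 | h5
    · rw [← hB, hee]; congr 1; apply Complex.ext
      · exact hzr
      · simpa using sub_eq_zero.1 h5
    · rw [← hA, hee]; congr 1; apply Complex.ext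
      · simpa using hzr
      · simp; linarith
  set D₁ : Set ℂ := ball 0 1 ∩ {z | m < z.re} with hD₁
  set D₂ : Set ℂ := ball 0 1 ∩ {z | z.re < m} with hD₂
  have hD1c : Convex ℝ D₁ := (convex_ball 0 1).inter
    (convex_halfSpace_gt Complex.reLm.isLinear m)
  have hD2c : Convex ℝ D₂ := (convex_ball 0 1).inter
    (convex_halfSpace_lt Complex.reLm.isLinear m)
  have hcl1 : z₁ ∈ closure D₁ := by
    apply mem_closure_of_sphere
    have e1 : ∀ᶠ t : ℝ in 𝓝[<] 1, m < t * z₁.re :=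
      (((continuous_id.mul continuous_const).tendsto 1).mono_left nhdsWithin_le_nhds).eventually
        (lt_mem_nhds (by simpa using h1))
    filter_upwards [e1, Ioo_mem_nhdsLT (zero_lt_one : (0:ℝ) < 1)] with t ht ht1
    refine ⟨?_, by simpa using ht⟩
    rw [mem_ball_zero_iff, norm_mul, mem_sphere_zero_iff_norm.1 h1s, Complex.norm_real,
      Real.norm_eq_abs, abs_of_pos ht1.1, mul_one]
    exact ht1.2
  have hcl2 : z₂ ∈ closure D₂ := by
    apply mem_closure_of_sphere
    have e1 : ∀ᶠ t : ℝ in 𝓝[<] 1, t * z₂.re < m :=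
      (((continuous_id.mul continuous_const).tendsto 1).mono_left nhdsWithin_le_nhds).eventually
        (gt_mem_nhds (by simpa using h2))
    filter_upwards [e1, Ioo_mem_nhdsLT (zero_lt_one : (0:ℝ) < 1)] with t ht ht1
    refine ⟨?_, by simpa using ht⟩
    rw [mem_ball_zero_iff, norm_mul, mem_sphere_zero_iff_norm.1 h2s, Complex.norm_real,
      Real.norm_eq_abs, abs_of_pos ht1.1, mul_one]
    exact ht1.2
  have hS : IsPreconnected (F '' D₁ ∪ (F '' D₂ ∪ Γ \ {p})) :=
    preconnected_image_union hFc hD1c.isPreconnected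
      (Set.inter_subset_left.trans ball_subset_closedBall)
      (preconnected_image_union hFc hD2c.isPreconnected
        (Set.inter_subset_left.trans ball_subset_closedBall) hΓp hcl2 ⟨hFΓ h2s, h2p⟩) hcl1
      (Or.inr ⟨hFΓ h1s, h1p⟩)
  have hLc : IsCompact (F '' Ch) := hChc.image_of_continuousOn (hFc.mono Set.inter_subset_left)
  have hDCh : ∀ x ∈ ball (0:ℂ) 1, x.re ≠ m → F x ∉ F '' Ch := by
    rintro x hx hxm ⟨y, hy, hxy⟩
    by_cases hyb : y ∈ ball (0:ℂ) 1
    · rw [← hFi hyb hx hxy] at hxm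
      exact hxm hy.2
    · have hys : y ∈ sphere (0:ℂ) 1 := by
        have := hy.1
        rw [← ball_union_sphere] at this
        exact this.resolve_left hyb
      exact hΩΓ (hFΩ hx) hp (hxy.symm.trans (hChp y hy hys))
  have hSL : Disjoint (F '' D₁ ∪ (F '' D₂ ∪ Γ \ {p})) (F '' Ch) := by
    rw [Set.disjoint_left]
    rintro w (⟨x, hx, rfl⟩ | ⟨x, hx, rfl⟩ | hw)
    · exact hDCh x hx.1 (ne_of_gt hx.2)
    · exact hDCh x hx.1 (ne_of_lt hx.2)
    · rintro ⟨y, hy, rfl⟩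
      by_cases hyb : y ∈ ball (0:ℂ) 1
      · exact hΩΓ (hFΩ hyb) hw.1 rfl
      · have hys : y ∈ sphere (0:ℂ) 1 := by
          have := hy.1
          rw [← ball_union_sphere] at this
          exact this.resolve_left hyb
        exact hw.2 (hChp y hy hys)
  obtain ⟨lL, hlL, hlLe⟩ := exists_log_ratio hS hLc hSL (w₁ := F ζ₁) (w₂ := F ζ₂)
    (Or.inl ⟨ζ₁, ⟨hζ1, by rw [hζ₁]; simpa using hε0⟩, rfl⟩)
    (Or.inr (Or.inl ⟨ζ₂, ⟨hζ2, by rw [hζ₂]; simpa using hε0⟩, rfl⟩))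
  obtain ⟨lΓ, hlΓ, hlΓe⟩ := exists_log_ratio hΩ hΓ hd (hFΩ hζ1) (hFΩ hζ2)
  set q : ℂ → ℂ := fun z => (z - ζ₁) / (z - ζ₂) with hq
  have key : ∀ (l : ℂ → ℂ) z, z ∈ closedBall (0:ℂ) 1 → z ≠ ζ₁ → z ≠ ζ₂ →
      Complex.exp (l (F z)) = (F z - F ζ₁) / (F z - F ζ₂) →
      Complex.exp (l (F z) - ρ₁ z + ρ₂ z) = q z := by
    intro l z hz hz1 hz2 hl
    rw [Complex.exp_add, Complex.exp_sub, hl, ← hρe₁ z hz, ← hρe₂ z hz]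
    have e1 := Complex.exp_ne_zero (ρ₁ z)
    have e2 := Complex.exp_ne_zero (ρ₂ z)
    have e3 := sub_ne_zero.2 hz1
    have e4 := sub_ne_zero.2 hz2
    rw [hq]; field_simp
  have hqre : ∀ z : ℂ, z ≠ ζ₂ → (q z).re * Complex.normSq (z - ζ₂) =
      (z.re - m) ^ 2 + z.im ^ 2 - ε ^ 2 ∧ (q z).im * Complex.normSq (z - ζ₂) = 2 * ε * z.im := by
    intro z hz
    have h0 : Complex.normSq (z - ζ₂) ≠ 0 := by
      rwa [Ne, Complex.normSq_eq_zero, sub_eq_zero]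
    simp only [hq]
    rw [Complex.div_re, Complex.div_im]
    constructor <;> field_simp <;> simp [hζ₁, hζ₂] <;> ring
  have hpos : ∀ z : ℂ, z ≠ ζ₂ → 0 < Complex.normSq (z - ζ₂) := by
    intro z hz; rwa [Complex.normSq_pos, sub_ne_zero]
  have hsph : ∀ z ∈ sphere (0:ℂ) 1, z ≠ ζ₁ ∧ z ≠ ζ₂ := by
    intro z hz
    rw [mem_sphere_zero_iff_norm] at hz
    constructor
    · rintro rfl; rw [mem_ball_zero_iff] at hζ1; exact hζ1.ne hz
    · rintro rfl; rw [mem_ball_zero_iff] at hζ2; exact hζ2.ne hz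
  have hChn : ∀ z ∈ Ch, z ≠ ζ₁ ∧ z ≠ ζ₂ := by
    rintro z ⟨-, hz⟩
    have hz' : z.re = m := hz
    constructor
    · intro h; rw [h, hζ₁, Complex.ofReal_re] at hz'; linarith
    · intro h; rw [h, hζ₂, Complex.ofReal_re] at hz'; linarith
  have hqc : ∀ s : Set ℂ, (∀ z ∈ s, z ≠ ζ₂) → ContinuousOn q s := fun s hs =>
    ContinuousOn.div (by fun_prop) (by fun_prop) fun z hz => sub_ne_zero.2 (hs z hz)
  have hAs : ee 1 (-δ) ∈ sphere (0:ℂ) 1 := by simp [norm_ee]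
  have hBs : ee 1 δ ∈ sphere (0:ℂ) 1 := by simp [norm_ee]
  have hAC : ee 1 (-δ) ∈ Ch := ⟨sphere_subset_closedBall hAs, by simp [hee, hm]⟩
  have hBC : ee 1 δ ∈ Ch := ⟨sphere_subset_closedBall hBs, by simp [hee, hm]⟩
  have hsphq : ∀ z ∈ sphere (0:ℂ) 1, q z ∈ Complex.slitPlane := by
    intro z hz
    have hz2 := (hsph z hz).2
    left
    have h3 : z.re ^ 2 + z.im ^ 2 = 1 := by
      rw [mem_sphere_zero_iff_norm] at hz
      have := Complex.sq_norm z
      rw [hz, Complex.normSq_apply] at this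
      nlinarith
    have h4 : 0 < (z.re - m) ^ 2 + z.im ^ 2 - ε ^ 2 := by
      have h5 : |z.re| ≤ 1 := by rw [abs_le]; constructor <;> nlinarith
      have h6 : z.re * m ≤ |m| := by
        calc z.re * m ≤ |z.re * m| := le_abs_self _
          _ = |z.re| * |m| := abs_mul _ _
          _ ≤ 1 * |m| := by gcongr
          _ = |m| := one_mul _
      have h7 : |m| ^ 2 = m ^ 2 := sq_abs m
      have h8 : 4 * ε ^ 2 = (1 - |m|) ^ 2 := by rw [hε]; ring
      nlinarith [abs_nonneg m]
    have h5 := (hqre z hz2).1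
    rw [← h5] at h4
    exact pos_of_mul_pos_left h4 (hpos z hz2).le
  have hChq : ∀ z ∈ Ch, - q z ∈ Complex.slitPlane := by
    intro z hz
    have hz2 := (hChn z hz).2
    have hzr : z.re = m := hz.2
    obtain ⟨e1, e2⟩ := hqre z hz2
    rw [hzr] at e1
    by_cases hi : z.im = 0
    · left
      rw [hi] at e1
      have := hpos z hz2
      rw [Complex.neg_re]
      by_contra hcon
      have : 0 ≤ (q z).re * Complex.normSq (z - ζ₂) := mul_nonneg (by linarith) this.le
      nlinarith
    · right
      rw [Complex.neg_im, neg_ne_zero]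
      intro h0
      rw [h0, zero_mul] at e2
      exact hi (by simpa [hε0.ne'] using e2.symm)
  have hsc : IsPreconnected (sphere (0:ℂ) 1) := isPreconnected_sphere (by simp) 0 1
  have E1 := log_sub_const hsc (l := fun z => lΓ (F z) - ρ₁ z + ρ₂ z)
    (m := fun z => Complex.log (q z))
    (((hlΓ.comp (hFc.mono sphere_subset_closedBall) hFΓ).sub
      (hρ₁.mono sphere_subset_closedBall)).add (hρ₂.mono sphere_subset_closedBall))
    ((hqc _ fun z hz => (hsph z hz).2).clog hsphq)
    (fun z hz => by
      rw [Complex.exp_log (Complex.slitPlane_ne_zero (hsphq z hz))]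
      exact key lΓ z (sphere_subset_closedBall hz) (hsph z hz).1 (hsph z hz).2
        (hlΓe _ (hFΓ hz))) hAs hBs
  have E2 := log_sub_const hChconv.isPreconnected (l := fun z => lL (F z) - ρ₁ z + ρ₂ z)
    (m := fun z => Complex.log (- q z) + π * Complex.I)
    (((hlL.comp (hFc.mono Set.inter_subset_left) (Set.mapsTo_image F Ch)).sub
      (hρ₁.mono Set.inter_subset_left)).add (hρ₂.mono Set.inter_subset_left))
    (((hqc _ fun z hz => (hChn z hz).2).neg.clog hChq).add continuousOn_const)
    (fun z hz => by
      rw [Complex.exp_add (Complex.log _), Complex.exp_log (Complex.slitPlane_ne_zero (hChq z hz)),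
        Complex.exp_pi_mul_I, mul_neg_one, neg_neg]
      exact key lL z hz.1 (hChn z hz).1 (hChn z hz).2
        (hlLe _ (Set.mem_image_of_mem F hz))) hAC hBC
  rw [hA, hB] at E1 E2
  have E3 : Complex.log (q (ee 1 δ)) - Complex.log (q (ee 1 (-δ))) =
      Complex.log (- q (ee 1 δ)) - Complex.log (- q (ee 1 (-δ))) := by
    linear_combination E2 - E1
  have him1 : 0 < (q (ee 1 δ)).im := by
    have h3 := (hqre _ (hsph _ hBs).2).2
    have : (0:ℝ) < 2 * ε * (ee 1 δ).im := by rw [hee]; positivity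
    rw [← h3] at this
    exact pos_of_mul_pos_left this (hpos _ (hsph _ hBs).2).le
  have him2 : (q (ee 1 (-δ))).im < 0 := by
    have h3 := (hqre _ (hsph _ hAs).2).2
    have : 2 * ε * (ee 1 (-δ)).im < 0 := by
      rw [hee]; simp only [Real.sin_neg]; nlinarith
    rw [← h3] at this
    by_contra hcon
    have := mul_nonneg (not_lt.1 hcon) (hpos _ (hsph _ hAs).2).le
    linarith
  have E4 := congrArg Complex.im E3
  simp only [Complex.sub_im, Complex.log_im] at E4
  rw [Complex.arg_neg_eq_arg_sub_pi_of_im_pos him1,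
    Complex.arg_neg_eq_arg_add_pi_of_im_neg him2] at E4
  linarith [pi_pos]

theorem boundary_arc_ne {F : ℂ → ℂ} {p : ℂ} (hF : DifferentiableOn ℂ F (ball 0 1))
    (hFc : ContinuousOn F (closedBall 0 1)) (h0 : F 0 ≠ p) {θ₀ η : ℝ} (hη : 0 < η)
    (h : ∀ θ, |θ - θ₀| < η → F (ee 1 θ) = p) : False := by
  obtain ⟨n, hn⟩ := exists_nat_gt (2 * π / η)
  have hn0 : 0 < (n : ℝ) := lt_of_le_of_lt (by positivity) hn
  have hnη : 2 * π / n < η := by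
    rw [div_lt_iff₀ hη] at hn
    rw [div_lt_iff₀ hn0]; linarith
  set Q : ℂ → ℂ := fun z => ∏ k ∈ Finset.range n, (F (ee 1 (2 * π / n * k) * z) - p) with hQ
  have hmb : ∀ x : ℝ, Set.MapsTo (fun z => ee 1 x * z) (ball 0 1) (ball 0 1) := by
    intro x z hz
    simpa [norm_ee] using hz
  have hmc : ∀ x : ℝ, Set.MapsTo (fun z => ee 1 x * z) (closedBall 0 1) (closedBall 0 1) := by
    intro x z hz
    simpa [norm_ee] using hz
  have hQd : DiffContOnCl ℂ Q (ball 0 1) := by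
    constructor
    · refine DifferentiableOn.fun_finsetProd fun k hk => ?_
      exact (hF.comp (by fun_prop) (hmb _)).sub_const p
    · rw [closure_ball _ one_ne_zero]
      refine continuousOn_finsetProd _ fun k hk => ?_
      exact (hFc.comp (by fun_prop) (hmc _)).sub continuousOn_const
  have hQ0 : Set.EqOn Q 0 (frontier (ball 0 1)) := by
    intro z hz
    rw [frontier_ball _ one_ne_zero, mem_sphere_zero_iff_norm] at hz
    have hzφ : z = ee 1 z.arg := by
      rw [ee]
      conv_lhs => rw [← Complex.norm_mul_exp_arg_mul_I z, hz]
      simp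
    set φ := z.arg
    set d := 2 * π / n with hd
    have hd0 : 0 < d := by positivity
    set j := ⌊(θ₀ - φ) / d⌋ with hj
    have hnz : (n : ℤ) ≠ 0 := by
      intro h; rw [Int.natCast_eq_zero] at h; rw [h] at hn0; simp at hn0
    have hk0 := Int.emod_nonneg j hnz
    have hk1 := Int.emod_lt_of_pos j (lt_of_le_of_ne (Int.natCast_nonneg n) hnz.symm)
    obtain ⟨k, hk⟩ := Int.eq_ofNat_of_zero_le hk0
    rw [hk] at hk1
    refine Finset.prod_eq_zero (i := k) (Finset.mem_range.2 (by exact_mod_cast hk1)) ?_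
    rw [sub_eq_zero, hzφ, ← ee_arg_add]
    have hjk : (j : ℝ) = k + n * (j / (n : ℤ) : ℤ) := by
      have := Int.emod_add_mul_ediv j n
      rw [hk] at this
      exact_mod_cast this.symm
    have e1 : d * k + φ = (d * j + φ) + ((-(j / (n : ℤ)) : ℤ) : ℝ) * (2 * π) := by
      rw [hjk, hd]; push_cast; field_simp; ring
    have e2 : ee 1 (d * k + φ) = ee 1 (d * j + φ) :=
      ee_one_eq_iff.2 ⟨_, e1⟩
    rw [e2]
    apply h
    have h1 := Int.floor_le ((θ₀ - φ) / d)
    have h2 := Int.lt_floor_add_one ((θ₀ - φ) / d)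
    rw [← hj, le_div_iff₀ hd0] at h1
    rw [← hj, div_lt_iff₀ hd0] at h2
    rw [abs_lt]; constructor <;> nlinarith
  have := Complex.eqOn_of_eqOn_frontier isBounded_ball hQd
    (differentiableOn_const (0:ℂ) |>.diffContOnCl_ball (c := 0) (R := 1) le_rfl |> fun h => h) hQ0
    (mem_ball_self one_pos)
  simp [hQ, Finset.prod_const, sub_eq_zero] at this
  exact h0 this.1

theorem boundary_inj {F : ℂ → ℂ} {Γ Ω : Set ℂ} (hF : DifferentiableOn ℂ F (ball 0 1))
    (hFi : Set.InjOn F (ball 0 1)) (hFc : ContinuousOn F (closedBall 0 1))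
    (hFΩ : Set.MapsTo F (ball 0 1) Ω) (hΩ : IsPreconnected Ω) (hΓ : IsCompact Γ)
    (hd : Disjoint Ω Γ) (hFΓ : Set.MapsTo F (sphere 0 1) Γ)
    (hΓp : ∀ p ∈ Γ, IsPreconnected (Γ \ {p})) {s t : ℝ} (hst : s < t) (hts : t < s + 2 * π) :
    F (ee 1 s) ≠ F (ee 1 t) := by
  intro heq
  set c := (s + t) / 2 with hc
  set δ := (t - s) / 2 with hδ
  have hmb : Set.BijOn (fun z => ee 1 c * z) (ball 0 1) (ball 0 1) := by
    refine ⟨fun z hz => by simpa [norm_ee] using hz, fun x _ y _ h => ?_, fun z hz => ?_⟩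
    · exact mul_left_cancel₀ (ee_ne_zero _ _) h
    · refine ⟨ee 1 (-c) * z, by simpa [norm_ee] using hz, ?_⟩
      simp only
      rw [← mul_assoc, ← ee_arg_add]; simp [ee]
  have hmc : Set.MapsTo (fun z => ee 1 c * z) (closedBall 0 1) (closedBall 0 1) :=
    fun z hz => by simpa [norm_ee] using hz
  have hms : Set.MapsTo (fun z => ee 1 c * z) (sphere 0 1) (sphere 0 1) :=
    fun z hz => by simpa [norm_ee] using hz
  set p := F (ee 1 s) with hp
  have hpΓ : p ∈ Γ := hFΓ (by simp [norm_ee])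
  have hF' : DifferentiableOn ℂ (fun z => F (ee 1 c * z)) (ball 0 1) :=
    hF.comp (by fun_prop) hmb.mapsTo
  have hFc' : ContinuousOn (fun z => F (ee 1 c * z)) (closedBall 0 1) :=
    hFc.comp (by fun_prop) hmc
  have h0p : F (ee 1 c * 0) ≠ p := fun h =>
    Set.disjoint_left.1 hd (hFΩ (hmb.mapsTo (mem_ball_self one_pos))) (by
      show F (ee 1 c * 0) ∈ Γ
      rw [h]; exact hpΓ)
  have hre : ∀ θ, (ee 1 θ).re = cos θ := by
    intro x; rw [ee]; simp [Complex.exp_re]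
  by_cases h1 : ∃ z ∈ sphere (0:ℂ) 1, cos δ < z.re ∧ F (ee 1 c * z) ≠ p
  swap
  · push Not at h1
    refine boundary_arc_ne hF' hFc' h0p (θ₀ := 0) (η := δ) (by rw [hδ]; linarith) fun θ hθ => ?_
    refine h1 _ (by simp [norm_ee]) ?_
    rw [hre, ← Real.cos_abs θ]
    rw [sub_zero] at hθ
    exact cos_lt_cos_of_nonneg_of_le_pi (abs_nonneg _) (by rw [hδ]; linarith) hθ
  by_cases h2 : ∃ z ∈ sphere (0:ℂ) 1, z.re < cos δ ∧ F (ee 1 c * z) ≠ p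
  swap
  · push Not at h2
    refine boundary_arc_ne hF' hFc' h0p (θ₀ := π) (η := π - δ) (by rw [hδ]; linarith)
      fun θ hθ => ?_
    refine h2 _ (by simp [norm_ee]) ?_
    have e1 : cos θ = - cos |θ - π| := by rw [Real.cos_abs, cos_sub_pi, neg_neg]
    have e2 : cos δ = - cos (π - δ) := by rw [cos_pi_sub, neg_neg]
    rw [hre, e1, e2, neg_lt_neg_iff]
    exact cos_lt_cos_of_nonneg_of_le_pi (abs_nonneg _) (by rw [hδ]; linarith) hθ
  obtain ⟨z₁, h1s, h1r, h1p⟩ := h1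
  obtain ⟨z₂, h2s, h2r, h2p⟩ := h2
  refine boundary_fiber_false hF' (hFi.comp hmb.injOn hmb.mapsTo) hFc' (hFΩ.comp hmb.mapsTo) hΩ hΓ
    hd (hFΓ.comp hms) hpΓ (hΓp p hpΓ) (δ := δ) (by rw [hδ]; linarith) (by rw [hδ]; linarith)
    ?_ ?_ h1s h2s h1r h2r h1p h2p
  · rw [← ee_arg_add, hp, hc, hδ]; congr 2; ring
  · rw [← ee_arg_add, heq, hc, hδ]; congr 2; ring

/-- A `2π`-periodic parametrization of a Jordan curve. -/
structure IsLoop (γ : ℝ → ℂ) : Prop where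
  cont : Continuous γ
  per : ∀ θ, γ (θ + 2 * π) = γ θ
  inj : ∀ s t, |s - t| < 2 * π → γ s = γ t → s = t

/-- Bounded turning of a closed curve with constant `C`. -/
def Turning (C : ℝ) (γ : ℝ → ℂ) : Prop :=
  ∀ s t : ℝ, s ≤ t → t ≤ s + 2 * π →
    min (Metric.diam (γ '' Set.Icc s t)) (Metric.diam (γ '' Set.Icc t (s + 2 * π)))
      ≤ C * ‖γ s - γ t‖

theorem isLoop_of_injOn {γ : ℝ → ℂ} (hc : Continuous γ) (hp : ∀ θ, γ (θ + 2 * π) = γ θ)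
    (hi : Set.InjOn γ (Set.Ico 0 (2 * π))) : IsLoop γ := by
  refine ⟨hc, hp, fun s t hst h => ?_⟩
  have hper : Function.Periodic γ (2 * π) := hp
  have h2 : (0:ℝ) < 2 * π := by positivity
  have e : ∀ x, γ (toIcoMod h2 0 x) = γ x := fun x => by
    rw [toIcoMod]; exact hper.sub_zsmul_eq _
  have m : ∀ x, toIcoMod h2 0 x ∈ Set.Ico 0 (2 * π) := fun x => by
    simpa using toIcoMod_mem_Ico h2 0 x
  have h3 := hi (m s) (m t) (by rw [e, e, h])
  rw [toIcoMod, toIcoMod] at h3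
  have h4 : s - t = ((toIcoDiv h2 0 s - toIcoDiv h2 0 t : ℤ) : ℝ) * (2 * π) := by
    simp only [zsmul_eq_mul] at h3
    push_cast; linarith
  rw [h4, abs_mul, abs_of_pos h2] at hst
  have h5 : |((toIcoDiv h2 0 s - toIcoDiv h2 0 t : ℤ) : ℝ)| < 1 := by
    by_contra hcon
    nlinarith [not_lt.1 hcon]
  have h6 : toIcoDiv h2 0 s - toIcoDiv h2 0 t = 0 := by
    rw [← Int.abs_lt_one_iff]; exact_mod_cast h5
  rw [h6] at h4
  simp at h4; linarith

namespace IsLoop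
variable {γ : ℝ → ℂ}

theorem range_eq (h : IsLoop γ) (τ : ℝ) : Set.range γ = γ '' Set.Ico τ (τ + 2 * π) := by
  have hper : Function.Periodic γ (2 * π) := h.per
  ext x; constructor
  · rintro ⟨y, rfl⟩
    obtain ⟨z, hz, hyz⟩ := hper.exists_mem_Ico (by positivity) y τ
    exact ⟨z, hz, hyz.symm⟩
  · rintro ⟨y, -, rfl⟩
    exact ⟨y, rfl⟩

theorem isCompact_range (h : IsLoop γ) : IsCompact (Set.range γ) := by
  have hper : Function.Periodic γ (2 * π) := h.per
  rw [← hper.image_Icc (by positivity) 0]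
  exact isCompact_Icc.image h.cont

theorem preconnected_compl (h : IsLoop γ) {p : ℂ} (hp : p ∈ Set.range γ) :
    IsPreconnected (Set.range γ \ {p}) := by
  obtain ⟨τ, rfl⟩ := hp
  have : Set.range γ \ {γ τ} = γ '' Set.Ioo τ (τ + 2 * π) := by
    rw [h.range_eq τ]
    ext x; constructor
    · rintro ⟨⟨u, hu, rfl⟩, hx⟩
      refine ⟨u, ⟨lt_of_le_of_ne hu.1 ?_, hu.2⟩, rfl⟩
      rintro rfl
      exact hx rfl
    · rintro ⟨u, hu, rfl⟩
      refine ⟨⟨u, ⟨hu.1.le, hu.2⟩, rfl⟩, fun hx => ?_⟩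
      have := h.inj u τ (by rw [abs_lt]; constructor <;> linarith [hu.1, hu.2]) hx
      linarith [hu.1]
  rw [this]
  exact isPreconnected_Ioo.image _ h.cont.continuousOn

theorem inter_arcs (h : IsLoop γ) {u v : ℝ} :
    γ '' Set.Icc u v ∩ γ '' Set.Icc v (u + 2 * π) ⊆ {γ u, γ v} := by
  rintro _ ⟨⟨x, hx, rfl⟩, ⟨y, hy, hxy⟩⟩
  rcases lt_or_ge (y - x) (2 * π) with h1 | h1
  · have : y = x := h.inj y x (by
      rw [abs_of_nonneg (by linarith [hx.2, hy.1])]; exact h1) hxy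
    right
    have : x = v := le_antisymm hx.2 (this ▸ hy.1)
    rw [this]; rfl
  · left
    have : x = u := by linarith [hx.1, hy.2]
    rw [this]

theorem union_arcs (h : IsLoop γ) {u v : ℝ} (huv : u ≤ v) (hvu : v ≤ u + 2 * π) :
    γ '' Set.Icc u v ∪ γ '' Set.Icc v (u + 2 * π) = Set.range γ := by
  have hper : Function.Periodic γ (2 * π) := h.per
  rw [← Set.image_union, Set.Icc_union_Icc_eq_Icc huv hvu, hper.image_Icc (by positivity)]

theorem arc_subset (h : IsLoop γ) {S : Set ℂ} (hS : IsPreconnected S) (hSr : S ⊆ Set.range γ)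
    {σ τ : ℝ} (h1 : γ σ ∈ S) (h2 : γ τ ∈ S) :
    γ '' Set.Icc σ τ ⊆ S ∨ γ '' Set.Icc τ (σ + 2 * π) ⊆ S := by
  by_contra hcon
  rw [not_or, Set.not_subset, Set.not_subset] at hcon
  obtain ⟨⟨_, ⟨u, hu, rfl⟩, huS⟩, ⟨_, ⟨v, hv, rfl⟩, hvS⟩⟩ := hcon
  have huv : u ≤ v := hu.2.trans hv.1
  have hvu : v ≤ u + 2 * π := hv.2.trans (by linarith [hu.1])
  obtain ⟨x, hxS, hx⟩ := isPreconnected_closed_iff.1 hS (γ '' Set.Icc u v)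
    (γ '' Set.Icc v (u + 2 * π)) (isCompact_Icc.image h.cont).isClosed
    (isCompact_Icc.image h.cont).isClosed (by rwa [h.union_arcs huv hvu])
    ⟨γ τ, h2, τ, ⟨hu.2, hv.1⟩, rfl⟩
    ⟨γ σ, h1, σ + 2 * π, ⟨hv.2, by linarith [hu.1]⟩, h.per σ⟩
  rcases h.inter_arcs hx with rfl | rfl
  · exact huS hxS
  · exact hvS hxS

theorem arc_sub_arc {a : ℝ → ℂ} (h : IsLoop γ) (ha : IsLoop a) (har : Set.range a ⊆ Set.range γ)
    {σ τ s t : ℝ} (hστ : σ < τ) (hτσ : τ < σ + 2 * π) (hst : s < t) (hts : t < s + 2 * π)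
    (hends : ({a s, a t} : Set ℂ) = {γ σ, γ τ}) :
    (a '' Set.Icc s t ⊆ γ '' Set.Icc σ τ ∧
      a '' Set.Icc t (s + 2 * π) ⊆ γ '' Set.Icc τ (σ + 2 * π)) ∨
    (a '' Set.Icc s t ⊆ γ '' Set.Icc τ (σ + 2 * π) ∧
      a '' Set.Icc t (s + 2 * π) ⊆ γ '' Set.Icc σ τ) := by
  have hr : ∀ x y, a '' Set.Icc x y ⊆ Set.range γ :=
    fun x y => (Set.image_subset_range _ _).trans har
  have hpc : ∀ x y, IsPreconnected (a '' Set.Icc x y) :=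
    fun x y => isPreconnected_Icc.image _ ha.cont.continuousOn
  have hσm : γ σ ∈ ({a s, a t} : Set ℂ) := by rw [hends]; simp
  have hτm : γ τ ∈ ({a s, a t} : Set ℂ) := by rw [hends]; simp
  have hsub1 : ({a s, a t} : Set ℂ) ⊆ a '' Set.Icc s t := by
    rintro x (rfl | rfl)
    · exact ⟨s, ⟨le_rfl, hst.le⟩, rfl⟩
    · exact ⟨t, ⟨hst.le, le_rfl⟩, rfl⟩
  have hsub2 : ({a s, a t} : Set ℂ) ⊆ a '' Set.Icc t (s + 2 * π) := by
    rintro x (rfl | rfl)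
    · exact ⟨s + 2 * π, ⟨hts.le, le_rfl⟩, ha.per s⟩
    · exact ⟨t, ⟨le_rfl, hts.le⟩, rfl⟩
  have hinter := ha.inter_arcs (u := s) (v := t)
  have hno : ∀ x y, σ ≤ x → y ≤ σ + 2 * π → (y ≤ τ ∨ τ ≤ x) → x < y →
      γ '' Set.Icc x y ⊆ a '' Set.Icc s t →
      ¬ γ '' Set.Icc x y ⊆ a '' Set.Icc t (s + 2 * π) := by
    intro x y hx hy hxyτ hxy h1 h2
    have h3 := hinter ⟨h1 ⟨(x + y) / 2, ⟨by linarith, by linarith⟩, rfl⟩,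
      h2 ⟨(x + y) / 2, ⟨by linarith, by linarith⟩, rfl⟩⟩
    rw [hends] at h3
    rcases h3 with h3 | h3
    · have := h.inj _ _ (by rw [abs_lt]; constructor <;> linarith) h3
      linarith
    · have := h.inj _ _ (by rw [abs_lt]; constructor <;> linarith) h3
      rcases hxyτ with h4 | h4 <;> linarith
  have hcover := h.union_arcs hστ.le hτσ.le
  have hend1 : ({γ σ, γ τ} : Set ℂ) ⊆ γ '' Set.Icc σ τ := by
    rintro x (rfl | rfl)
    · exact ⟨σ, ⟨le_rfl, hστ.le⟩, rfl⟩
    · exact ⟨τ, ⟨hστ.le, le_rfl⟩, rfl⟩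
  have hend2 : ({γ σ, γ τ} : Set ℂ) ⊆ γ '' Set.Icc τ (σ + 2 * π) := by
    rintro x (rfl | rfl)
    · exact ⟨σ + 2 * π, ⟨hτσ.le, le_rfl⟩, h.per σ⟩
    · exact ⟨τ, ⟨le_rfl, hτσ.le⟩, rfl⟩
  -- if `U ⊆ S₁`, `V ⊆ S₂` then `S₁ ⊆ U'`
  have hfin : ∀ {U V S T : Set ℂ}, U ∪ V = Set.range γ → ({γ σ, γ τ} : Set ℂ) ⊆ U →
      S ⊆ Set.range γ → V ⊆ T → S ∩ T ⊆ {a s, a t} → S ⊆ U := by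
    intro U V S T hUV hU hS hV hST x hx
    have := hS hx
    rw [← hUV] at this
    rcases this with h1 | h1
    · exact h1
    · have := hST ⟨hx, hV h1⟩
      rw [hends] at this
      exact hU this
  have hinter' := hinter
  rw [Set.inter_comm] at hinter'
  have hcover' := hcover
  rw [Set.union_comm] at hcover'
  rcases h.arc_subset (hpc s t) (hr s t) (hsub1 hσm) (hsub1 hτm) with h1 | h1 <;>
  rcases h.arc_subset (hpc t (s + 2 * π)) (hr t _) (hsub2 hσm) (hsub2 hτm)
    with h2 | h2
  · exact absurd h2 (hno σ τ le_rfl hτσ.le (Or.inl le_rfl) hστ h1)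
  · left
    exact ⟨hfin hcover hend1 (hr _ _) h2 hinter, hfin hcover' hend2 (hr _ _) h1 hinter'⟩
  · right
    exact ⟨hfin hcover' hend2 (hr _ _) h2 hinter, hfin hcover hend1 (hr _ _) h1 hinter'⟩
  · exact absurd h2 (hno τ (σ + 2 * π) hστ.le le_rfl (Or.inr le_rfl) hτσ h1)

theorem turning_transfer {a : ℝ → ℂ} {C : ℝ} (h : IsLoop γ) (ha : IsLoop a)
    (har : Set.range a ⊆ Set.range γ) (hT : Turning C γ) : Turning C a := by
  intro s t hst hts
  have hbd : ∀ x y, Bornology.IsBounded (γ '' Set.Icc x y) :=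
    fun x y => (isCompact_Icc.image h.cont).isBounded
  rcases eq_or_lt_of_le hst with rfl | hst
  · refine (min_le_left _ _).trans ?_
    simp
  rcases eq_or_lt_of_le hts with rfl | hts
  · refine (min_le_right _ _).trans ?_
    simp [ha.per]
  obtain ⟨σ, hσ⟩ := har ⟨s, rfl⟩
  have h2 : a t ∈ γ '' Set.Ico σ (σ + 2 * π) := by
    rw [← h.range_eq σ]; exact har ⟨t, rfl⟩
  obtain ⟨τ, hτ, hτe⟩ := h2
  have hne : σ ≠ τ := by
    rintro rfl
    have := ha.inj s t (by rw [abs_lt]; constructor <;> linarith) (by rw [← hσ, ← hτe])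
    linarith
  have hστ := lt_of_le_of_ne hτ.1 hne
  have key := hT σ τ hστ.le hτ.2.le
  rw [hσ, hτe] at key
  refine le_trans ?_ key
  rcases h.arc_sub_arc ha har hστ hτ.2 hst hts (by rw [hσ, hτe]) with ⟨h1, h2⟩ | ⟨h1, h2⟩
  · exact min_le_min (diam_mono h1 (hbd _ _)) (diam_mono h2 (hbd _ _))
  · rw [min_comm]
    exact min_le_min (diam_mono h2 (hbd _ _)) (diam_mono h1 (hbd _ _))

end IsLoop

/-- The Dirichlet energy of smooth functions controls the energy of their pullback by `a`. -/
def Cap (a : ℝ → ℂ) : Prop :=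
  ∀ φ : ℂ → ℂ, ContDiff ℝ 1 φ → douglasEnergyP (fun θ => φ (a θ))
      ≤ ENNReal.ofReal (4 * π) * ∫⁻ w, ENNReal.ofReal (‖fderiv ℝ φ w‖ ^ 2)

theorem Cap.real {a : ℝ → ℂ} (h : Cap a) {ψ : ℂ → ℝ} (hψ : ContDiff ℝ 1 ψ) :
    douglasEnergyP (fun θ => (ψ (a θ) : ℂ))
      ≤ ENNReal.ofReal (4 * π) * ∫⁻ w, ENNReal.ofReal (‖fderiv ℝ ψ w‖ ^ 2) := by
  refine (h (fun w => (ψ w : ℂ)) (Complex.ofRealCLM.contDiff.comp hψ)).trans ?_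
  gcongr with w
  have hd : DifferentiableAt ℝ ψ w := (hψ.differentiable one_ne_zero) w
  have e : fderiv ℝ (fun w => (ψ w : ℂ)) w = Complex.ofRealCLM.comp (fderiv ℝ ψ w) :=
    (Complex.ofRealCLM.hasFDerivAt.comp w hd.hasFDerivAt).fderiv
  rw [e]
  refine (ContinuousLinearMap.opNorm_comp_le _ _).trans ?_
  rw [Complex.ofRealCLM_norm, one_mul]

theorem exists_bump : ∃ (β : ℂ → ℝ) (B : ℝ), 0 < B ∧ ContDiff ℝ 1 β ∧ (∀ w, 0 ≤ β w) ∧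
    (∀ w, ‖w‖ ≤ 1 → β w = 1) ∧ (∀ w, 2 ≤ ‖w‖ → β w = 0) ∧ (∀ w, ‖fderiv ℝ β w‖ ≤ B) ∧
    (∀ w, fderiv ℝ β w ≠ 0 → 1 ≤ ‖w‖ ∧ ‖w‖ < 2) := by
  let f : ContDiffBump (0 : ℂ) := ⟨1, 3 / 2, one_pos, by norm_num⟩
  have hc : ContDiff ℝ 1 f := f.contDiff
  have hcont : Continuous (fderiv ℝ f) := hc.continuous_fderiv one_ne_zero
  obtain ⟨B, hB⟩ := hcont.bounded_above_of_compact_support (f.hasCompactSupport.fderiv (𝕜 := ℝ))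
  refine ⟨f, max B 1, by positivity, hc, fun w => f.nonneg, fun w hw => ?_, fun w hw => ?_,
    fun w => (hB w).trans (le_max_left _ _), fun w hw => ⟨?_, ?_⟩⟩
  · exact f.one_of_mem_closedBall (by simpa [f] using hw)
  · exact f.zero_of_le_dist (by simp [f]; linarith)
  · by_contra hcon
    apply hw
    have : (f : ℂ → ℝ) =ᶠ[𝓝 w] fun _ => 1 := by
      filter_upwards [isOpen_ball.mem_nhds (show w ∈ ball (0:ℂ) 1 by simpa using hcon)] with z hz
      exact f.one_of_mem_closedBall (ball_subset_closedBall hz)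
    rw [this.fderiv_eq]; simp
  · by_contra hcon
    apply hw
    have : (f : ℂ → ℝ) =ᶠ[𝓝 w] fun _ => 0 := by
      filter_upwards [(isClosed_closedBall (x := (0:ℂ)) (ε := 3 / 2)).isOpen_compl.mem_nhds
        (show w ∈ (closedBall (0:ℂ) (3/2))ᶜ by simp; linarith)] with z hz
      refine f.zero_of_le_dist ?_
      simp at hz ⊢
      exact hz.le
    rw [this.fderiv_eq]; simp

/-- A fixed smooth cutoff function of the plane. -/
noncomputable def β₀ : ℂ → ℝ := exists_bump.choose
/-- A bound for the derivative of the cutoff function. -/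
noncomputable def B₀ : ℝ := exists_bump.choose_spec.choose

theorem β₀_spec : 0 < B₀ ∧ ContDiff ℝ 1 β₀ ∧ (∀ w, 0 ≤ β₀ w) ∧
    (∀ w, ‖w‖ ≤ 1 → β₀ w = 1) ∧ (∀ w, 2 ≤ ‖w‖ → β₀ w = 0) ∧ (∀ w, ‖fderiv ℝ β₀ w‖ ≤ B₀) ∧
    (∀ w, fderiv ℝ β₀ w ≠ 0 → 1 ≤ ‖w‖ ∧ ‖w‖ < 2) := exists_bump.choose_spec.choose_spec

/-- Cutoff function of the disk with centre `p` and radius `r`. -/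
noncomputable def bump (p : ℂ) (r : ℝ) (w : ℂ) : ℝ := β₀ (r⁻¹ • (w - p))

theorem norm_smul_inv {r : ℝ} (hr : 0 < r) (z : ℂ) : ‖r⁻¹ • z‖ = ‖z‖ / r := by
  rw [norm_smul, norm_inv, Real.norm_eq_abs, abs_of_pos hr]; ring

theorem contDiff_bump (p : ℂ) (r : ℝ) : ContDiff ℝ 1 (bump p r) :=
  β₀_spec.2.1.comp (by fun_prop)

theorem bump_nonneg (p : ℂ) (r : ℝ) (w : ℂ) : 0 ≤ bump p r w := β₀_spec.2.2.1 _

theorem bump_eq_one {p w : ℂ} {r : ℝ} (hr : 0 < r) (h : ‖w - p‖ ≤ r) : bump p r w = 1 :=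
  β₀_spec.2.2.2.1 _ (by rw [norm_smul_inv hr]; exact (div_le_one hr).2 h)

theorem bump_eq_zero {p w : ℂ} {r : ℝ} (hr : 0 < r) (h : 2 * r ≤ ‖w - p‖) : bump p r w = 0 :=
  β₀_spec.2.2.2.2.1 _ (by rw [norm_smul_inv hr]; exact (le_div_iff₀ hr).2 h)

theorem fderiv_bump (p : ℂ) (r : ℝ) (w : ℂ) :
    fderiv ℝ (bump p r) w = r⁻¹ • fderiv ℝ β₀ (r⁻¹ • (w - p)) := by
  have h1 : HasFDerivAt (fun w : ℂ => r⁻¹ • (w - p)) (r⁻¹ • ContinuousLinearMap.id ℝ ℂ) w :=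
    ((hasFDerivAt_id w).sub_const p).const_smul r⁻¹
  have h2 := (β₀_spec.2.1.differentiable one_ne_zero (r⁻¹ • (w - p))).hasFDerivAt
  have h3 := h2.comp w h1
  have h4 : HasFDerivAt (bump p r) _ w := h3
  rw [h4.fderiv]
  ext z
  simp

theorem norm_fderiv_bump_le {p w : ℂ} {r : ℝ} (hr : 0 < r) :
    ‖fderiv ℝ (bump p r) w‖ ≤ B₀ / r := by
  rw [fderiv_bump, norm_smul, norm_inv, Real.norm_eq_abs, abs_of_pos hr, inv_mul_eq_div]
  gcongr
  exact β₀_spec.2.2.2.2.2.1 _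

theorem fderiv_bump_ne_zero {p w : ℂ} {r : ℝ} (hr : 0 < r) (h : fderiv ℝ (bump p r) w ≠ 0) :
    r ≤ ‖w - p‖ ∧ ‖w - p‖ < 2 * r := by
  have h1 : fderiv ℝ β₀ (r⁻¹ • (w - p)) ≠ 0 := by
    intro h0
    exact h (by rw [fderiv_bump, h0, smul_zero])
  have h2 := β₀_spec.2.2.2.2.2.2 _ h1
  rw [norm_smul_inv hr, le_div_iff₀ hr, div_lt_iff₀ hr, one_mul] at h2
  exact h2

theorem lintegral_fderiv_bump_le {p : ℂ} {r : ℝ} (hr : 0 < r) :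
    ∫⁻ w, ENNReal.ofReal (‖fderiv ℝ (bump p r) w‖ ^ 2) ≤ ENNReal.ofReal (4 * π * B₀ ^ 2) := by
  calc ∫⁻ w, ENNReal.ofReal (‖fderiv ℝ (bump p r) w‖ ^ 2)
      ≤ ∫⁻ w, (ball p (2 * r)).indicator (fun _ => ENNReal.ofReal ((B₀ / r) ^ 2)) w := by
        refine lintegral_mono fun w => ?_
        by_cases h : fderiv ℝ (bump p r) w = 0
        · simp [h]
        · rw [Set.indicator_of_mem (by
            rw [mem_ball, dist_eq_norm]; exact (fderiv_bump_ne_zero hr h).2)]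
          gcongr
          exact norm_fderiv_bump_le hr
    _ = ENNReal.ofReal (4 * π * B₀ ^ 2) := by
        rw [lintegral_indicator_const measurableSet_ball, Complex.volume_ball,
          ← ENNReal.ofReal_pow (by positivity),
          show (NNReal.pi : ENNReal) = ENNReal.ofReal π by
            rw [← NNReal.coe_real_pi, ENNReal.ofReal_coe_nnreal],
          ← ENNReal.ofReal_mul (by positivity), ← ENNReal.ofReal_mul (by positivity)]
        congr 1
        field_simp
        ring

theorem continuous_norm_fderiv_sq {ψ : ℂ → ℝ} (h : ContDiff ℝ 1 ψ) :
    Continuous fun w => ‖fderiv ℝ ψ w‖ ^ 2 :=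
  ((h.continuous_fderiv one_ne_zero).norm).pow 2

theorem lintegral_fderiv_sum_le {ι : Type*} (T : Finset ι) (p : ι → ℂ) {r : ℝ} (hr : 0 < r) :
    ∫⁻ w, ENNReal.ofReal (‖fderiv ℝ (fun w => ∑ i ∈ T, bump (p i) r w) w‖ ^ 2)
      ≤ ENNReal.ofReal (T.card ^ 2 * (4 * π * B₀ ^ 2)) := by
  have hd : ∀ i w, DifferentiableAt ℝ (bump (p i) r) w :=
    fun i w => (contDiff_bump _ _).differentiable one_ne_zero w
  calc ∫⁻ w, ENNReal.ofReal (‖fderiv ℝ (fun w => ∑ i ∈ T, bump (p i) r w) w‖ ^ 2)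
      ≤ ∫⁻ w, ENNReal.ofReal T.card * ∑ i ∈ T,
          ENNReal.ofReal (‖fderiv ℝ (bump (p i) r) w‖ ^ 2) := by
        refine lintegral_mono fun w => ?_
        rw [← ENNReal.ofReal_sum_of_nonneg fun i _ => by positivity,
          ← ENNReal.ofReal_mul (by positivity)]
        refine ENNReal.ofReal_le_ofReal ?_
        rw [fderiv_fun_sum fun i _ => hd i w]
        refine le_trans ?_ (sq_sum_le_card_mul_sum_sq (s := T))
        gcongr
        exact norm_sum_le _ _
    _ = ENNReal.ofReal T.card *
          ∑ i ∈ T, ∫⁻ w, ENNReal.ofReal (‖fderiv ℝ (bump (p i) r) w‖ ^ 2) := by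
        have hm : ∀ i ∈ T, Measurable fun w =>
            ENNReal.ofReal (‖fderiv ℝ (bump (p i) r) w‖ ^ 2) := fun i _ =>
          (continuous_norm_fderiv_sq (contDiff_bump _ _)).measurable.ennreal_ofReal
        rw [lintegral_const_mul _ (Finset.measurable_fun_sum _ hm), lintegral_finsetSum _ hm]
    _ ≤ ENNReal.ofReal T.card * ∑ i ∈ T, ENNReal.ofReal (4 * π * B₀ ^ 2) := by
        gcongr
        exact lintegral_fderiv_bump_le hr
    _ = _ := by
        rw [Finset.sum_const, nsmul_eq_mul, ← ENNReal.ofReal_natCast,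
            ← ENNReal.ofReal_mul (by positivity),
          ← ENNReal.ofReal_mul (by positivity)]
        congr 1; ring

/-- Average of cutoff functions at dyadic scales. -/
noncomputable def logBump (p : ℂ) (ρ : ℝ) (n : ℕ) (w : ℂ) : ℝ :=
  ∑ k ∈ Finset.range n, (n : ℝ)⁻¹ * bump p (2 ^ k * ρ) w

theorem contDiff_logBump (p : ℂ) (ρ : ℝ) (n : ℕ) : ContDiff ℝ 1 (logBump p ρ n) :=
  ContDiff.sum fun _ _ => contDiff_const.mul (contDiff_bump _ _)

theorem lintegral_fderiv_logBump_le (p : ℂ) {ρ : ℝ} (hρ : 0 < ρ) {n : ℕ} (hn : n ≠ 0) :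
    ∫⁻ w, ENNReal.ofReal (‖fderiv ℝ (logBump p ρ n) w‖ ^ 2)
      ≤ ENNReal.ofReal (4 * π * B₀ ^ 2 / n) := by
  have hd : ∀ k w, DifferentiableAt ℝ (bump p (2 ^ k * ρ)) w :=
    fun i w => (contDiff_bump _ _).differentiable one_ne_zero w
  have hpos : ∀ k : ℕ, 0 < 2 ^ k * ρ := fun k => by positivity
  have huniq : ∀ w, ∀ k l : ℕ, fderiv ℝ (bump p (2 ^ k * ρ)) w ≠ 0 →
      fderiv ℝ (bump p (2 ^ l * ρ)) w ≠ 0 → k ≤ l := by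
    intro w k l hk hl
    by_contra hcon
    have h1 := (fderiv_bump_ne_zero (hpos k) hk).1
    have h2 := (fderiv_bump_ne_zero (hpos l) hl).2
    have h3 : (2:ℝ) ^ (l + 1) ≤ 2 ^ k := pow_le_pow_right₀ (by norm_num) (by omega)
    rw [pow_succ] at h3
    nlinarith
  have hpt : ∀ w, ‖fderiv ℝ (logBump p ρ n) w‖ ^ 2 =
      ∑ k ∈ Finset.range n, ((n : ℝ)⁻¹) ^ 2 * ‖fderiv ℝ (bump p (2 ^ k * ρ)) w‖ ^ 2 := by
    intro w
    have e : fderiv ℝ (logBump p ρ n) w =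
        ∑ k ∈ Finset.range n, (n : ℝ)⁻¹ • fderiv ℝ (bump p (2 ^ k * ρ)) w := by
      have : logBump p ρ n = fun w => ∑ k ∈ Finset.range n, (n : ℝ)⁻¹ * bump p (2 ^ k * ρ) w := rfl
      rw [this, fderiv_fun_sum fun k _ => (hd k w).const_mul _]
      exact Finset.sum_congr rfl fun k _ => fderiv_const_mul (hd k w) _
    rw [e]
    by_cases hex : ∃ k ∈ Finset.range n, fderiv ℝ (bump p (2 ^ k * ρ)) w ≠ 0
    · obtain ⟨k, hk, hk0⟩ := hex
      have h0 : ∀ l ∈ Finset.range n, l ≠ k → fderiv ℝ (bump p (2 ^ l * ρ)) w = 0 := by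
        intro l _ hlk
        by_contra hl
        exact hlk (le_antisymm (huniq w l k hl hk0) (huniq w k l hk0 hl))
      rw [Finset.sum_eq_single_of_mem k hk fun l hl hlk => by rw [h0 l hl hlk, smul_zero],
        Finset.sum_eq_single_of_mem k hk fun l hl hlk => by rw [h0 l hl hlk]; simp,
        norm_smul, mul_pow, Real.norm_eq_abs, sq_abs]
    · push Not at hex
      rw [Finset.sum_eq_zero fun k hk => by rw [hex k hk, smul_zero],
        Finset.sum_eq_zero fun k hk => by rw [hex k hk]; simp]
      simp
  simp only [hpt]
  have hm : ∀ i ∈ Finset.range n, Measurable fun w =>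
      ENNReal.ofReal (((n : ℝ)⁻¹) ^ 2 * ‖fderiv ℝ (bump p (2 ^ i * ρ)) w‖ ^ 2) := fun i _ =>
    ((continuous_norm_fderiv_sq (contDiff_bump _ _)).measurable.const_mul _).ennreal_ofReal
  have hsum : ∀ w, ENNReal.ofReal (∑ k ∈ Finset.range n,
      ((n : ℝ)⁻¹) ^ 2 * ‖fderiv ℝ (bump p (2 ^ k * ρ)) w‖ ^ 2) = ∑ k ∈ Finset.range n,
      ENNReal.ofReal (((n : ℝ)⁻¹) ^ 2 * ‖fderiv ℝ (bump p (2 ^ k * ρ)) w‖ ^ 2) :=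
    fun w => ENNReal.ofReal_sum_of_nonneg fun k _ => by positivity
  simp only [hsum]
  rw [lintegral_finsetSum _ hm]
  calc _ ≤ ∑ k ∈ Finset.range n, ENNReal.ofReal (((n : ℝ)⁻¹) ^ 2 * (4 * π * B₀ ^ 2)) := by
        refine Finset.sum_le_sum fun k _ => ?_
        simp only [ENNReal.ofReal_mul (sq_nonneg ((n : ℝ)⁻¹))]
        rw [lintegral_const_mul _ (continuous_norm_fderiv_sq
          (contDiff_bump _ _)).measurable.ennreal_ofReal]
        gcongr
        exact lintegral_fderiv_bump_le (hpos k)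
    _ = _ := by
        rw [Finset.sum_const, nsmul_eq_mul, Finset.card_range, ← ENNReal.ofReal_natCast,
          ← ENNReal.ofReal_mul (by positivity)]
        congr 1
        have : (n : ℝ) ≠ 0 := by exact_mod_cast hn
        field_simp

theorem logBump_eq_one {p w : ℂ} {ρ : ℝ} (hρ : 0 < ρ) {n : ℕ} (hn : n ≠ 0) (h : ‖w - p‖ ≤ ρ) :
    logBump p ρ n w = 1 := by
  rw [logBump, Finset.sum_congr rfl (g := fun _ => (n : ℝ)⁻¹) fun k _ => by
    have h1 : (1:ℝ) ≤ 2 ^ k := one_le_pow₀ (by norm_num)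
    rw [bump_eq_one (by positivity) (h.trans (by nlinarith)), mul_one]]
  have : (n : ℝ) ≠ 0 := by exact_mod_cast hn
  simp [this]

theorem logBump_eq_zero {p w : ℂ} {ρ : ℝ} (hρ : 0 < ρ) {n : ℕ} (h : 2 ^ n * ρ ≤ ‖w - p‖) :
    logBump p ρ n w = 0 := by
  refine Finset.sum_eq_zero fun k hk => ?_
  have h3 : (2:ℝ) ^ (k + 1) ≤ 2 ^ n :=
    pow_le_pow_right₀ (by norm_num) (Finset.mem_range.1 hk)
  rw [pow_succ] at h3
  rw [bump_eq_zero (by positivity) (le_trans (by nlinarith) h), mul_zero]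

theorem lintegral_window {g : ℝ → ENNReal} (hg : ∀ θ, g (θ + 2 * π) = g θ) (c : ℝ) :
    ∫⁻ θ in Set.Ioc c (c + 2 * π), g θ = ∫⁻ θ in Set.Ioc 0 (2 * π), g θ := by
  have h1 : (fun θ : ℝ => θ + c) ⁻¹' Set.Ioc c (c + 2 * π) = Set.Ioc 0 (2 * π) := by
    ext θ; simp only [Set.mem_preimage, Set.mem_Ioc]
    constructor <;> rintro ⟨h, h'⟩ <;> constructor <;> linarith
  have h2 := (measurePreserving_add_right (volume : Measure ℝ) c).setLIntegral_comp_preimage_emb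
    (MeasurableEquiv.addRight c).measurableEmbedding g (Set.Ioc c (c + 2 * π))
  rw [h1] at h2
  rw [← h2]
  exact lintegral_per_shift hg c

theorem exp_add_period (θ : ℝ) :
    Complex.exp (((θ + 2 * π : ℝ) : ℂ) * Complex.I) = Complex.exp (θ * Complex.I) := by
  push_cast
  rw [add_mul, Complex.exp_add, Complex.exp_two_pi_mul_I, mul_one]

theorem le_energy {u : ℝ → ℂ} (hu : ∀ θ, u (θ + 2 * π) = u θ) (c : ℝ) {I : Set ℝ} {J : ℝ → Set ℝ}
    (hI : I ⊆ Set.Ioc c (c + 2 * π)) (hJ : ∀ θ ∈ I, J θ ⊆ Set.Ioc c (c + 2 * π))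
    (hIm : MeasurableSet I) (hJm : ∀ θ ∈ I, MeasurableSet (J θ))
    {d : ℝ → ℝ} (hd : ∀ θ ∈ I, ∀ σ ∈ J θ,
      ‖Complex.exp (θ * Complex.I) - Complex.exp (σ * Complex.I)‖ ≤ d θ)
    (h1 : ∀ θ ∈ I, ∀ σ ∈ J θ, 1 ≤ ‖u θ - u σ‖) :
    ∫⁻ θ in I, ENNReal.ofReal ((d θ ^ 2)⁻¹) * volume (J θ) ≤ douglasEnergyP u := by
  have e : douglasEnergyP u = ∫⁻ θ in Set.Ioc c (c + 2 * π), ∫⁻ σ in Set.Ioc c (c + 2 * π),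
      ENNReal.ofReal (‖u θ - u σ‖ ^ 2 /
        ‖Complex.exp (θ * Complex.I) - Complex.exp (σ * Complex.I)‖ ^ 2) := by
    rw [lintegral_window (g := fun θ => ∫⁻ σ in Set.Ioc c (c + 2 * π), ENNReal.ofReal
      (‖u θ - u σ‖ ^ 2 / ‖Complex.exp (θ * Complex.I) - Complex.exp (σ * Complex.I)‖ ^ 2))
      (fun θ => by simp only [hu, exp_add_period])]
    unfold douglasEnergyP
    refine lintegral_congr fun θ => ?_
    exact (lintegral_window (g := fun σ => ENNReal.ofReal
      (‖u θ - u σ‖ ^ 2 / ‖Complex.exp (θ * Complex.I) - Complex.exp (σ * Complex.I)‖ ^ 2))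
      (fun σ => by simp only [hu, exp_add_period]) c).symm
  rw [e]
  refine le_trans ?_ (lintegral_mono_set hI)
  refine setLIntegral_mono' hIm fun θ hθ => ?_
  refine le_trans ?_ (lintegral_mono_set (hJ θ hθ))
  rw [← setLIntegral_const]
  refine setLIntegral_mono' (hJm θ hθ) fun σ hσ => ?_
  refine ENNReal.ofReal_le_ofReal ?_
  have hn : 0 < ‖Complex.exp (θ * Complex.I) - Complex.exp (σ * Complex.I)‖ := by
    rw [norm_pos_iff, sub_ne_zero]
    intro h
    have h2 : ee 1 θ = ee 1 σ := by simpa [ee] using h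
    obtain ⟨m, hm⟩ := ee_one_eq_iff.1 h2
    have h3 := h1 θ hθ σ hσ
    have hper : Function.Periodic u (2 * π) := hu
    rw [hm, hper.int_mul m σ, sub_self, norm_zero] at h3
    linarith
  rw [inv_eq_one_div]
  have := hd θ hθ σ hσ
  have h3 := h1 θ hθ σ hσ
  gcongr
  nlinarith

theorem norm_exp_sub_le (θ σ : ℝ) :
    ‖Complex.exp (θ * Complex.I) - Complex.exp (σ * Complex.I)‖ ≤ |θ - σ| := by
  have e : Complex.exp (θ * Complex.I) - Complex.exp (σ * Complex.I) =
      Complex.exp (σ * Complex.I) * (Complex.exp (Complex.I * (θ - σ : ℝ)) - 1) := by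
    rw [mul_sub, ← Complex.exp_add, mul_one]; congr 2; push_cast; ring
  rw [e, norm_mul, Complex.norm_exp_ofReal_mul_I, one_mul]
  exact norm_exp_I_mul_ofReal_sub_one_le

theorem le_energy_box {u : ℝ → ℂ} (hu : ∀ θ, u (θ + 2 * π) = u θ) {x t : ℝ} (ht : 0 < t)
    (ht' : t ≤ π / 2)
    (h1 : ∀ θ ∈ Set.Icc x (x + t), ∀ σ ∈ Set.Icc (x + π) (x + 2 * π - t), 1 ≤ ‖u θ - u σ‖) :
    ENNReal.ofReal (1 / 9) ≤ douglasEnergyP u := by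
  have hpi := pi_pos
  refine le_trans ?_ (le_energy hu x (I := Set.Ioc x (x + t))
    (J := fun _ => Set.Ioc (x + 2 * π - 2 * t) (x + 2 * π - t)) (d := fun _ => 3 * t)
    (fun θ hθ => ⟨hθ.1, by linarith [hθ.2]⟩)
    (fun _ _ σ hσ => ⟨by linarith [hσ.1], by linarith [hσ.2]⟩)
    measurableSet_Ioc (fun _ _ => measurableSet_Ioc) (fun θ hθ σ hσ => ?_) fun θ hθ σ hσ => ?_)
  · simp only [Real.volume_Ioc, lintegral_const, Measure.restrict_apply MeasurableSet.univ,
      Set.univ_inter]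
    rw [← ENNReal.ofReal_mul (by positivity), ← ENNReal.ofReal_mul (by
      have : x + 2 * π - t - (x + 2 * π - 2 * t) = t := by ring
      rw [this]; positivity)]
    refine ENNReal.ofReal_le_ofReal (le_of_eq ?_)
    field_simp
    ring
  · have : Complex.exp (θ * Complex.I) = Complex.exp (((θ + 2 * π : ℝ) : ℂ) * Complex.I) :=
      (exp_add_period θ).symm
    rw [this]
    refine (norm_exp_sub_le _ _).trans ?_
    rw [abs_le]
    constructor <;> linarith [hθ.1, hθ.2, hσ.1, hσ.2]
  · exact h1 θ ⟨hθ.1.le, hθ.2⟩ σ ⟨by linarith [hσ.1], hσ.2⟩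

theorem le_energy_log {u : ℝ → ℂ} (hu : ∀ θ, u (θ + 2 * π) = u θ) {y l m : ℝ} (hl : 0 < l)
    (hm : 2 * l < m) (hmp : l + 2 * m ≤ 2 * π)
    (h1 : ∀ θ ∈ Set.Icc (y - m) y, ∀ σ ∈ Set.Icc (y + l) (y + l + m), 1 ≤ ‖u θ - u σ‖) :
    ENNReal.ofReal (log (m / (2 * l)) / 16) ≤ douglasEnergyP u := by
  refine le_trans ?_ (le_energy hu (y - m) (I := Set.Ioc (y - m / 2) (y - l))
    (J := fun θ => Set.Ioc (y + l + (y - θ)) (y + l + 2 * (y - θ))) (d := fun θ => 4 * (y - θ))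
    (fun θ hθ => ⟨by linarith [hθ.1], by linarith [hθ.2]⟩)
    (fun θ hθ σ hσ => ⟨by linarith [hσ.1, hθ.2], by linarith [hσ.2, hθ.1]⟩)
    measurableSet_Ioc (fun _ _ => measurableSet_Ioc) (fun θ hθ σ hσ => ?_) fun θ hθ σ hσ => ?_)
  · have e : ∫⁻ θ in Set.Ioc (y - m / 2) (y - l), ENNReal.ofReal (((4 * (y - θ)) ^ 2)⁻¹) *
        volume (Set.Ioc (y + l + (y - θ)) (y + l + 2 * (y - θ))) =
        ∫⁻ θ in Set.Ioc (y - m / 2) (y - l), ENNReal.ofReal (1 / 16 * (1 / (y - θ))) := by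
      refine setLIntegral_congr_fun measurableSet_Ioc fun θ hθ => ?_
      have : 0 < y - θ := by linarith [hθ.2]
      simp only [Real.volume_Ioc]
      rw [← ENNReal.ofReal_mul (by positivity)]
      congr 1
      field_simp
      ring
    have hle : y - m / 2 ≤ y - l := by linarith
    have hintble :
        IntervalIntegrable (fun θ => 1 / 16 * (1 / (y - θ))) volume (y - m / 2) (y - l) := by
      refine ContinuousOn.intervalIntegrable ?_
      rw [Set.uIcc_of_le hle]
      refine continuousOn_const.mul (continuousOn_const.div (by fun_prop) fun θ hθ => ?_)
      have : 0 < y - θ := by linarith [hθ.2]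
      exact this.ne'
    have e2 : ∫ θ in (y - m / 2)..(y - l), 1 / 16 * (1 / (y - θ)) = log (m / (2 * l)) / 16 := by
      rw [intervalIntegral.integral_const_mul,
        intervalIntegral.integral_comp_sub_left (fun s => 1 / s),
        integral_one_div_of_pos (by linarith) (by linarith)]
      rw [show y - (y - m / 2) = m / 2 by ring, show y - (y - l) = l by ring, div_div]
      ring
    rw [e, ← e2, intervalIntegral.integral_of_le hle,
      ofReal_integral_eq_lintegral_ofReal ((intervalIntegrable_iff_integrableOn_Ioc_of_le hle).1 hintble)]
    refine (ae_restrict_mem measurableSet_Ioc).mono fun θ hθ => ?_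
    have : 0 < y - θ := by linarith [hθ.2]
    show 0 ≤ _
    positivity
  · refine (norm_exp_sub_le _ _).trans ?_
    rw [abs_le]
    constructor <;> linarith [hθ.1, hθ.2, hσ.1, hσ.2]
  · exact h1 θ ⟨by linarith [hθ.1], by linarith [hθ.2]⟩ σ ⟨by linarith [hσ.1, hθ.2], by linarith [hσ.2, hθ.1]⟩

theorem exists_pos_le_of_periodic {f : ℝ → ℝ} (hc : Continuous f) (hp : ∀ θ, f (θ + 2 * π) = f θ)
    (h0 : ∀ θ, 0 < f θ) : ∃ d, 0 < d ∧ ∀ θ, d ≤ f θ := by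
  obtain ⟨y, -, hy⟩ := (isCompact_Icc (a := (0:ℝ)) (b := 2 * π)).exists_isMinOn
    ⟨0, by constructor <;> positivity⟩ hc.continuousOn
  refine ⟨f y, h0 y, fun θ => ?_⟩
  have hper : Function.Periodic f (2 * π) := hp
  obtain ⟨z, hz, hfz⟩ := hper.exists_mem_Ico₀ two_pi_pos θ
  rw [hfz]
  exact hy ⟨hz.1, hz.2.le⟩

section

variable {a : ℝ → ℂ} {C : ℝ}

theorem IsLoop.bounded_arc (h : IsLoop a) (s t : ℝ) : Bornology.IsBounded (a '' Set.Icc s t) :=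
  (isCompact_Icc.image h.cont).isBounded

theorem IsLoop.exists_diam_arc (h : IsLoop a) :
    ∃ d, 0 < d ∧ ∀ s t, s + π / 2 ≤ t → d ≤ diam (a '' Set.Icc s t) := by
  have hpi := pi_pos
  obtain ⟨d, hd, hd'⟩ := exists_pos_le_of_periodic (f := fun y => ‖a (y + π / 2) - a y‖)
    (by have := h.cont; fun_prop)
    (fun θ => by rw [h.per, show θ + 2 * π + π / 2 = θ + π / 2 + 2 * π by ring, h.per]) (fun θ => by
      rw [norm_pos_iff, sub_ne_zero]
      intro hh
      have := h.inj _ _ (by rw [add_sub_cancel_left, abs_of_pos (by positivity)]; linarith) hh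
      linarith)
  refine ⟨d, hd, fun s t hst => (hd' s).trans ?_⟩
  rw [← dist_eq_norm]
  exact dist_le_diam_of_mem (h.bounded_arc s t) ⟨_, ⟨by linarith, hst⟩, rfl⟩
    ⟨_, ⟨le_rfl, by linarith⟩, rfl⟩

theorem IsLoop.diam_mono (h : IsLoop a) {s t s' t' : ℝ} (hs : s' ≤ s) (ht : t ≤ t') :
    diam (a '' Set.Icc s t) ≤ diam (a '' Set.Icc s' t') :=
  Metric.diam_mono (Set.image_mono (Set.Icc_subset_Icc hs ht)) (h.bounded_arc _ _)

theorem IsLoop.image_add (h : IsLoop a) (s t : ℝ) :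
    a '' Set.Icc (s + 2 * π) (t + 2 * π) = a '' Set.Icc s t := by
  rw [← Set.image_add_const_Icc, Set.image_image]
  simp only [h.per]

theorem IsLoop.arc_separation (h : IsLoop a) (hC : 0 < C) (hT : Turning C a) (hcap : Cap a) :
    ∃ c, 0 < c ∧ ∀ x t, 0 < t → t ≤ π / 2 → ∀ s ∈ Set.Icc (x - t) x, ∀ u ∈ Set.Icc (x + t) (x + π),
      c * diam (a '' Set.Icc (x - t) x) ≤ ‖a s - a u‖ := by
  have hpi := pi_pos
  obtain ⟨d, hd, hd'⟩ := h.exists_diam_arc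
  set D₀ := diam (Set.range a)
  have hDb : Bornology.IsBounded (Set.range a) := h.isCompact_range.isBounded
  have hD : ∀ s t, diam (a '' Set.Icc s t) ≤ D₀ := fun s t =>
    Metric.diam_mono (Set.image_subset_range _ _) hDb
  have hD₀ : 0 < D₀ := hd.trans_le ((hd' 0 (π / 2) (by simp)).trans (hD _ _))
  obtain ⟨n, hn⟩ := exists_nat_gt (9 * (4 * π * (4 * π * B₀ ^ 2)))
  have hn0 : n ≠ 0 := by
    rintro rfl
    have : 0 ≤ 9 * (4 * π * (4 * π * B₀ ^ 2)) := by positivity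
    norm_num at hn; linarith
  set c₁ := min 1 (d / D₀)
  have hc₁ : 0 < c₁ := lt_min one_pos (by positivity)
  refine ⟨min (c₁ / (C ^ 2 * 2 ^ n)) (d / (2 * C * D₀)), lt_min (by positivity) (by positivity), ?_⟩
  intro x t ht ht' s hs u hu
  set c := min (c₁ / (C ^ 2 * 2 ^ n)) (d / (2 * C * D₀))
  have hc : 0 < c := lt_min (by positivity) (by positivity)
  have hc2 : c * (C ^ 2 * 2 ^ n) ≤ c₁ := (le_div_iff₀ (by positivity)).1 (min_le_left _ _)
  have hc3 : c * (2 * C * D₀) ≤ d := (le_div_iff₀ (by positivity)).1 (min_le_right _ _)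
  set D := diam (a '' Set.Icc (x - t) x)
  have hDpos : 0 < D := by
    have h1 : dist (a (x - t)) (a x) ≤ D := dist_le_diam_of_mem (h.bounded_arc _ _)
      ⟨_, ⟨le_rfl, by linarith⟩, rfl⟩ ⟨_, ⟨by linarith, le_rfl⟩, rfl⟩
    refine lt_of_lt_of_le (dist_pos.2 fun hh => ?_) h1
    have := h.inj _ _ (by rw [sub_sub_cancel_left, abs_neg, abs_of_pos ht]; linarith) hh
    linarith
  by_contra hcon
  push Not at hcon
  have hA2 : diam (a '' Set.Icc x (x + t)) ≤ C * (c * D) := by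
    have h1 := (hT s u (by linarith [hs.2, hu.1]) (by linarith [hs.1, hu.2])).trans
      (mul_le_mul_of_nonneg_left hcon.le hC.le)
    rcases min_le_iff.1 h1 with h2 | h2
    · exact (h.diam_mono hs.2 hu.1).trans h2
    · exfalso
      have h3 := (hd' u (s + 2 * π) (by linarith [hs.1, hu.2])).trans h2
      have h4 : C * (c * D) ≤ C * (c * D₀) := by gcongr; exact hD _ _
      linarith
  have h24 : ∀ σ ∈ Set.Icc x (x + t), ∀ τ ∈ Set.Icc (x + π) (x + 2 * π - t),
      c₁ * D ≤ C * ‖a σ - a τ‖ := by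
    intro σ hσ τ hτ
    rcases min_le_iff.1 (hT σ τ (by linarith [hσ.2, hτ.1]) (by linarith [hσ.1, hτ.2])) with h2 | h2
    · refine le_trans ?_ h2
      refine le_trans ?_ (hd' σ τ (by linarith [hσ.2, hτ.1]))
      calc c₁ * D ≤ d / D₀ * D₀ := by
            gcongr
            · exact min_le_right _ _
            · exact hD _ _
        _ = d := by field_simp
    · refine le_trans ?_ h2
      refine le_trans ?_ (h.diam_mono (s := x - t + 2 * π) (t := x + 2 * π) (by linarith [hτ.2])
        (by linarith [hσ.1]))
      rw [h.image_add]
      calc c₁ * D ≤ 1 * D := by gcongr; exact min_le_left _ _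
        _ = D := one_mul _
  have hρ : 0 < C * (c * D) := by positivity
  have hE := (hcap.real (contDiff_logBump (a x) (C * (c * D)) n)).trans
    (mul_le_mul_right (lintegral_fderiv_logBump_le (a x) hρ hn0) _)
  have hlow := le_energy_box (u := fun θ => ((logBump (a x) (C * (c * D)) n (a θ) : ℝ) : ℂ))
    (fun θ => by simp only [h.per]) (x := x) ht ht' (fun σ hσ τ hτ => by
      have h1 : logBump (a x) (C * (c * D)) n (a σ) = 1 := by
        refine logBump_eq_one hρ hn0 ?_
        rw [← dist_eq_norm]
        exact (dist_le_diam_of_mem (h.bounded_arc _ _) ⟨σ, hσ, rfl⟩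
          ⟨x, ⟨le_rfl, by linarith⟩, rfl⟩).trans hA2
      have h2 : logBump (a x) (C * (c * D)) n (a τ) = 0 := by
        refine logBump_eq_zero hρ ?_
        have h3 := h24 x ⟨le_rfl, by linarith⟩ τ hτ
        rw [norm_sub_rev]
        have h4 : c * (C ^ 2 * 2 ^ n) * D ≤ c₁ * D := by gcongr
        have h5 : C * (2 ^ n * (C * (c * D))) ≤ C * ‖a x - a τ‖ := by
          refine le_trans (le_of_eq ?_) (h4.trans h3); ring
        exact le_of_mul_le_mul_left h5 hC
      simp [h1, h2])
  have h5 := hlow.trans hE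
  rw [← ENNReal.ofReal_mul (by positivity), ENNReal.ofReal_le_ofReal_iff (by positivity)] at h5
  have hn' : (0:ℝ) < n := by positivity
  rw [← mul_div_assoc, div_le_div_iff₀ (by norm_num) hn'] at h5
  linarith

theorem exists_cover {ε : ℝ} (hε : 0 < ε) :
    ∃ T : Finset ℂ, ∀ z : ℂ, ‖z‖ ≤ 1 → ∃ p ∈ T, ‖z - p‖ ≤ ε := by
  obtain ⟨T, -, hT, hc⟩ := (isCompact_closedBall (0:ℂ) 1).finite_cover_balls hε
  refine ⟨hT.toFinset, fun z hz => ?_⟩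
  have h1 := hc (show z ∈ closedBall (0:ℂ) 1 by simpa using hz)
  simp only [Set.mem_iUnion, mem_ball, dist_eq_norm, exists_prop] at h1
  obtain ⟨p, hp, h⟩ := h1
  exact ⟨p, by simpa using hp, h.le⟩

variable {b : ℝ → ℂ} {H : ℝ → ℝ}

theorem doubling_right (h : IsLoop a) (hbp : ∀ θ, b (θ + 2 * π) = b θ) (hC : 0 < C)
    (hT : Turning C a) (hcap : Cap a)
    (hcapb : Cap b) (hab : ∀ θ, a θ = b (H θ)) (hc : Continuous H) (hm : StrictMono H)
    (hp : ∀ θ, H (θ + 2 * π) = H θ + 2 * π) :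
    ∃ M, 0 < M ∧ ∀ x t, 0 < t → H x - H (x - t) ≤ M * (H (x + t) - H x) := by
  have hpi := pi_pos
  obtain ⟨c, hcpos, hsep⟩ := h.arc_separation hC hT hcap
  obtain ⟨δ, hδ, hδ'⟩ := exists_pos_le_of_periodic (f := fun y => H (y + π / 2) - H y)
    (by fun_prop) (fun θ => by
      rw [hp, show θ + 2 * π + π / 2 = θ + π / 2 + 2 * π by ring, hp]; ring)
    (fun θ => sub_pos.2 (hm (by linarith)))
  obtain ⟨T, hTc⟩ := exists_cover (ε := c / 4) (by positivity)
  set E₀ := 4 * π * ((T.card : ℝ) ^ 2 * (4 * π * B₀ ^ 2))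
  have hE₀ : 0 ≤ E₀ := by positivity
  set K := 2 * exp (16 * E₀)
  have hK : 2 ≤ K := by
    have := one_le_exp (x := 16 * E₀) (by positivity)
    simp only [K]; linarith
  have hmain : ∀ x t, 0 < t → t ≤ π / 2 →
      min (H x - H (x - t)) (H (x + π) - H (x + t)) ≤ K * (H (x + t) - H x) := by
    intro x t ht ht'
    set D := diam (a '' Set.Icc (x - t) x)
    set l := H (x + t) - H x
    set m := min (H x - H (x - t)) (H (x + π) - H (x + t))
    have hl : 0 < l := sub_pos.2 (hm (by linarith))
    rcases le_or_gt m (2 * l) with h2 | h2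
    · exact h2.trans (by gcongr)
    have hDpos : 0 < D := by
      have h1 : dist (a (x - t)) (a x) ≤ D := dist_le_diam_of_mem (h.bounded_arc _ _)
        ⟨_, ⟨le_rfl, by linarith⟩, rfl⟩ ⟨_, ⟨by linarith, le_rfl⟩, rfl⟩
      refine lt_of_lt_of_le (dist_pos.2 fun hh => ?_) h1
      have := h.inj _ _ (by rw [sub_sub_cancel_left, abs_neg, abs_of_pos ht]; linarith) hh
      linarith
    classical
    set T' := T.filter fun p => ∃ s ∈ Set.Icc (x - t) x, ‖a s - (a x + D * p)‖ ≤ c * D / 4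
    have hr : 0 < c * D / 4 := by positivity
    set ψ : ℂ → ℝ := fun w => ∑ p ∈ T', bump (a x + D * p) (c * D / 4) w
    have hψ : ContDiff ℝ 1 ψ := ContDiff.sum fun _ _ => contDiff_bump _ _
    have hE := (hcapb.real hψ).trans (mul_le_mul_right
      (lintegral_fderiv_sum_le T' (fun p => a x + D * p) hr) _)
    have hψ1 : ∀ s ∈ Set.Icc (x - t) x, 1 ≤ ψ (a s) := by
      intro s hs
      have h1 : ‖a s - a x‖ ≤ D := by
        rw [← dist_eq_norm]
        exact dist_le_diam_of_mem (h.bounded_arc _ _) ⟨s, hs, rfl⟩ ⟨x, ⟨by linarith, le_rfl⟩, rfl⟩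
      have hD' : (D : ℂ) ≠ 0 := by exact_mod_cast hDpos.ne'
      obtain ⟨p, hpT, hp1⟩ := hTc ((a s - a x) / D) (by
        rw [norm_div, Complex.norm_real, Real.norm_of_nonneg hDpos.le]
        exact (div_le_one hDpos).2 h1)
      have h3 : ‖a s - (a x + D * p)‖ ≤ c * D / 4 := by
        have e : a s - (a x + D * p) = D * ((a s - a x) / D - p) := by field_simp; ring
        rw [e, norm_mul, Complex.norm_real, Real.norm_of_nonneg hDpos.le]
        nlinarith
      have h4 : bump (a x + D * p) (c * D / 4) (a s) = 1 := bump_eq_one hr h3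
      rw [← h4]
      exact Finset.single_le_sum (f := fun p => bump (a x + D * p) (c * D / 4) (a s))
        (fun _ _ => bump_nonneg _ _ _) (Finset.mem_filter.2 ⟨hpT, s, hs, h3⟩)
    have hψ0 : ∀ u ∈ Set.Icc (x + t) (x + π), ψ (a u) = 0 := by
      intro u hu
      refine Finset.sum_eq_zero fun p hp => ?_
      obtain ⟨-, s, hs, h3⟩ := Finset.mem_filter.1 hp
      refine bump_eq_zero hr ?_
      have h4 := hsep x t ht ht' s hs u hu
      have h5 : ‖a s - a u‖ ≤ ‖a s - (a x + D * p)‖ + ‖a u - (a x + D * p)‖ := by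
        have := norm_sub_le (a s - (a x + D * p)) (a u - (a x + D * p))
        simpa using this
      have h4' : c * D ≤ ‖a s - a u‖ := h4
      linarith
    have hlow := le_energy_log (u := fun θ => (ψ (b θ) : ℂ)) (fun θ => by simp only [hbp])
      (y := H x) hl h2 (by
        have e1 : m ≤ _ := min_le_left _ _
        have e2 : m ≤ _ := min_le_right _ _
        have e3 := hp (x - π)
        rw [show x - π + 2 * π = x + π by ring] at e3
        have e4 := hm.monotone (show x - π ≤ x - t by linarith)
        simp only [l]
        linarith) (fun θ hθ σ hσ => by
        obtain ⟨s, hs, rfl⟩ := intermediate_value_Icc (show x - t ≤ x by linarith) hc.continuousOn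
          (show θ ∈ Set.Icc (H (x - t)) (H x) from ⟨by
            have e1 : m ≤ H x - H (x - t) := min_le_left _ _
            linarith [hθ.1], hθ.2⟩)
        obtain ⟨u, hu, rfl⟩ := intermediate_value_Icc (show x + t ≤ x + π by linarith)
          hc.continuousOn
          (show σ ∈ Set.Icc (H (x + t)) (H (x + π)) from ⟨by
            have := hσ.1; simp only [l] at this; linarith, by
            have e1 : m ≤ H (x + π) - H (x + t) := min_le_right _ _
            have := hσ.2; simp only [l] at this; linarith⟩)
        rw [← hab, ← hab, hψ0 u hu, Complex.ofReal_zero, sub_zero, Complex.norm_real]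
        exact (hψ1 s hs).trans (le_abs_self _))
    have h5 := hlow.trans hE
    rw [← ENNReal.ofReal_mul (by positivity), ENNReal.ofReal_le_ofReal_iff (by positivity)] at h5
    have h6 : 4 * π * ((T'.card : ℝ) ^ 2 * (4 * π * B₀ ^ 2)) ≤ E₀ := by
      simp only [E₀]
      gcongr
      exact Finset.filter_subset _ _
    have h7 : log (m / (2 * l)) ≤ 16 * E₀ := by linarith
    have hm0 : 0 < m := by linarith
    rw [log_le_iff_le_exp (by positivity), div_le_iff₀ (by positivity)] at h7
    simp only [K]
    linarith
  have hmono := hm.monotone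
  have hδπ : δ ≤ 2 * π := by
    have h1 := hδ' 0
    have h2 := hmono (show (0:ℝ) + π / 2 ≤ 0 + 2 * π by linarith)
    have h3 := hp 0
    linarith
  set M := max ((1 + 2 * π / δ) * K) (6 * π / δ + 3)
  refine ⟨M, by positivity, fun x t ht => ?_⟩
  have hl : 0 < H (x + t) - H x := sub_pos.2 (hm (by linarith))
  rcases le_or_gt t (π / 2) with ht' | ht'
  · refine le_trans ?_ (mul_le_mul_of_nonneg_right (le_max_left _ _) hl.le)
    rcases min_le_iff.1 (hmain x t ht ht') with h1 | h1
    · refine h1.trans ?_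
      have : K ≤ (1 + 2 * π / δ) * K := by
        have : 0 ≤ 2 * π / δ * K := by positivity
        linarith
      gcongr
    · have h2 := hδ' (x + t)
      have h3 := hmono (show x + t + π / 2 ≤ x + π by linarith)
      have h4 : δ ≤ K * (H (x + t) - H x) := by linarith
      have h5 : H x - H (x - t) ≤ 2 * π := by
        have e3 := hp (x - 2 * π)
        rw [show x - 2 * π + 2 * π = x by ring] at e3
        have := hmono (show x - 2 * π ≤ x - t by linarith)
        linarith
      have h6 : 2 * π ≤ 2 * π / δ * (K * (H (x + t) - H x)) := by
        rw [div_mul_eq_mul_div, le_div_iff₀ hδ]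
        gcongr
      have h7 : 0 ≤ K * (H (x + t) - H x) := by positivity
      linarith
  · refine le_trans ?_ (mul_le_mul_of_nonneg_right (le_max_right _ _) hl.le)
    set k : ℕ := ⌊t / (2 * π)⌋₊
    have hk1 : (k : ℝ) * (2 * π) ≤ t :=
      (le_div_iff₀ two_pi_pos).1 (Nat.floor_le (by positivity))
    have hk2 : t < (k + 1) * (2 * π) :=
      (div_lt_iff₀ two_pi_pos).1 (Nat.lt_floor_add_one _)
    have e1 := lift_add_int hp x k
    have e2 := lift_add_int hp x (-(k + 1))
    have e3 := lift_add_int hp (x + t) (-k)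
    push_cast at e1 e2
    have h1 := hmono (show x + -(k + 1) * (2 * π) ≤ x - t by linarith)
    have h2 := hmono (show x + k * (2 * π) ≤ x + t by linarith)
    have h3 : δ ≤ H (x + t) - H x := by
      have h4 := hmono (show x + π / 2 ≤ x + t by linarith)
      linarith [hδ' x]
    have h4 : H x - H (x - t) ≤ (k + 1) * (2 * π) := by linarith
    have h5 : k * (2 * π) ≤ H (x + t) - H x := by linarith
    have h6 : 6 * π ≤ 6 * π / δ * (H (x + t) - H x) := by
      rw [div_mul_eq_mul_div, le_div_iff₀ hδ]
      gcongr
    nlinarith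

theorem doubling (h : IsLoop a) (hbl : IsLoop b) (hC : 0 < C)
    (hT : Turning C a) (hcap : Cap a)
    (hcapb : Cap b) (hab : ∀ θ, a θ = b (H θ)) (hc : Continuous H) (hm : StrictMono H)
    (hp : ∀ θ, H (θ + 2 * π) = H θ + 2 * π) :
    ∃ M, 0 < M ∧ (∀ x t, 0 < t → H (x + t) - H x ≤ M * (H x - H (x - t))) ∧
      ∀ x t, 0 < t → H x - H (x - t) ≤ M * (H (x + t) - H x) := by
  obtain ⟨M, hM, hr⟩ := doubling_right h hbl.per hC hT hcap hcapb hab hc hm hp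
  have hneg : ∀ {f : ℝ → ℂ}, IsLoop f → IsLoop fun θ => f (-θ) := fun hf =>
    ⟨hf.cont.comp continuous_neg, fun θ => by
      rw [show -(θ + 2 * π) = -θ - 2 * π by ring, ← hf.per, sub_add_cancel], fun s t hst hh => by
      have := hf.inj (-s) (-t) (by rwa [show -s - -t = -(s - t) by ring, abs_neg]) hh
      linarith⟩
  have hcapneg : ∀ {f : ℝ → ℂ}, IsLoop f → Cap f → Cap fun θ => f (-θ) := fun {f} hf hcf φ hφ => by
    have := hcf φ hφ
    rwa [← energy_comp_neg (u := fun θ => φ (f θ)) (hφ.continuous.comp hf.cont)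
      (fun θ => by simp only [hf.per])] at this
  have hTn : Turning C fun θ => a (-θ) :=
    h.turning_transfer (hneg h) (by rintro _ ⟨θ, rfl⟩; exact ⟨-θ, rfl⟩) hT
  obtain ⟨M', hM', hr'⟩ := doubling_right (hneg h) (hneg hbl).per hC hTn (hcapneg h hcap)
    (hcapneg hbl hcapb) (H := fun θ => -H (-θ)) (fun θ => by simp [hab]) (by fun_prop)
    (fun s t hst => neg_lt_neg (hm (neg_lt_neg hst))) (fun θ => by
      have := hp (-(θ + 2 * π))
      rw [show -(θ + 2 * π) + 2 * π = -θ by ring] at this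
      simp only [this]; ring)
  refine ⟨max M M', by positivity, fun x t ht => ?_, fun x t ht => ?_⟩
  · have h1 := hr' (-x) t ht
    rw [neg_neg, show -(-x - t) = x + t by ring, show -(-x + t) = x - t by ring] at h1
    have h2 : 0 ≤ H x - H (x - t) := sub_nonneg.2 (hm.monotone (by linarith))
    calc _ = -H x - -H (x + t) := by ring
      _ ≤ _ := h1
      _ = M' * (H x - H (x - t)) := by ring
      _ ≤ _ := by gcongr; exact le_max_right _ _
  · have h2 : 0 ≤ H (x + t) - H x := sub_nonneg.2 (hm.monotone (by linarith))
    exact (hr x t ht).trans (by gcongr; exact le_max_left _ _)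

end

/-- Square-summable two-sided sequences. -/
noncomputable abbrev X := lp (fun _ : ℤ => ℂ) 2

/-- Standard basis of `X`. -/
noncomputable def bs (n : ℤ) : X := lp.single 2 n (1 : ℂ)

theorem bs_apply (n m : ℤ) : (bs n : ℤ → ℂ) m = if m = n then 1 else 0 := by
  split_ifs with h
  · subst h; exact lp.single_apply_self _ _ _
  · exact lp.single_apply_ne _ _ _ h

theorem norm_sq_eq (x : X) : HasSum (fun n => ‖x n‖ ^ 2) (‖x‖ ^ 2) := by
  simpa using lp.hasSum_norm (p := 2) (by norm_num) x

theorem hasSum_bs (x : X) : HasSum (fun n => x n • bs n) x := by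
  have := lp.hasSum_single (p := 2) (by norm_num) x
  refine this.congr_fun ?_
  intro n
  rw [bs, ← lp.single_smul, smul_eq_mul, mul_one]

theorem hasSum_coord {ι : Type*} {f : ι → X} {x : X} (h : HasSum f x) (m : ℤ) :
    HasSum (fun i => (f i : ℤ → ℂ) m) (x m) := by
  have := h.mapL (lp.evalCLM ℂ (fun _ : ℤ => ℂ) 2 m)
  exact this

theorem hasSum_map (T : X →L[ℂ] X) (x : X) (m : ℤ) :
    HasSum (fun n => x n * (T (bs n)) m) (T x m) := by
  have := hasSum_coord ((hasSum_bs x).mapL T) m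
  simpa using this

theorem clm_ext {T U : X →L[ℂ] X} (h : ∀ n m, T (bs n) m = U (bs n) m) : T = U := by
  ext x m
  refine (hasSum_map T x m).unique ?_
  simp only [h]
  exact hasSum_map U x m

theorem inner_bs (n : ℤ) (x : X) : inner ℂ (bs n) x = x n := by
  rw [bs, lp.inner_single_left]; simp

theorem adjoint_bs (T : X →L[ℂ] X) (n m : ℤ) :
    (ContinuousLinearMap.adjoint T) (bs n) m = starRingEnd ℂ (T (bs m) n) := by
  rw [← inner_bs, ContinuousLinearMap.adjoint_inner_right, ← inner_conj_symm, inner_bs]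

theorem norm_sum_bs_sq (s : Finset ℤ) (x : ℤ → ℂ) :
    ‖∑ n ∈ s, x n • bs n‖ ^ 2 = ∑ n ∈ s, ‖x n‖ ^ 2 := by
  have h := norm_sq_eq (∑ n ∈ s, x n • bs n)
  refine h.unique ?_
  have e : ∀ m, (∑ n ∈ s, x n • bs n : X) m = if m ∈ s then x m else 0 := by
    intro m
    rw [lp.coeFn_sum]
    simp [bs_apply]
  simp only [e]
  rw [← Finset.sum_congr rfl fun m hm => show ‖if m ∈ s then x m else 0‖ ^ 2
      = ‖x m‖ ^ 2 by simp [hm]]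
  exact hasSum_sum_of_ne_finset_zero (s := s) (f := fun m => ‖if m ∈ s then x m else 0‖ ^ 2)
    (fun m hm => by simp [hm])

theorem exists_clm_of_columns (c : ℤ → X) (K : ℝ)
    (h : ∀ (s : Finset ℤ) (x : ℤ → ℂ), ‖∑ n ∈ s, x n • c n‖ ≤ K * √(∑ n ∈ s, ‖x n‖ ^ 2)) :
    ∃ T : X →L[ℂ] X, ∀ n, T (bs n) = c n := by
  have hK : 0 ≤ K := by
    have h1 := h {0} fun _ => 1
    simp only [Finset.sum_singleton, norm_one, one_pow, sqrt_one, mul_one] at h1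
    exact (norm_nonneg _).trans h1
  have hs : ∀ x : X, Summable fun n => x n • c n := by
    intro x
    rw [summable_iff_vanishing_norm]
    intro ε hε
    obtain ⟨s, hs⟩ := summable_iff_vanishing_norm.1 (norm_sq_eq x).summable ((ε / (K + 1)) ^ 2)
      (by positivity)
    refine ⟨s, fun t ht => (h t x).trans_lt ?_⟩
    have h1 := hs t ht
    rw [Real.norm_of_nonneg (Finset.sum_nonneg fun _ _ => by positivity)] at h1
    have h2 : √(∑ n ∈ t, ‖x n‖ ^ 2) ≤ ε / (K + 1) := by
      rw [sqrt_le_left (by positivity)]; exact h1.le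
    calc K * √(∑ n ∈ t, ‖x n‖ ^ 2) ≤ K * (ε / (K + 1)) := by gcongr
      _ < (K + 1) * (ε / (K + 1)) := by
          have : 0 < ε / (K + 1) := by positivity
          nlinarith
      _ = ε := by field_simp
  let L : X →ₗ[ℂ] X :=
    { toFun := fun x => ∑' n, x n • c n
      map_add' := fun x y => by
        rw [← (hs x).tsum_add (hs y)]
        exact tsum_congr fun n => by rw [← add_smul]; rfl
      map_smul' := fun r x => by
        rw [RingHom.id_apply, ← (hs x).tsum_const_smul]
        exact tsum_congr fun n => by rw [smul_smul]; rfl }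
  refine ⟨L.mkContinuous K fun x => ?_, fun n => ?_⟩
  · refine le_of_tendsto (hs x).hasSum.norm (Eventually.of_forall fun s => (h s x).trans ?_)
    gcongr
    rw [sqrt_le_left (norm_nonneg _)]
    exact sum_le_hasSum s (fun _ _ => by positivity) (norm_sq_eq x)
  · show ∑' m, (bs n : ℤ → ℂ) m • c m = c n
    rw [tsum_eq_single n fun m hm => by rw [bs_apply, if_neg hm, zero_smul], bs_apply, if_pos rfl,
      one_smul]

theorem exists_mask (Q : ℤ → Prop) :
    ∃ T : X →L[ℂ] X, (∀ x n, Q n → T x n = x n) ∧ ∀ x n, ¬ Q n → T x n = 0 := by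
  classical
  obtain ⟨T, hT⟩ := exists_clm_of_columns (fun n => if Q n then bs n else 0) 1 fun s x => by
    rw [one_mul, Real.le_sqrt (norm_nonneg _) (Finset.sum_nonneg fun _ _ => by positivity)]
    have : ∑ n ∈ s, x n • (if Q n then bs n else 0) =
        ∑ n ∈ s, (if Q n then x n else 0) • bs n :=
      Finset.sum_congr rfl fun n _ => by split_ifs <;> simp
    rw [this, norm_sum_bs_sq]
    gcongr with n
    split_ifs <;> simp
  have e : ∀ x m, T x m = if Q m then x m else 0 := by
    intro x m
    refine (hasSum_map T x m).unique ?_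
    simp only [hT]
    convert hasSum_single m (f := fun n => x n * ((if Q n then bs n else 0 : X) : ℤ → ℂ) m)
      (fun n hn => ?_) using 1
    · split_ifs <;> simp [bs_apply]
    · split_ifs <;> simp [bs_apply, hn.symm]
  exact ⟨T, fun x n hn => by rw [e, if_pos hn], fun x n hn => by rw [e, if_neg hn]⟩

theorem exists_of_summable {f : ℤ → ℂ} (h : Summable fun n => ‖f n‖ ^ 2) :
    ∃ x : X, ∀ n, x n = f n :=
  ⟨⟨f, memℓp_gen (by simpa using h)⟩, fun _ => rfl⟩

/-- `x` lists the Fourier coefficients of `u`, normalised for the `Ḣ^{1/2}` seminorm. -/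
structure Rep (u : ℝ → ℂ) (x : X) : Prop where
  memLp : MemLp u 2 per
  coord : ∀ n, x n = (√|(n : ℝ)| : ℝ) * fc u n

theorem norm_sq_coord (c : ℂ) (n : ℤ) : ‖((√|(n : ℝ)| : ℝ) : ℂ) * c‖ ^ 2 = |(n : ℝ)| * ‖c‖ ^ 2 := by
  rw [norm_mul, mul_pow, Complex.norm_real, Real.norm_of_nonneg (sqrt_nonneg _),
    sq_sqrt (abs_nonneg _)]

theorem Rep.energy {u : ℝ → ℂ} {x : X} (h : Rep u x) :
    douglasEnergyP u = ENNReal.ofReal (4 * π ^ 2 * ‖x‖ ^ 2) := by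
  rw [energy_eq h.memLp, ENNReal.ofReal_mul (p := 4 * π ^ 2) (by positivity),
    ← (norm_sq_eq x).tsum_eq,
    ENNReal.ofReal_tsum_of_nonneg (fun _ => by positivity) (norm_sq_eq x).summable]
  congr 1
  refine tsum_congr fun n => ?_
  rw [h.coord, norm_sq_coord]

theorem exists_rep_of_summable {u : ℝ → ℂ} (hu : MemLp u 2 per)
    (h : Summable fun n : ℤ => |(n : ℝ)| * ‖fc u n‖ ^ 2) : ∃ x, Rep u x := by
  obtain ⟨x, hx⟩ := exists_of_summable (f := fun n => ((√|(n : ℝ)| : ℝ) : ℂ) * fc u n)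
    (by simpa only [norm_sq_coord] using h)
  exact ⟨x, hu, hx⟩

theorem exists_rep {u : ℝ → ℂ} (hu : MemLp u 2 per) (h : douglasEnergyP u < ⊤) : ∃ x, Rep u x := by
  refine exists_rep_of_summable hu ?_
  rw [energy_eq hu] at h
  have h1 : ∑' n : ℤ, ENNReal.ofReal (|(n : ℝ)| * ‖fc u n‖ ^ 2) ≠ ⊤ := by
    intro h2
    rw [h2, ENNReal.mul_top (by simp)] at h
    exact lt_irrefl _ h
  have h2 := ENNReal.summable_toReal h1
  refine h2.congr fun n => ?_
  rw [ENNReal.toReal_ofReal (by positivity)]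

theorem Rep.zero_coord {u : ℝ → ℂ} {x : X} (h : Rep u x) : x 0 = 0 := by
  rw [h.coord]; simp

theorem Rep.fc_eq {u : ℝ → ℂ} {x : X} (h : Rep u x) {n : ℤ} (hn : n ≠ 0) :
    fc u n = x n / (√|(n : ℝ)| : ℝ) := by
  rw [h.coord, mul_div_cancel_left₀]
  have : (0:ℝ) < √|(n : ℝ)| := sqrt_pos.2 (abs_pos.2 (by exact_mod_cast hn))
  exact Complex.ofReal_ne_zero.2 this.ne'

theorem Rep.congr_ae {u v : ℝ → ℂ} {x : X} (h : Rep u x) (huv : u =ᵐ[per] v) : Rep v x :=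
  ⟨(memLp_congr_ae huv).1 h.memLp, fun n => by rw [h.coord, fc_congr huv]⟩

theorem Rep.add {u v : ℝ → ℂ} {x y : X} (h : Rep u x) (h' : Rep v y) :
    Rep (fun θ => u θ + v θ) (x + y) :=
  ⟨h.memLp.add h'.memLp, fun n => by
    rw [fc_add (integrable_of_memLp_two h.memLp) (integrable_of_memLp_two h'.memLp), mul_add,
      ← h.coord, ← h'.coord]; rfl⟩

theorem Rep.sub {u v : ℝ → ℂ} {x y : X} (h : Rep u x) (h' : Rep v y) :
    Rep (fun θ => u θ - v θ) (x - y) :=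
  ⟨h.memLp.sub h'.memLp, fun n => by
    rw [fc_sub (integrable_of_memLp_two h.memLp) (integrable_of_memLp_two h'.memLp), mul_sub,
      ← h.coord, ← h'.coord]; rfl⟩

theorem Rep.const_mul {u : ℝ → ℂ} {x : X} (h : Rep u x) (c : ℂ) :
    Rep (fun θ => c * u θ) (c • x) :=
  ⟨h.memLp.const_mul c, fun n => by
    rw [fc_const_mul, mul_left_comm, ← h.coord]; rfl⟩

theorem rep_zero : Rep (fun _ => 0) 0 :=
  ⟨MemLp.zero, fun n => by rw [show fc (fun _ => 0) n = 0 by simp [fc]]; simp⟩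

theorem rep_const (c : ℂ) : Rep (fun _ => c) 0 :=
  ⟨memLp_const c, fun n => by
    have h : (fun _ : ℝ => c) = fun θ => c * ee 0 θ := by simp [ee]
    rw [h, fc_const_mul, fc_ee]
    by_cases hn : n = 0 <;> simp [hn]⟩

theorem Rep.sum {ι : Type*} (s : Finset ι) {u : ι → ℝ → ℂ} {x : ι → X}
    (h : ∀ i ∈ s, Rep (u i) (x i)) : Rep (fun θ => ∑ i ∈ s, u i θ) (∑ i ∈ s, x i) := by
  classical
  induction s using Finset.induction_on with
  | empty => simpa using rep_zero
  | insert a s ha ih =>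
    simp only [Finset.sum_insert ha]
    exact (h a (by simp)).add (ih fun i hi => h i (by simp [hi]))

theorem rep_ee {n : ℤ} : Rep (ee n) (((√|(n : ℝ)| : ℝ) : ℂ) • bs n) :=
  ⟨memLp_of_continuous (continuous_ee n) 2, fun m => by
    rw [fc_ee, lp.coeFn_smul, Pi.smul_apply, bs_apply]
    by_cases h : m = n <;> simp [h]⟩

theorem exists_fun_rep (x : X) (h0 : x 0 = 0) : ∃ u : ℝ → ℂ, Measurable u ∧
    (∀ θ, u (θ + 2 * π) = u θ) ∧ Rep u x ∧ fc u 0 = 0 := by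
  have hs : Summable fun n : ℤ => ‖x n / ((√|(n : ℝ)| : ℝ) : ℂ)‖ ^ 2 := by
    refine Summable.of_nonneg_of_le (fun _ => by positivity) (fun n => ?_) (norm_sq_eq x).summable
    rcases eq_or_ne n 0 with rfl | hn
    · simp [h0]
    · have h1 : (1:ℝ) ≤ |(n : ℝ)| := by exact_mod_cast Int.one_le_abs hn
      rw [norm_div, Complex.norm_real, Real.norm_of_nonneg (sqrt_nonneg _), div_pow,
        sq_sqrt (abs_nonneg _)]
      exact div_le_self (by positivity) h1
  obtain ⟨u, hu, hp, hm, hf⟩ := exists_fc_eq hs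
  refine ⟨u, hu, hp, ⟨hm, fun n => ?_⟩, by rw [hf, h0, zero_div]⟩
  rw [hf]
  rcases eq_or_ne n 0 with rfl | hn
  · simp [h0]
  · rw [mul_div_cancel₀]
    have : (0:ℝ) < √|(n : ℝ)| := sqrt_pos.2 (abs_pos.2 (by exact_mod_cast hn))
    exact Complex.ofReal_ne_zero.2 this.ne'

/-- A lift of a circle homeomorphism together with its inverse. -/
structure Inv (H K : ℝ → ℝ) : Prop where
  cont : Continuous H
  mono : StrictMono H
  per : ∀ θ, H (θ + 2 * π) = H θ + 2 * π
  right : ∀ t, H (K t) = t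
  left : ∀ θ, K (H θ) = θ

section
variable {H K : ℝ → ℝ}

theorem exists_inv (hc : Continuous H) (hm : StrictMono H) (hp : ∀ θ, H (θ + 2 * π) = H θ + 2 * π) :
    ∃ K, Inv H K := by
  have hsurj : Function.Surjective H := by
    refine hc.surjective ?_ ?_
    · refine tendsto_atTop_atTop.2 fun y => ?_
      obtain ⟨k, hk⟩ := exists_nat_gt ((y - H 0) / (2 * π))
      refine ⟨k * (2 * π), fun x hx => ?_⟩
      have h1 := lift_add_int hp 0 k
      rw [zero_add] at h1
      push_cast at h1
      rw [div_lt_iff₀ two_pi_pos] at hk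
      have := hm.monotone hx
      linarith
    · refine tendsto_atBot_atBot.2 fun y => ?_
      obtain ⟨k, hk⟩ := exists_nat_gt ((H 0 - y) / (2 * π))
      refine ⟨(-k : ℤ) * (2 * π), fun x hx => ?_⟩
      have h1 := lift_add_int hp 0 (-k)
      rw [zero_add] at h1
      rw [div_lt_iff₀ two_pi_pos] at hk
      have := hm.monotone hx
      rw [h1] at this
      push_cast at this
      linarith
  exact ⟨Function.surjInv hsurj, hc, hm, hp, Function.surjInv_eq hsurj,
    Function.leftInverse_surjInv ⟨hm.injective, hsurj⟩⟩

theorem Inv.symm (h : Inv H K) : Inv K H := by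
  have hmono : StrictMono K := fun s t hst => by
    rw [← h.mono.lt_iff_lt, h.right, h.right]; exact hst
  refine ⟨?_, hmono, fun t => ?_, h.left, h.right⟩
  · exact hmono.monotone.continuous_of_surjective fun θ => ⟨H θ, h.left θ⟩
  · apply h.mono.injective
    rw [h.right, h.per, h.right]

theorem Inv.le_iff (h : Inv H K) {σ t : ℝ} : σ ≤ K t ↔ H σ ≤ t := by
  rw [← h.mono.le_iff_le, h.right]

theorem Inv.integral_comp_mul (h : Inv H K) {A a' u u' : ℝ → ℂ}
    (ha : IntervalIntegrable a' volume 0 (2 * π))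
    (hA : ∀ θ ∈ Set.Icc 0 (2 * π), A θ = A 0 + ∫ σ in 0..θ, a' σ)
    (hu : ∀ t, HasDerivAt u (u' t) t) (hu' : Continuous u') :
    ∫ θ in 0..(2 * π), u (H θ) * a' θ =
      u (H (2 * π)) * A (2 * π) - u (H 0) * A 0 - ∫ t in (H 0)..(H (2 * π)), A (K t) * u' t := by
  have hpi := pi_pos
  have h2π : (0:ℝ) ≤ 2 * π := by positivity
  have hH : H 0 ≤ H (2 * π) := h.mono.monotone h2π
  have hai : Integrable a' (volume.restrict (Set.Ioc 0 (2 * π))) :=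
    (intervalIntegrable_iff_integrableOn_Ioc_of_le h2π).1 ha
  have hui : Integrable u' (volume.restrict (Set.Ioc (H 0) (H (2 * π)))) :=
    (hu'.integrableOn_Icc (a := H 0) (b := H (2 * π))).mono_set Set.Ioc_subset_Icc_self
  set μ := volume.restrict (Set.Ioc (H 0) (H (2 * π)))
  set ν := volume.restrict (Set.Ioc 0 (2 * π))
  let f : ℝ × ℝ → ℂ := {p : ℝ × ℝ | H p.2 ≤ p.1}.indicator fun p => u' p.1 * a' p.2
  have hset : MeasurableSet {p : ℝ × ℝ | H p.2 ≤ p.1} :=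
    (isClosed_le (h.cont.comp continuous_snd) continuous_fst).measurableSet
  have hf : Integrable f (μ.prod ν) := (hui.mul_prod hai).indicator hset
  have hsw := integral_integral_swap (f := fun t σ => f (t, σ)) hf
  have e1 : ∀ t ∈ Set.Ioc (H 0) (H (2 * π)), ∫ σ, f (t, σ) ∂ν = u' t * (A (K t) - A 0) := by
    intro t ht
    have hk0 : 0 ≤ K t := h.le_iff.2 ht.1.le
    have hk1 : K t ≤ 2 * π := by
      have := h.symm.mono.monotone ht.2
      rwa [h.left] at this
    have e : (fun σ => f (t, σ)) = (Set.Iic (K t)).indicator fun σ => u' t * a' σ := by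
      funext σ
      by_cases hσ : H σ ≤ t
      · rw [Set.indicator_of_mem (by exact h.le_iff.2 hσ)]
        exact Set.indicator_of_mem (s := {p : ℝ × ℝ | H p.2 ≤ p.1}) (by exact hσ) _
      · rw [Set.indicator_of_notMem (by rw [Set.mem_Iic, h.le_iff]; exact hσ)]
        exact Set.indicator_of_notMem (s := {p : ℝ × ℝ | H p.2 ≤ p.1}) (by exact hσ) _
    rw [e, integral_indicator measurableSet_Iic, Measure.restrict_restrict measurableSet_Iic,
      Set.inter_comm, Set.Ioc_inter_Iic, min_eq_right hk1,
      integral_const_mul, hA _ ⟨hk0, hk1⟩, intervalIntegral.integral_of_le hk0]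
    ring
  have e2 : ∀ σ ∈ Set.Ioc 0 (2 * π), ∫ t, f (t, σ) ∂μ = a' σ * (u (H (2 * π)) - u (H σ)) := by
    intro σ hσ
    have h0 : H 0 < H σ := h.mono hσ.1
    have h1 : H σ ≤ H (2 * π) := h.mono.monotone hσ.2
    have e : (fun t => f (t, σ)) = (Set.Ici (H σ)).indicator fun t => u' t * a' σ := by
      funext t
      by_cases hσ : H σ ≤ t
      · rw [Set.indicator_of_mem (by exact hσ)]
        exact Set.indicator_of_mem (s := {p : ℝ × ℝ | H p.2 ≤ p.1}) (by exact hσ) _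
      · rw [Set.indicator_of_notMem (by exact hσ)]
        exact Set.indicator_of_notMem (s := {p : ℝ × ℝ | H p.2 ≤ p.1}) (by exact hσ) _
    have hIcc : Set.Ici (H σ) ∩ Set.Ioc (H 0) (H (2 * π)) = Set.Icc (H σ) (H (2 * π)) := by
      ext t
      simp only [Set.mem_inter_iff, Set.mem_Ici, Set.mem_Ioc, Set.mem_Icc]
      constructor
      · rintro ⟨h, -, h'⟩; exact ⟨h, h'⟩
      · rintro ⟨h, h'⟩; exact ⟨h, h0.trans_le h, h'⟩
    rw [e, integral_indicator measurableSet_Ici, Measure.restrict_restrict measurableSet_Ici, hIcc,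
      integral_mul_const, integral_Icc_eq_integral_Ioc, ← intervalIntegral.integral_of_le h1,
      intervalIntegral.integral_eq_sub_of_hasDerivAt (fun t _ => hu t)
        (hu'.intervalIntegrable _ _)]
    ring
  have hl : ∫ t, ∫ σ, f (t, σ) ∂ν ∂μ =
      (∫ t in (H 0)..(H (2 * π)), A (K t) * u' t) - A 0 * (u (H (2 * π)) - u (H 0)) := by
    have hcont : ContinuousOn A (Set.Icc 0 (2 * π)) := by
      refine ContinuousOn.congr ?_ hA
      refine continuousOn_const.add ?_
      have := intervalIntegral.continuousOn_primitive_interval (μ := volume) (f := a') (a := 0)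
        (b := 2 * π) (by
          rw [Set.uIcc_of_le h2π, integrableOn_Icc_iff_integrableOn_Ioc]; exact hai)
      rwa [Set.uIcc_of_le h2π] at this
    have hAi : IntervalIntegrable (fun t => A (K t) * u' t) volume (H 0) (H (2 * π)) := by
      refine ContinuousOn.intervalIntegrable ?_
      rw [Set.uIcc_of_le hH]
      refine (hcont.comp h.symm.cont.continuousOn fun t ht => ?_).mul hu'.continuousOn
      refine ⟨h.le_iff.2 ht.1, ?_⟩
      have := h.symm.mono.monotone ht.2
      rwa [h.left] at this
    rw [setIntegral_congr_fun measurableSet_Ioc e1, ← intervalIntegral.integral_of_le hH,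
      ← intervalIntegral.integral_eq_sub_of_hasDerivAt (fun t _ => hu t)
        (hu'.intervalIntegrable (H 0) (H (2 * π))), ← intervalIntegral.integral_const_mul,
      ← intervalIntegral.integral_sub hAi ((hu'.intervalIntegrable _ _).const_mul _)]
    exact intervalIntegral.integral_congr fun t _ => by ring
  have hr : ∫ σ, ∫ t, f (t, σ) ∂μ ∂ν =
      u (H (2 * π)) * (A (2 * π) - A 0) - ∫ θ in 0..(2 * π), u (H θ) * a' θ := by
    have huc : Continuous fun θ => u (H θ) :=
      (continuous_iff_continuousAt.2 fun t => (hu t).continuousAt).comp h.cont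
    rw [setIntegral_congr_fun measurableSet_Ioc e2, ← intervalIntegral.integral_of_le h2π,
      hA (2 * π) ⟨h2π, le_rfl⟩, add_sub_cancel_left, ← intervalIntegral.integral_const_mul,
      ← intervalIntegral.integral_sub (ha.const_mul _)
        (ha.continuousOn_mul huc.continuousOn)]
    exact intervalIntegral.integral_congr fun t _ => by ring
  rw [hl, hr] at hsw
  linear_combination hsw

theorem integral_window {g : ℝ → ℂ} (hg : ∀ θ, g (θ + 2 * π) = g θ) (c : ℝ) :
    ∫ t in c..(c + 2 * π), g t = ∫ t in 0..(2 * π), g t := by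
  have hper : Function.Periodic g (2 * π) := hg
  have := hper.intervalIntegral_add_eq c 0
  rwa [zero_add] at this

theorem Inv.integral_comp_mul_periodic (h : Inv H K) {A a' u u' : ℝ → ℂ}
    (ha : IntervalIntegrable a' volume 0 (2 * π))
    (hA : ∀ θ ∈ Set.Icc 0 (2 * π), A θ = A 0 + ∫ σ in 0..θ, a' σ)
    (hAp : ∀ θ, A (θ + 2 * π) = A θ)
    (hu : ∀ t, HasDerivAt u (u' t) t) (hu' : Continuous u') (hup : ∀ θ, u (θ + 2 * π) = u θ)
    (hup' : ∀ θ, u' (θ + 2 * π) = u' θ) :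
    ∫ θ in 0..(2 * π), u (H θ) * a' θ = -∫ t in 0..(2 * π), A (K t) * u' t := by
  have h1 := h.integral_comp_mul ha hA hu hu'
  have e1 := h.per 0
  have e2 := hAp 0
  rw [zero_add] at e1 e2
  rw [h1, e1, e2, hup, integral_window fun t => by rw [h.symm.per, hAp, hup']]
  ring

end

/-- Polarised Parseval identity. -/
theorem hasSum_parseval {w z : ℝ → ℂ} (hw : MemLp w 2 per) (hz : MemLp z 2 per) :
    HasSum (fun n => starRingEnd ℂ (fc w n) * fc z n)
      ((1 / (2 * π) : ℝ) * ∫ θ in 0..(2 * π), starRingEnd ℂ (w θ) * z θ) := by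
  have pol : ∀ a b : ℂ, starRingEnd ℂ a * b = (1 / 4 : ℂ) * (((‖b + 1 * a‖ ^ 2 : ℝ) : ℂ) -
      ((‖b + (-1) * a‖ ^ 2 : ℝ) : ℂ) + Complex.I * ((‖b + Complex.I * a‖ ^ 2 : ℝ) : ℂ) -
      Complex.I * ((‖b + (-Complex.I) * a‖ ^ 2 : ℝ) : ℂ)) := by
    intro a b
    simp only [← Complex.normSq_eq_norm_sq, Complex.normSq_eq_conj_mul_self, map_add, map_mul,
      map_neg, map_one, Complex.conj_I]
    have hI := Complex.I_sq
    linear_combination ((1/2 : ℂ) * (starRingEnd ℂ a) * b - (1/2) * a * starRingEnd ℂ b) * hI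
  have hm : ∀ c : ℂ, MemLp (fun θ => z θ + c * w θ) 2 per := fun c => hz.add (hw.const_mul c)
  have key : ∀ c : ℂ, HasSum (fun n => ((‖fc z n + c * fc w n‖ ^ 2 : ℝ) : ℂ))
      ((1 / (2 * π) : ℝ) * ∫ θ in 0..(2 * π), ((‖z θ + c * w θ‖ ^ 2 : ℝ) : ℂ)) := by
    intro c
    have := Complex.hasSum_ofReal.2 (parseval (hm c))
    rw [Complex.ofReal_mul, ← intervalIntegral.integral_ofReal] at this
    refine this.congr_fun fun n => ?_
    rw [fc_add (integrable_of_memLp_two hz) (integrable_of_memLp_two (hw.const_mul c)),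
        fc_const_mul]
  have hintble : ∀ c :
      ℂ, IntervalIntegrable (fun θ => ((‖z θ + c * w θ‖ ^ 2 : ℝ) : ℂ)) volume 0 (2 * π) := by
    intro c
    rw [intervalIntegrable_iff_integrableOn_Ioc_of_le two_pi_pos.le]
    exact ((memLp_two_iff_integrable_sq_norm (hm c).1).1 (hm c)).ofReal
  have hs := ((((key 1).sub (key (-1))).add ((key Complex.I).mul_left Complex.I)).sub
    ((key (-Complex.I)).mul_left Complex.I)).mul_left (1 / 4 : ℂ)
  have e : ∫ θ in 0..(2 * π), starRingEnd ℂ (w θ) * z θ = (1 / 4 : ℂ) *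
      ((∫ θ in 0..(2 * π), ((‖z θ + 1 * w θ‖ ^ 2 : ℝ) : ℂ)) -
        (∫ θ in 0..(2 * π), ((‖z θ + (-1) * w θ‖ ^ 2 : ℝ) : ℂ)) +
        Complex.I * (∫ θ in 0..(2 * π), ((‖z θ + Complex.I * w θ‖ ^ 2 : ℝ) : ℂ)) -
        Complex.I * ∫ θ in 0..(2 * π), ((‖z θ + (-Complex.I) * w θ‖ ^ 2 : ℝ) : ℂ)) := by
    rw [← intervalIntegral.integral_const_mul Complex.I,
        ← intervalIntegral.integral_const_mul Complex.I,
      ← intervalIntegral.integral_sub (hintble _) (hintble _),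
      ← intervalIntegral.integral_add ((hintble _).sub (hintble _)) ((hintble _).const_mul _),
      ← intervalIntegral.integral_sub (((hintble _).sub (hintble _)).add ((hintble _).const_mul _))
        ((hintble _).const_mul _), ← intervalIntegral.integral_const_mul]
    exact intervalIntegral.integral_congr fun θ _ => pol _ _
  rw [e]
  have e' : ∀ c x y z w : ℂ, c * (1 / 4 * (x - y + Complex.I * z - Complex.I * w)) =
      1 / 4 * (c * x - c * y + Complex.I * (c * z) - Complex.I * (c * w)) := by
    intro c x y z w; ring
  rw [e']
  exact hs.congr_fun fun n => pol _ _

/-- Projection of `X` onto the negative modes. -/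
noncomputable def Pm : X →L[ℂ] X := (exists_mask (· < 0)).choose

theorem Pm_apply (x : X) (n : ℤ) : Pm x n = if n < 0 then x n else 0 := by
  split_ifs with h
  · exact (exists_mask (· < 0)).choose_spec.1 x n h
  · exact (exists_mask (· < 0)).choose_spec.2 x n h

/-- The symmetry of `X` with sign `-1` on negative modes. -/
noncomputable def Sg : X →L[ℂ] X := 1 - (2 : ℂ) • Pm

/-- Signs of `Sg`. -/
noncomputable def sg (n : ℤ) : ℂ := if n < 0 then -1 else 1

theorem sg_mul_sg (n : ℤ) : sg n * sg n = 1 := by unfold sg; split_ifs <;> norm_num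

theorem conj_sg (n : ℤ) : starRingEnd ℂ (sg n) = sg n := by unfold sg; split_ifs <;> simp

theorem Sg_apply (x : X) (n : ℤ) : Sg x n = sg n * x n := by
  show x n - 2 * Pm x n = _
  rw [Pm_apply, sg]
  split_ifs <;> ring

theorem Sg_Sg (x : X) : Sg (Sg x) = x := by
  ext n; rw [Sg_apply, Sg_apply, ← mul_assoc, sg_mul_sg, one_mul]

theorem Sg_bs (n : ℤ) : Sg (bs n) = sg n • bs n := by
  ext m
  rw [Sg_apply]
  show _ = sg n * bs n m
  rw [bs_apply]
  split_ifs with h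
  · rw [h]
  · simp

theorem Sg_adjoint : Sg.adjoint = Sg := by
  refine clm_ext fun n m => ?_
  rw [adjoint_bs, Sg_apply, Sg_apply, bs_apply, bs_apply, map_mul, conj_sg]
  by_cases h : m = n
  · subst h; simp
  · rw [if_neg h, if_neg (Ne.symm h)]; simp

theorem Pm_Pm (x : X) : Pm (Pm x) = Pm x := by
  ext n; simp only [Pm_apply]; split_ifs <;> rfl

theorem Pm_adjoint : Pm.adjoint = Pm := by
  refine clm_ext fun n m => ?_
  rw [adjoint_bs, Pm_apply, Pm_apply, bs_apply, bs_apply]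
  by_cases h : m = n
  · subst h; split_ifs <;> simp
  · rw [if_neg h, if_neg (Ne.symm h)]; simp

theorem Sg_Pm (x : X) : Sg (Pm x) = -Pm x := by
  ext n
  show _ = -(Pm x n)
  rw [Sg_apply, Pm_apply, sg]
  split_ifs <;> simp

theorem Pm_Sg (x : X) : Pm (Sg x) = -Pm x := by
  ext n
  show _ = -(Pm x n)
  rw [Pm_apply, Pm_apply, Sg_apply, sg]
  split_ifs <;> simp

theorem norm_sq_Pm (x : X) : ‖x‖ ^ 2 = ‖Pm x‖ ^ 2 + ‖x - Pm x‖ ^ 2 := by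
  refine (norm_sq_eq x).unique ?_
  refine ((norm_sq_eq (Pm x)).add (norm_sq_eq (x - Pm x))).congr_fun fun n => ?_
  rw [show (x - Pm x : X) n = x n - Pm x n from rfl, Pm_apply]
  split_ifs <;> simp

theorem inner_Sg (x : X) : RCLike.re (inner ℂ x (Sg x)) = ‖x - Pm x‖ ^ 2 - ‖Pm x‖ ^ 2 := by
  have e : Sg x = (x - Pm x) - Pm x := by
    ext n
    show _ = (x n - Pm x n) - Pm x n
    rw [Sg_apply, Pm_apply, sg]; split_ifs <;> simp
  have o : inner ℂ (x - Pm x) (Pm x) = 0 := by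
    have h := ContinuousLinearMap.adjoint_inner_left Pm (Pm x) x
    rw [Pm_adjoint, Pm_Pm] at h
    rw [inner_sub_left, h, sub_self]
  have o' : inner ℂ (Pm x) (x - Pm x) = 0 := by
    rw [← inner_conj_symm, o, map_zero]
  have : inner ℂ x (Sg x) = inner ℂ (x - Pm x) (x - Pm x) - inner ℂ (Pm x) (Pm x) := by
    rw [e]
    nth_rewrite 1 [show x = (x - Pm x) + Pm x by abel]
    rw [inner_add_left, inner_sub_right, inner_sub_right (Pm x), o, o']
    ring
  rw [this, map_sub, inner_self_eq_norm_sq, inner_self_eq_norm_sq]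

section
variable {H K : ℝ → ℝ}

/-- `C` is the composition operator `u ↦ u ∘ H` in normalised Fourier coordinates. -/
structure IsComp (H : ℝ → ℝ) (C : X →L[ℂ] X) : Prop where
  col : ∀ n : ℤ, n ≠ 0 → Rep (fun θ => ee n (H θ)) (((√|(n : ℝ)| : ℝ) : ℂ) • C (bs n))
  zero : C (bs 0) = bs 0

theorem sqrt_abs_pos {n : ℤ} (hn : n ≠ 0) : 0 < √|(n : ℝ)| :=
  sqrt_pos.2 (abs_pos.2 (by exact_mod_cast hn))

theorem sqrt_abs_ne {n : ℤ} (hn : n ≠ 0) : ((√|(n : ℝ)| : ℝ) : ℂ) ≠ 0 :=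
  Complex.ofReal_ne_zero.2 (sqrt_abs_pos hn).ne'

theorem exists_isComp (hc : Continuous H) {A : ℝ}
    (hA : ∀ (N : ℕ) (x : ℤ → ℂ),
      douglasEnergyP (fun θ => ∑ n ∈ Finset.Icc (-(N : ℤ)) N, x n * ee n (H θ))
        ≤ ENNReal.ofReal A * ∑ n ∈ Finset.Icc (-(N : ℤ)) N,
            ENNReal.ofReal (|(n : ℝ)| * ‖x n‖ ^ 2)) :
    ∃ C, IsComp H C := by
  classical
  have hcont : ∀ n, Continuous fun θ => ee n (H θ) := fun n => (continuous_ee n).comp hc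
  have hfin : ∀ (s : Finset ℤ) (x : ℤ → ℂ),
      douglasEnergyP (fun θ => ∑ n ∈ s, x n * ee n (H θ))
        ≤ ENNReal.ofReal A * ∑ n ∈ s, ENNReal.ofReal (|(n : ℝ)| * ‖x n‖ ^ 2) := by
    intro s x
    obtain ⟨N, hN⟩ : ∃ N : ℕ, s ⊆ Finset.Icc (-(N : ℤ)) N := by
      refine ⟨s.sup Int.natAbs, fun n hn => ?_⟩
      have := Finset.le_sup (f := Int.natAbs) hn
      rw [Finset.mem_Icc]
      omega
    have := hA N (fun n => if n ∈ s then x n else 0)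
    rw [← Finset.sum_subset hN fun n _ hn => by simp [hn]] at this
    refine le_trans (le_of_eq ?_) (this.trans (le_of_eq ?_))
    · congr 1; funext θ
      rw [← Finset.sum_subset hN fun n _ hn => by simp [hn]]
      exact Finset.sum_congr rfl fun n hn => by simp [hn]
    · congr 1
      exact Finset.sum_congr rfl fun n hn => by simp [hn]
  have hE : ∀ n, ∃ x, Rep (fun θ => ee n (H θ)) x := by
    intro n
    refine exists_rep (memLp_of_continuous (hcont n) 2) ?_
    have := hfin {n} (fun _ => 1)
    simp only [Finset.sum_singleton, one_mul] at this
    exact this.trans_lt (ENNReal.mul_lt_top ENNReal.ofReal_lt_top ENNReal.ofReal_lt_top)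
  choose x hx using hE
  let c : ℤ → X := fun n => if n = 0 then bs 0 else (((√|(n : ℝ)| : ℝ) : ℂ))⁻¹ • x n
  have hbound : ∀ (s : Finset ℤ) (y : ℤ → ℂ), (0 : ℤ) ∉ s →
      ‖∑ n ∈ s, y n • c n‖ ≤ √(|A| / (4 * π ^ 2)) * √(∑ n ∈ s, ‖y n‖ ^ 2) := by
    intro s y h0
    have hne : ∀ n ∈ s, n ≠ 0 := fun n hn h => h0 (h ▸ hn)
    have hr : Rep (fun θ => ∑ n ∈ s, (y n / ((√|(n : ℝ)| : ℝ) : ℂ)) * ee n (H θ))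
        (∑ n ∈ s, y n • c n) := by
      refine Rep.sum s fun n hn => ?_
      have := (hx n).const_mul (y n / ((√|(n : ℝ)| : ℝ) : ℂ))
      rwa [show y n • c n = (y n / ((√|(n : ℝ)| : ℝ) : ℂ)) • x n by
        simp only [c, if_neg (hne n hn)]; rw [smul_smul, div_eq_mul_inv]]
    have h1 := hfin s fun n => y n / ((√|(n : ℝ)| : ℝ) : ℂ)
    rw [hr.energy, ← ENNReal.ofReal_sum_of_nonneg fun n _ => by positivity,
      ← ENNReal.ofReal_mul' (Finset.sum_nonneg fun n _ => by positivity),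
      Finset.sum_congr rfl (g := fun n => ‖y n‖ ^ 2) fun n hn => by
        rw [norm_div, Complex.norm_real, norm_of_nonneg (sqrt_nonneg _), div_pow,
            sq_sqrt (abs_nonneg _)]
        have : (0:ℝ) < |(n:ℝ)| := abs_pos.2 (by exact_mod_cast hne n hn)
        field_simp] at h1
    have hS : 0 ≤ ∑ n ∈ s, ‖y n‖ ^ 2 := Finset.sum_nonneg fun n _ => by positivity
    have h2 : 4 * π ^ 2 * ‖∑ n ∈ s, y n • c n‖ ^ 2 ≤ |A| * ∑ n ∈ s, ‖y n‖ ^ 2 := by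
      have h3 := h1.trans (ENNReal.ofReal_le_ofReal
        (mul_le_mul_of_nonneg_right (le_abs_self A) hS))
      rwa [ENNReal.ofReal_le_ofReal_iff (by positivity)] at h3
    rw [← sqrt_mul (by positivity)]
    refine le_sqrt_of_sq_le ?_
    rw [div_mul_eq_mul_div, le_div_iff₀ (by positivity)]
    linarith
  obtain ⟨C, hC⟩ := exists_clm_of_columns c (√(|A| / (4 * π ^ 2)) + 1) fun s y => by
    have hle : ∀ t ⊆ s, √(∑ n ∈ t, ‖y n‖ ^ 2) ≤ √(∑ n ∈ s, ‖y n‖ ^ 2) := fun t ht =>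
      sqrt_le_sqrt (Finset.sum_le_sum_of_subset_of_nonneg ht fun n _ _ => by positivity)
    have h1 := (hbound (s.erase 0) y (Finset.notMem_erase _ _)).trans
      (mul_le_mul_of_nonneg_left (hle _ (Finset.erase_subset 0 s)) (sqrt_nonneg _))
    by_cases h0 : (0:ℤ) ∈ s
    · rw [← Finset.add_sum_erase _ _ h0]
      refine (norm_add_le _ _).trans ?_
      have h2 : ‖y 0 • c 0‖ ≤ √(∑ n ∈ s, ‖y n‖ ^ 2) := by
        rw [norm_smul, show c 0 = bs 0 from if_pos rfl, show ‖bs 0‖ = 1 by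
          rw [bs, lp.norm_single (by norm_num)]; simp, mul_one]
        have := hle {0} (by simpa using h0)
        rwa [Finset.sum_singleton, sqrt_sq (norm_nonneg _)] at this
      linarith
    · rw [Finset.erase_eq_of_notMem h0] at h1
      have := sqrt_nonneg (∑ n ∈ s, ‖y n‖ ^ 2)
      linarith
  refine ⟨C, fun n hn => ?_, by rw [hC]; exact if_pos rfl⟩
  rw [hC, show c n = (((√|(n : ℝ)| : ℝ) : ℂ))⁻¹ • x n from if_neg hn,
      smul_inv_smul₀ (sqrt_abs_ne hn)]
  exact hx n

end

section
variable {H K : ℝ → ℝ} {C : X →L[ℂ] X}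

theorem hasSum_inner (x y : X) : HasSum (fun n => starRingEnd ℂ (x n) * y n) (inner ℂ x y) := by
  have := lp.hasSum_inner (𝕜 := ℂ) x y
  refine this.congr_fun fun n => ?_
  rw [RCLike.inner_apply, mul_comm]

theorem Rep.coord_ext {u : ℝ → ℂ} {x y : X} (h : Rep u x) (h' : Rep u y) : x = y := by
  ext n; rw [h.coord, h'.coord]

theorem fc_comp_aux (h : Inv H K) {y : ℝ → ℂ} (hy : Continuous y)
    (hyp : ∀ θ, y (θ + 2 * π) = y θ) {n : ℤ} {L : ℂ}
    (hL : Tendsto (fun ε : ℝ => ∑' k, starRingEnd ℂ (fc (fun θ => ee n (H θ)) k) *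
      (((ee k ε - 1) / ε) * fc y k)) (𝓝[>] 0) (𝓝 L)) :
    n * Complex.I * fc (fun t => y (K t)) n = L := by
  have hcont : Continuous fun θ => ee n (H θ) := (continuous_ee n).comp h.cont
  set A : ℝ → ℝ → ℂ := fun ε θ => (ε : ℂ)⁻¹ * ∫ σ in θ..(θ + ε), y σ with hAdef
  set a : ℝ → ℝ → ℂ := fun ε θ => (ε : ℂ)⁻¹ * (y (θ + ε) - y θ) with hadef
  have hy1 : ∀ c d, IntervalIntegrable y volume c d := fun c d => hy.intervalIntegrable c d
  have hA' : ∀ ε θ, HasDerivAt (A ε) (a ε θ) θ := by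
    intro ε θ
    have hp : ∀ t, HasDerivAt (fun x => ∫ σ in (0:ℝ)..x, y σ) (y t) t := fun t =>
      intervalIntegral.integral_hasDerivAt_right (hy1 _ _)
        (hy.stronglyMeasurableAtFilter _ _) hy.continuousAt
    have h1 : HasDerivAt (fun x => ∫ σ in (0:ℝ)..(x + ε), y σ) (y (θ + ε)) θ :=
      (hp (θ + ε)).comp_add_const θ ε
    have e : A ε = fun θ => (ε : ℂ)⁻¹ * ((∫ σ in (0:ℝ)..(θ + ε), y σ) - ∫ σ in (0:ℝ)..θ, y σ) := by
      funext θ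
      rw [hAdef]; dsimp only
      rw [intervalIntegral.integral_interval_sub_left (hy1 _ _) (hy1 _ _)]
    rw [e]
    exact (h1.sub (hp θ)).const_mul _
  have hac : ∀ ε, Continuous (a ε) := fun ε => by
    rw [hadef]; dsimp only; fun_prop
  have hApc : ∀ ε, Continuous (A ε) := fun ε =>
    continuous_iff_continuousAt.2 fun θ => (hA' ε θ).continuousAt
  have hAp : ∀ ε θ, A ε (θ + 2 * π) = A ε θ := by
    intro ε θ
    rw [hAdef]; dsimp only
    rw [show θ + 2 * π + ε = (θ + ε) + 2 * π by ring,
      ← intervalIntegral.integral_comp_add_right (f := y) (a := θ) (b := θ + ε) (2 * π)]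
    simp only [hyp]
  have key : ∀ ε, n * Complex.I * fc (fun t => A ε (K t)) n =
      ∑' k, starRingEnd ℂ (fc (fun θ => ee n (H θ)) k) * (((ee k ε - 1) / ε) * fc y k) := by
    intro ε
    have h1 := h.integral_comp_mul_periodic (A := A ε) (a' := a ε) (u := ee (-n))
      (u' := fun t => ((-n : ℤ) : ℂ) * Complex.I * ee (-n) t)
      ((hac ε).intervalIntegrable _ _)
      (fun θ _ => by
        rw [intervalIntegral.integral_eq_sub_of_hasDerivAt (fun t _ => hA' ε t)
          ((hac ε).intervalIntegrable _ _)]; ring)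
      (hAp ε) (fun t => hasDerivAt_ee _ _) (by have := continuous_ee (-n); fun_prop)
      (fun θ => ee_period _ _) (fun θ => by rw [ee_period])
    have h2 := (hasSum_parseval (memLp_of_continuous hcont 2)
        (memLp_of_continuous (hac ε) 2)).tsum_eq
    have h3 : ∀ k, fc (a ε) k = ((ee k ε - 1) / ε) * fc y k := by
      intro k
      rw [hadef]; dsimp only
      rw [fc_const_mul, fc_sub (integrable_of_continuous (by fun_prop))
          (integrable_of_continuous hy),
        fc_shift hyp]
      ring
    simp only [h3, conj_ee] at h2
    rw [h2, h1]
    have e : ∫ t in 0..(2 * π), A ε (K t) * (((-n : ℤ) : ℂ) * Complex.I * ee (-n) t) =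
        (((-n : ℤ) : ℂ) * Complex.I) * ∫ t in 0..(2 * π), ee (-n) t * A ε (K t) := by
      rw [← intervalIntegral.integral_const_mul]
      exact intervalIntegral.integral_congr fun t _ => by ring
    rw [e]
    unfold fc
    push_cast
    ring
  have hlim :
      Tendsto (fun ε : ℝ => fc (fun t => A ε (K t)) n) (𝓝[>] 0) (𝓝 (fc (fun t => y (K t)) n)) := by
    obtain ⟨B, hB⟩ : ∃ B, ∀ θ, ‖y θ‖ ≤ B := by
      obtain ⟨B, hB⟩ :=
          (isCompact_Icc (a := (0:ℝ)) (b := 2 * π)).exists_bound_of_continuousOn hy.continuousOn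
      refine ⟨B, fun θ => ?_⟩
      obtain ⟨s, hs, e⟩ := Function.Periodic.exists_mem_Ico₀ (f := y) hyp two_pi_pos θ
      rw [e]; exact hB s ⟨hs.1, hs.2.le⟩
    unfold fc
    refine Tendsto.const_mul _ ?_
    refine intervalIntegral.tendsto_integral_filter_of_dominated_convergence (fun _ =>
        B) ?_ ?_ ?_ ?_
    · exact Eventually.of_forall fun ε => ((continuous_ee _).mul
        ((hApc ε).comp h.symm.cont)).aestronglyMeasurable
    · filter_upwards [self_mem_nhdsWithin] with ε hε
      refine Eventually.of_forall fun t _ => ?_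
      have hε : 0 < ε := hε
      rw [norm_mul, norm_ee, one_mul, hAdef]
      dsimp only
      rw [norm_mul, norm_inv, Complex.norm_real, norm_of_nonneg hε.le]
      have := intervalIntegral.norm_integral_le_of_norm_le_const (a := K t) (b := K t + ε) (f := y)
        fun x _ => hB x
      rw [add_sub_cancel_left, abs_of_pos hε] at this
      rw [inv_mul_le_iff₀ hε, mul_comm]
      exact this
    · exact intervalIntegrable_const
    · refine Eventually.of_forall fun t _ => Tendsto.const_mul _ ?_
      have hp : HasDerivAt (fun x => ∫ σ in (0:ℝ)..x, y σ) (y (K t)) (K t) :=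
        intervalIntegral.integral_hasDerivAt_right (hy1 _ _)
          (hy.stronglyMeasurableAtFilter _ _) hy.continuousAt
      have := hp.tendsto_slope_zero_right
      refine this.congr fun ε => ?_
      rw [intervalIntegral.integral_interval_sub_left (hy1 _ _) (hy1 _ _), hAdef, Complex.real_smul,
        Complex.ofReal_inv]
  exact tendsto_nhds_unique (((hlim.const_mul (n * Complex.I)).congr key)) hL

/-- Change of variables by the inverse homeomorphism, in terms of the adjoint. -/
theorem Rep.comp_inv (h : Inv H K) (hC : IsComp H C) {y : ℝ → ℂ} {x : X} (hy : Continuous y)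
    (hyp : ∀ θ, y (θ + 2 * π) = y θ) (hr : Rep y x) :
    Rep (fun t => y (K t)) (Sg (C.adjoint (Sg x))) := by
  refine ⟨memLp_of_continuous (hy.comp h.symm.cont) 2, fun n => ?_⟩
  have hadj : C.adjoint (Sg x) n = inner ℂ (C (bs n)) (Sg x) := by
    rw [← inner_bs, ContinuousLinearMap.adjoint_inner_right]
  rcases eq_or_ne n 0 with rfl | hn
  · rw [Sg_apply, hadj, hC.zero, inner_bs, Sg_apply, hr.zero_coord]; simp
  have hpos := sqrt_abs_pos hn
  set e := fun θ => ee n (H θ)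
  have hce := hC.col n hn
  have hsq : ∀ k : ℤ, ((√|(k : ℝ)| : ℝ) : ℂ) * ((√|(k : ℝ)| : ℝ) : ℂ) * sg k = k := by
    intro k
    rw [← Complex.ofReal_mul, mul_self_sqrt (abs_nonneg _)]
    unfold sg
    split_ifs with hk
    · rw [abs_of_neg (by exact_mod_cast hk)]; push_cast; ring
    · rw [abs_of_nonneg (by exact_mod_cast not_lt.1 hk)]; push_cast; ring
  have hsum := hasSum_inner (((√|(n : ℝ)| : ℝ) : ℂ) • C (bs n)) (Sg x)
  have hterm : ∀ k, starRingEnd ℂ ((((√|(n : ℝ)| : ℝ) : ℂ) • C (bs n) : X) k) * (Sg x) k =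
      starRingEnd ℂ (fc e k) * (k * fc y k) := by
    intro k
    rw [hce.coord, Sg_apply, hr.coord, map_mul, Complex.conj_ofReal]
    linear_combination (starRingEnd ℂ (fc e k) * fc y k) * hsq k
  have hL := fc_comp_aux h hy hyp (n := n)
    (L := Complex.I * inner ℂ (((√|(n : ℝ)| : ℝ) : ℂ) • C (bs n)) (Sg x)) ?_
  · rw [inner_smul_left, Complex.conj_ofReal, ← hadj] at hL
    rw [Sg_apply]
    have h2 := hsq n
    have hne := sqrt_abs_ne hn
    apply mul_left_cancel₀ (mul_ne_zero hne Complex.I_ne_zero)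
    have h3 := sg_mul_sg n
    calc _ = sg n * (Complex.I * (((√|(n : ℝ)| : ℝ) : ℂ) * C.adjoint (Sg x) n)) := by ring
      _ = sg n * (n * Complex.I * fc (fun t => y (K t)) n) := by rw [hL]
      _ = _ := by
        linear_combination (-sg n * Complex.I * fc (fun t => y (K t)) n) * h2
            + (((√|(n : ℝ)| : ℝ) : ℂ) * ((√|(n : ℝ)| : ℝ) : ℂ) * Complex.I *
          fc (fun t => y (K t)) n) * h3
  · rw [← hsum.tsum_eq, ← tsum_mul_left]
    simp only [hterm]
    have hsummable : Summable fun k : ℤ => ‖starRingEnd ℂ (fc e k) * (k * fc y k)‖ := by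
      have := hsum.summable.norm
      simpa only [hterm] using this
    refine tendsto_tsum_of_dominated_convergence hsummable (fun k => ?_) ?_
    · have hd := (hasDerivAt_ee k 0).tendsto_slope_zero_right
      have hd' : Tendsto (fun t : ℝ => (ee k t - 1) / t) (𝓝[>] 0) (𝓝 (k * Complex.I)) := by
        have e0 : ee k 0 = 1 := by simp [ee]
        rw [e0, mul_one] at hd
        refine hd.congr fun t => ?_
        rw [zero_add, Complex.real_smul, Complex.ofReal_inv, div_eq_inv_mul]
      have := (hd'.mul_const (fc y k)).const_mul (starRingEnd ℂ (fc e k))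
      rw [show starRingEnd ℂ (fc e k) * (k * Complex.I * fc y k) =
        Complex.I * (starRingEnd ℂ (fc e k) * (k * fc y k)) by ring] at this
      exact this
    · filter_upwards [self_mem_nhdsWithin] with ε hε k
      have hε : 0 < ε := hε
      rw [norm_mul, norm_mul _ (_ * _)]
      refine mul_le_mul_of_nonneg_left ?_ (norm_nonneg _)
      rw [norm_mul, norm_mul]
      refine mul_le_mul_of_nonneg_right ?_ (norm_nonneg _)
      rw [norm_div, Complex.norm_real, norm_of_nonneg hε.le, div_le_iff₀ hε]
      have := norm_exp_sub_le (k * ε) 0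
      rw [sub_zero, abs_mul, abs_of_pos hε] at this
      simpa [ee] using this

end

/-- Composition operators of a homeomorphism and of its inverse. -/
structure Ops (H K : ℝ → ℝ) (C C' : X →L[ℂ] X) : Prop where
  inv : Inv H K
  comp : ∀ {y : ℝ → ℂ} {x : X}, Continuous y → (∀ θ, y (θ + 2 * π) = y θ) → Rep y x →
    Rep (fun θ => y (H θ)) (C x)
  comp' : ∀ {y : ℝ → ℂ} {x : X}, Continuous y → (∀ θ, y (θ + 2 * π) = y θ) → Rep y x →
    Rep (fun θ => y (K θ)) (C' x)
  left : ∀ x, C' (C x) = x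
  right : ∀ x, C (C' x) = x
  adj : ∀ x, C.adjoint x = Sg (C' (Sg x))
  zero : C (bs 0) = bs 0
  zero' : C' (bs 0) = bs 0

section
variable {H K : ℝ → ℝ} {C C' : X →L[ℂ] X}

theorem exists_ops (h : Inv H K) (hC : IsComp H C) : ∃ C', Ops H K C C' := by
  set C' : X →L[ℂ] X := Sg * C.adjoint * Sg with hC'
  have hC'a : ∀ x, C' x = Sg (C.adjoint (Sg x)) := fun _ => rfl
  have hcomp' : ∀ {y : ℝ → ℂ} {x : X}, Continuous y → (∀ θ, y (θ + 2 * π) = y θ) → Rep y x →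
    Rep (fun θ => y (K θ)) (C' x) := fun hy hyp hr => hr.comp_inv h hC hy hyp
  have hcol0 : ∀ n, n ≠ 0 → C (bs n) 0 = 0 := by
    intro n hn
    have := (hC.col n hn).zero_coord
    exact (mul_eq_zero.1 (show ((√|(n : ℝ)| : ℝ) : ℂ) * C (bs n) 0 = 0 from this)).resolve_left
      (sqrt_abs_ne hn)
  have hIC : IsComp K C' := by
    refine ⟨fun n hn => ?_, ?_⟩
    · have := hcomp' (continuous_ee n) (ee_period n) (rep_ee (n := n))
      rwa [map_smul] at this
    · ext m
      rw [hC'a, Sg_bs, map_smul, map_smul]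
      show sg 0 * Sg (C.adjoint (bs 0)) m = _
      rw [Sg_apply, adjoint_bs, bs_apply]
      split_ifs with hm
      · rw [hm, hC.zero, bs_apply]; simp [sg]
      · rw [hcol0 m hm]; simp
  have hadj : ∀ x, Sg (C'.adjoint (Sg x)) = C x := by
    intro x
    have : C'.adjoint = Sg * C * Sg := by
      rw [hC', ← ContinuousLinearMap.star_eq_adjoint, star_mul, star_mul]
      simp only [ContinuousLinearMap.star_eq_adjoint]
      rw [Sg_adjoint, ContinuousLinearMap.adjoint_adjoint, mul_assoc]
    rw [this]
    show Sg (Sg (C (Sg (Sg x)))) = C x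
    rw [Sg_Sg, Sg_Sg]
  have hcomp : ∀ {y : ℝ → ℂ} {x : X}, Continuous y → (∀ θ, y (θ + 2 * π) = y θ) → Rep y x →
      Rep (fun θ => y (H θ)) (C x) := fun hy hyp hr => by
    have := hr.comp_inv h.symm hIC hy hyp
    rwa [hadj] at this
  have aux : ∀ {H K : ℝ → ℝ} {C C' : X →L[ℂ] X}, Inv H K → IsComp H C → C' (bs 0) = bs 0 →
      (∀ {y : ℝ → ℂ} {x : X}, Continuous y → (∀ θ, y (θ + 2 * π) = y θ) → Rep y x →
        Rep (fun θ => y (K θ)) (C' x)) → ∀ x, C' (C x) = x := by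
    intro H K C C' h hC h0 hc x
    have : C' * C = 1 := by
      refine clm_ext fun n m => ?_
      show C' (C (bs n)) m = bs n m
      rcases eq_or_ne n 0 with rfl | hn
      · rw [hC.zero, h0]
      · have h1 := hc ((continuous_ee n).comp h.cont) (fun θ => by
          show ee n (H (θ + 2 * π)) = ee n (H θ); rw [h.per, ee_period]) (hC.col n hn)
        simp only [Function.comp_apply, h.right] at h1
        have h2 := h1.coord_ext rep_ee
        rw [map_smul] at h2
        rw [smul_right_injective _ (sqrt_abs_ne hn) h2]
    exact congrArg (fun T : X →L[ℂ] X => T x) this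
  refine ⟨C', h, hcomp, hcomp', aux h hC hIC.zero hcomp', aux h.symm hIC hC.zero hcomp, fun x => ?_,
    hC.zero, hIC.zero⟩
  rw [hC'a, Sg_Sg, Sg_Sg]

theorem Ops.symm (h : Ops H K C C') : Ops K H C' C := by
  refine ⟨h.inv.symm, h.comp', h.comp, h.right, h.left, fun x => ?_, h.zero', h.zero⟩
  refine ext_inner_left ℂ fun v => ?_
  have hS : ∀ a b : X, inner ℂ (Sg a) b = inner ℂ a (Sg b) := fun a b => by
    rw [← ContinuousLinearMap.adjoint_inner_right, Sg_adjoint]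
  rw [ContinuousLinearMap.adjoint_inner_right, ← hS,
      ← ContinuousLinearMap.adjoint_inner_left, h.adj,
    hS, Sg_Sg, Sg_Sg]

theorem Ops.col (h : Ops H K C C') (n : ℤ) :
    Rep (fun θ => ee n (H θ)) (((√|(n : ℝ)| : ℝ) : ℂ) • C (bs n)) := by
  have := h.comp (continuous_ee n) (ee_period n) (rep_ee (n := n))
  rwa [map_smul] at this

theorem Ops.col_zero (h : Ops H K C C') {n : ℤ} (hn : n ≠ 0) : C (bs n) 0 = 0 :=
  (mul_eq_zero.1 (show ((√|(n : ℝ)| : ℝ) : ℂ) * C (bs n) 0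
      = 0 from (h.col n).zero_coord)).resolve_left
    (sqrt_abs_ne hn)

theorem Ops.map_zero_coord (h : Ops H K C C') {x : X} (hx : x 0 = 0) : C x 0 = 0 := by
  refine (hasSum_map C x 0).unique ?_
  refine hasSum_zero.congr_fun fun n => ?_
  rcases eq_or_ne n 0 with rfl | hn
  · rw [hx, zero_mul]
  · rw [h.col_zero hn, mul_zero]

theorem Ops.energy (h : Ops H K C C') (x : X) :
    ‖C x - Pm (C x)‖ ^ 2 - ‖Pm (C x)‖ ^ 2 = ‖x - Pm x‖ ^ 2 - ‖Pm x‖ ^ 2 := by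
  rw [← inner_Sg, ← inner_Sg, ← ContinuousLinearMap.adjoint_inner_right, h.adj, Sg_Sg, h.left]

theorem Ops.norm_le (h : Ops H K C C') {x : X} (hx : Pm x = x) : ‖x‖ ≤ ‖Pm (C x)‖ := by
  have h1 := h.energy x
  rw [hx, sub_self, norm_zero] at h1
  have := sq_nonneg ‖C x - Pm (C x)‖
  exact le_of_sq_le_sq (by linarith) (norm_nonneg _)

/-- Coefficient sequences of real-valued functions. -/
def IsR (x : X) : Prop := ∀ n, x (-n) = starRingEnd ℂ (x n)

theorem fc_conj (u : ℝ → ℂ) (n : ℤ) :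
    fc (fun θ => starRingEnd ℂ (u θ)) (-n) = starRingEnd ℂ (fc u n) := by
  rw [fc_eq_setIntegral, fc_eq_setIntegral, map_mul, Complex.conj_ofReal, ← integral_conj]
  simp only [map_mul, conj_ee, neg_neg]

theorem Ops.isR (h : Ops H K C C') {x : X} (hx : IsR x) : IsR (C x) := by
  intro m
  have hent : ∀ n, C (bs (-n)) (-m) = starRingEnd ℂ (C (bs n) m) := by
    intro n
    rcases eq_or_ne n 0 with rfl | hn
    · rw [neg_zero, h.zero, bs_apply, bs_apply]
      by_cases hm : m = 0 <;> simp [hm]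
    · have h1 := (h.col (-n)).coord (-m)
      have h2 := (h.col n).coord m
      have h3 := fc_conj (fun θ => ee n (H θ)) m
      simp only [conj_ee] at h3
      rw [h3] at h1
      simp only [Int.cast_neg, abs_neg] at h1
      apply mul_left_cancel₀ (sqrt_abs_ne hn)
      refine h1.trans ?_
      have h4 := congrArg (starRingEnd ℂ) h2
      rw [map_mul, Complex.conj_ofReal] at h4
      rw [← h4]
      show starRingEnd ℂ (_ * C (bs n) m) = _
      rw [map_mul, Complex.conj_ofReal]
  have h1 := (Equiv.neg ℤ).hasSum_iff.2 (hasSum_map C x (-m))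
  have h2 := (Complex.hasSum_conj'.2 (hasSum_map C x m))
  refine h1.unique (h2.congr_fun fun n => ?_)
  show x (-n) * C (bs (-n)) (-m) = _
  rw [hent, hx, map_mul]

theorem Rep.isR {u : ℝ → ℂ} {x : X} (h : Rep u x) (hu : ∀ θ, starRingEnd ℂ (u θ) = u θ) :
    IsR x := by
  intro n
  rw [h.coord, h.coord, map_mul, ← fc_conj, Complex.conj_ofReal]
  simp [hu]

/-- The negative block of `C` is surjective. -/
theorem Ops.exists_solution (h : Ops H K C C') (y : X) : ∃ ψ, Pm ψ = ψ ∧ Pm (y + C ψ) = 0 := by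
  have lower : ∀ {H K : ℝ → ℝ} {C C' : X →L[ℂ] X}, Ops H K C C' → ∀ x,
      ‖x‖ ≤ ‖(1 - Pm + Pm * C * Pm) x‖ := by
    intro H K C C' h x
    refine le_of_sq_le_sq ?_ (norm_nonneg _)
    rw [norm_sq_Pm x, norm_sq_Pm ((1 - Pm + Pm * C * Pm) x)]
    have e : (1 - Pm + Pm * C * Pm) x = (x - Pm x) + Pm (C (Pm x)) := rfl
    have e1 : Pm ((1 - Pm + Pm * C * Pm) x) = Pm (C (Pm x)) := by
      rw [e, map_add, map_sub, Pm_Pm, sub_self, zero_add, Pm_Pm]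
    rw [e1, e, add_sub_cancel_right]
    gcongr
    exact h.norm_le (Pm_Pm x)
  set A : X →L[ℂ] X := 1 - Pm + Pm * C * Pm with hA
  have hadj : A.adjoint = 1 - Pm + Pm * C' * Pm := by
    rw [hA, ← ContinuousLinearMap.star_eq_adjoint, star_add, star_sub, star_one, star_mul, star_mul]
    simp only [ContinuousLinearMap.star_eq_adjoint, Pm_adjoint]
    congr 1
    ext x : 1
    show Pm (C.adjoint (Pm x)) = Pm (C' (Pm x))
    rw [h.adj, Sg_Pm, map_neg, map_neg, map_neg, Pm_Sg, neg_neg]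
  have hlow := lower h
  have hlow' := lower h.symm
  rw [← hadj] at hlow'
  have hclosed : IsClosed (LinearMap.range (A : X →ₗ[ℂ] X) : Set X) := by
    have := (AddMonoidHomClass.antilipschitz_of_bound A (K := 1) fun x => by
      rw [NNReal.coe_one, one_mul]; exact hlow x).isClosed_range A.uniformContinuous
    rw [LinearMap.coe_range]
    exact this
  have hker : (LinearMap.range (A : X →ₗ[ℂ] X))ᗮ = ⊥ := by
    rw [eq_bot_iff]
    intro x hx
    rw [ContinuousLinearMap.orthogonal_range] at hx
    have : A.adjoint x = 0 := hx
    have h1 := hlow' x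
    rw [this, norm_zero] at h1
    simpa using h1
  have : CompleteSpace (LinearMap.range (A : X →ₗ[ℂ] X)) := hclosed.completeSpace_coe
  have htop : LinearMap.range (A : X →ₗ[ℂ] X) = ⊤ := Submodule.orthogonal_eq_bot_iff.1 hker
  obtain ⟨x, hx⟩ : ∃ x, A x = -Pm y := by
    have : -Pm y ∈ LinearMap.range (A : X →ₗ[ℂ] X) := by rw [htop]; trivial
    obtain ⟨x, hx⟩ := this
    exact ⟨x, hx⟩
  refine ⟨Pm x, Pm_Pm x, ?_⟩
  have h1 := congrArg Pm hx
  have e : Pm (A x) = Pm (C (Pm x)) := by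
    show Pm ((x - Pm x) + Pm (C (Pm x))) = _
    rw [map_add, map_sub, Pm_Pm, sub_self, zero_add, Pm_Pm]
  rw [e, map_neg, Pm_Pm] at h1
  rw [map_add, h1, add_neg_cancel]

end

theorem norm_ee_one_sub (θ σ : ℝ) : ‖ee 1 θ - ee 1 σ‖ = 2 * |sin ((θ - σ) / 2)| := by
  have h := norm_ee_sub_ee σ θ
  rw [norm_sub_rev, h]
  have h2 := Complex.norm_exp_I_mul_ofReal_sub_one (θ - σ)
  rw [norm_mul, norm_of_nonneg (by norm_num : (0:ℝ) ≤ 2), norm_eq_abs] at h2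
  rw [← h2, ee]
  congr 3
  push_cast; ring

theorem abs_le_norm_ee_sub {δ x y : ℝ} (hδ : 0 < δ) (hδπ : δ ≤ π) (h : |x - y| ≤ 2 * π - δ) :
    δ / π ^ 2 * |x - y| ≤ ‖ee 1 x - ee 1 y‖ := by
  have hpi := pi_pos
  rw [norm_ee_one_sub]
  set t := |x - y| / 2 with ht
  have ht0 : 0 ≤ t := by positivity
  have hs : |sin ((x - y) / 2)| = sin t := by
    rw [abs_sin_eq_sin_abs_of_abs_le_pi, abs_div, abs_two]
    rw [abs_div, abs_two]; linarith
  rw [hs]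
  have hc : |x - y| = 2 * t := by rw [ht]; ring
  rw [hc] at h ⊢
  have hgoal : δ / π ^ 2 * t ≤ sin t := by
    rcases le_total t (π / 2) with h1 | h1
    · refine le_trans ?_ (mul_le_sin ht0 h1)
      refine mul_le_mul_of_nonneg_right ?_ ht0
      rw [div_le_div_iff₀ (by positivity) hpi]
      nlinarith
    · rw [← sin_pi_sub]
      refine le_trans ?_ (mul_le_sin (by linarith) (by linarith))
      calc δ / π ^ 2 * t ≤ δ / π ^ 2 * π := by gcongr; linarith
        _ = 2 / π * (δ / 2) := by field_simp
        _ ≤ _ := by gcongr; linarith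
  linarith

/-- If `e^{iH}` has finite energy, then so has the periodic part of `H`. -/
theorem energy_sub_id_lt_top {H K : ℝ → ℝ} (h : Inv H K)
    (hE : douglasEnergyP (fun θ => ee 1 (H θ)) < ⊤) :
    douglasEnergyP (fun θ => ((H θ - θ : ℝ) : ℂ)) < ⊤ := by
  have hpi := pi_pos
  obtain ⟨d, hd, hdle⟩ := exists_pos_le_of_periodic (f := fun y => H (y + π) - H y)
    ((h.cont.comp (by fun_prop)).sub h.cont)
    (fun y => by
      show H (y + 2 * π + π) - H (y + 2 * π) = H (y + π) - H y
      rw [show y + 2 * π + π = (y + π) + 2 * π by ring, h.per, h.per]; ring)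
    (fun y => sub_pos.2 (h.mono (by linarith)))
  set δ := min d π with hδdef
  have hδ : 0 < δ := lt_min hd hpi
  have hδπ : δ ≤ π := min_le_right _ _
  set c := δ / π ^ 2 with hc
  have hc0 : 0 < c := by positivity
  have near : ∀ θ σ, σ ≤ θ → θ ≤ σ + π → |H θ - H σ| ≤ 2 * π - δ := by
    intro θ σ h1 h2
    have e1 := h.mono.monotone h1
    have e2 := h.mono.monotone h2
    have e3 := hdle (σ + π)
    have e4 := h.per σ
    have e5 : δ ≤ d := min_le_left _ _
    rw [abs_of_nonneg (by linarith)]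
    rw [show σ + π + π = σ + 2 * π by ring] at e3
    linarith
  have near' : ∀ θ σ, |θ - σ| ≤ π → |H θ - H σ| ≤ 2 * π - δ := by
    intro θ σ h1
    rw [abs_le] at h1
    rcases le_total σ θ with h2 | h2
    · exact near θ σ h2 (by linarith)
    · rw [abs_sub_comm]; exact near σ θ h2 (by linarith)
  set v : ℝ → ℂ := fun θ => ((H θ - θ : ℝ) : ℂ) with hv
  have pt0 : ∀ θ σ, |θ - σ| ≤ π → c * ‖v θ - v σ‖ ≤
      ‖ee 1 (H θ) - ee 1 (H σ)‖ + ‖ee 1 θ - ee 1 σ‖ := by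
    intro θ σ h1
    have e1 := abs_le_norm_ee_sub hδ hδπ (near' θ σ h1)
    have e2 := abs_le_norm_ee_sub hδ hδπ (x := θ) (y := σ) (by linarith)
    have e3 : ‖v θ - v σ‖ ≤ |H θ - H σ| + |θ - σ| := by
      rw [hv]; dsimp only
      rw [← Complex.ofReal_sub, Complex.norm_real, norm_eq_abs,
        show H θ - θ - (H σ - σ) = (H θ - H σ) - (θ - σ) by ring]
      exact abs_sub _ _
    calc c * ‖v θ - v σ‖ ≤ c * (|H θ - H σ| + |θ - σ|) := by gcongr
      _ = c * |H θ - H σ| + c * |θ - σ| := by ring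
      _ ≤ _ := add_le_add e1 e2
  have hshift : ∀ (σ : ℝ) (m : ℤ), ee 1 (σ + m * (2 * π)) = ee 1 σ := fun σ m =>
    ee_one_eq_iff.2 ⟨m, rfl⟩
  have pt : ∀ θ σ, c * ‖v θ - v σ‖ ≤ ‖ee 1 (H θ) - ee 1 (H σ)‖ + ‖ee 1 θ - ee 1 σ‖ := by
    intro θ σ
    set m : ℤ := round ((θ - σ) / (2 * π)) with hm
    have h1 : |θ - (σ + m * (2 * π))| ≤ π := by
      have := abs_sub_round ((θ - σ) / (2 * π))
      have e : θ - (σ + m * (2 * π)) = ((θ - σ) / (2 * π) - m) * (2 * π) := by field_simp; ring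
      rw [e, abs_mul, abs_of_pos two_pi_pos]
      calc _ ≤ 1 / 2 * (2 * π) := by gcongr
        _ = π := by ring
    have h2 := pt0 θ _ h1
    have h3 : v (σ + m * (2 * π)) = v σ := by
      rw [hv]; dsimp only
      rw [lift_add_int h.per]; congr 1; ring
    rwa [h3, lift_add_int h.per, hshift, hshift] at h2
  have pt2 : ∀ θ σ, ENNReal.ofReal (‖v θ - v σ‖ ^ 2 /
      ‖Complex.exp (θ * Complex.I) - Complex.exp (σ * Complex.I)‖ ^ 2) ≤
      ENNReal.ofReal (2 / c ^ 2) * (ENNReal.ofReal (‖ee 1 (H θ) - ee 1 (H σ)‖ ^ 2 /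
        ‖Complex.exp (θ * Complex.I) - Complex.exp (σ * Complex.I)‖ ^ 2) + 1) := by
    intro θ σ
    have e : ∀ t : ℝ, Complex.exp (t * Complex.I) = ee 1 t := fun t => by simp [ee]
    rw [e, e, ← ENNReal.ofReal_one, ← ENNReal.ofReal_add (by positivity) zero_le_one,
      ← ENNReal.ofReal_mul (by positivity)]
    refine ENNReal.ofReal_le_ofReal ?_
    set D := ‖ee 1 θ - ee 1 σ‖
    set N := ‖ee 1 (H θ) - ee 1 (H σ)‖
    have hp := pt θ σ
    rcases (norm_nonneg (ee 1 θ - ee 1 σ)).eq_or_lt with h0 | h0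
    · rw [show D = 0 from h0.symm]; simp; positivity
    have h0 : 0 < D := h0
    have hN : 0 ≤ N := norm_nonneg _
    have h4 : ‖v θ - v σ‖ ^ 2 ≤ 2 / c ^ 2 * (N ^ 2 + D ^ 2) := by
      rw [div_mul_eq_mul_div, le_div_iff₀ (by positivity)]
      have : (c * ‖v θ - v σ‖) ^ 2 ≤ (N + D) ^ 2 := by gcongr
      nlinarith [sq_nonneg (N - D)]
    rw [div_le_iff₀ (by positivity)]
    refine h4.trans (le_of_eq ?_)
    field_simp
  unfold douglasEnergyP
  calc _ ≤ ∫⁻ θ in Set.Ioc 0 (2 * π), ENNReal.ofReal (2 / c ^ 2) *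
      ((∫⁻ σ in Set.Ioc 0 (2 * π), ENNReal.ofReal (‖ee 1 (H θ) - ee 1 (H σ)‖ ^ 2 /
        ‖Complex.exp (θ * Complex.I) - Complex.exp (σ * Complex.I)‖ ^ 2))
            + ENNReal.ofReal (2 * π)) := by
        refine lintegral_mono fun θ => ?_
        refine (lintegral_mono (pt2 θ)).trans (le_of_eq ?_)
        rw [lintegral_const_mul' _ _ ENNReal.ofReal_ne_top, lintegral_add_right _ measurable_const]
        simp
    _ = ENNReal.ofReal (2 / c ^ 2) * (douglasEnergyP (fun θ => ee 1 (H θ)) +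
        ENNReal.ofReal (2 * π) * ENNReal.ofReal (2 * π)) := by
        rw [lintegral_const_mul' _ _ ENNReal.ofReal_ne_top, lintegral_add_right _ measurable_const]
        simp [douglasEnergyP]
    _ < ⊤ := ENNReal.mul_lt_top ENNReal.ofReal_lt_top (ENNReal.add_lt_top.2 ⟨hE,
        ENNReal.mul_lt_top ENNReal.ofReal_lt_top ENNReal.ofReal_lt_top⟩)

theorem exists_analytic {c : ℕ → ℂ} {M : ℝ} (hc : ∀ n, ‖c n‖ ≤ M) :
    ∃ g : ℂ → ℂ, DifferentiableOn ℂ g (ball 0 1) ∧ ∀ n, tc g n = c n := by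
  set p := FormalMultilinearSeries.ofScalars ℂ c with hp
  have hr : (1 : ENNReal) ≤ p.radius := by
    have := p.le_radius_of_bound M (r := 1) fun n => by
      rw [hp, FormalMultilinearSeries.ofScalars_norm]; simpa using hc n
    simpa using this
  have hb := p.hasFPowerSeriesOnBall (lt_of_lt_of_le zero_lt_one hr)
  have hsub : ball (0 : ℂ) 1 ⊆ Metric.eball 0 p.radius := by
    intro z hz
    rw [Metric.mem_eball]
    refine lt_of_lt_of_le ?_ hr
    rw [edist_dist, ← ENNReal.ofReal_one]
    exact (ENNReal.ofReal_lt_ofReal_iff one_pos).2 hz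
  have hd : DifferentiableOn ℂ p.sum (ball 0 1) := hb.differentiableOn.mono hsub
  refine ⟨p.sum, hd, fun n => ?_⟩
  have h2 : (0:ℝ) ≤ 1 / 2 := by norm_num
  have h21 : (1 / 2 : ℝ) < 1 := by norm_num
  have h1 := fc_circle hd h2 h21 n
  have hs : Summable fun k : ℕ => ‖c k * ((1 / 2 : ℝ) : ℂ) ^ k‖ := by
    refine Summable.of_nonneg_of_le (fun _ => norm_nonneg _) (fun k => ?_)
      ((summable_geometric_of_lt_one h2 h21).mul_left M)
    rw [norm_mul, norm_pow, Complex.norm_real, norm_of_nonneg h2]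
    exact mul_le_mul_of_nonneg_right (hc k) (by positivity)
  have h3 := fc_of_hasSum (d := fun k : ℕ => c k * ((1 / 2 : ℝ) : ℂ) ^ k) hs (fun k => (k : ℤ))
    (u := fun θ => p.sum ((1 / 2 : ℝ) * ee 1 θ)) (fun θ => by
      have := hb.hasSum (hsub (circle_mem_ball h2 h21 θ))
      rw [zero_add] at this
      refine this.congr_fun fun k => ?_
      rw [hp, FormalMultilinearSeries.ofScalars_apply_eq, smul_eq_mul, mul_pow, ee_pow, one_mul]
      ring) n
  have h4 : fc (fun θ => p.sum ((1 / 2 : ℝ) * ee 1 θ)) n = c n * ((1 / 2 : ℝ) : ℂ) ^ n := by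
    refine h3.unique ?_
    have := hasSum_ite_eq (α := ℂ) n (c n * ((1 / 2 : ℝ) : ℂ) ^ n)
    refine this.congr_fun fun k => ?_
    by_cases h : k = n
    · subst h; simp
    · rw [if_neg h, if_neg (by exact_mod_cast Ne.symm h)]
  rw [h1] at h4
  exact mul_right_cancel₀ (pow_ne_zero n (Complex.ofReal_ne_zero.2 (by norm_num))) h4

theorem contDiffAt_of_ball {g : ℂ → ℂ} (hg : DifferentiableOn ℂ g (ball 0 1)) {n : ℕ} :
    ContDiffAt ℂ n g 0 :=
  (hg.contDiffOn isOpen_ball).contDiffAt (isOpen_ball.mem_nhds (mem_ball_self one_pos))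

theorem differentiableOn_deriv {g : ℂ → ℂ} (hg : DifferentiableOn ℂ g (ball 0 1)) :
    DifferentiableOn ℂ (deriv g) (ball 0 1) := hg.deriv isOpen_ball

theorem tc_zero (g : ℂ → ℂ) : tc g 0 = g 0 := by simp [tc]

theorem tc_congr {f g : ℂ → ℂ} (h : Set.EqOn f g (ball 0 1)) (n : ℕ) : tc f n = tc g n := by
  unfold tc
  congr 1
  refine Filter.EventuallyEq.iteratedDeriv_eq n ?_
  exact h.eventuallyEq_of_mem (isOpen_ball.mem_nhds (mem_ball_self one_pos))

theorem tc_deriv (g : ℂ → ℂ) (n : ℕ) : tc (deriv g) n = (n + 1) * tc g (n + 1) := by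
  unfold tc
  rw [iteratedDeriv_succ', Nat.factorial_succ]
  have : (n.factorial : ℂ) ≠ 0 := by exact_mod_cast n.factorial_ne_zero
  have h2 : (n : ℂ) + 1 ≠ 0 := by exact_mod_cast n.succ_ne_zero
  push_cast
  field_simp

theorem tc_mul {f g : ℂ → ℂ} (hf : DifferentiableOn ℂ f (ball 0 1))
    (hg : DifferentiableOn ℂ g (ball 0 1))
    (n : ℕ) : tc (fun z => f z * g z) n = ∑ i ∈ Finset.range (n + 1), tc f i * tc g (n - i) := by
  unfold tc
  rw [iteratedDeriv_fun_mul (contDiffAt_of_ball hf) (contDiffAt_of_ball hg), Finset.mul_sum]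
  refine Finset.sum_congr rfl fun i hi => ?_
  have hi : i ≤ n := Nat.lt_succ_iff.1 (Finset.mem_range.1 hi)
  have h1 := Nat.choose_mul_factorial_mul_factorial hi
  have h2 : ((n.choose i : ℕ) : ℂ) * (i.factorial : ℂ) * ((n - i).factorial : ℂ) = n.factorial := by
    exact_mod_cast h1
  have a1 : (n.factorial : ℂ) ≠ 0 := by exact_mod_cast n.factorial_ne_zero
  have a2 : (i.factorial : ℂ) ≠ 0 := by exact_mod_cast i.factorial_ne_zero
  have a3 : ((n - i).factorial : ℂ) ≠ 0 := by exact_mod_cast (n - i).factorial_ne_zero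
  field_simp
  linear_combination (iteratedDeriv i f 0 * iteratedDeriv (n - i) g 0) * h2

theorem differentiableOn_exp {p : ℂ → ℂ} (hp : DifferentiableOn ℂ p (ball 0 1)) :
    DifferentiableOn ℂ (fun z => Complex.exp (p z)) (ball 0 1) :=
  Complex.differentiable_exp.comp_differentiableOn hp

theorem tc_exp_succ {p : ℂ → ℂ} (hp : DifferentiableOn ℂ p (ball 0 1)) (n : ℕ) :
    (n + 1) * tc (fun z => Complex.exp (p z)) (n + 1) = ∑ i ∈ Finset.range (n + 1),
      ((i + 1) * tc p (i + 1)) * tc (fun z => Complex.exp (p z)) (n - i) := by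
  rw [← tc_deriv, tc_congr (g := fun z => deriv p z * Complex.exp (p z)) (fun z hz => by
    have := (hp.differentiableAt (isOpen_ball.mem_nhds hz)).hasDerivAt.cexp
    rw [this.deriv, mul_comm]), tc_mul (differentiableOn_deriv hp) (differentiableOn_exp hp)]
  simp only [tc_deriv]

/-- The Lebedev–Milin inequality. -/
theorem lebedev_milin {p : ℂ → ℂ} (hp : DifferentiableOn ℂ p (ball 0 1)) (h0 : p 0 = 0)
    (hs : Summable fun n : ℕ => n * ‖tc p n‖ ^ 2) (N : ℕ) :
    ∑ n ∈ Finset.range N, ‖tc (fun z => Complex.exp (p z)) n‖ ^ 2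
        ≤ rexp (∑' n : ℕ, n * ‖tc p n‖ ^ 2) := by
  set A : ℕ → ℝ := fun n => n * ‖tc p n‖ ^ 2 with hA
  have hA0 : ∀ n, 0 ≤ A n := fun n => by rw [hA]; positivity
  obtain ⟨a, ha, hat⟩ :=
      exists_analytic (c := fun n => ((A n : ℝ) : ℂ)) (M := ∑' n, A n) fun n => by
    rw [Complex.norm_real, norm_of_nonneg (hA0 n)]
    exact hs.le_tsum n fun k _ => hA0 k
  set b := tc (fun z => Complex.exp (a z)) with hb
  set β := tc (fun z => Complex.exp (p z)) with hβ
  have ind : ∀ n, ((b n).re : ℂ) = b n ∧ ‖β n‖ ^ 2 ≤ (b n).re := by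
    intro n
    induction n using Nat.strong_induction_on with
    | _ n ih =>
    rcases n with _ | n
    · have h1 : a 0 = 0 := by rw [← tc_zero a, hat]; simp [hA]
      have e1 : b 0 = 1 := by rw [hb, tc_zero, h1]; simp
      have e2 : β 0 = 1 := by rw [hβ, tc_zero, h0]; simp
      rw [e1, e2]; simp
    · have r1 := tc_exp_succ ha n
      have r2 := tc_exp_succ hp n
      rw [← hb] at r1
      rw [← hβ] at r2
      have e1 : ((n + 1 : ℕ) : ℂ) * b (n + 1) =
          ((∑ i ∈ Finset.range (n + 1), ((i + 1) * A (i + 1)) * (b (n - i)).re : ℝ) : ℂ) := by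
        push_cast
        rw [r1]
        refine Finset.sum_congr rfl fun i hi => ?_
        rw [hat, (ih (n - i) (by omega)).1]
      have hne : ((n + 1 : ℕ) : ℂ) ≠ 0 := by exact_mod_cast n.succ_ne_zero
      have e2 : b (n + 1) = (((∑ i ∈ Finset.range (n + 1), ((i + 1) * A (i + 1)) * (b (n - i)).re) /
          (n + 1 : ℕ) : ℝ) : ℂ) := by
        rw [Complex.ofReal_div, ← e1, Complex.ofReal_natCast, mul_div_cancel_left₀ _ hne]
      refine ⟨by rw [e2, Complex.ofReal_re], ?_⟩
      rw [e2, Complex.ofReal_re, le_div_iff₀ (by positivity)]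
      have c1 : ((n : ℝ) + 1) * ‖β (n + 1)‖ ≤
          ∑ i ∈ Finset.range (n + 1), 1 * (((i + 1 : ℕ) * ‖tc p (i + 1)‖) * ‖β (n - i)‖) := by
        have : ((n : ℝ) + 1) * ‖β (n + 1)‖ = ‖((n : ℂ) + 1) * β (n + 1)‖ := by
          rw [norm_mul, show (n : ℂ) + 1
              = ((n + 1 : ℕ) : ℂ) by push_cast; ring, Complex.norm_natCast]
          push_cast; ring
        rw [this, r2]
        refine (norm_sum_le _ _).trans (le_of_eq (Finset.sum_congr rfl fun i _ => ?_))
        rw [norm_mul, norm_mul, one_mul]; congr 2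
        rw [← Nat.cast_succ, Complex.norm_natCast]
      have c2 : (((n : ℝ) + 1) * ‖β (n + 1)‖) ^ 2 ≤ ((n : ℝ) + 1) *
          ∑ i ∈ Finset.range (n + 1), ((i + 1) * A (i + 1)) * (b (n - i)).re := by
        calc _ ≤ (∑ i ∈ Finset.range (n + 1),
            1 * (((i + 1 : ℕ) * ‖tc p (i + 1)‖) * ‖β (n - i)‖)) ^ 2 := by
              gcongr
          _ ≤ _ := Finset.sum_mul_sq_le_sq_mul_sq _ _ _
          _ ≤ _ := by
              simp only [one_pow, Finset.sum_const, Finset.card_range, nsmul_eq_mul, mul_one]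
              push_cast
              refine mul_le_mul_of_nonneg_left (Finset.sum_le_sum fun i hi => ?_) (by positivity)
              rw [mul_pow, mul_pow]
              have := (ih (n - i) (by omega)).2
              calc _ ≤ ((i : ℝ) + 1) ^ 2 * ‖tc p (i + 1)‖ ^ 2 * (b (n - i)).re := by gcongr
                _ = _ := by rw [hA]; push_cast; ring
      push_cast
      have hn : (0:ℝ) < n + 1 := by positivity
      refine le_of_mul_le_mul_left (le_trans (le_of_eq ?_) c2) hn
      ring
  have hr : ∀ r ∈ Set.Ioo (0:ℝ) 1, ∑ n ∈ Finset.range N, ‖β n‖ ^ 2 * r ^ n ≤ rexp (∑' n, A n) := by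
    intro r hr
    have hz : (r : ℂ) ∈ ball (0 : ℂ) 1 := by
      simpa [abs_of_pos hr.1] using hr.2
    have h1 := Complex.hasSum_re (hasSum_tc (differentiableOn_exp ha) hz)
    have h2 := Complex.hasSum_re (hasSum_tc ha hz)
    have e1 : ∀ n, (b n * (r : ℂ) ^ n).re = (b n).re * r ^ n := fun n => by
      rw [← Complex.ofReal_pow, Complex.re_mul_ofReal]
    have e2 : ∀ n, (tc a n * (r : ℂ) ^ n).re = A n * r ^ n := fun n => by
      rw [hat, ← Complex.ofReal_pow, Complex.re_mul_ofReal, Complex.ofReal_re]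
    have h3 : ‖Complex.exp (a r)‖ ≤ rexp (∑' n, A n) := by
      rw [Complex.norm_exp]
      gcongr
      refine hasSum_le (fun n => ?_) h2 hs.hasSum
      rw [e2]
      exact mul_le_of_le_one_right (hA0 n) (pow_le_one₀ hr.1.le hr.2.le)
    calc _ ≤ ∑ n ∈ Finset.range N, (b n * (r : ℂ) ^ n).re := by
          refine Finset.sum_le_sum fun n _ => ?_
          rw [e1]
          have := hr.1
          exact mul_le_mul_of_nonneg_right (ind n).2 (by positivity)
      _ ≤ (Complex.exp (a r)).re := by
          refine sum_le_hasSum _ (fun n _ => ?_) h1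
          have h4 : 0 ≤ (b n).re := (sq_nonneg _).trans (ind n).2
          have := hr.1
          show 0 ≤ (b n * (r : ℂ) ^ n).re
          rw [e1]; positivity
      _ ≤ _ := (Complex.re_le_norm _).trans h3
  have hlim : Tendsto (fun r : ℝ => ∑ n ∈ Finset.range N, ‖β n‖ ^ 2 * r ^ n) (𝓝[<] 1)
      (𝓝 (∑ n ∈ Finset.range N, ‖β n‖ ^ 2 * 1 ^ n)) := by
    have : Continuous fun r : ℝ => ∑ n ∈ Finset.range N, ‖β n‖ ^ 2 * r ^ n := by fun_prop
    exact (this.tendsto 1).mono_left nhdsWithin_le_nhds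
  simp only [one_pow, mul_one] at hlim
  refine le_of_tendsto hlim ?_
  filter_upwards [Ioo_mem_nhdsLT (show (0:ℝ) < 1 by norm_num)] with r h using hr r h

/-- A sequence of radii increasing to `1`. -/
noncomputable def rad (k : ℕ) : ℝ := 1 - 1 / ((k : ℝ) + 1)

lemma rad_nonneg (k : ℕ) : 0 ≤ rad k := by
  unfold rad
  have : 1 / ((k : ℝ) + 1) ≤ 1 := by
    rw [div_le_one (by positivity)]; linarith [(Nat.cast_nonneg k : (0:ℝ) ≤ k)]
  linarith

lemma rad_lt_one (k : ℕ) : rad k < 1 := by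
  unfold rad
  have : 0 < 1 / ((k : ℝ) + 1) := by positivity
  linarith

lemma tendsto_rad : Tendsto rad atTop (𝓝 1) := by
  have := (tendsto_one_div_add_atTop_nhds_zero_nat (𝕜 := ℝ)).const_sub 1
  rw [sub_zero] at this
  exact this

lemma exists_dilate (y : X) : ∃ ys : ℕ → X,
    (∀ k n, ys k n = ((rad k ^ n.natAbs : ℝ) : ℂ) * y n) ∧ Tendsto ys atTop (𝓝 y) := by
  have hp0 : ∀ k (n : ℤ), 0 ≤ rad k ^ n.natAbs := fun k n => pow_nonneg (rad_nonneg k) _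
  have hp1 : ∀ k (n : ℤ), rad k ^ n.natAbs ≤ 1 := fun k n =>
    pow_le_one₀ (rad_nonneg k) (rad_lt_one k).le
  have hy := (norm_sq_eq y).summable
  have h1 : ∀ k, ∃ x : X, ∀ n, x n = ((rad k ^ n.natAbs : ℝ) : ℂ) * y n := fun k => by
    refine exists_of_summable (hy.of_nonneg_of_le (fun n => sq_nonneg _) fun n => ?_)
    rw [norm_mul, Complex.norm_real, norm_of_nonneg (hp0 k n)]
    refine pow_le_pow_left₀ (by have := hp0 k n; positivity) ?_ 2
    exact mul_le_of_le_one_left (norm_nonneg _) (hp1 k n)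
  choose ys hys using h1
  refine ⟨ys, hys, ?_⟩
  rw [tendsto_iff_norm_sub_tendsto_zero]
  have h2 : Tendsto (fun k => ∑' n, ‖(ys k - y) n‖ ^ 2) atTop (𝓝 (∑' _n : ℤ, (0:ℝ))) := by
    refine tendsto_tsum_of_dominated_convergence (bound := fun n => ‖y n‖ ^ 2) hy (fun n => ?_)
      (Eventually.of_forall fun k n => ?_)
    · have h3 : Tendsto (fun k => ‖((rad k ^ n.natAbs : ℝ) : ℂ) * y n - y n‖ ^ 2) atTop
          (𝓝 (‖(((1:ℝ) ^ n.natAbs : ℝ) : ℂ) * y n - y n‖ ^ 2)) := by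
        refine ((Tendsto.sub_const (Tendsto.mul_const _ ?_) _).norm).pow 2
        exact (Complex.continuous_ofReal.tendsto _).comp (tendsto_rad.pow _)
      simp only [one_pow, Complex.ofReal_one, one_mul, sub_self, norm_zero] at h3
      simpa [hys] using h3
    · have e : (ys k - y) n = ((rad k ^ n.natAbs - 1 : ℝ) : ℂ) * y n := by
        show ys k n - y n = _
        rw [hys]; push_cast; ring
      rw [e, norm_mul, Complex.norm_real, norm_of_nonneg (by positivity)]
      have : ‖rad k ^ n.natAbs - 1‖ ≤ 1 := by
        rw [Real.norm_eq_abs, abs_le]; constructor <;> linarith [hp0 k n, hp1 k n]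
      gcongr
      exact mul_le_of_le_one_left (norm_nonneg _) this
  simp only [tsum_zero] at h2
  have h3 : ∀ k, ‖ys k - y‖ = √(∑' n, ‖(ys k - y) n‖ ^ 2) := fun k => by
    rw [(norm_sq_eq _).tsum_eq, sqrt_sq (norm_nonneg _)]
  simp only [h3]
  have h4 := (Real.continuous_sqrt.tendsto 0).comp h2
  rw [Real.sqrt_zero] at h4
  exact h4

/-- A mean-zero function is controlled in `L²` by its representative. -/
lemma Rep.lintegral_le {u : ℝ → ℂ} {x : X} (h : WP.Rep u x) (h0 : fc u 0 = 0) :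
    ∫⁻ θ, ENNReal.ofReal (‖u θ‖ ^ 2) ∂per ≤ ENNReal.ofReal (2 * π * ‖x‖ ^ 2) := by
  rw [lintegral_norm_sq_eq h.memLp, ENNReal.ofReal_mul (p := 2 * π) (by positivity)]
  refine mul_le_mul' (le_refl (ENNReal.ofReal (2 * π))) ?_
  rw [← (norm_sq_eq x).tsum_eq, ENNReal.ofReal_tsum_of_nonneg (fun n => sq_nonneg _)
      (norm_sq_eq x).summable]
  refine ENNReal.tsum_le_tsum fun n => ENNReal.ofReal_le_ofReal ?_
  rw [h.coord, norm_sq_coord]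
  rcases eq_or_ne n 0 with rfl | hn
  · simp [h0]
  · refine le_mul_of_one_le_left (sq_nonneg _) ?_
    exact_mod_cast Int.one_le_abs hn

lemma eLpNorm_two_eq (u : ℝ → ℂ) :
    eLpNorm u 2 per = (∫⁻ θ, ENNReal.ofReal (‖u θ‖ ^ 2) ∂per) ^ (1 / 2 : ℝ) := by
  rw [eLpNorm_eq_lintegral_rpow_enorm_toReal (by norm_num) (by norm_num)]
  simp only [ENNReal.toReal_ofNat, ENNReal.rpow_ofNat]
  congr 2
  funext θ
  rw [ENNReal.ofReal_pow (norm_nonneg _), ofReal_norm]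

lemma tendsto_eLpNorm {us : ℕ → ℝ → ℂ} {xs : ℕ → X} {u : ℝ → ℂ} {x : X}
    (hs : ∀ k, WP.Rep (us k) (xs k)) (h : WP.Rep u x) (hs0 : ∀ k, fc (us k) 0 = 0) (h0 : fc u 0 = 0)
    (hx : Tendsto xs atTop (𝓝 x)) :
    Tendsto (fun k => eLpNorm (fun θ => us k θ - u θ) 2 per) atTop (𝓝 0) := by
  have h1 : ∀ k, eLpNorm (fun θ => us k θ - u θ) 2 per
      ≤ ENNReal.ofReal (2 * π * ‖xs k - x‖ ^ 2) ^ (1/2:ℝ) := by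
    intro k
    rw [eLpNorm_two_eq]
    gcongr
    refine ((hs k).sub h).lintegral_le ?_
    rw [fc_sub (integrable_of_memLp_two (hs k).memLp) (integrable_of_memLp_two h.memLp), hs0,
        h0, sub_zero]
  refine tendsto_of_tendsto_of_tendsto_of_le_of_le tendsto_const_nhds ?_ (fun k => zero_le) h1
  have h2 : Tendsto (fun k => 2 * π * ‖xs k - x‖ ^ 2) atTop (𝓝 (2 * π * 0 ^ 2)) :=
    (((tendsto_iff_norm_sub_tendsto_zero.1 hx).pow 2).const_mul _)
  have h3 := ((ENNReal.continuous_rpow_const (y :=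
      (1/2:ℝ))).tendsto _).comp (ENNReal.tendsto_ofReal h2)
  rw [zero_pow two_ne_zero, mul_zero, ENNReal.ofReal_zero,
      ENNReal.zero_rpow_of_pos (by norm_num)] at h3
  exact h3

lemma exists_subseq_ae {us : ℕ → ℝ → ℂ} {xs : ℕ → X} {u : ℝ → ℂ} {x : X}
    (hs : ∀ k, WP.Rep (us k) (xs k)) (h : WP.Rep u x) (hs0 : ∀ k, fc (us k) 0 = 0) (h0 : fc u 0 = 0)
    (hx : Tendsto xs atTop (𝓝 x)) :
    ∃ ns : ℕ → ℕ, StrictMono ns ∧ ∀ᵐ θ ∂per, Tendsto (fun i => us (ns i) θ) atTop (𝓝 (u θ)) :=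
  (tendstoInMeasure_of_tendsto_eLpNorm (by norm_num) (fun k => (hs k).memLp.1) h.memLp.1
    (tendsto_eLpNorm hs h hs0 h0 hx)).exists_seq_tendsto_ae

lemma Rep.conj {u : ℝ → ℂ} {x : X} (h : WP.Rep u x) :
    ∃ y, WP.Rep (fun θ => starRingEnd ℂ (u θ)) y ∧ ‖y‖ = ‖x‖ := by
  have hm : MemLp (fun θ => starRingEnd ℂ (u θ)) 2 per := h.memLp.star
  have he : douglasEnergyP (fun θ => starRingEnd ℂ (u θ)) = douglasEnergyP u := by
    unfold douglasEnergyP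
    simp only [← map_sub, RCLike.norm_conj]
  obtain ⟨y, hy⟩ := exists_rep hm (by rw [he, h.energy]; exact ENNReal.ofReal_lt_top)
  refine ⟨y, hy, ?_⟩
  rw [hy.energy, h.energy, ENNReal.ofReal_eq_ofReal_iff (by positivity) (by positivity)] at he
  have h2 : ‖y‖ ^ 2 = ‖x‖ ^ 2 := mul_left_cancel₀ (by positivity) he
  exact (pow_left_inj₀ (norm_nonneg _) (norm_nonneg _) two_ne_zero).1 h2

/-- Exponential integrability of functions of finite energy. -/
theorem Rep.lintegral_exp_le {u : ℝ → ℂ} {x : X} (h : WP.Rep u x) (h0 : fc u 0 = 0) :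
    ∫⁻ θ, ENNReal.ofReal (‖Complex.exp (u θ)‖ ^ 2) ∂per
        ≤ ENNReal.ofReal (2 * π * rexp (4 * ‖x‖ ^ 2)) := by
  obtain ⟨x', hx', hn⟩ := h.conj
  have hv := h.add hx'
  set v := fun θ => u θ + starRingEnd ℂ (u θ) with hvdef
  set y := x + x' with hy
  have hfu := integrable_of_memLp_two h.memLp
  have hfu' := integrable_of_memLp_two hx'.memLp
  have hconj0 : fc (fun θ => starRingEnd ℂ (u θ)) 0 = 0 := by
    have := fc_conj u 0; rw [neg_zero] at this; rw [this, h0, map_zero]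
  have hv0 : fc v 0 = 0 := by rw [hvdef, fc_add hfu hfu', h0, hconj0, add_zero]
  have hvr : ∀ n, fc v (-n) = starRingEnd ℂ (fc v n) := fun n => by
    rw [← fc_conj]; congr 1; funext θ; simp [hvdef, add_comm]
  have hny : ‖y‖ ^ 2 ≤ 4 * ‖x‖ ^ 2 := by
    have := norm_add_le x x'
    rw [hn] at this
    rw [← hy] at this
    nlinarith [norm_nonneg y, norm_nonneg x]
  have hys := norm_sq_eq y
  have hyn : ∀ n, ‖y n‖ ^ 2 = |(n:ℝ)| * ‖fc v n‖ ^ 2 := fun n => by rw [hv.coord, norm_sq_coord]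
  have hb : ∀ n : ℤ, ‖fc v n‖ ≤ ‖y‖ := fun n => by
    rcases eq_or_ne n 0 with rfl | hn
    · rw [hv0]; simp
    · have h1 := le_hasSum hys n fun m _ => sq_nonneg _
      rw [hyn] at h1
      have h2 : (1:ℝ) ≤ |(n:ℝ)| := by exact_mod_cast Int.one_le_abs hn
      exact (sq_le_sq₀ (norm_nonneg _) (norm_nonneg _)).1
        ((le_mul_of_one_le_left (sq_nonneg _) h2).trans h1)
  obtain ⟨q, hq, hqt⟩ := exists_analytic (c := fun n : ℕ => fc v n) (M := ‖y‖) fun n => hb n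
  have hq0 : q 0 = 0 := by rw [← tc_zero q, hqt]; exact_mod_cast hv0
  have hle : Summable (fun n : ℕ => (n:ℝ) * ‖tc q n‖ ^ 2) ∧ ∑' n :
      ℕ, (n:ℝ) * ‖tc q n‖ ^ 2 ≤ ‖y‖ ^ 2 := by
    have e : ∀ n : ℕ, (n:ℝ) * ‖tc q n‖ ^ 2 = ‖y (n:ℤ)‖ ^ 2 := fun n => by
      rw [hyn, hqt]; simp
    simp only [e]
    have hs : Summable (fun n : ℕ => ‖y (n:ℤ)‖ ^ 2) :=
        hys.summable.comp_injective Nat.cast_injective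
    refine ⟨hs, ?_⟩
    rw [← hys.tsum_eq]
    exact hs.tsum_le_tsum_of_inj (fun n : ℕ => (n : ℤ)) Nat.cast_injective (fun _ _ => sq_nonneg _)
      (fun _ => le_rfl) hys.summable
  have hcirc : ∀ k, ∫⁻ θ, ENNReal.ofReal (‖Complex.exp (q (rad k * ee 1 θ))‖ ^ 2) ∂per ≤
      ENNReal.ofReal (2 * π * rexp (4 * ‖x‖ ^ 2)) := fun k => by
    rw [lintegral_circle (differentiableOn_exp hq) (rad_nonneg k) (rad_lt_one k),
      ENNReal.ofReal_mul (p := 2 * π) (by positivity)]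
    refine mul_le_mul' (le_refl (ENNReal.ofReal (2 * π))) ?_
    refine ENNReal.tsum_le_of_sum_range_le fun N => ?_
    rw [← ENNReal.ofReal_sum_of_nonneg fun n _ => by have := rad_nonneg k; positivity]
    refine ENNReal.ofReal_le_ofReal ?_
    calc _ ≤ ∑ n ∈ Finset.range N, ‖tc (fun z => Complex.exp (q z)) n‖ ^ 2 := by
          refine Finset.sum_le_sum fun n _ => mul_le_of_le_one_right (sq_nonneg _) ?_
          exact pow_le_one₀ (rad_nonneg k) (rad_lt_one k).le
      _ ≤ _ := lebedev_milin hq hq0 hle.1 N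
      _ ≤ _ := by gcongr; exact hle.2.trans hny
  obtain ⟨ys, hysc, hyst⟩ := exists_dilate y
  set w : ℕ → ℝ → ℂ := fun k θ => q (rad k * ee 1 θ) with hw
  have hwc : ∀ k, Continuous (w k) := fun k => by
    refine hq.continuousOn.comp_continuous (by have := continuous_ee 1; fun_prop) fun θ => ?_
    exact circle_mem_ball (rad_nonneg k) (rad_lt_one k) θ
  have hwcc : ∀ k, Continuous (fun θ => starRingEnd ℂ (w k θ)) :=
      fun k => Complex.continuous_conj.comp (hwc k)
  have hwn : ∀ k (n : ℤ), fc (fun θ => w k θ + starRingEnd ℂ (w k θ)) n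
      = ((rad k ^ n.natAbs : ℝ) : ℂ) * fc v n := by
    intro k n
    rw [fc_add (integrable_of_continuous (hwc k)) (integrable_of_continuous (hwcc k))]
    have hcn := fc_conj (w k) (-n)
    rw [neg_neg] at hcn
    rw [hcn]
    rcases lt_trichotomy n 0 with hn | rfl | hn
    · rw [hw, fc_circle_neg hq (rad_nonneg k) (rad_lt_one k) hn]
      obtain ⟨m, rfl⟩ : ∃ m : ℕ, n = -(m:ℤ) := ⟨n.natAbs, by omega⟩
      rw [neg_neg, fc_circle hq (rad_nonneg k) (rad_lt_one k), hqt, hvr]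
      simp [mul_comm]
    · have := fc_circle hq (rad_nonneg k) (rad_lt_one k) 0
      rw [tc_zero, hq0, zero_mul, Nat.cast_zero] at this
      simp [hw, this, hv0]
    · rw [hw, fc_circle_neg hq (rad_nonneg k) (rad_lt_one k) (n := -n) (by omega)]
      obtain ⟨m, rfl⟩ : ∃ m : ℕ, n = (m:ℤ) := ⟨n.natAbs, by omega⟩
      rw [fc_circle hq (rad_nonneg k) (rad_lt_one k), hqt]
      simp [mul_comm]
  have hrep : ∀ k, WP.Rep (fun θ => w k θ + starRingEnd ℂ (w k θ)) (ys k) := fun k =>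
    ⟨memLp_of_continuous ((hwc k).add (hwcc k)) 2, fun n => by rw [hysc, hwn, hv.coord]; ring⟩
  obtain ⟨ns, -, hns⟩ := exists_subseq_ae hrep hv (fun k => by rw [hwn, hv0, mul_zero]) hv0 hyst
  have hsq : ∀ z : ℂ, ‖Complex.exp z‖ ^ 2 = ‖Complex.exp (z + starRingEnd ℂ z)‖ := fun z => by
    rw [Complex.norm_exp, Complex.norm_exp, ← Real.exp_nat_mul]; congr 1; simp; ring
  calc _ ≤ ∫⁻ θ, liminf (fun i => ENNReal.ofReal (‖Complex.exp (w (ns i) θ)‖ ^ 2)) atTop ∂per := by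
        refine lintegral_mono_ae ?_
        filter_upwards [hns] with θ hθ
        refine le_of_eq (Tendsto.liminf_eq ?_).symm
        refine ENNReal.tendsto_ofReal ?_
        simp only [hsq]
        exact ((Complex.continuous_exp.tendsto _).comp hθ).norm
    _ ≤ liminf (fun i => ∫⁻ θ, ENNReal.ofReal (‖Complex.exp (w (ns i) θ)‖ ^ 2) ∂per) atTop := by
        refine lintegral_liminf_le' fun i => ?_
        have := hwc (ns i)
        exact (ENNReal.continuous_ofReal.comp (by fun_prop)).aemeasurable
    _ ≤ liminf (fun _ : ℕ => ENNReal.ofReal (2 * π * rexp (4 * ‖x‖ ^ 2))) atTop :=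
        liminf_le_liminf (Eventually.of_forall fun i => hcirc (ns i))
    _ = _ := liminf_const _

lemma norm_exp_sub_exp_le (a b : ℂ) :
    ‖Complex.exp a - Complex.exp b‖ ≤ ‖a - b‖ * (‖Complex.exp a‖ + ‖Complex.exp b‖) := by
  have h := (convex_segment b a).norm_image_sub_le_of_norm_deriv_le (f := Complex.exp)
    (C := ‖Complex.exp a‖ + ‖Complex.exp b‖) (fun z _ => Complex.differentiable_exp z)
        (fun z hz => ?_)
    (left_mem_segment ℝ b a) (right_mem_segment ℝ b a)
  · rwa [mul_comm]
  · rw [Complex.deriv_exp, Complex.norm_exp, Complex.norm_exp, Complex.norm_exp]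
    have h1 : z.re ≤ max a.re b.re := by
      obtain ⟨s, t, hs, ht, hst, rfl⟩ := hz
      simp only [Complex.add_re, Complex.real_smul, Complex.re_ofReal_mul]
      calc s * b.re + t * a.re ≤ s * max a.re b.re + t * max a.re b.re := by
            gcongr
            · exact le_max_right _ _
            · exact le_max_left _ _
        _ = _ := by rw [← add_mul, hst, one_mul]
    rcases le_max_iff.1 h1 with h | h
    · linarith [exp_le_exp.2 h, exp_pos b.re]
    · linarith [exp_le_exp.2 h, exp_pos a.re]

lemma Rep.memLp_exp {u : ℝ → ℂ} {x : X} (h : WP.Rep u x) (h0 : fc u 0 = 0) :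
    MemLp (fun θ => Complex.exp (u θ)) 2 per ∧
      eLpNorm (fun θ => Complex.exp (u θ)) 2 per
          ≤ ENNReal.ofReal (2 * π * rexp (4 * ‖x‖ ^ 2)) ^ (1 / 2 : ℝ) := by
  have h1 : eLpNorm (fun θ => Complex.exp (u θ)) 2 per ≤
      ENNReal.ofReal (2 * π * rexp (4 * ‖x‖ ^ 2)) ^ (1 / 2 : ℝ) := by
    rw [eLpNorm_two_eq]
    gcongr
    exact h.lintegral_exp_le h0
  exact ⟨⟨Complex.continuous_exp.comp_aestronglyMeasurable h.memLp.1,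
    h1.trans_lt (ENNReal.rpow_lt_top_of_nonneg (by norm_num) ENNReal.ofReal_ne_top)⟩, h1⟩

lemma tendsto_eLpNorm_exp {us : ℕ → ℝ → ℂ} {xs : ℕ → X} {u : ℝ → ℂ} {x : X}
    (hs : ∀ k, WP.Rep (us k) (xs k)) (h : WP.Rep u x) (hs0 : ∀ k, fc (us k) 0 = 0) (h0 : fc u 0 = 0)
    (hx : Tendsto xs atTop (𝓝 x)) :
    Tendsto (fun k =>
        eLpNorm (fun θ => Complex.exp (us k θ) - Complex.exp (u θ)) 1 per) atTop (𝓝 0) := by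
  set L : ℝ → ENNReal := fun s => ENNReal.ofReal (2 * π * rexp (4 * s ^ 2)) ^ (1 / 2 : ℝ) with hL
  have h1 : ∀ k, eLpNorm (fun θ => Complex.exp (us k θ) - Complex.exp (u θ)) 1 per ≤
      eLpNorm (fun θ => us k θ - u θ) 2 per * (L ‖xs k‖ + L ‖x‖) := by
    intro k
    have hk := (hs k).memLp_exp (hs0 k)
    have hu := h.memLp_exp h0
    have m1 := hk.1.1.norm
    have m2 := hu.1.1.norm
    have m3 := (hs k).memLp.1.sub h.memLp.1
    calc _ ≤ eLpNorm ((fun θ => ‖Complex.exp (us k θ)‖ + ‖Complex.exp (u θ)‖) • fun θ =>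
        us k θ - u θ) 1 per := by
          refine eLpNorm_mono fun θ => ?_
          refine (norm_exp_sub_exp_le _ _).trans (le_of_eq ?_)
          rw [Pi.smul_apply', norm_smul, norm_of_nonneg (by positivity), mul_comm]
      _ ≤ eLpNorm (fun θ => ‖Complex.exp (us k θ)‖ + ‖Complex.exp (u θ)‖) 2 per *
          eLpNorm (fun θ => us k θ - u θ) 2 per :=
        eLpNorm_smul_le_mul_eLpNorm (p := 2) (q := 2) m3 (m1.add m2)
      _ ≤ (L ‖xs k‖ + L ‖x‖) * eLpNorm (fun θ => us k θ - u θ) 2 per := by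
        refine mul_le_mul' ((eLpNorm_add_le m1 m2 (by norm_num)).trans (add_le_add ?_ ?_)) le_rfl
        · rw [eLpNorm_norm]; exact hk.2
        · rw [eLpNorm_norm]; exact hu.2
      _ = _ := mul_comm _ _
  refine tendsto_of_tendsto_of_tendsto_of_le_of_le tendsto_const_nhds ?_ (fun k => zero_le) h1
  have hLc : Tendsto (fun k => L ‖xs k‖ + L ‖x‖) atTop (𝓝 (L ‖x‖ + L ‖x‖)) := by
    refine Tendsto.add_const _ ?_
    have : Continuous L := by
      refine ENNReal.continuous_rpow_const.comp (ENNReal.continuous_ofReal.comp ?_)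
      fun_prop
    exact (this.tendsto _).comp hx.norm
  have hfin : L ‖x‖ ≠ ⊤ := ENNReal.rpow_ne_top_of_nonneg (by norm_num) ENNReal.ofReal_ne_top
  have := ENNReal.Tendsto.mul (tendsto_eLpNorm hs h hs0 h0 hx)
      (Or.inr (by finiteness)) hLc (Or.inr (by simp))
  rwa [zero_mul] at this

theorem tendsto_integral_exp {us : ℕ → ℝ → ℂ} {xs : ℕ → X} {u : ℝ → ℂ} {x : X}
    (hs : ∀ k, WP.Rep (us k) (xs k)) (h : WP.Rep u x) (hs0 : ∀ k, fc (us k) 0 = 0) (h0 : fc u 0 = 0)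
    (hx : Tendsto xs atTop (𝓝 x)) {m : ℝ → ℂ} (hm : AEStronglyMeasurable m per)
        (hb : ∀ θ, ‖m θ‖ ≤ 1) :
    Tendsto (fun k => ∫ θ, m θ * Complex.exp (us k θ) ∂per) atTop
      (𝓝 (∫ θ, m θ * Complex.exp (u θ) ∂per)) := by
  have hi : ∀ {v : ℝ → ℂ} {y : X}, WP.Rep v y → fc v 0
      = 0 → Integrable (fun θ => m θ * Complex.exp (v θ)) per := 
    fun hv hv0 =>
        (integrable_of_memLp_two (hv.memLp_exp hv0).1).bdd_mul hm (Eventually.of_forall hb)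
  refine tendsto_integral_of_L1' _ (hi h h0).1 (Eventually.of_forall fun k => hi (hs k) (hs0 k)) ?_
  refine tendsto_of_tendsto_of_tendsto_of_le_of_le tendsto_const_nhds
    (tendsto_eLpNorm_exp hs h hs0 h0 hx) (fun k => zero_le) fun k => ?_
  refine eLpNorm_mono fun θ => ?_
  simp only [Pi.sub_apply, ← mul_sub, norm_mul]
  exact mul_le_of_le_one_left (norm_nonneg _) (hb θ)

/-- Exponentials of functions with only positive modes. -/
theorem fc_exp_of_pos {u : ℝ → ℂ} {x : X} (h : WP.Rep u x) (h0 : fc u 0 = 0)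
    (hneg : ∀ n < 0, fc u n = 0) :
    ∃ g, DifferentiableOn ℂ g (ball 0 1) ∧ g 0 = 0 ∧ (∀ n : ℕ, tc g n = fc u n) ∧
      (∀ n < 0, fc (fun θ => Complex.exp (u θ)) n = 0) ∧
      ∀ n : ℕ, fc (fun θ => Complex.exp (u θ)) n = tc (fun z => Complex.exp (g z)) n := by
  have hb : ∀ n : ℤ, ‖fc u n‖ ≤ ‖x‖ := fun n => by
    rcases eq_or_ne n 0 with rfl | hn
    · rw [h0]; simp
    · have h1 := le_hasSum (norm_sq_eq x) n fun m _ => sq_nonneg _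
      rw [h.coord, norm_sq_coord] at h1
      have h2 : (1:ℝ) ≤ |(n:ℝ)| := by exact_mod_cast Int.one_le_abs hn
      exact (sq_le_sq₀ (norm_nonneg _) (norm_nonneg _)).1
        ((le_mul_of_one_le_left (sq_nonneg _) h2).trans h1)
  obtain ⟨g, hg, hgt⟩ := exists_analytic (c := fun n : ℕ => fc u n) (M := ‖x‖) fun n => hb n
  have hg0 : g 0 = 0 := by rw [← tc_zero g, hgt]; exact_mod_cast h0
  refine ⟨g, hg, hg0, hgt, ?_⟩
  obtain ⟨ys, hysc, hyst⟩ := exists_dilate x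
  have hc : ∀ k, Continuous (fun θ => g (rad k * ee 1 θ)) := fun k => by
    refine hg.continuousOn.comp_continuous (by have := continuous_ee 1; fun_prop) fun θ => ?_
    exact circle_mem_ball (rad_nonneg k) (rad_lt_one k) θ
  have hn : ∀ k (n : ℤ), fc (fun θ => g (rad k * ee 1 θ)) n
      = ((rad k ^ n.natAbs : ℝ) : ℂ) * fc u n := by
    intro k n
    rcases lt_or_ge n 0 with hn | hn
    · rw [fc_circle_neg hg (rad_nonneg k) (rad_lt_one k) hn, hneg n hn, mul_zero]
    · obtain ⟨m, rfl⟩ : ∃ m : ℕ, n = (m:ℤ) := ⟨n.natAbs, by omega⟩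
      rw [fc_circle hg (rad_nonneg k) (rad_lt_one k), hgt]
      simp [mul_comm]
  have hrep : ∀ k, WP.Rep (fun θ => g (rad k * ee 1 θ)) (ys k) := fun k =>
    ⟨memLp_of_continuous (hc k) 2, fun n => by rw [hysc, hn, h.coord]; ring⟩
  have key : ∀ n, Tendsto (fun k => fc (fun θ => Complex.exp (g (rad k * ee 1 θ))) n) atTop
      (𝓝 (fc (fun θ => Complex.exp (u θ)) n)) := fun n => by
    simp only [fc_eq_setIntegral]
    exact (tendsto_integral_exp hrep h (fun k => by rw [hn, h0, mul_zero]) h0 hyst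
      (continuous_ee (-n)).aestronglyMeasurable fun θ => (norm_ee _ _).le).const_mul _
  refine ⟨fun n hn => ?_, fun n => ?_⟩
  · refine tendsto_nhds_unique (key n) ?_
    simp only [fc_circle_neg (differentiableOn_exp hg) (rad_nonneg _) (rad_lt_one _) hn]
    exact tendsto_const_nhds
  · refine tendsto_nhds_unique (key n) ?_
    simp only [fc_circle (differentiableOn_exp hg) (rad_nonneg _) (rad_lt_one _)]
    have := ((Complex.continuous_ofReal.tendsto _).comp tendsto_rad).pow n
    simpa using this.const_mul (tc (fun z => Complex.exp (g z)) n)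

theorem Cap.energy_lt_top {a : ℝ → ℂ} (h : Cap a) {R : ℝ} (hR : 0 < R) (ha : ∀ θ, ‖a θ‖ ≤ R) :
    douglasEnergyP a < ⊤ := by
  let χ : ContDiffBump (0 : ℂ) := ⟨R, R + 1, hR, by linarith⟩
  set φ : ℂ → ℂ := fun w => χ w • w with hφ
  have hφc : ContDiff ℝ 1 φ := χ.contDiff.smul contDiff_id
  have hsupp : HasCompactSupport φ := χ.hasCompactSupport.smul_right
  have he : (fun θ => φ (a θ)) = a := by
    funext θ
    have : χ (a θ) = 1 := χ.one_of_mem_closedBall (by simpa using ha θ)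
    simp [hφ, this]
  have h1 := h φ hφc
  rw [he] at h1
  refine h1.trans_lt (ENNReal.mul_lt_top ENNReal.ofReal_lt_top ?_)
  have hc : Continuous fun w => ‖fderiv ℝ φ w‖ ^ 2 := by
    have := hφc.continuous_fderiv one_ne_zero
    fun_prop
  have hs : HasCompactSupport fun w => ‖fderiv ℝ φ w‖ ^ 2 :=
    (hsupp.fderiv (𝕜 := ℝ)).comp_left (g := fun T => ‖T‖ ^ 2) (by simp)
  have := (hc.integrable_of_hasCompactSupport (μ := volume) hs).lintegral_lt_top
  exact this

lemma one_lt_norm_inv {z : ℂ} (hz : z ≠ 0) (h : ‖z‖ < 1) : 1 < ‖z⁻¹‖ := by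
  rw [norm_inv]; exact (one_lt_inv₀ (norm_pos_iff.2 hz)).2 h

/-- The exterior map in the coordinate `1/z` at infinity. -/
theorem exists_exterior {G : ℂ → ℂ} {w₀ : ℂ} (hG : DifferentiableOn ℂ G {z : ℂ | 1 < ‖z‖})
    (hGi : Set.InjOn G {z : ℂ | 1 < ‖z‖}) (hw : ∀ z : ℂ, 1 < ‖z‖ → G z ≠ w₀)
    (hGc : ContinuousOn G {z : ℂ | 1 ≤ ‖z‖})
    (hGinf : Tendsto G (Bornology.cobounded ℂ) (Bornology.cobounded ℂ)) :
    ∃ g : ℂ → ℂ, DifferentiableOn ℂ g (ball 0 1) ∧ ContinuousOn g (closedBall 0 1) ∧ g 0 ≠ 0 ∧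
      ∀ z ∈ closedBall (0:ℂ) 1, z ≠ 0 → g z = z * G z⁻¹ := by
  set κ : ℂ → ℂ := fun z => (G z⁻¹ - w₀)⁻¹ with hκ
  have hinv : Tendsto (fun z : ℂ => z⁻¹) (𝓝[≠] 0) (Bornology.cobounded ℂ) :=
      tendsto_inv₀_nhdsNE_zero
  have hκ0 : Tendsto κ (𝓝[≠] 0) (𝓝 0) := by
    refine tendsto_inv₀_cobounded.comp ?_
    have : Tendsto (fun w : ℂ => w - w₀) (Bornology.cobounded ℂ) (Bornology.cobounded ℂ) := by
      rw [← tendsto_norm_atTop_iff_cobounded]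
      refine tendsto_atTop_mono (fun w => norm_sub_norm_le w w₀) ?_
      exact tendsto_atTop_add_const_right _ _ tendsto_norm_cobounded_atTop
    exact this.comp (hGinf.comp hinv)
  set k : ℂ → ℂ := Function.update κ 0 0 with hk
  have hkne : ∀ z, z ≠ 0 → k z = κ z := fun z hz => Function.update_of_ne hz _ _
  have hk0 : k 0 = 0 := Function.update_self _ _ _
  have hκd : DifferentiableOn ℂ κ (ball 0 1 \ {0}) := by
    intro z hz
    have hz0 : z ≠ 0 := hz.2
    have h1 := one_lt_norm_inv hz0 (by simpa using hz.1)
    have hopen : IsOpen {z : ℂ | 1 < ‖z‖} := isOpen_lt continuous_const continuous_norm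
    have h2 := (hG.differentiableAt (hopen.mem_nhds h1)).comp z (differentiableAt_inv hz0)
    exact ((h2.sub_const w₀).inv (sub_ne_zero.2 (hw _ h1))).differentiableWithinAt
  have hkd : DifferentiableOn ℂ k (ball 0 1) := by
    refine (Complex.differentiableOn_compl_singleton_and_continuousAt_iff (ball_mem_nhds 0 one_pos)).1
      ⟨hκd.congr fun z hz => hkne z hz.2, ?_⟩
    rw [continuousAt_update_same]
    exact hκ0
  have hkz : ∀ z ∈ ball (0:ℂ) 1, z ≠ 0 → k z ≠ 0 := fun z hz hz0 => by
    rw [hkne z hz0]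
    exact inv_ne_zero (sub_ne_zero.2 (hw _ (one_lt_norm_inv hz0 (by simpa using hz))))
  have hki : Set.InjOn k (ball 0 1) := by
    intro z hz w hw' h
    rcases eq_or_ne z 0 with rfl | hz0
    · by_contra hne
      exact hkz w hw' (Ne.symm hne) (h ▸ hk0)
    rcases eq_or_ne w 0 with rfl | hw0
    · exact absurd (h.trans hk0) (hkz z hz hz0)
    rw [hkne z hz0, hkne w hw0] at h
    have h1 := hGi (one_lt_norm_inv hz0 (by simpa using hz))
        (one_lt_norm_inv hw0 (by simpa using hw'))
      (sub_left_injective (inv_injective h))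
    exact inv_injective h1
  have hd0 : deriv k 0 ≠ 0 := deriv_ne_zero_of_injOn
    (hkd.analyticAt (ball_mem_nhds 0 one_pos)) (ball_mem_nhds 0 one_pos) hki
  have hds : DifferentiableOn ℂ (dslope k 0) (ball 0 1) :=
    (Complex.differentiableOn_dslope (ball_mem_nhds 0 one_pos)).2 hkd
  have hdne : ∀ z ∈ ball (0:ℂ) 1, dslope k 0 z ≠ 0 := fun z hz => by
    rcases eq_or_ne z 0 with rfl | hz0
    · rwa [dslope_same]
    · rw [dslope_of_ne _ hz0, slope_def_field, hk0, sub_zero, sub_zero]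
      exact div_ne_zero (hkz z hz hz0) hz0
  set g : ℂ → ℂ := fun z => if z = 0 then (deriv k 0)⁻¹ else z * G z⁻¹ with hg
  have hgz : ∀ z, z ≠ 0 → g z = z * G z⁻¹ := fun z hz => by simp [hg, hz]
  have hgd : DifferentiableOn ℂ g (ball 0 1) := by
    refine (((hds.inv hdne).add (differentiableOn_id.mul_const w₀))).congr fun z hz => ?_
    rcases eq_or_ne z 0 with rfl | hz0
    · simp [hg, dslope_same]
    · have h1 := sub_ne_zero.2 (hw _ (one_lt_norm_inv hz0 (by simpa using hz)))
      rw [hgz z hz0]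
      simp only [Pi.add_apply, Pi.inv_apply, dslope_of_ne _ hz0, slope_def_field, hk0, sub_zero,
          id, hkne z hz0, hκ]
      field_simp
      ring
  refine ⟨g, hgd, fun z hz => ?_, by simpa [hg] using hd0, fun z _ hz0 => hgz z hz0⟩
  rcases eq_or_ne z 0 with rfl | hz0
  · exact (hgd.differentiableAt (ball_mem_nhds 0 one_pos)).continuousAt.continuousWithinAt
  · have h1 : ContinuousOn (fun z => z * G z⁻¹) (closedBall 0 1 \ {0}) := by
      refine continuousOn_id.mul (hGc.comp (continuousOn_inv₀.mono fun z hz => hz.2) fun z hz => ?_)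
      show 1 ≤ ‖z⁻¹‖
      rw [norm_inv]
      exact (one_le_inv₀ (norm_pos_iff.2 hz.2)).2 (by simpa using hz.1)
    have h2 : ContinuousWithinAt g (closedBall 0 1 \ {0}) z :=
      (h1 z ⟨hz, hz0⟩).congr (fun y hy => hgz y hy.2) (hgz z hz0)
    exact h2.mono_of_mem_nhdsWithin (inter_mem self_mem_nhdsWithin
      (mem_nhdsWithin_of_mem_nhds (isOpen_compl_singleton.mem_nhds hz0)))

/-- The data extracted from a welding: composition operators and the boundary values. -/
structure Weld (F g : ℂ → ℂ) (H K : ℝ → ℝ) (C C' : X →L[ℂ] X) : Prop where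
  ops : Ops H K C C'
  hF : DifferentiableOn ℂ F (ball 0 1)
  inj : Set.InjOn F (ball 0 1)
  cF : ContinuousOn F (closedBall 0 1)
  hg : DifferentiableOn ℂ g (ball 0 1)
  cg : ContinuousOn g (closedBall 0 1)
  g_ne : g 0 ≠ 0
  weld : ∀ θ, F (ee 1 θ) = ee 1 (H θ) * g (ee (-1) (H θ))
  energy : douglasEnergyP (fun θ => F (ee 1 θ)) < ⊤

lemma ee_one_eq (θ : ℝ) : ee 1 θ = Complex.exp (θ * Complex.I) := by
  simp [ee]

lemma ee_mem_sphere (n : ℤ) (θ : ℝ) : ee n θ ∈ sphere (0:ℂ) 1 := by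
  simp [norm_ee]

theorem exists_weld (γ : ℝ → ℂ) (hγc : Continuous γ) (hγp : ∀ θ, γ (θ + 2 * π) = γ θ)
    (hγi : Set.InjOn γ (Set.Ico 0 (2 * π)))
    (hqc : ∃ C : ℝ, 0 < C ∧ Turning C γ)
    (Ω Ωstar : Set ℂ) (hΩconn : IsConnected Ω) (hdisj : Disjoint Ω Ωstar)
    (hunion : Ω ∪ Ωstar = (Set.range γ)ᶜ)
    (F : ℂ → ℂ) (hF : DifferentiableOn ℂ F (ball (0 : ℂ) 1))
    (hFbij : Set.BijOn F (ball (0 : ℂ) 1) Ω)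
    (hFc : ContinuousOn F (closedBall (0 : ℂ) 1))
    (hFΓ : Set.MapsTo F (sphere (0 : ℂ) 1) (Set.range γ))
    (G : ℂ → ℂ) (hG : DifferentiableOn ℂ G {z : ℂ | 1 < ‖z‖})
    (hGbij : Set.BijOn G {z : ℂ | 1 < ‖z‖} Ωstar)
    (hGc : ContinuousOn G {z : ℂ | 1 ≤ ‖z‖})
    (hGinf : Tendsto G (Bornology.cobounded ℂ) (Bornology.cobounded ℂ))
    (H : ℝ → ℝ) (hHc : Continuous H) (hHm : StrictMono H)
    (hHp : ∀ θ, H (θ + 2 * π) = H θ + 2 * π)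
    (hweld : ∀ θ : ℝ, F (Complex.exp (θ * Complex.I)) = G (Complex.exp (H θ * Complex.I))) :
    ∃ g K C C', Weld F g H K C C' := by
  obtain ⟨R, hR, hT⟩ := hqc
  have hγ := isLoop_of_injOn hγc hγp hγi
  obtain ⟨K, hK⟩ := exists_inv hHc hHm hHp
  set a : ℝ → ℂ := fun θ => F (ee 1 θ) with ha
  set b : ℝ → ℂ := fun θ => G (ee 1 θ) with hb
  have hab : ∀ θ, a θ = b (H θ) := fun θ => by
    rw [ha, hb]; simp only [ee_one_eq]; exact hweld θ
  have hba : ∀ t, b t = a (K t) := fun t => by rw [hab, hK.right]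
  have hac : Continuous a := hFc.comp_continuous (continuous_ee 1) fun θ =>
    sphere_subset_closedBall (ee_mem_sphere 1 θ)
  have hap : ∀ θ, a (θ + 2 * π) = a θ := fun θ => by rw [ha]; simp only [ee_period]
  have hdisjΓ : Disjoint Ω (Set.range γ) := by
    rw [Set.disjoint_left]
    intro z hz hz'
    have : z ∈ (Set.range γ)ᶜ := hunion ▸ Or.inl hz
    exact this hz'
  have hne : ∀ {s t : ℝ}, s < t → t < s + 2 * π → a s ≠ a t :=
    boundary_inj hF hFbij.injOn hFc hFbij.mapsTo hΩconn.isPreconnected hγ.isCompact_range hdisjΓ hFΓ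
      fun p hp => hγ.preconnected_compl hp
  have hla : IsLoop a := ⟨hac, hap, fun s t hst h => by
    rw [abs_lt] at hst
    rcases lt_trichotomy s t with h1 | h1 | h1
    · exact absurd h (hne h1 (by linarith))
    · exact h1
    · exact absurd h.symm (hne h1 (by linarith))⟩
  have hlb : IsLoop b := by
    refine ⟨?_, fun t => ?_, fun s t hst h => ?_⟩
    · rw [show b = fun t => a (K t) from funext hba]; exact hac.comp hK.symm.cont
    · rw [hba, hba, hK.symm.per, hap]
    · rw [hba, hba] at h
      rw [abs_lt] at hst
      refine hK.symm.mono.injective (hla.inj _ _ (abs_lt.2 ⟨?_, ?_⟩) h)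
      · have := hK.symm.mono (show t < s + 2 * π by linarith)
        rw [hK.symm.per] at this; linarith
      · have := hK.symm.mono (show s < t + 2 * π by linarith)
        rw [hK.symm.per] at this; linarith
  have hTa : Turning R a := hγ.turning_transfer hla (by
    rintro _ ⟨θ, rfl⟩; exact hFΓ (ee_mem_sphere 1 θ)) hT
  have hca : Cap a := fun φ hφ => energy_comp_le_interior hF hFbij.injOn hFc hφ
  have hcb : Cap b := fun φ hφ => energy_comp_le_exterior hG hGbij.injOn hGc hφ
  obtain ⟨M, -, h1, h2⟩ := doubling hla hlb hR hTa hca hcb hab hHc hHm hHp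
  obtain ⟨C, hC⟩ := exists_isComp hHc (energy_comp_trig_le hHc hHm hHp h1 h2)
  obtain ⟨C', hO⟩ := exists_ops hK hC
  obtain ⟨w₀, hw₀⟩ := hΩconn.nonempty
  obtain ⟨g, hg, hgc, hg0, hgG⟩ := exists_exterior (w₀ := w₀) hG hGbij.injOn
    (fun z hz h => Set.disjoint_left.1 hdisj hw₀ (h ▸ hGbij.mapsTo hz)) hGc hGinf
  obtain ⟨B, hB⟩ := (isCompact_closedBall (0:ℂ) 1).exists_bound_of_continuousOn hFc
  refine ⟨g, K, C, C', hO, hF, hFbij.injOn, hFc, hg, hgc, hg0, fun θ => ?_, ?_⟩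
  · have h3 := hgG (ee (-1) (H θ)) (sphere_subset_closedBall (ee_mem_sphere _ _)) (ee_ne_zero _ _)
    have h4 : (ee (-1) (H θ))⁻¹ = ee 1 (H θ) := by rw [← ee_neg, neg_neg]
    rw [h3, h4, ← mul_assoc, ← ee_add, add_neg_cancel, ee_zero, one_mul]
    exact hab θ
  · exact hca.energy_lt_top (R := max B 1) (by positivity) fun θ =>
      (hB _ (sphere_subset_closedBall (ee_mem_sphere 1 θ))).trans (le_max_left _ _)

lemma intervalIntegrable_of_per {d : ℝ → ℂ} (hd : Integrable d per) :
    IntervalIntegrable d volume 0 (2 * π) :=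
  (intervalIntegrable_iff_integrableOn_Ioc_of_le two_pi_pos.le).2 hd

lemma Inv.refl : Inv (fun θ => θ) (fun θ => θ) :=
  ⟨continuous_id, strictMono_id, fun _ => rfl, fun _ => rfl, fun _ => rfl⟩

lemma integral_eq_fc (u : ℝ → ℂ) (n : ℤ) :
    ∫ θ in 0..(2 * π), ee (-n) θ * u θ = (2 * π : ℂ) * fc u n := by
  have hp : (π : ℂ) ≠ 0 := by exact_mod_cast pi_ne_zero
  rw [fc]; push_cast; field_simp

lemma fc_primitive {d : ℝ → ℂ} (hd : Integrable d per) (h0 : fc d 0 = 0) (n : ℤ) :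
    fc d n = n * Complex.I * fc (fun θ => ∫ σ in 0..θ, d σ) n := by
  have hp : (π : ℂ) ≠ 0 := by exact_mod_cast pi_ne_zero
  have hA : ∫ σ in 0..(2 * π), d σ = 0 := by
    have := integral_eq_fc d 0
    rw [h0, mul_zero] at this
    simpa [ee_zero] using this
  have := Inv.refl.integral_comp_mul (A := fun θ => ∫ σ in 0..θ, d σ) (a' := d)
    (u := ee (-n)) (u' := fun t => (-n : ℤ) * Complex.I * ee (-n) t)
    (intervalIntegrable_of_per hd) (by simp) (fun t => hasDerivAt_ee _ _)
    (continuous_const.mul (continuous_ee _))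
  rw [integral_eq_fc, hA, intervalIntegral.integral_same] at this
  have e : ∀ t, (∫ σ in 0..t, d σ) * (((-n : ℤ) : ℂ) * Complex.I * ee (-n) t) =
      (-n * Complex.I) * (ee (-n) t * ∫ σ in 0..t, d σ) := fun t => by push_cast; ring
  simp only [e] at this
  rw [intervalIntegral.integral_const_mul, integral_eq_fc] at this
  have h2 : (2 * π : ℂ) ≠ 0 := mul_ne_zero two_ne_zero hp
  apply mul_left_cancel₀ h2
  rw [this]; ring

lemma memLp_of_continuousOn {u : ℝ → ℂ} (hu : ContinuousOn u (Set.Icc 0 (2 * π))) (p : ENNReal) :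
    MemLp u p per := by
  obtain ⟨C, hC⟩ := (isCompact_Icc (a := 0) (b := 2 * π)).exists_bound_of_continuousOn hu
  refine MemLp.of_bound ?_ C ?_
  · exact (hu.mono Set.Ioc_subset_Icc_self).aestronglyMeasurable measurableSet_Ioc
  · rw [per]
    filter_upwards [ae_restrict_mem measurableSet_Ioc] with θ hθ
    exact hC θ (Set.Ioc_subset_Icc_self hθ)

lemma eqOn_of_ae_per {u v : ℝ → ℂ} (h : u =ᵐ[per] v) (hu : ContinuousOn u (Set.Icc 0 (2 * π)))
    (hv : ContinuousOn v (Set.Icc 0 (2 * π))) : Set.EqOn u v (Set.Icc 0 (2 * π)) := by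
  refine Measure.eqOn_Icc_of_ae_eq volume two_pi_pos.ne ?_ hu hv
  rw [← restrict_Ioc_eq_restrict_Icc]
  exact h

lemma eqOn_const_of_fc {u : ℝ → ℂ} (hu : ContinuousOn u (Set.Icc 0 (2 * π)))
    (h : ∀ n, n ≠ 0 → fc u n = 0) : ∀ θ ∈ Set.Icc 0 (2 * π), u θ = u 0 := by
  have h0 : u =ᵐ[per] fun _ => fc u 0 := by
    refine ae_eq_of_fc_eq (memLp_of_continuousOn hu 2) (memLp_of_continuous continuous_const 2)
      fun n => ?_
    have e : (fun _ : ℝ => fc u 0) = fun θ => fc u 0 * ee 0 θ := by funext θ; rw [ee_zero, mul_one]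
    rw [e, fc_const_mul, fc_ee]
    by_cases hn : n = 0
    · simp [hn]
    · simp [hn, h n hn]
  have h1 := eqOn_of_ae_per h0 hu continuousOn_const
  intro θ hθ
  rw [h1 hθ, h1 (Set.left_mem_Icc.2 two_pi_pos.le)]

/-- A continuous function is a primitive of `d` as soon as the Fourier coefficients say so. -/
theorem eq_primitive {a d : ℝ → ℂ} (ha : ContinuousOn a (Set.Icc 0 (2 * π)))
    (hd : Integrable d per) (h : ∀ n, fc d n = n * Complex.I * fc a n) :
    ∀ θ ∈ Set.Icc 0 (2 * π), a θ = a 0 + ∫ σ in 0..θ, d σ := by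
  have hA : ContinuousOn (fun θ => ∫ σ in 0..θ, d σ) (Set.Icc 0 (2 * π)) := by
    have := intervalIntegral.continuousOn_primitive_interval (μ := volume) (f := d) (a := 0)
      (b := 2 * π) ?_
    · rwa [Set.uIcc_of_le two_pi_pos.le] at this
    · rw [Set.uIcc_of_le two_pi_pos.le, integrableOn_Icc_iff_integrableOn_Ioc]
      exact hd
  have h0 : fc d 0 = 0 := by rw [h]; simp
  have := eqOn_const_of_fc (u := fun θ => a θ - ∫ σ in 0..θ, d σ) (ha.sub hA) fun n hn => by
    rw [fc_sub (integrable_of_memLp_two (memLp_of_continuousOn ha 2))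
      (integrable_of_memLp_two (memLp_of_continuousOn hA 2))]
    have h1 := fc_primitive hd h0 n
    rw [h] at h1
    have : (n * Complex.I : ℂ) ≠ 0 := mul_ne_zero (by exact_mod_cast hn) Complex.I_ne_zero
    rw [mul_left_cancel₀ this h1, sub_self]
  intro θ hθ
  have h2 := this θ hθ
  simp only [intervalIntegral.integral_same, sub_zero] at h2
  rw [← h2]; ring

lemma fc_ee_mul (m : ℤ) (v : ℝ → ℂ) (n : ℤ) : fc (fun θ => ee m θ * v θ) n = fc v (n - m) := by
  unfold fc
  congr 2
  funext θ
  rw [← mul_assoc, ← ee_add]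
  congr 2; ring

lemma integral_disk_boundary_neg {V : ℂ → ℂ} (hV : DifferentiableOn ℂ V (ball 0 1))
    (hc : ContinuousOn V (closedBall 0 1)) :
    ∫ t in 0..(2 * π), V (ee (-1) t) = (2 * π : ℂ) * V 0 := by
  have h1 := integral_eq_fc (fun t => V (ee (-1) t)) 0
  have h2 := fc_comp_neg (u := fun t => V (ee 1 t)) (fun t => by rw [ee_period]) 0
  have e : ∀ t, ee 1 (-t) = ee (-1) t := fun t => by simp [ee]
  simp only [e] at h2
  rw [h2, neg_zero] at h1
  have h3 := fc_boundary hV hc 0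
  rw [Nat.cast_zero] at h3
  rw [h3, tc_zero] at h1
  simpa [ee_zero] using h1

/-- A holomorphic logarithm of the derivative of a univalent function. -/
theorem exists_log_deriv {F : ℂ → ℂ} (hF : DifferentiableOn ℂ F (ball 0 1))
    (inj : Set.InjOn F (ball 0 1)) :
    ∃ L : ℂ → ℂ, DifferentiableOn ℂ L (ball 0 1) ∧ (∀ z ∈ ball (0 : ℂ) 1,
      deriv L z = deriv (deriv F) z / deriv F z ∧ Complex.exp (L z) = deriv F z) := by
  have hne : ∀ z ∈ ball (0 : ℂ) 1, deriv F z ≠ 0 := fun z hz =>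
    deriv_ne_zero_of_injOn (hF.analyticAt (isOpen_ball.mem_nhds hz)) (isOpen_ball.mem_nhds hz) inj
  have h1 := differentiableOn_deriv hF
  have h2 := differentiableOn_deriv h1
  obtain ⟨P, -, hP⟩ := ((h2.div h1 hne).isExactOn_ball).with_val_at 0 0
  have hPd : DifferentiableOn ℂ P (ball 0 1) := fun z hz =>
    (hP z hz).differentiableAt.differentiableWithinAt
  have hconst : ∀ z ∈ ball (0 : ℂ) 1, deriv F z * Complex.exp (-P z) =
      deriv F 0 * Complex.exp (-P 0) := by
    intro z hz
    refine (convex_ball (0 : ℂ) 1).is_const_of_fderivWithin_eq_zero (𝕜 := ℂ)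
      (f := fun z => deriv F z * Complex.exp (-P z)) ?_ ?_ hz (mem_ball_self one_pos)
    · exact h1.mul (hPd.neg.cexp)
    · intro w hw
      rw [fderivWithin_of_isOpen isOpen_ball hw]
      have hd : HasDerivAt (fun z => deriv F z * Complex.exp (-P z)) 0 w := by
        have a1 := (h1.differentiableAt (isOpen_ball.mem_nhds hw)).hasDerivAt
        have a2 := (hP w hw).neg.cexp
        have := a1.mul a2
        have e : deriv (deriv F) w * Complex.exp (-P w) + deriv F w * (Complex.exp (-P w) *
            -(deriv (deriv F) w / deriv F w)) = 0 := by
          field_simp [hne w hw]; ring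
        rw [← e]; exact this
      have := hd.hasFDerivAt.fderiv
      rw [this]; ext; simp
  have h0 := hne 0 (mem_ball_self one_pos)
  refine ⟨fun z => P z + (Complex.log (deriv F 0) - P 0), hPd.add_const _, fun z hz => ⟨?_, ?_⟩⟩
  · rw [deriv_add_const, (hP z hz).deriv]; rfl
  · rw [Complex.exp_add, Complex.exp_sub, Complex.exp_log h0]
    have := hconst z hz
    rw [Complex.exp_neg, Complex.exp_neg] at this
    have e1 := Complex.exp_ne_zero (P z)
    have e2 := Complex.exp_ne_zero (P 0)
    field_simp at this ⊢
    linear_combination -this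

/-- Polynomial approximation of the elements of `X` with negative modes only. -/
theorem exists_poly {ψ : X} (hψ : Pm ψ = ψ) :
    ∃ (p : ℕ → ℂ → ℂ) (xs : ℕ → X), (∀ N, Differentiable ℂ (p N)) ∧
      (∀ N, WP.Rep (fun t => p N (ee (-1) t)) (xs N)) ∧ Tendsto xs atTop (𝓝 ψ) := by
  let ι : ℕ → ℤ := fun n => -((n : ℤ) + 1)
  have hι : Function.Injective ι := fun a b h => by simp only [ι] at h; omega
  have h0 : ∀ n : ℕ, ι n ≠ 0 := fun n => by simp only [ι]; omega
  let cf : ℕ → ℂ := fun n => ψ (ι n) / ((√|(ι n : ℝ)| : ℝ) : ℂ)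
  have hs : HasSum (fun n : ℕ => ψ (ι n) • bs (ι n)) ψ := by
    refine (hι.hasSum_iff (f := fun n : ℤ => ψ n • bs n) fun n hn => ?_).2 (hasSum_bs ψ)
    have : ¬ n < 0 := fun h => hn ⟨(-n - 1).toNat, by simp only [ι]; omega⟩
    have h1 : ψ n = 0 := by rw [← hψ, Pm_apply, if_neg this]
    show ψ n • bs n = 0
    rw [h1, zero_smul]
  refine ⟨fun N z => ∑ n ∈ Finset.range N, cf n * z ^ (n + 1),
    fun N => ∑ n ∈ Finset.range N, ψ (ι n) • bs (ι n), fun N => by fun_prop, fun N => ?_,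
    hs.tendsto_sum_nat⟩
  refine Rep.sum _ fun n _ => ?_
  have h1 := (rep_ee (n := ι n)).const_mul (cf n)
  have e : (fun t => cf n * ee (-1) t ^ (n + 1)) = fun t => cf n * ee (ι n) t := by
    funext t
    rw [ee_pow]
    congr 2
    simp only [ι]; push_cast; ring
  rw [e]
  have e2 : cf n • ((√|(ι n : ℝ)| : ℝ) : ℂ) • bs (ι n) = ψ (ι n) • bs (ι n) := by
    rw [smul_smul]; congr 1
    exact div_mul_cancel₀ _ (sqrt_abs_ne (h0 n))
  rw [← e2]
  exact h1

lemma hasDerivAt_comp_ee_neg {V : ℂ → ℂ} (hV : Differentiable ℂ V) (t : ℝ) :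
    HasDerivAt (fun t => V (ee (-1) t)) (-Complex.I * (ee (-1) t * deriv V (ee (-1) t))) t := by
  have := (hV (ee (-1) t)).hasDerivAt.comp t (hasDerivAt_ee (-1) t)
  have e : deriv V (ee (-1) t) * (((-1 : ℤ) : ℂ) * Complex.I * ee (-1) t) =
    -Complex.I * (ee (-1) t * deriv V (ee (-1) t)) := by push_cast; ring
  rw [← e]; exact this

lemma continuous_deriv_of_entire {V : ℂ → ℂ} (hV : Differentiable ℂ V) : Continuous (deriv V) :=
  (hV.contDiff (n := 1)).continuous_deriv le_rfl

theorem Weld.integral_exterior {F g : ℂ → ℂ} {H K : ℝ → ℝ} {C C' : X →L[ℂ] X}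
    (W : Weld F g H K C C') {a' : ℝ → ℂ} (ha : Integrable a' per)
    (hA : ∀ θ ∈ Set.Icc 0 (2 * π), F (ee 1 θ) = F (ee 1 0) + ∫ σ in 0..θ, a' σ)
    {V : ℂ → ℂ} (hV : Differentiable ℂ V) :
    ∫ θ in 0..(2 * π), V (ee (-1) (H θ)) * a' θ = (2 * π : ℂ) * (Complex.I * g 0 * deriv V 0) := by
  have hV' := continuous_deriv_of_entire hV
  have h1 := W.ops.inv.integral_comp_mul_periodic (A := fun θ => F (ee 1 θ)) (a' := a')
    (intervalIntegrable_of_per ha) hA (fun θ => by rw [ee_period])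
    (hasDerivAt_comp_ee_neg hV)
    (continuous_const.mul ((continuous_ee _).mul (hV'.comp (continuous_ee _))))
    (fun θ => by rw [ee_period]) (fun θ => by rw [ee_period])
  rw [h1]
  have h2 := integral_disk_boundary_neg (V := fun z => g z * deriv V z)
    (W.hg.mul (hV.deriv.differentiableOn)) (W.cg.mul hV'.continuousOn)
  have e : ∀ t, F (ee 1 (K t)) * (-Complex.I * (ee (-1) t * deriv V (ee (-1) t))) =
      -Complex.I * (g (ee (-1) t) * deriv V (ee (-1) t)) := by
    intro t
    rw [W.weld, W.ops.inv.right, ee_neg]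
    have := ee_ne_zero 1 t
    field_simp
  simp only [e]
  rw [intervalIntegral.integral_const_mul, h2]
  ring

/-- Boundary values of `log F'`. -/
theorem exists_boundary_log {F : ℂ → ℂ} (hF : DifferentiableOn ℂ F (ball 0 1))
    (inj : Set.InjOn F (ball 0 1)) (cF : ContinuousOn F (closedBall 0 1))
    (h : ∫⁻ z in ball (0 : ℂ) 1, ENNReal.ofReal (‖deriv (deriv F) z / deriv F z‖ ^ 2) < ⊤) :
    ∃ (u : ℝ → ℂ) (x : X) (c : ℂ), c ≠ 0 ∧ Measurable u ∧ (∀ θ, u (θ + 2 * π) = u θ) ∧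
      WP.Rep u x ∧ fc u 0 = 0 ∧ MemLp (fun θ => Complex.exp (u θ)) 2 per ∧
      ∀ θ ∈ Set.Icc 0 (2 * π), F (ee 1 θ) =
        F (ee 1 0) + ∫ σ in 0..θ, c * Complex.I * (ee 1 σ * Complex.exp (u σ)) := by
  obtain ⟨L, hL, hL'⟩ := exists_log_deriv hF inj
  have hsum : Summable fun n : ℕ => ((n : ℝ) + 1) * ‖tc L (n + 1)‖ ^ 2 := by
    have e : ∫⁻ z in ball (0 : ℂ) 1, ENNReal.ofReal (‖deriv (deriv F) z / deriv F z‖ ^ 2) =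
        ∫⁻ z in ball (0 : ℂ) 1, ENNReal.ofReal (‖deriv L z‖ ^ 2) :=
      setLIntegral_congr_fun measurableSet_ball fun z hz => by rw [(hL' z hz).1]
    rw [e, lintegral_disk (differentiableOn_deriv hL)] at h
    have h1 : ∑' n : ℕ, ENNReal.ofReal (‖tc (deriv L) n‖ ^ 2 / (n + 1)) ≠ ⊤ := by
      intro h2
      rw [h2, ENNReal.mul_top (by simpa using pi_pos)] at h
      exact lt_irrefl _ h
    have h2 := ENNReal.summable_toReal h1
    refine h2.congr fun n => ?_
    rw [ENNReal.toReal_ofReal (by positivity), tc_deriv, norm_mul, mul_pow]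
    have : ‖((n : ℂ) + 1)‖ = (n : ℝ) + 1 := by
      have : ((n : ℂ) + 1) = ((n + 1 : ℕ) : ℂ) := by push_cast; ring
      rw [this, Complex.norm_natCast]; push_cast; ring
    rw [this]
    have : (n : ℝ) + 1 ≠ 0 := by positivity
    field_simp
  let f : ℤ → ℂ := fun n => if 0 < n then ((√|(n : ℝ)| : ℝ) : ℂ) * tc L n.toNat else 0
  have hf : Summable fun n => ‖f n‖ ^ 2 := by
    have hι : Function.Injective (fun n : ℕ => (n : ℤ) + 1) := fun a b h => by
      simp only at h; omega
    refine (hι.summable_iff fun n hn => ?_).1 ?_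
    · have : ¬ 0 < n := fun h => hn ⟨(n - 1).toNat, by simp only; omega⟩
      simp [f, this]
    · refine hsum.congr fun n => ?_
      have h1 : (0 : ℤ) < n + 1 := by omega
      simp only [Function.comp, f, if_pos h1]
      rw [norm_sq_coord]
      have e1 : ((n : ℤ) + 1).toNat = n + 1 := by omega
      rw [e1]; push_cast
      rw [abs_of_nonneg (by positivity)]
  obtain ⟨x, hx⟩ := exists_of_summable hf
  obtain ⟨u, hum, hup, hux, hu0⟩ := exists_fun_rep x (by rw [hx]; simp [f])
  have hpos : ∀ n : ℕ, n ≠ 0 → fc u n = tc L n := by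
    intro n hn
    have h1 := hux.coord n
    have hn' : (n : ℤ) ≠ 0 := by exact_mod_cast hn
    rw [hx] at h1
    simp only [f] at h1
    rw [if_pos (by omega)] at h1
    exact (mul_left_cancel₀ (sqrt_abs_ne hn') h1).symm
  have hneg : ∀ n < 0, fc u n = 0 := by
    intro n hn
    have h1 := hux.coord n
    rw [hx] at h1
    simp only [f] at h1
    rw [if_neg (by omega)] at h1
    exact (mul_eq_zero.1 h1.symm).resolve_left (sqrt_abs_ne hn.ne)
  obtain ⟨q, hq, hq0, hqc, hen, hep⟩ := fc_exp_of_pos hux hu0 hneg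
  have hqL : Set.EqOn q (fun z => L z - L 0) (ball 0 1) := by
    intro z hz
    have h1 := hasSum_tc hq hz
    have h3 : HasSum (fun n => (tc L n - if n = 0 then L 0 else 0) * z ^ n) (L z - L 0) := by
      refine ((hasSum_tc hL hz).sub (hasSum_ite_eq 0 (L 0))).congr_fun fun n => ?_
      by_cases h : n = 0
      · subst h; simp
      · simp [h]
    refine h1.unique (h3.congr_fun fun n => ?_)
    by_cases hn : n = 0
    · subst hn
      rw [tc_zero, tc_zero, hq0, if_pos rfl, sub_self]
    · rw [hqc, hpos n hn, if_neg hn, sub_zero]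
  have hc0 := Complex.exp_ne_zero (L 0)
  have hep' : ∀ n : ℕ, Complex.exp (L 0) * fc (fun θ => Complex.exp (u θ)) n =
      (n + 1) * tc F (n + 1) := by
    intro n
    have e : Set.EqOn (fun z => Complex.exp (q z)) (fun z => Complex.exp (-L 0) * deriv F z)
        (ball 0 1) := by
      intro z hz
      show Complex.exp (q z) = Complex.exp (-L 0) * deriv F z
      rw [hqL hz, ← (hL' z hz).2, ← Complex.exp_add]
      congr 1; ring
    rw [hep, tc_congr e]
    have e2 : tc (fun z => Complex.exp (-L 0) * deriv F z) n
        = Complex.exp (-L 0) * tc (deriv F) n := by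
      rw [tc, tc, iteratedDeriv_const_mul_field]
      ring
    rw [e2, tc_deriv, ← mul_assoc, ← Complex.exp_add]
    simp
  have hmem : MemLp (fun θ => Complex.exp (u θ)) 2 per := (hux.memLp_exp hu0).1
  refine ⟨u, x, Complex.exp (L 0), hc0, hum, hup, hux, hu0, hmem, ?_⟩
  refine eq_primitive ?_ ?_ fun n => ?_
  · exact cF.comp (continuous_ee 1).continuousOn
      fun θ _ => sphere_subset_closedBall (ee_mem_sphere 1 θ)
  · refine Integrable.const_mul ?_ _
    exact integrable_ee_mul (integrable_of_memLp_two hmem) 1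
  · rw [fc_const_mul, fc_ee_mul]
    rcases lt_trichotomy n 0 with hn | rfl | hn
    · rw [hen _ (by omega), fc_boundary_neg hF cF hn]; ring
    · rw [hen _ (by omega)]; simp
    · obtain ⟨m, rfl⟩ : ∃ m : ℕ, n = (m : ℤ) + 1 := ⟨(n - 1).toNat, by omega⟩
      have h1 := hep' m
      have h2 := fc_boundary hF cF (m + 1)
      push_cast at h2
      rw [add_sub_cancel_right, h2, mul_right_comm, h1]
      push_cast; ring

/-- If the image under `H` of the measure `ρ dθ` has no nonconstant Fourier mode, it is a multiple
of Lebesgue measure. -/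
theorem Inv.eq_integral {H K : ℝ → ℝ} (h : Inv H K) {ρ : ℝ → ℝ} (hp : ∀ θ, ρ (θ + 2 * π) = ρ θ)
    (hi : IntervalIntegrable ρ volume 0 (2 * π))
    (h0 : ∀ n : ℤ, n ≠ 0 → ∫ θ in 0..(2 * π), ee (-n) (H θ) * (ρ θ : ℂ) = 0) (s t : ℝ) :
    ((∫ θ in 0..(2 * π), ρ θ) / (2 * π)) * (H t - H s) = ∫ θ in s..t, ρ θ := by
  have hpi := pi_pos
  have hpC : (π : ℂ) ≠ 0 := Complex.ofReal_ne_zero.2 hpi.ne'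
  have hpp : Function.Periodic ρ (2 * π) := hp
  have hii : ∀ a b, IntervalIntegrable ρ volume a b := fun a b =>
    hpp.intervalIntegrable₀ two_pi_pos.ne' hi a b
  set c₀ : ℝ := (∫ θ in 0..(2 * π), ρ θ) / (2 * π) with hc₀
  set A : ℝ → ℝ := fun θ => ∫ σ in 0..θ, ρ σ with hAdef
  have hA2 : A (2 * π) = c₀ * (2 * π) := by rw [hc₀]; field_simp; rfl
  have hA0 : A 0 = 0 := intervalIntegral.integral_same
  have hAp : ∀ θ, A (θ + 2 * π) = A θ + c₀ * (2 * π) := by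
    intro θ
    rw [← hA2]
    have h1 := hpp.intervalIntegral_add_eq θ 0
    rw [zero_add] at h1
    have h2 := intervalIntegral.integral_add_adjacent_intervals (hii 0 θ) (hii θ (θ + 2 * π))
    simp only [hAdef]
    rw [← h2, h1]
  have hAc : Continuous A := intervalIntegral.continuous_primitive hii 0
  set B : ℝ → ℝ := fun t => A (K t) - c₀ * t with hBdef
  have hBc : Continuous B := (hAc.comp h.symm.cont).sub (continuous_const.mul continuous_id)
  have hBp : ∀ t, B (t + 2 * π) = B t := by
    intro t
    simp only [hBdef]
    rw [h.symm.per, hAp]; ring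
  have hBf : ∀ n : ℤ, n ≠ 0 → fc (fun t => (B t : ℂ)) n = 0 := by
    intro n hn
    set u' : ℝ → ℂ := fun t => (-n : ℤ) * Complex.I * ee (-n) t with hu'
    have hu'c : Continuous u' := continuous_const.mul (continuous_ee _)
    have hu : ∀ t, HasDerivAt (ee (-n)) (u' t) t := fun t => hasDerivAt_ee _ _
    have h1 := h.integral_comp_mul (A := fun θ => (A θ : ℂ)) (a' := fun θ => (ρ θ : ℂ))
      (u := ee (-n)) (u' := u') ⟨hi.1.ofReal, hi.2.ofReal⟩
      (fun θ _ => by rw [hA0, intervalIntegral.integral_ofReal]; simp [hAdef]) hu hu'c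
    have e1 := h.per 0
    rw [zero_add] at e1
    rw [h0 n hn, hA0, hA2, e1, ee_period] at h1
    have h2 : ∫ t in (H 0)..(H 0 + 2 * π), (t : ℂ) * u' t = 2 * π * ee (-n) (H 0) := by
      have := intervalIntegral.integral_mul_deriv_eq_deriv_mul (a := H 0) (b := H 0 + 2 * π)
        (u := fun t : ℝ => (t : ℂ)) (u' := fun _ => 1) (v := ee (-n)) (v' := u')
        (fun t _ => by simpa using (hasDerivAt_id t).ofReal_comp) (fun t _ => hu t)
        (by simp) (hu'c.intervalIntegrable _ _)
      rw [this, ee_period]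
      have e2 : ∫ t in (H 0)..(H 0 + 2 * π), (1 : ℂ) * ee (-n) t = 0 := by
        simp only [one_mul]
        rw [integral_window (fun t => ee_period _ t), integral_ee, if_neg (by simpa using hn)]
      rw [e2]; push_cast; ring
    have h3 : ∫ t in (H 0)..(H 0 + 2 * π), (B t : ℂ) * u' t =
        (∫ t in (H 0)..(H 0 + 2 * π), (A (K t) : ℂ) * u' t) -
          c₀ * ∫ t in (H 0)..(H 0 + 2 * π), (t : ℂ) * u' t := by
      rw [← intervalIntegral.integral_const_mul, ← intervalIntegral.integral_sub]
      · congr 1; funext t; simp only [hBdef]; push_cast; ring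
      · refine Continuous.intervalIntegrable ?_ _ _
        exact (Complex.continuous_ofReal.comp (hAc.comp h.symm.cont)).mul hu'c
      · refine Continuous.intervalIntegrable ?_ _ _
        exact continuous_const.mul (Complex.continuous_ofReal.mul hu'c)
    have h4 : ∫ t in 0..(2 * π), (B t : ℂ) * u' t = 0 := by
      rw [← integral_window (g := fun t => (B t : ℂ) * u' t)
        (fun t => by simp only [hu']; rw [hBp, ee_period]) (H 0), h3, h2]
      push_cast at h1
      linear_combination h1
    have e3 : ∀ t, (B t : ℂ) * u' t = (-n * Complex.I) * (ee (-n) t * (B t : ℂ)) := by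
      intro t; simp only [hu']; push_cast; ring
    simp only [e3] at h4
    rw [intervalIntegral.integral_const_mul, integral_eq_fc] at h4
    have h5 : (-n * Complex.I : ℂ) ≠ 0 :=
      mul_ne_zero (neg_ne_zero.2 (by exact_mod_cast hn)) Complex.I_ne_zero
    have h6 := (mul_eq_zero.1 h4).resolve_left h5
    exact (mul_eq_zero.1 h6).resolve_left (mul_ne_zero two_ne_zero hpC)
  have hBconst : ∀ t, B t = B 0 := by
    intro t
    obtain ⟨y, hy, hty⟩ := Function.Periodic.exists_mem_Ico₀ (f := B) hBp two_pi_pos t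
    rw [hty]
    have := eqOn_const_of_fc (u := fun t => (B t : ℂ))
      (Complex.continuous_ofReal.comp hBc).continuousOn hBf y (Set.Ico_subset_Icc_self hy)
    exact_mod_cast this
  have key : ∀ θ, A θ = c₀ * H θ + B 0 := by
    intro θ
    have := hBconst (H θ)
    simp only [hBdef] at this ⊢
    rw [h.left] at this
    linarith
  have h7 := intervalIntegral.integral_interval_sub_left (hii 0 t) (hii 0 s)
  have k1 := key t
  have k2 := key s
  simp only [hAdef] at k1 k2
  rw [← h7, k1, k2]; ring

section
variable {H K : ℝ → ℝ} {C C' : X →L[ℂ] X}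

theorem Ops.exists_displacement (h : Ops H K C C') :
    ∃ d, WP.Rep (fun θ => ((H θ - θ : ℝ) : ℂ)) d := by
  have hc := h.inv.cont
  refine exists_rep (memLp_of_continuous (by fun_prop) 2) (energy_sub_id_lt_top h.inv ?_)
  rw [(h.col 1).energy]
  exact ENNReal.ofReal_lt_top

lemma IsR.add {x y : X} (hx : IsR x) (hy : IsR y) : IsR (x + y) := fun n => by
  show x (-n) + y (-n) = starRingEnd ℂ (x n + y n)
  rw [hx, hy, map_add]

lemma IsR.I_smul_Sg {x : X} (hx : IsR x) (h0 : x 0 = 0) : IsR (Complex.I • Sg x) := fun n => by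
  show Complex.I * Sg x (-n) = starRingEnd ℂ (Complex.I * Sg x n)
  rw [Sg_apply, Sg_apply, hx, map_mul, map_mul, conj_sg, Complex.conj_I]
  rcases eq_or_ne n 0 with rfl | hn
  · rw [h0]; simp
  · have : sg (-n) = -sg n := by
      unfold sg
      rcases lt_or_gt_of_ne hn with h | h
      · rw [if_neg (by omega), if_pos h]; norm_num
      · rw [if_pos (by omega), if_neg (by omega)]
    rw [this]; ring

theorem Ops.exists_real_solution (h : Ops H K C C') {u D : ℝ → ℂ} {x d : X} (hx : WP.Rep u x)
    (hd : WP.Rep D d) (hD : ∀ θ, starRingEnd ℂ (D θ) = D θ) :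
    ∃ Ψ, Pm Ψ = Ψ ∧ IsR (x - C Ψ - Complex.I • d) := by
  obtain ⟨xb, hxb, -⟩ := hx.conj
  set y : X := (1 / (2 * Complex.I)) • (x - xb) - d with hy
  have hyR : IsR y := by
    refine Rep.isR (((hx.sub hxb).const_mul (1 / (2 * Complex.I))).sub hd) fun θ => ?_
    simp only [map_sub, map_mul, map_div₀, map_one, map_ofNat, Complex.conj_I,
        Complex.conj_conj, hD]
    field_simp [Complex.I_ne_zero]
    ring
  have hy0 : y 0 = 0 := (((hx.sub hxb).const_mul (1 / (2 * Complex.I))).sub hd).zero_coord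
  set w := C' y with hw
  have hwR : IsR w := h.symm.isR hyR
  have hw0 : w 0 = 0 := h.symm.map_zero_coord hy0
  have hzR : IsR (C (Complex.I • Sg w)) := h.isR (hwR.I_smul_Sg hw0)
  have hmR : IsR ((1 / 2 : ℂ) • (x + xb)) := by
    refine Rep.isR ((hx.add hxb).const_mul (1 / 2)) fun θ => ?_
    simp only [map_add, map_mul, map_div₀, map_one, map_ofNat, Complex.conj_conj]
    ring
  refine ⟨(2 * Complex.I) • Pm w, by rw [map_smul, Pm_Pm], ?_⟩
  have e1 : (2 * Complex.I) • Pm w = Complex.I • w - Complex.I • Sg w := by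
    show _ = Complex.I • w - Complex.I • (w - (2 : ℂ) • Pm w)
    rw [smul_sub, sub_sub_cancel, smul_smul, mul_comm]
  have e2 : x - C ((2 * Complex.I) • Pm w) - Complex.I • d =
      (1 / 2 : ℂ) • (x + xb) + C (Complex.I • Sg w) := by
    rw [e1, map_sub, map_smul C Complex.I w, hw, h.right, hy, smul_sub, smul_smul]
    have : Complex.I * (1 / (2 * Complex.I)) = 1 / 2 := by field_simp
    rw [this]
    module
  rw [e2]
  exact hmR.add hzR
end

theorem exists_real_rep {x : X} (hR : IsR x) (h0 : x 0 = 0) :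
    ∃ j : ℝ → ℝ, Measurable j ∧ (∀ θ, j (θ + 2 * π) = j θ) ∧ WP.Rep (fun θ => (j θ : ℂ)) x ∧
      fc (fun θ => (j θ : ℂ)) 0 = 0 := by
  obtain ⟨u, hm, hp, hu, hu0⟩ := exists_fun_rep x h0
  obtain ⟨y, hy, -⟩ := hu.conj
  have h1 : (fun θ => starRingEnd ℂ (u θ)) =ᵐ[per] u := by
    refine ae_eq_of_fc_eq hy.memLp hu.memLp fun n => ?_
    have e := fc_conj u (-n)
    rw [neg_neg] at e
    rw [e]
    rcases eq_or_ne n 0 with rfl | hn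
    · rw [neg_zero, hu0, map_zero]
    · have h2 := hR n
      rw [hu.coord, hu.coord, map_mul, Complex.conj_ofReal] at h2
      have h3 : √|((-n : ℤ) : ℝ)| = √|(n : ℝ)| := by push_cast; rw [abs_neg]
      rw [h3] at h2
      rw [mul_left_cancel₀ (sqrt_abs_ne hn) h2, Complex.conj_conj]
  have h2 : u =ᵐ[per] fun θ => (((u θ).re : ℝ) : ℂ) := by
    filter_upwards [h1] with θ hθ
    exact (Complex.conj_eq_iff_re.1 hθ).symm
  exact ⟨fun θ => (u θ).re, Complex.measurable_re.comp hm,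
      fun θ => by simp only [hp], hu.congr_ae h2, by
    rw [← fc_congr h2, hu0]⟩

lemma Rep.sub_mean {u : ℝ → ℂ} {x : X} (h : WP.Rep u x) :
    WP.Rep (fun θ => u θ - fc u 0) x ∧ fc (fun θ => u θ - fc u 0) 0 = 0 := by
  constructor
  · have := h.sub (rep_const (fc u 0))
    rwa [sub_zero] at this
  · rw [fc_sub (integrable_of_memLp_two h.memLp) (integrable_of_continuous continuous_const)]
    have e : (fun _ : ℝ => fc u 0) = fun θ => fc u 0 * ee 0 θ := by funext θ; rw [ee_zero, mul_one]
    rw [e, fc_const_mul, fc_ee]; simp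

lemma exp_neg_I_mul_sub (s θ : ℝ) :
    Complex.exp (-(Complex.I * ((s - θ : ℝ) : ℂ))) = ee (-1) s * ee 1 θ := by
  rw [ee, ee, ← Complex.exp_add]; push_cast; ring_nf

lemma deriv_pow_mul_exp_zero {p : ℂ → ℂ} (hp : Differentiable ℂ p) {n : ℕ} (hn : n ≠ 0) :
    deriv (fun z => z ^ (n + 1) * Complex.exp (p z)) 0 = 0 := by
  have h1 : HasDerivAt (fun z : ℂ => z ^ (n + 1)) (((n + 1 : ℕ) : ℂ) * 0 ^ n) 0 := by
    simpa using hasDerivAt_pow (n + 1) (0 : ℂ)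
  have := h1.mul (hp 0).hasDerivAt.cexp
  have e := this.deriv
  rw [zero_pow hn, zero_pow (Nat.succ_ne_zero n)] at e
  simp only [mul_zero, zero_mul, add_zero] at e
  exact e

theorem Weld.exists_density {F g : ℂ → ℂ} {H K : ℝ → ℝ} {C C' : X →L[ℂ] X}
    (W : Weld F g H K C C')
    (h : ∫⁻ z in ball (0 : ℂ) 1, ENNReal.ofReal (‖deriv (deriv F) z / deriv F z‖ ^ 2) < ⊤) :
    ∃ φ : ℝ → ℝ, (∀ s t : ℝ, s ≤ t → H t - H s = ∫ θ in s..t, φ θ) ∧ (∀ᵐ θ : ℝ, 0 < φ θ) ∧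
        douglasEnergyP (fun θ => (Real.log (φ θ) : ℂ)) < ⊤ := by
  obtain ⟨u, x, c, hc, hum, hup, hux, hu0, hue, hA⟩ := exists_boundary_log W.hF W.inj W.cF h
  obtain ⟨d, hd⟩ := W.ops.exists_displacement
  obtain ⟨Ψ, hΨ, hJ⟩ := W.ops.exists_real_solution hux hd fun θ => Complex.conj_ofReal _
  have hJ0 : (x - C Ψ - Complex.I • d) 0 = 0 := by
    have h1 : Ψ 0 = 0 := by rw [← hΨ, Pm_apply, if_neg (lt_irrefl _)]
    have h2 := W.ops.map_zero_coord h1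
    show x 0 - C Ψ 0 - Complex.I * d 0 = 0
    rw [h2, hux.zero_coord, hd.zero_coord]; simp
  obtain ⟨j, hjm, hjp, hj, hj0⟩ := exists_real_rep hJ hJ0
  obtain ⟨p, xs, hp, hpr, hpl⟩ := exists_poly hΨ
  have hHc := W.ops.inv.cont
  have hintble : Integrable (fun θ => c * Complex.I * (ee 1 θ * Complex.exp (u θ))) per :=
    (integrable_ee_mul (integrable_of_memLp_two hue) 1).const_mul _
  have hcI : c * Complex.I ≠ 0 := mul_ne_zero hc Complex.I_ne_zero
  have hzero : ∀ n : ℕ, n ≠ 0 → ∫ θ, ee (-n) (H θ) * Complex.exp (j θ) ∂per = 0 := by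
    intro n hn
    let v : ℕ → ℝ → ℂ := fun N θ =>
      u θ - p N (ee (-1) (H θ)) - Complex.I * ((H θ - θ : ℝ) : ℂ)
    have hv : ∀ N, WP.Rep (v N) (x - C (xs N) - Complex.I • d) := fun N =>
      (hux.sub (W.ops.comp ((hp N).continuous.comp (continuous_ee _))
        (fun θ => by simp only [Function.comp_apply, ee_period]) (hpr N))).sub (hd.const_mul _)
    have hlim : Tendsto (fun N => x - C (xs N) - Complex.I • d) atTop
        (𝓝 (x - C Ψ - Complex.I • d)) :=
      (tendsto_const_nhds.sub ((C.continuous.tendsto Ψ).comp hpl)).sub tendsto_const_nhds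
    have hT := tendsto_integral_exp (fun N => (hv N).sub_mean.1) hj (fun N => (hv N).sub_mean.2)
      hj0 hlim (m := fun θ => ee (-n) (H θ))
      ((continuous_ee _).comp hHc).aestronglyMeasurable (fun θ => (norm_ee _ _).le)
    have h0 : ∀ N, ∫ θ, ee (-n) (H θ) * Complex.exp (v N θ - fc (v N) 0) ∂per = 0 := by
      intro N
      have hV : Differentiable ℂ fun z => z ^ (n + 1) * Complex.exp (-p N z) :=
        (differentiable_id.pow _).mul (hp N).neg.cexp
      have h1 := W.integral_exterior hintble hA hV
      have hd0 : deriv (fun z => z ^ (n + 1) * Complex.exp (-p N z)) 0 = 0 :=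
        deriv_pow_mul_exp_zero (hp N).neg hn
      rw [hd0, mul_zero, mul_zero,
        intervalIntegral.integral_of_le two_pi_pos.le] at h1
      have e : ∀ θ, ee (-n) (H θ) * Complex.exp (v N θ - fc (v N) 0) =
          Complex.exp (-fc (v N) 0) / (c * Complex.I) *
          (ee (-1) (H θ) ^ (n + 1) * Complex.exp (-p N (ee (-1) (H θ))) *
            (c * Complex.I * (ee 1 θ * Complex.exp (u θ)))) := by
        intro θ
        have e1 : v N θ - fc (v N) 0 = -fc (v N) 0 + (u θ + (-p N (ee (-1) (H θ)) +
          -(Complex.I * ((H θ - θ : ℝ) : ℂ)))) := by simp only [v]; ring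
        rw [e1, Complex.exp_add, Complex.exp_add, Complex.exp_add, exp_neg_I_mul_sub, pow_succ,
          ee_pow]
        have e2 : (-1 : ℤ) * n = -n := by ring
        simp only [e2]
        have := Complex.I_ne_zero
        field_simp
      simp only [e]
      rw [integral_const_mul]
      erw [h1]
      rw [mul_zero]
    simp only [h0] at hT
    exact (tendsto_nhds_unique hT tendsto_const_nhds)
  set ρ : ℝ → ℝ := fun θ => rexp (j θ) with hρ
  have hρC : ∀ θ, ((ρ θ : ℝ) : ℂ) = Complex.exp (j θ) := fun θ => Complex.ofReal_exp _
  have hρi : IntervalIntegrable ρ volume 0 (2 * π) := by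
    have h1 := (integrable_of_memLp_two (hj.memLp_exp hj0).1).re
    rw [intervalIntegrable_iff_integrableOn_Ioc_of_le two_pi_pos.le]
    refine h1.congr (Eventually.of_forall fun θ => ?_)
    show (Complex.exp (j θ)).re = ρ θ
    rw [← hρC, Complex.ofReal_re]
  have hmodes : ∀ n : ℤ, n ≠ 0 → ∫ θ in 0..(2 * π), ee (-n) (H θ) * (ρ θ : ℂ) = 0 := by
    have hn1 : ∀ n : ℕ, n ≠ 0 → ∫ θ in 0..(2 * π), ee (-n) (H θ) * (ρ θ : ℂ) = 0 := by
      intro n hn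
      rw [intervalIntegral.integral_of_le two_pi_pos.le]
      simp only [hρC]
      exact hzero n hn
    intro n hn
    rcases lt_or_gt_of_ne hn with h1 | h1
    · have h2 := congrArg (starRingEnd ℂ) (hn1 n.natAbs (by omega))
      rw [intervalIntegral.integral_of_le two_pi_pos.le, ← integral_conj, map_zero] at h2
      rw [intervalIntegral.integral_of_le two_pi_pos.le, ← h2]
      congr 1; funext θ
      rw [map_mul, conj_ee, Complex.conj_ofReal]
      congr 2; omega
    · have h2 := hn1 n.natAbs (by omega)
      have e : ((n.natAbs : ℕ) : ℤ) = n := by omega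
      rwa [e] at h2
  have hI : 0 < ∫ θ in 0..(2 * π), ρ θ :=
    intervalIntegral.intervalIntegral_pos_of_pos hρi (fun θ => exp_pos _) two_pi_pos
  set c₀ := (∫ θ in 0..(2 * π), ρ θ) / (2 * π) with hc₀
  have hc₀p : 0 < c₀ := div_pos hI two_pi_pos
  refine ⟨fun θ => c₀⁻¹ * ρ θ, fun s t _ => ?_, Eventually.of_forall fun θ =>
    mul_pos (inv_pos.2 hc₀p) (exp_pos _), ?_⟩
  · have := W.ops.inv.eq_integral (fun θ => by simp only [hρ, hjp]) hρi hmodes s t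
    rw [intervalIntegral.integral_const_mul, ← this, ← hc₀, ← mul_assoc, inv_mul_cancel₀ hc₀p.ne',
      one_mul]
  · have h1 := (hj.sub (rep_const ((Real.log c₀ : ℝ) : ℂ))).energy
    have e : (fun θ => ((Real.log (c₀⁻¹ * ρ θ) : ℝ) : ℂ)) =
        fun θ => (j θ : ℂ) - ((Real.log c₀ : ℝ) : ℂ) := by
      funext θ
      rw [Real.log_mul (inv_pos.2 hc₀p).ne' (exp_pos _).ne', Real.log_inv, Real.log_exp]
      push_cast; ring
    rw [e, h1]
    exact ENNReal.ofReal_lt_top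

theorem Inv.integral_comp_mul_density {H K : ℝ → ℝ} (h : Inv H K) {φ : ℝ → ℝ}
    (hφ : IntervalIntegrable φ volume 0 (2 * π))
    (hH : ∀ s t : ℝ, s ≤ t → H t - H s = ∫ θ in s..t, φ θ)
    {u u' : ℝ → ℂ} (hu : ∀ t, HasDerivAt u (u' t) t) (hu' : Continuous u')
    (hup : ∀ t, u (t + 2 * π) = u t) :
    ∫ θ in 0..(2 * π), u (H θ) * (φ θ : ℂ) = ∫ t in 0..(2 * π), u t := by
  have e1 := h.per 0
  rw [zero_add] at e1
  rw [h.integral_comp_mul (A := fun θ => (H θ : ℂ)) (a' := fun θ => (φ θ : ℂ)) (u := u) (u' := u')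
    ⟨hφ.1.ofReal, hφ.2.ofReal⟩ (fun θ hθ => by
      have := hH 0 θ hθ.1
      rw [intervalIntegral.integral_ofReal, ← this]; push_cast; ring) hu hu']
  have := intervalIntegral.integral_mul_deriv_eq_deriv_mul (a := H 0) (b := H (2 * π))
    (u := fun t : ℝ => (t : ℂ)) (u' := fun _ => 1) (v := u) (v' := u')
    (fun t _ => by simpa using (hasDerivAt_id t).ofReal_comp) (fun t _ => hu t)
    (by simp) (hu'.intervalIntegrable _ _)
  simp only [h.right]
  rw [this]
  simp only [one_mul]
  rw [e1, integral_window hup, hup]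
  push_cast; ring

lemma intervalIntegrable_density {H K : ℝ → ℝ} (h : Inv H K) {φ : ℝ → ℝ}
    (hH : ∀ s t : ℝ, s ≤ t → H t - H s = ∫ θ in s..t, φ θ) :
    IntervalIntegrable φ volume 0 (2 * π) := by
  by_contra hn
  have h1 := hH 0 (2 * π) two_pi_pos.le
  rw [intervalIntegral.integral_undef hn] at h1
  have e1 := h.per 0
  rw [zero_add] at e1
  have := pi_pos
  linarith

/-- A function with square integrable derivative has a representative in `X`. -/
lemma exists_rep_primitive {d : ℝ → ℂ} (hd : MemLp d 2 per) {a : ℝ → ℂ} (ha : MemLp a 2 per)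
    (h : ∀ n, fc d n = n * Complex.I * fc a n) : ∃ x, WP.Rep a x := by
  refine exists_rep_of_summable ha ?_
  refine Summable.of_nonneg_of_le (fun n => by positivity) (fun n => ?_) (parseval hd).summable
  rw [h, norm_mul, norm_mul, Complex.norm_I, mul_one, Complex.norm_intCast, mul_pow]
  gcongr
  rcases eq_or_ne n 0 with rfl | hn
  · simp
  · have : (1 : ℝ) ≤ |(n : ℝ)| := by exact_mod_cast Int.one_le_abs hn
    nlinarith

section
variable {F g : ℂ → ℂ} {H K : ℝ → ℝ} {C C' : X →L[ℂ] X}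

lemma Weld.comp_inv (W : Weld F g H K C C') (t : ℝ) :
    F (ee 1 (K t)) = ee 1 t * g (ee (-1) t) := by
  rw [W.weld, W.ops.inv.right]

lemma Weld.fc_comp_inv (W : Weld F g H K C C') (n : ℤ) :
    fc (fun t => F (ee 1 (K t))) n = fc (fun t => g (ee 1 t)) (1 - n) := by
  simp only [W.comp_inv]
  rw [fc_ee_mul]
  have h2 := fc_comp_neg (u := fun t => g (ee 1 t)) (fun t => by rw [ee_period]) (n - 1)
  have e : ∀ t, ee 1 (-t) = ee (-1) t := fun t => by simp [ee]
  simp only [e] at h2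
  rw [h2, neg_sub]

/-- The interior and exterior Hardy decompositions are transverse. -/
theorem Weld.eq_of_modes (W : Weld F g H K C C') {f : ℝ → ℂ} (hfc : Continuous f)
    (hfp : ∀ θ, f (θ + 2 * π) = f θ) {x : X} (hx : WP.Rep f x) (hneg : ∀ n < 0, fc f n = 0)
    (hK : ∀ n : ℤ, 2 ≤ n → fc (fun t => f (K t)) n = 0) :
    ∃ α : ℂ, ∀ n : ℤ, n ≠ 0 → fc f n = α * fc (fun θ => F (ee 1 θ)) n := by
  have hac : Continuous fun θ => F (ee 1 θ) := W.cF.comp_continuous (continuous_ee 1)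
    fun θ => sphere_subset_closedBall (ee_mem_sphere 1 θ)
  obtain ⟨xa, hxa⟩ := exists_rep (memLp_of_continuous hac 2) W.energy
  set α := fc (fun t => f (K t)) 1 / g 0 with hα
  refine ⟨α, ?_⟩
  have hr := hx.sub (hxa.const_mul α)
  set v : ℝ → ℂ := fun θ => f θ - α * F (ee 1 θ) with hv
  have hvf : ∀ n, fc v n = fc f n - α * fc (fun θ => F (ee 1 θ)) n := fun n =>
    (fc_sub (integrable_of_continuous hfc) (integrable_of_continuous (hac.const_mul α)) n).trans
      (congrArg _ (fc_const_mul _ _ _))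
  have hvc : Continuous v := hfc.sub (continuous_const.mul hac)
  have hvp : ∀ θ, v (θ + 2 * π) = v θ := fun θ => by simp only [hv, hfp, ee_period]
  have hr' := W.ops.comp' hvc hvp hr
  set z := C' (x - α • xa) with hz
  have hKc := W.ops.inv.symm.cont
  have hPz : Pm z = z := by
    ext n
    rw [Pm_apply]
    split_ifs with hn
    · rfl
    rcases eq_or_ne n 0 with rfl | hn0
    · exact hr'.zero_coord.symm
    have hm : fc (fun t => v (K t)) n = 0 := by
      have e := fc_sub (integrable_of_continuous (hfc.comp hKc))
        (integrable_of_continuous ((hac.const_mul α).comp hKc)) n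
      have e2 := fc_const_mul α (fun t => F (ee 1 (K t))) n
      rw [W.fc_comp_inv] at e2
      refine (e.trans (congrArg _ e2)).trans ?_
      show fc (fun t => f (K t)) n - _ = 0
      rcases lt_or_ge n 2 with h2 | h2
      · have : n = 1 := by omega
        subst this
        have h3 := fc_boundary W.hg W.cg 0
        rw [Nat.cast_zero, tc_zero] at h3
        rw [sub_self, h3, hα, div_mul_cancel₀ _ W.g_ne, sub_self]
      · rw [hK n h2, fc_boundary_neg W.hg W.cg (by omega), mul_zero, sub_zero]
    rw [hr'.coord, hm, mul_zero]
  have hle := W.ops.norm_le hPz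
  rw [hz, W.ops.right] at hle
  have hP0 : Pm (x - α • xa) = 0 := by
    ext n
    rw [Pm_apply]
    split_ifs with hn
    · rw [hr.coord, hvf, hneg n hn, fc_boundary_neg W.hF W.cF hn, mul_zero, sub_zero, mul_zero]
      rfl
    · rfl
  rw [hP0, norm_zero] at hle
  have hz0 : z = 0 := norm_le_zero_iff.1 hle
  have hx0 : x - α • xa = 0 := by rw [← W.ops.right (x - α • xa), ← hz, hz0, map_zero]
  intro n hn
  have h1 := hr.fc_eq hn
  rw [hx0, hvf] at h1
  have h2 : (0 : X) n = 0 := rfl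
  rw [h2, zero_div, sub_eq_zero] at h1
  exact h1

end

lemma exp_log_add_I_mul_sub {r : ℝ} (hr : 0 < r) (s θ : ℝ) (w m : ℂ) :
    Complex.exp ((Real.log r : ℂ) + Complex.I * ((s - θ : ℝ) : ℂ) + w - m) =
      Complex.exp (-m) * (ee 1 s * ee (-1) θ * Complex.exp w * r) := by
  have e1 : (Real.log r : ℂ) + Complex.I * ((s - θ : ℝ) : ℂ) + w - m =
      -m + ((Real.log r : ℝ) + ((1 : ℤ) * s * Complex.I + (((-1 : ℤ) * θ * Complex.I) + w))) := by
    push_cast; ring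
  rw [e1, Complex.exp_add, Complex.exp_add, Complex.exp_add, Complex.exp_add, ← Complex.ofReal_exp,
    Real.exp_log hr, ee, ee]
  ring

variable {F g : ℂ → ℂ} {H K : ℝ → ℝ} {C C' : X →L[ℂ] X}

/-- Solution of the Hilbert-type problem on the circle with data `log φ + i (H θ - θ)`. -/
theorem Ops.exists_interior_log (O : Ops H K C C') {φ : ℝ → ℝ}
    (hH : ∀ s t : ℝ, s ≤ t → H t - H s = ∫ θ in s..t, φ θ) (hφ : ∀ᵐ θ : ℝ, 0 < φ θ)
    (hE : douglasEnergyP (fun θ => (Real.log (φ θ) : ℂ)) < ⊤) :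
    ∃ (u : ℝ → ℂ) (x : X), (∀ θ, u (θ + 2 * π) = u θ) ∧ WP.Rep u x ∧ fc u 0 = 0 ∧
      (∀ n < 0, fc u n = 0) ∧ ∀ n : ℤ, 2 ≤ n →
        ∫ θ, (ee (-n) (H θ) * ee 1 θ) * Complex.exp (u θ) ∂per = 0 := by
  have hHc := O.inv.cont
  have hφi := intervalIntegrable_density O.inv hH
  have hφp : Integrable φ per := (intervalIntegrable_iff_integrableOn_Ioc_of_le two_pi_pos.le).1 hφi
  have hφae : ∀ᵐ θ ∂per, 0 < φ θ := ae_restrict_of_ae hφ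
  have hlm : AEStronglyMeasurable (fun θ => (Real.log (φ θ) : ℂ)) per :=
    (Complex.measurable_ofReal.comp_aemeasurable
      (Real.measurable_log.comp_aemeasurable hφp.1.aemeasurable)).aestronglyMeasurable
  obtain ⟨l, hl⟩ := exists_rep (memLp_of_energy_lt_top hlm hE) hE
  obtain ⟨d, hd⟩ := O.exists_displacement
  obtain ⟨ψ, hψ, hsol⟩ := O.exists_solution (l + Complex.I • d)
  have hJ := hl.add (hd.const_mul Complex.I)
  have hx0 : (l + Complex.I • d + C ψ : X) 0 = 0 := by
    have h1 : ψ 0 = 0 := by rw [← hψ, Pm_apply, if_neg (lt_irrefl _)]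
    have h2 := O.map_zero_coord h1
    show (l + Complex.I • d : X) 0 + C ψ 0 = 0
    rw [h2, hJ.zero_coord, add_zero]
  obtain ⟨u, hum, hup, hu, hu0⟩ := exists_fun_rep _ hx0
  obtain ⟨p, xs, hp, hpr, hpl⟩ := exists_poly hψ
  refine ⟨u, _, hup, hu, hu0, fun n hn => ?_, fun n hn => ?_⟩
  · rw [hu.fc_eq hn.ne]
    have := Pm_apply (l + Complex.I • d + C ψ) n
    rw [hsol, if_pos hn] at this
    rw [← this]
    show (0 : ℂ) / _ = 0
    rw [zero_div]
  · let v : ℕ → ℝ → ℂ := fun N θ =>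
      (Real.log (φ θ) : ℂ) + Complex.I * ((H θ - θ : ℝ) : ℂ) + p N (ee (-1) (H θ))
    have hv : ∀ N, WP.Rep (v N) (l + Complex.I • d + C (xs N)) := fun N =>
      hJ.add (O.comp ((hp N).continuous.comp (continuous_ee _))
        (fun θ => by simp only [Function.comp_apply, ee_period]) (hpr N))
    have hlim : Tendsto (fun N => l + Complex.I • d + C (xs N)) atTop
        (𝓝 (l + Complex.I • d + C ψ)) :=
      tendsto_const_nhds.add ((C.continuous.tendsto ψ).comp hpl)
    have hT := tendsto_integral_exp (fun N => (hv N).sub_mean.1) hu (fun N => (hv N).sub_mean.2)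
      hu0 hlim (m := fun θ => ee (-n) (H θ) * ee 1 θ)
      (((continuous_ee _).comp hHc).mul (continuous_ee _)).aestronglyMeasurable
      (fun θ => by rw [norm_mul, norm_ee, norm_ee, mul_one])
    have h0 : ∀ N, ∫ θ, (ee (-n) (H θ) * ee 1 θ) *
        Complex.exp (v N θ - fc (v N) 0) ∂per = 0 := by
      intro N
      obtain ⟨k, rfl⟩ : ∃ k : ℕ, n = (k : ℤ) + 2 := ⟨(n - 2).toNat, by omega⟩
      have hV : Differentiable ℂ fun z => z ^ (k + 1) * Complex.exp (p N z) :=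
        (differentiable_id.pow _).mul (hp N).cexp
      have h1 := O.inv.integral_comp_mul_density hφi hH (hasDerivAt_comp_ee_neg hV)
        (continuous_const.mul ((continuous_ee _).mul
          ((continuous_deriv_of_entire hV).comp (continuous_ee _))))
        (fun t => by rw [ee_period])
      rw [integral_disk_boundary_neg hV.differentiableOn hV.continuous.continuousOn,
        zero_pow (Nat.succ_ne_zero k), zero_mul, mul_zero,
        intervalIntegral.integral_of_le two_pi_pos.le] at h1
      have e : ∀ᵐ θ ∂per, (ee (-((k : ℤ) + 2)) (H θ) * ee 1 θ) * Complex.exp (v N θ - fc (v N) 0) =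
          Complex.exp (-fc (v N) 0) *
          (ee (-1) (H θ) ^ (k + 1) * Complex.exp (p N (ee (-1) (H θ))) * (φ θ : ℂ)) := by
        filter_upwards [hφae] with θ hθ
        simp only [v]
        rw [exp_log_add_I_mul_sub hθ, ee_pow]
        have e2 : ee (-((k : ℤ) + 2)) (H θ) * ee 1 (H θ) = ee (-1 * ((k + 1 : ℕ) : ℤ)) (H θ) := by
          rw [← ee_add]; congr 1; push_cast; ring
        have e3 : ee 1 θ * ee (-1) θ = 1 := by rw [← ee_add]; exact ee_zero θ
        rw [← e2]
        linear_combination (Complex.exp (-fc (v N) 0) * ee (-((k : ℤ) + 2)) (H θ) * ee 1 (H θ) *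
          Complex.exp (p N (ee (-1) (H θ))) * φ θ) * e3
      rw [integral_congr_ae e, integral_const_mul]
      erw [h1]
      rw [mul_zero]
    simp only [h0] at hT
    exact (tendsto_nhds_unique hT tendsto_const_nhds)

theorem Weld.lintegral_lt_top (W : Weld F g H K C C') {φ : ℝ → ℝ}
    (hH : ∀ s t : ℝ, s ≤ t → H t - H s = ∫ θ in s..t, φ θ) (hφ : ∀ᵐ θ : ℝ, 0 < φ θ)
    (hE : douglasEnergyP (fun θ => (Real.log (φ θ) : ℂ)) < ⊤) :
    ∫⁻ z in ball (0 : ℂ) 1, ENNReal.ofReal (‖deriv (deriv F) z / deriv F z‖ ^ 2) < ⊤ := by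
  obtain ⟨u, x, hup, hu, hu0, hneg, hext⟩ := W.ops.exists_interior_log hH hφ hE
  obtain ⟨q, hq, -, hqc, hen, hep⟩ := fc_exp_of_pos hu hu0 hneg
  have hue : MemLp (fun θ => Complex.exp (u θ)) 2 per := (hu.memLp_exp hu0).1
  set d : ℝ → ℂ := fun θ => Complex.I * (ee 1 θ * Complex.exp (u θ)) with hd
  have hdi : Integrable d per := (integrable_ee_mul (integrable_of_memLp_two hue) 1).const_mul _
  have hdm : MemLp d 2 per := by
    refine hue.of_le hdi.1 (Eventually.of_forall fun θ => ?_)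
    simp only [hd, norm_mul, Complex.norm_I, norm_ee, one_mul, le_refl]
  have hdf : ∀ n, fc d n = Complex.I * fc (fun θ => Complex.exp (u θ)) (n - 1) := fun n => by
    rw [hd, fc_const_mul, fc_ee_mul]
  have hd0 : fc d 0 = 0 := by rw [hdf, hen _ (by norm_num), mul_zero]
  have hdp : Function.Periodic d (2 * π) := fun θ => by simp only [hd, ee_period, hup]
  have hdI : ∀ a b, IntervalIntegrable d volume a b :=
    hdp.intervalIntegrable₀ two_pi_pos.ne' (intervalIntegrable_of_per hdi)
  set f : ℝ → ℂ := fun θ => ∫ σ in 0..θ, d σ with hf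
  have hfc : Continuous f := intervalIntegral.continuous_primitive hdI 0
  have hd2 : ∫ σ in 0..(2 * π), d σ = 0 := by
    have := integral_eq_fc d 0
    rw [hd0, mul_zero] at this
    simpa [ee_zero] using this
  have hfp : ∀ θ, f (θ + 2 * π) = f θ := by
    intro θ
    have h1 := hdp.intervalIntegral_add_eq θ 0
    rw [zero_add, hd2] at h1
    have h2 := intervalIntegral.integral_add_adjacent_intervals (hdI 0 θ) (hdI θ (θ + 2 * π))
    rw [h1, add_zero] at h2
    exact h2.symm
  have hfm : MemLp f 2 per := memLp_of_continuous hfc 2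
  have hfd : ∀ n, fc d n = n * Complex.I * fc f n := fc_primitive hdi hd0
  obtain ⟨y, hy⟩ := exists_rep_primitive hdm hfm hfd
  have hnI : ∀ n : ℤ, n ≠ 0 → (n * Complex.I : ℂ) ≠ 0 := fun n hn =>
    mul_ne_zero (by exact_mod_cast hn) Complex.I_ne_zero
  have hfneg : ∀ n < 0, fc f n = 0 := fun n hn => by
    have h1 := hfd n
    rw [hdf, hen _ (by omega), mul_zero] at h1
    exact (mul_eq_zero.1 h1.symm).resolve_left (hnI n hn.ne)
  have hfK : ∀ n : ℤ, 2 ≤ n → fc (fun t => f (K t)) n = 0 := by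
    intro n hn
    have h1 := W.ops.inv.integral_comp_mul_periodic (A := f) (a' := d) (u := ee (-n))
      (u' := fun t => (-n : ℤ) * Complex.I * ee (-n) t) (intervalIntegrable_of_per hdi)
      (fun θ _ => by simp [hf]) hfp (fun t => hasDerivAt_ee _ _)
      (continuous_const.mul (continuous_ee _)) (fun θ => ee_period _ _)
      (fun θ => by simp only [ee_period])
    have h2 : ∫ θ in 0..(2 * π), ee (-n) (H θ) * d θ = 0 := by
      have e : ∀ θ, ee (-n) (H θ) * d θ =
          Complex.I * ((ee (-n) (H θ) * ee 1 θ) * Complex.exp (u θ)) := fun θ => by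
        simp only [hd]; ring
      simp only [e]
      rw [intervalIntegral.integral_const_mul, intervalIntegral.integral_of_le two_pi_pos.le]
      erw [hext n hn]
      rw [mul_zero]
    have e : ∀ t, f (K t) * ((-n : ℤ) * Complex.I * ee (-n) t) =
        (-n * Complex.I) * (ee (-n) t * f (K t)) := fun t => by push_cast; ring
    simp only [e] at h1
    rw [h2, intervalIntegral.integral_const_mul, integral_eq_fc] at h1
    have h3 : (-n * Complex.I : ℂ) ≠ 0 := by
      rw [neg_mul]; exact neg_ne_zero.2 (hnI n (by omega))
    have h4 := (mul_eq_zero.1 (neg_eq_zero.1 h1.symm)).resolve_left h3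
    exact (mul_eq_zero.1 h4).resolve_left (mul_ne_zero two_ne_zero (Complex.ofReal_ne_zero.2 pi_ne_zero))
  obtain ⟨α, hα⟩ := W.eq_of_modes hfc hfp hy hfneg hfK
  have hcoef : ∀ n : ℕ, tc (fun z => Complex.exp (q z)) n = α * tc (deriv F) n := by
    intro n
    have h1 := hfd (n + 1)
    have h2 := fc_boundary W.hF W.cF (n + 1)
    push_cast at h2
    rw [hα _ (by omega), hdf, add_sub_cancel_right, hep, h2] at h1
    rw [tc_deriv]
    apply mul_left_cancel₀ Complex.I_ne_zero
    rw [h1]; push_cast; ring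
  have hF' := differentiableOn_deriv W.hF
  have hexp : Set.EqOn (fun z => Complex.exp (q z)) (fun z => α * deriv F z) (ball 0 1) := by
    intro z hz
    refine (hasSum_tc (differentiableOn_exp hq) hz).unique
      (((hasSum_tc hF' hz).mul_left α).congr_fun fun n => ?_)
    rw [hcoef, mul_assoc]
  have hlog : ∀ z ∈ ball (0 : ℂ) 1, deriv (deriv F) z / deriv F z = deriv q z := by
    intro z hz
    have hz' := isOpen_ball.mem_nhds hz
    have h1 := ((hq.differentiableAt hz').hasDerivAt).cexp
    have h2 := ((hF'.differentiableAt hz').hasDerivAt).const_mul α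
    have h3 := (h1.congr_of_eventuallyEq (hexp.symm.eventuallyEq_of_mem hz')).unique h2
    have h4 : Complex.exp (q z) = α * deriv F z := hexp hz
    have h5 := Complex.exp_ne_zero (q z)
    rw [h4] at h3 h5
    have hα0 := left_ne_zero_of_mul h5
    have hF0 := right_ne_zero_of_mul h5
    rw [div_eq_iff hF0]
    apply mul_left_cancel₀ hα0
    rw [← h3]; ring
  rw [setLIntegral_congr_fun measurableSet_ball fun z hz => by rw [hlog z hz],
    lintegral_disk (differentiableOn_deriv hq)]
  refine ENNReal.mul_lt_top ENNReal.ofReal_lt_top ?_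
  have hs : Summable fun n : ℕ => ‖tc (deriv q) n‖ ^ 2 / ((n : ℝ) + 1) := by
    have hι : Function.Injective (fun n : ℕ => (n : ℤ) + 1) := fun a b h => by
      simp only at h; omega
    refine ((norm_sq_eq x).summable.comp_injective hι).congr fun n => ?_
    have e1 := hqc (n + 1)
    push_cast at e1
    have e2 : ‖((n : ℂ) + 1)‖ = (n : ℝ) + 1 := by
      have : ((n : ℂ) + 1) = ((n + 1 : ℕ) : ℂ) := by push_cast; ring
      rw [this, Complex.norm_natCast]; push_cast; ring
    simp only [Function.comp]
    rw [hu.coord, norm_sq_coord, tc_deriv, norm_mul, mul_pow, e2, e1]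
    push_cast
    rw [abs_of_nonneg (by positivity)]
    have : (n : ℝ) + 1 ≠ 0 := by positivity
    field_simp
  rw [← ENNReal.ofReal_tsum_of_nonneg (fun n => by positivity) hs]
  exact ENNReal.ofReal_lt_top

end WP

theorem wp_quasicircle_iff_log_welding_derivative_in_Hhalf
    -- the Jordan curve `Γ = range γ`, parametrized `2π`-periodically and injectively
    (γ : ℝ → ℂ) (hγc : Continuous γ) (hγp : ∀ θ, γ (θ + 2 * π) = γ θ)
    (hγi : Set.InjOn γ (Set.Ico 0 (2 * π)))
    -- `Γ` is a quasicircle: Ahlfors' bounded turning condition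
    (hqc : ∃ C : ℝ, 0 < C ∧ ∀ s t : ℝ, s ≤ t → t ≤ s + 2 * π →
      min (Metric.diam (γ '' Set.Icc s t)) (Metric.diam (γ '' Set.Icc t (s + 2 * π)))
        ≤ C * ‖γ s - γ t‖)
    -- interior `Ω` and exterior `Ωstar`
    (Ω Ωstar : Set ℂ)
    (hΩo : IsOpen Ω) (hΩconn : IsConnected Ω) (hΩso : IsOpen Ωstar)
    (hΩsconn : IsConnected Ωstar) (hdisj : Disjoint Ω Ωstar)
    (hunion : Ω ∪ Ωstar = (Set.range γ)ᶜ)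
    (hΩbdd : Bornology.IsBounded Ω) (hΩsunbdd : ¬ Bornology.IsBounded Ωstar)
    -- the interior Riemann map `F : 𝔻 → Ω`, with its Carathéodory extension
    (F : ℂ → ℂ) (hF : DifferentiableOn ℂ F (ball (0 : ℂ) 1))
    (hFbij : Set.BijOn F (ball (0 : ℂ) 1) Ω)
    (hFc : ContinuousOn F (closedBall (0 : ℂ) 1))
    (hFΓ : Set.MapsTo F (sphere (0 : ℂ) 1) (Set.range γ))
    -- the exterior Riemann map `G : Δ → Ω*` with `G(z) → ∞` as `z → ∞`
    (G : ℂ → ℂ) (hG : DifferentiableOn ℂ G {z : ℂ | 1 < ‖z‖})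
    (hGbij : Set.BijOn G {z : ℂ | 1 < ‖z‖} Ωstar)
    (hGc : ContinuousOn G {z : ℂ | 1 ≤ ‖z‖})
    (hGΓ : Set.MapsTo G (sphere (0 : ℂ) 1) (Set.range γ))
    (hGinf : Filter.Tendsto G (Bornology.cobounded ℂ) (Bornology.cobounded ℂ))
    -- the lift `H` of the welding homeomorphism `h = g⁻¹ ∘ f` of `S¹`
    (H : ℝ → ℝ) (hHc : Continuous H) (hHm : StrictMono H)
    (hHp : ∀ θ, H (θ + 2 * π) = H θ + 2 * π)
    (hweld : ∀ θ : ℝ, F (Complex.exp (θ * Complex.I)) = G (Complex.exp (H θ * Complex.I))) :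
    -- WP  ↔  `h` absolutely continuous, `h' > 0` a.e., and `E(log h') < ∞`
    (∫⁻ z in ball (0 : ℂ) 1,
        ENNReal.ofReal (‖deriv (deriv F) z / deriv F z‖ ^ 2)) < ⊤ ↔
      ∃ φ : ℝ → ℝ,
        (∀ s t : ℝ, s ≤ t → H t - H s = ∫ θ in s..t, φ θ) ∧
        (∀ᵐ θ : ℝ, 0 < φ θ) ∧
        douglasEnergyP (fun θ => (Real.log (φ θ) : ℂ)) < ⊤ := by
  obtain ⟨g, K, C, C', W⟩ := WP.exists_weld γ hγc hγp hγi hqc Ω Ωstar hΩconn hdisj hunion F hF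
    hFbij hFc hFΓ G hG hGbij hGc hGinf H hHc hHm hHp hweld
  exact ⟨W.exists_density, fun ⟨φ, h1, h2, h3⟩ => W.lintegral_lt_top h1 h2 h3⟩
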